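/- Let D be a bounded domain in ℂⁿ with C²-smooth boundary that is strongly pseudoconvex (the Levi form of a defining function of ∂D is positive definite on the complex tangent space at every boundary point). If {p^j} is any sequence of points of D converging to a boundary point p⁰ ∈ ∂D, then h_D(p^j) → 0 as j → ∞. -/

import Mathlib

open MeasureTheory Metric Filter Topology Set
open scoped ENNReal

noncomputable section

/-- Membership in the Bergman space `A²(Ω)`: holomorphic and square-integrable. -/
def MemA2 {n : ℕ} (Ω : Set (Fin n → ℂ)) (f : (Fin n → ℂ) → ℂ) : Prop :=
  DifferentiableOn ℂ f Ω ∧ MemLp f 2 (volume.restrict Ω)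

/-- `K` is the Bergman kernel of `Ω`: the reproducing kernel of `A²(Ω)`. -/
def IsBergmanKernel {n : ℕ} (Ω : Set (Fin n → ℂ)) (K : (Fin n → ℂ) → (Fin n → ℂ) → ℂ) : Prop :=
  (∀ w ∈ Ω, MemA2 Ω fun z => K z w) ∧
  ∀ f, MemA2 Ω f → ∀ w ∈ Ω, f w = ∫ z in Ω, f z * (starRingEnd ℂ) (K z w)

/-- Wirtinger derivative `∂f/∂z_μ`. -/
def wderiv {n : ℕ} (μ : Fin n) (f : (Fin n → ℂ) → ℂ) (z : Fin n → ℂ) : ℂ :=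
  (fderiv ℝ f z (Pi.single μ 1) - Complex.I * fderiv ℝ f z (Pi.single μ Complex.I)) / 2

/-- Wirtinger derivative `∂f/∂z̄_μ`. -/
def wderivBar {n : ℕ} (μ : Fin n) (f : (Fin n → ℂ) → ℂ) (z : Fin n → ℂ) : ℂ :=
  (fderiv ℝ f z (Pi.single μ 1) + Complex.I * fderiv ℝ f z (Pi.single μ Complex.I)) / 2

/-- One-variable Wirtinger derivative `∂f/∂z`. -/
def wderiv1 (f : ℂ → ℂ) (z : ℂ) : ℂ :=
  (fderiv ℝ f z 1 - Complex.I * fderiv ℝ f z Complex.I) / 2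

/-- One-variable Wirtinger derivative `∂f/∂z̄`. -/
def wderiv1Bar (f : ℂ → ℂ) (z : ℂ) : ℂ :=
  (fderiv ℝ f z 1 + Complex.I * fderiv ℝ f z Complex.I) / 2

/-- Bergman metric tensor `g_{μν}(z) = ∂² log K(z,z) / ∂z_μ ∂z̄_ν`. -/
def bergmanTensor {n : ℕ} (K : (Fin n → ℂ) → (Fin n → ℂ) → ℂ) (μ ν : Fin n)
    (z : Fin n → ℂ) : ℂ :=
  wderiv μ (fun w => wderivBar ν (fun u => Complex.log (K u u)) w) z

/-- The hermitian quadratic form of the Bergman metric. -/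
def bergmanQuad {n : ℕ} (K : (Fin n → ℂ) → (Fin n → ℂ) → ℂ) (z ξ : Fin n → ℂ) : ℝ :=
  (∑ μ, ∑ ν, bergmanTensor K μ ν z * ξ μ * (starRingEnd ℂ) (ξ ν)).re

/-- The Bergman metric `b_Ω(z,ξ)`. -/
def bergmanMetric {n : ℕ} (K : (Fin n → ℂ) → (Fin n → ℂ) → ℂ) (z ξ : Fin n → ℂ) : ℝ :=
  Real.sqrt (bergmanQuad K z ξ)

/-- Piecewise-`C¹` curves on `[0,1]`. -/
def PiecewiseC1 {n : ℕ} (γ : ℝ → (Fin n → ℂ)) : Prop :=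
  ContinuousOn γ (Set.Icc 0 1) ∧
  ∃ (k : ℕ) (t : Fin (k + 1) → ℝ), StrictMono t ∧ t 0 = 0 ∧ t (Fin.last k) = 1 ∧
    ∀ i : Fin k, ContDiffOn ℝ 1 γ (Set.Icc (t i.castSucc) (t i.succ))

/-- The Bergman length of a curve. -/
def bergmanLength {n : ℕ} (K : (Fin n → ℂ) → (Fin n → ℂ) → ℂ) (γ : ℝ → (Fin n → ℂ)) : ℝ :=
  ∫ t in (0:ℝ)..1, bergmanMetric K (γ t) (deriv γ t)

/-- The Bergman pseudodistance of `Ω`. -/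
def bergmanDist {n : ℕ} (Ω : Set (Fin n → ℂ)) (K : (Fin n → ℂ) → (Fin n → ℂ) → ℂ)
    (z w : Fin n → ℂ) : ℝ :=
  sInf { L : ℝ | ∃ γ : ℝ → (Fin n → ℂ), γ 0 = z ∧ γ 1 = w ∧
    (∀ t ∈ Set.Icc (0:ℝ) 1, γ t ∈ Ω) ∧ PiecewiseC1 γ ∧ L = bergmanLength K γ }

/-- The Bergman ball `B_Ω(p,r)`. -/
def bergmanBall {n : ℕ} (Ω : Set (Fin n → ℂ)) (K : (Fin n → ℂ) → (Fin n → ℂ) → ℂ)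
    (p : Fin n → ℂ) (r : ℝ) : Set (Fin n → ℂ) :=
  { z ∈ Ω | bergmanDist Ω K p z < r }

/-- The Bergman pseudodistance is an honest distance. -/
def BergmanDistIsDistance {n : ℕ} (Ω : Set (Fin n → ℂ))
    (K : (Fin n → ℂ) → (Fin n → ℂ) → ℂ) : Prop :=
  ∀ z ∈ Ω, ∀ w ∈ Ω, z ≠ w → 0 < bergmanDist Ω K z w

/-- `Ω` is complete with respect to the Bergman distance. -/
def BergmanComplete {n : ℕ} (Ω : Set (Fin n → ℂ))
    (K : (Fin n → ℂ) → (Fin n → ℂ) → ℂ) : Prop :=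
  ∀ x : ℕ → (Fin n → ℂ), (∀ k, x k ∈ Ω) →
    (∀ ε : ℝ, 0 < ε → ∃ N, ∀ k ≥ N, ∀ l ≥ N, bergmanDist Ω K (x k) (x l) < ε) →
    ∃ p ∈ Ω, Filter.Tendsto (fun k => bergmanDist Ω K (x k) p) Filter.atTop (nhds 0)

/-- The Euclidean unit ball `𝔹ⁿ ⊂ ℂⁿ`. -/
def euclUnitBall (n : ℕ) : Set (Fin n → ℂ) :=
  { z | ∑ μ, ‖z μ‖ ^ 2 < 1 }

/-- The Bergman–Fridman invariant `h_X(p)`. -/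
def fridmanInv {n : ℕ} (Ω : Set (Fin n → ℂ)) (K : (Fin n → ℂ) → (Fin n → ℂ) → ℂ)
    (p : Fin n → ℂ) : ℝ :=
  sInf { c : ℝ | ∃ r : ℝ, 0 < r ∧ c = 1 / r ∧ ∃ f : (Fin n → ℂ) → (Fin n → ℂ),
    DifferentiableOn ℂ f (euclUnitBall n) ∧ Set.InjOn f (euclUnitBall n) ∧
    f '' euclUnitBall n ⊆ Ω ∧ bergmanBall Ω K p r ⊆ f '' euclUnitBall n }

/-- Biholomorphic equivalence of domains in `ℂⁿ` (an injective holomorphic map of `ℂⁿ`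
restricted to a domain is automatically a biholomorphism onto its image). -/
def Biholomorphic {n : ℕ} (U V : Set (Fin n → ℂ)) : Prop :=
  ∃ f : (Fin n → ℂ) → (Fin n → ℂ),
    DifferentiableOn ℂ f U ∧ Set.InjOn f U ∧ f '' U = V

/-- The Levi form of a real-valued function `ρ` at `p` in direction `ξ`. -/
def leviForm {n : ℕ} (ρ : (Fin n → ℂ) → ℝ) (p ξ : Fin n → ℂ) : ℝ :=
  (∑ μ, ∑ ν, wderiv μ (fun w => wderivBar ν (fun u => (ρ u : ℂ)) w) p
      * ξ μ * (starRingEnd ℂ) (ξ ν)).re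

/-- The complex tangent space of `{ρ = 0}` at `p`. -/
def complexTangent {n : ℕ} (ρ : (Fin n → ℂ) → ℝ) (p : Fin n → ℂ) : Set (Fin n → ℂ) :=
  { ξ | ∑ μ, wderiv μ (fun u => (ρ u : ℂ)) p * ξ μ = 0 }

/-- Strong pseudoconvexity at a boundary point, for defining function `ρ`. -/
def StronglyPseudoconvexAt {n : ℕ} (ρ : (Fin n → ℂ) → ℝ) (p : Fin n → ℂ) : Prop :=
  ∀ ξ ∈ complexTangent ρ p, ξ ≠ 0 → 0 < leviForm ρ p ξ

/-- `ρ` is a (global) defining function for `D`. -/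
def IsDefiningFunction {n : ℕ} (D : Set (Fin n → ℂ)) (ρ : (Fin n → ℂ) → ℝ) : Prop :=
  (∀ z, z ∈ D ↔ ρ z < 0) ∧ ∀ z ∈ frontier D, fderiv ℝ ρ z ≠ 0

/-- Plurisubharmonicity via the sub-mean-value property on complex lines. -/
def PlurisubharmonicOn {n : ℕ} (u : (Fin n → ℂ) → ℝ) (Ω : Set (Fin n → ℂ)) : Prop :=
  UpperSemicontinuousOn u Ω ∧
  ∀ (a b : Fin n → ℂ) (r : ℝ), 0 < r →
    (∀ w : ℂ, ‖w‖ ≤ r → a + w • b ∈ Ω) →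
    u a ≤ (1 / (2 * Real.pi)) *
      ∫ θ in (0:ℝ)..(2 * Real.pi), u (a + ((r : ℂ) * Complex.exp (θ * Complex.I)) • b)

/-- Pseudoconvexity: `-log dist(·, ∂D)` is plurisubharmonic on `D`. -/
def IsPseudoconvex {n : ℕ} (D : Set (Fin n → ℂ)) : Prop :=
  PlurisubharmonicOn (fun z => -Real.log (Metric.infDist z Dᶜ)) D

/-- Order of vanishing at `0` of a vector-valued map on `ℂ` (`⊤` if it vanishes to
infinite order). -/
def vanishingOrderC {n : ℕ} (f : ℂ → (Fin n → ℂ)) : ℝ≥0∞ :=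
  sInf ((fun m : ℕ => (m : ℝ≥0∞)) '' { m : ℕ | iteratedDeriv m f 0 ≠ 0 })

/-- Order of vanishing at `0` of a real-valued function on `ℂ`. -/
def vanishingOrderR (g : ℂ → ℝ) : ℝ≥0∞ :=
  sInf ((fun m : ℕ => (m : ℝ≥0∞)) '' { m : ℕ | iteratedFDeriv ℝ m g 0 ≠ 0 })

/-- The D'Angelo 1-type of `ρ` at `p`. -/
def dAngeloOneType {n : ℕ} (ρ : (Fin n → ℂ) → ℝ) (p : Fin n → ℂ) : ℝ≥0∞ :=
  ⨆ (φ : ℂ → (Fin n → ℂ)) (_ : AnalyticAt ℂ φ 0) (_ : φ 0 = p)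
    (_ : vanishingOrderC (fun w => φ w - p) ≠ ⊤),
    vanishingOrderR (fun w => ρ (φ w)) / vanishingOrderC (fun w => φ w - p)

/-- The Levi form at `p` has at most one degenerate eigenvalue. -/
def LeviCorankOneAt {n : ℕ} (ρ : (Fin n → ℂ) → ℝ) (p : Fin n → ℂ) : Prop :=
  ∃ V : Submodule ℂ (Fin n → ℂ), n - 2 ≤ Module.finrank ℂ V ∧
    (V : Set (Fin n → ℂ)) ⊆ complexTangent ρ p ∧
    ∀ ξ ∈ V, ξ ≠ 0 → 0 < leviForm ρ p ξ

/-- A bounded smooth pseudoconvex finite-type Levi corank one domain, with defining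
function `ρ`. -/
def IsLeviCorankOneDomain {n : ℕ} (D : Set (Fin n → ℂ)) (ρ : (Fin n → ℂ) → ℝ) : Prop :=
  IsOpen D ∧ IsConnected D ∧ Bornology.IsBounded D ∧ IsPseudoconvex D ∧
  ContDiff ℝ (⊤ : ℕ∞) ρ ∧ IsDefiningFunction D ρ ∧
  (∀ p ∈ frontier D, dAngeloOneType ρ p ≠ ⊤) ∧
  ∀ p ∈ frontier D, LeviCorankOneAt ρ p

/-- The open unit disc in `ℂ`. -/
def openUnitDisc : Set ℂ := Metric.ball 0 1

/-- Tautness of a domain in `ℂⁿ`. -/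
def IsTaut {n : ℕ} (D : Set (Fin n → ℂ)) : Prop :=
  ∀ f : ℕ → ℂ → (Fin n → ℂ),
    (∀ k, DifferentiableOn ℂ (f k) openUnitDisc ∧ f k '' openUnitDisc ⊆ D) →
    ∃ φ : ℕ → ℕ, StrictMono φ ∧
      ((∃ g : ℂ → (Fin n → ℂ), DifferentiableOn ℂ g openUnitDisc ∧ g '' openUnitDisc ⊆ D ∧
          TendstoLocallyUniformlyOn (fun k => f (φ k)) g Filter.atTop openUnitDisc) ∨
        ∀ S : Set ℂ, IsCompact S → S ⊆ openUnitDisc →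
          ∀ L : Set (Fin n → ℂ), IsCompact L → L ⊆ D →
            ∀ᶠ k in Filter.atTop, ∀ w ∈ S, f (φ k) w ∉ L)

/-- Convergence of a sequence of domains in the local Hausdorff sense. -/
def LocalHausdorffConv {n : ℕ} (Ω : ℕ → Set (Fin n → ℂ)) (Ωl : Set (Fin n → ℂ)) : Prop :=
  (∀ S : Set (Fin n → ℂ), IsCompact S → S ⊆ Ωl → ∀ᶠ j in Filter.atTop, S ⊆ Ω j) ∧
  ∀ S : Set (Fin n → ℂ), IsCompact S →
    (∃ j₀ : ℕ, S ⊆ interior (⋂ j, ⋂ (_ : j₀ ≤ j), Ω j)) → S ⊆ Ωl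

/-- A real-valued subharmonic polynomial of degree at most `d` in one complex variable,
containing no harmonic terms. -/
def SubharmonicPolyNoHarm (P : ℂ → ℝ) (d : ℕ) : Prop :=
  (∃ c : Fin (d + 1) → Fin (d + 1) → ℂ,
    (∀ j, c j 0 = 0) ∧ (∀ k, c 0 k = 0) ∧
    ∀ w : ℂ, (P w : ℂ) = ∑ j, ∑ k, c j k * w ^ (j : ℕ) * (starRingEnd ℂ) w ^ (k : ℕ)) ∧
  ∀ w : ℂ, 0 ≤ (wderiv1 (fun u => wderiv1Bar (fun v => (P v : ℂ)) u) w).re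

/-- A strictly subharmonic real polynomial of degree `2` in one complex variable. -/
def StrictlySubharmonicPolyDeg2 (Q : ℂ → ℝ) : Prop :=
  (∃ c : Fin 3 → Fin 3 → ℂ, ∀ w : ℂ,
      (Q w : ℂ) = ∑ j, ∑ k, c j k * w ^ (j : ℕ) * (starRingEnd ℂ) w ^ (k : ℕ)) ∧
  ∀ w : ℂ, 0 < (wderiv1 (fun u => wderiv1Bar (fun v => (Q v : ℂ)) u) w).re

/-- A nontangential cone in `D` with vertex `p0 ∈ ∂D`. -/
def IsNontangentialCone {n : ℕ} (D Γ : Set (Fin n → ℂ)) (p0 : Fin n → ℂ) : Prop :=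
  Γ ⊆ D ∧ p0 ∈ closure Γ ∧
  ∃ C : ℝ, 0 < C ∧ ∀ z ∈ Γ, ‖z - p0‖ ≤ C * Metric.infDist z Dᶜ

/-- The Bergman kernel is positive on the diagonal of `Ω`. -/
def DiagPos {n : ℕ} (Ω : Set (Fin n → ℂ)) (K : (Fin n → ℂ) → (Fin n → ℂ) → ℂ) : Prop :=
  ∀ z ∈ Ω, (K z z).im = 0 ∧ 0 < (K z z).re

/-- The Bergman metric of `Ω` is positive definite. -/
def BergPosDef {n : ℕ} (Ω : Set (Fin n → ℂ)) (K : (Fin n → ℂ) → (Fin n → ℂ) → ℂ) : Prop :=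
  ∀ z ∈ Ω, ∀ ξ : Fin n → ℂ, ξ ≠ 0 → 0 < bergmanMetric K z ξ

/-- The real coordinate directions of `ℂⁿ ≃ ℝ^{2n}`. -/
def realDir {n : ℕ} (μ : Fin (2 * n)) : Fin n → ℂ :=
  Pi.single ⟨(μ : ℕ) / 2, by have := μ.isLt; omega⟩
    (if (μ : ℕ) % 2 = 0 then 1 else Complex.I)

/-- The real coefficients `g̃_{μν}` of the Bergman metric, obtained by polarization. -/
def realTensor {n : ℕ} (K : (Fin n → ℂ) → (Fin n → ℂ) → ℂ) (μ ν : Fin (2 * n))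
    (z : Fin n → ℂ) : ℝ :=
  (bergmanQuad K z (realDir μ + realDir ν) - bergmanQuad K z (realDir μ)
    - bergmanQuad K z (realDir ν)) / 2

/-- The Christoffel symbols `Γ^η_{μν}` of the Bergman metric, in real coordinates. -/
def christoffel {n : ℕ} (K : (Fin n → ℂ) → (Fin n → ℂ) → ℂ) (η μ ν : Fin (2 * n))
    (z : Fin n → ℂ) : ℝ :=
  (1 / 2) * ∑ τ : Fin (2 * n),
    (fderiv ℝ (realTensor K ν τ) z (realDir μ)
      + fderiv ℝ (realTensor K τ μ) z (realDir ν)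
      - fderiv ℝ (realTensor K μ ν) z (realDir τ))
    * (Matrix.of fun a b => realTensor K a b z)⁻¹ τ η

/-- `z0 ∈ ∂D` is a local holomorphic peak point of `D`. -/
def IsLocalPeakPoint {n : ℕ} (D : Set (Fin n → ℂ)) (z0 : Fin n → ℂ) : Prop :=
  ∃ U ∈ nhds z0, ∃ g : (Fin n → ℂ) → ℂ,
    DifferentiableOn ℂ g (U ∩ D) ∧ ContinuousOn g (closure (U ∩ D)) ∧
    g z0 = 1 ∧ ∀ z ∈ closure (U ∩ D), z ≠ z0 → ‖g z‖ < 1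

/-- A real polynomial on `ℂⁿ` containing no pluriharmonic terms. -/
def IsPolyNoPluriharm {n : ℕ} (P : (Fin n → ℂ) → ℝ) : Prop :=
  ∃ (d : ℕ) (c : (Fin n → Fin (d + 1)) → (Fin n → Fin (d + 1)) → ℂ),
    (∀ α β, (∀ j, (β j : ℕ) = 0) → c α β = 0) ∧
    (∀ α β, (∀ j, (α j : ℕ) = 0) → c α β = 0) ∧
    ∀ z, (P z : ℂ) = ∑ α, ∑ β, c α β * (∏ j, z j ^ (α j : ℕ)) *
      ∏ j, (starRingEnd ℂ) (z j) ^ (β j : ℕ)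

section Osgood

variable {E F : Type*} [NormedAddCommGroup E] [NormedSpace ℂ E] [NormedAddCommGroup F]
  [NormedSpace ℂ F]

theorem hasDerivAt_comp_add_smul {f : E → F} {x v : E} {ζ : ℂ}
    (hf : DifferentiableAt ℂ f (x + ζ • v)) :
    HasDerivAt (fun t : ℂ => f (x + t • v)) (fderiv ℂ f (x + ζ • v) v) ζ := by
  have h1 : HasDerivAt (fun t : ℂ => x + t • v) v ζ := by
    simpa using ((hasDerivAt_id ζ).smul_const v).const_add x
  exact hf.hasFDerivAt.comp_hasDerivAt ζ h1

/-- Cauchy estimate for the Fréchet derivative of a bounded holomorphic map. -/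
theorem norm_fderiv_le_of_bounded_on_ball {f : E → F} {x : E} {s M : ℝ} (hs : 0 < s)
    (hf : DifferentiableOn ℂ f (ball x s)) (hM : ∀ y ∈ ball x s, ‖f y‖ ≤ M) :
    ‖fderiv ℂ f x‖ ≤ 2 * M / s := by
  have hM0 : 0 ≤ M := (norm_nonneg _).trans (hM x (mem_ball_self hs))
  refine ContinuousLinearMap.opNorm_le_bound _ (by positivity) fun v => ?_
  rcases eq_or_ne v 0 with rfl | hv
  · simp
  have hv' : 0 < ‖v‖ := norm_pos_iff.2 hv
  set r : ℝ := s / (2 * ‖v‖) with hr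
  have hr0 : 0 < r := by positivity
  have hmem : ∀ ζ : ℂ, ‖ζ‖ ≤ r → x + ζ • v ∈ ball x s := by
    intro ζ hζ
    rw [mem_ball, dist_eq_norm, add_sub_cancel_left, norm_smul]
    calc ‖ζ‖ * ‖v‖ ≤ r * ‖v‖ := by gcongr
      _ = s / 2 := by rw [hr]; field_simp
      _ < s := by linarith
  have hd : ∀ ζ : ℂ, ‖ζ‖ ≤ r →
      HasDerivAt (fun t : ℂ => f (x + t • v)) (fderiv ℂ f (x + ζ • v) v) ζ := fun ζ hζ =>
    hasDerivAt_comp_add_smul ((hf _ (hmem ζ hζ)).differentiableAt (isOpen_ball.mem_nhds (hmem ζ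
        hζ)))
  have h0 := (hd 0 (by simpa using hr0.le)).deriv
  have hD : DiffContOnCl ℂ (fun t : ℂ => f (x + t • v)) (ball 0 r) := by
    refine DifferentiableOn.diffContOnCl fun ζ hζ => ?_
    have := closure_ball_subset_closedBall hζ
    exact (hd ζ (by simpa using this)).differentiableAt.differentiableWithinAt
  have := Complex.norm_deriv_le_of_forall_mem_sphere_norm_le (C := M) hr0 hD fun ζ hζ =>
    hM _ (hmem ζ (by simpa using (mem_sphere_zero_iff_norm.1 hζ).le))
  rw [h0] at this
  simp only [zero_smul, add_zero] at this
  calc ‖fderiv ℂ f x v‖ ≤ M / r := this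
    _ = 2 * M / s * ‖v‖ := by rw [hr]; field_simp

theorem fderiv_lipschitz_of_bounded_on_ball {f : E → F} {x : E} {s M : ℝ} (hs : 0 < s)
    (hf : DifferentiableOn ℂ f (ball x (4 * s))) (hM : ∀ y ∈ ball x (4 * s), ‖f y‖ ≤ M)
    {y z : E} (hy : y ∈ ball x s) (hz : z ∈ ball x s) :
    ‖fderiv ℂ f y - fderiv ℂ f z‖ ≤ 4 * M / s ^ 2 * ‖y - z‖ := by
  have hM0 : 0 ≤ M := (norm_nonneg _).trans (hM x (mem_ball_self (by positivity)))
  have hdiff : ∀ w ∈ ball x (4 * s), DifferentiableAt ℂ f w := fun w hw =>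
    (hf w hw).differentiableAt (isOpen_ball.mem_nhds hw)
  have hb : ∀ w ∈ ball x (3 * s), ‖fderiv ℂ f w‖ ≤ 2 * M / s := by
    intro w hw
    have hsub : ball w s ⊆ ball x (4 * s) := by
      apply ball_subset_ball'
      rw [mem_ball] at hw
      linarith
    exact norm_fderiv_le_of_bounded_on_ball hs (hf.mono hsub) fun y hy => hM y (hsub hy)
  have hyz : ‖y - z‖ < 2 * s := by
    rw [← dist_eq_norm]
    have := dist_triangle_right y z x
    rw [mem_ball] at hy hz
    linarith
  have hsub2 : ∀ w ∈ ball z s, w ∈ ball x (3 * s) ∧ w + (y - z) ∈ ball x (3 * s) := by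
    intro w hw
    rw [mem_ball] at hw hz hy
    constructor
    · rw [mem_ball]
      have := dist_triangle w z x
      linarith
    · rw [mem_ball]
      have h1 := dist_triangle (w + (y - z)) y x
      have h2 : dist (w + (y - z)) y = dist w z := by
        rw [dist_eq_norm, dist_eq_norm]; congr 1; abel
      linarith
  have hsub3 : ball x (3 * s) ⊆ ball x (4 * s) := ball_subset_ball (by linarith)
  have hg : ∀ w ∈ ball z s, HasFDerivAt (fun w => f (w + (y - z)) - f w)
      (fderiv ℂ f (w + (y - z)) - fderiv ℂ f w) w := by
    intro w hw
    have h1 := (hdiff _ (hsub3 (hsub2 w hw).2)).hasFDerivAt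
    have h2 := (hdiff _ (hsub3 (hsub2 w hw).1)).hasFDerivAt
    exact ((hasFDerivAt_comp_add_right _).2 h1).sub h2
  have hgb : ∀ w ∈ ball z s, ‖f (w + (y - z)) - f w‖ ≤ 2 * M / s * ‖y - z‖ := by
    intro w hw
    have := (convex_ball x (3 * s)).norm_image_sub_le_of_norm_fderiv_le (𝕜 := ℂ) (f := f)
      (C := 2 * M / s) (fun u hu => hdiff u (hsub3 hu)) hb (hsub2 w hw).1 (hsub2 w hw).2
    simpa using this
  have := norm_fderiv_le_of_bounded_on_ball hs
    (fun w hw => (hg w hw).differentiableAt.differentiableWithinAt) hgb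
  rw [(hg z (mem_ball_self hs)).fderiv] at this
  simp only [add_sub_cancel] at this
  calc _ ≤ _ := this
    _ = _ := by field_simp; ring

theorem exists_bounded_ball {f : E → F} {U : Set E} (hU : IsOpen U) (hf : DifferentiableOn ℂ f U)
    {x : E} (hx : x ∈ U) : ∃ s > 0, ∃ M, ball x (4 * s) ⊆ U ∧ ∀ y ∈ ball x (4 * s), ‖f y‖ ≤ M := by
  have hc : ContinuousAt f x := ((hf x hx).differentiableAt (hU.mem_nhds hx)).continuousAt
  have h1 : ∀ᶠ y in 𝓝 x, y ∈ U ∧ ‖f y‖ < ‖f x‖ + 1 :=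
    Filter.Eventually.and (hU.mem_nhds hx) (hc.norm.eventually_lt continuousAt_const (by simp))
  obtain ⟨ε, hε, h⟩ := Metric.eventually_nhds_iff_ball.1 h1
  refine ⟨ε / 4, by positivity, ‖f x‖ + 1, ?_⟩
  rw [show 4 * (ε / 4) = ε by ring]
  exact ⟨fun y hy => (h y hy).1, fun y hy => (h y hy).2.le⟩

theorem continuousOn_fderiv_of_holomorphic {f : E → F} {U : Set E} (hU : IsOpen U)
    (hf : DifferentiableOn ℂ f U) : ContinuousOn (fderiv ℂ f) U := by
  intro x hx
  obtain ⟨s, hs, M, hsub, hM⟩ := exists_bounded_ball hU hf hx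
  refine ContinuousAt.continuousWithinAt ?_
  have : LipschitzOnWith (Real.toNNReal (4 * M / s ^ 2)) (fderiv ℂ f) (ball x s) := by
    refine LipschitzOnWith.of_dist_le_mul fun y hy z hz => ?_
    rw [dist_eq_norm, dist_eq_norm]
    refine (fderiv_lipschitz_of_bounded_on_ball hs (hf.mono hsub) hM hy hz).trans ?_
    gcongr
    exact Real.le_coe_toNNReal _
  exact this.continuousOn.continuousAt (isOpen_ball.mem_nhds (mem_ball_self hs))

theorem differentiableAt_fderiv_apply [CompleteSpace F] {f : E → F} {U : Set E} (hU : IsOpen U)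
    (hf : DifferentiableOn ℂ f U) {x : E} (hx : x ∈ U) (v : E) :
    DifferentiableAt ℂ (fun y => fderiv ℂ f y v) x := by
  obtain ⟨s, hs, M, hsub, hM⟩ := exists_bounded_ball hU hf hx
  have hM0 : 0 ≤ M := (norm_nonneg _).trans (hM x (mem_ball_self (by positivity)))
  have hdiff : ∀ w ∈ ball x (4 * s), DifferentiableAt ℂ f w := fun w hw =>
    (hf w (hsub hw)).differentiableAt (hU.mem_nhds (hsub hw))
  set r : ℝ := s / (‖v‖ + 1) with hr
  have hr0 : 0 < r := by positivity
  have hrv : r * ‖v‖ ≤ s := by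
    rw [hr, div_mul_eq_mul_div, div_le_iff₀ (by positivity)]; nlinarith [norm_nonneg v]
  have hmem : ∀ y ∈ ball x s, ∀ ζ : ℂ, ‖ζ‖ ≤ r → y + ζ • v ∈ ball x (2 * s) := by
    intro y hy ζ hζ
    rw [mem_ball] at hy ⊢
    have h1 := dist_triangle (y + ζ • v) y x
    have h2 : dist (y + ζ • v) y ≤ s := by
      rw [dist_eq_norm, add_sub_cancel_left, norm_smul]
      exact (mul_le_mul_of_nonneg_right hζ (norm_nonneg _)).trans hrv
    linarith
  have hsub2 : ball x (2 * s) ⊆ ball x (4 * s) := ball_subset_ball (by linarith)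
  have hcm : ∀ θ : ℝ, ‖circleMap 0 r θ‖ ≤ r := fun θ => by simp [abs_of_pos hr0]
  have hform : ∀ y ∈ ball x s, fderiv ℂ f y v = (2 * Real.pi * Complex.I : ℂ)⁻¹ •
      ∫ θ in (0:ℝ)..2 * Real.pi, (deriv (circleMap 0 r) θ * ((circleMap 0 r θ - 0) ^ 2)⁻¹) •
        f (y + circleMap 0 r θ • v) := by
    intro y hy
    have hd : ∀ ζ : ℂ, ‖ζ‖ ≤ r →
        HasDerivAt (fun t : ℂ => f (y + t • v)) (fderiv ℂ f (y + ζ • v) v) ζ := fun ζ hζ =>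
      hasDerivAt_comp_add_smul (hdiff _ (hsub2 (hmem y hy ζ hζ)))
    have h0 := (hd 0 (by simpa using hr0.le)).deriv
    simp only [zero_smul, add_zero] at h0
    rw [← h0]
    set V : Set ℂ := (fun t : ℂ => y + t • v) ⁻¹' ball x (4 * s)
    have hV : IsOpen V := isOpen_ball.preimage (by fun_prop)
    have := Complex.cderiv_eq_deriv (f := fun t : ℂ => f (y + t • v)) (z := 0) hV
      (fun ζ hζ => (hasDerivAt_comp_add_smul (hdiff _ hζ)).differentiableAt.differentiableWithinAt)
      hr0 (fun ζ hζ => hsub2 (hmem y hy ζ (by simpa using hζ)))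
    rw [← this, Complex.cderiv, circleIntegral]
    simp only [smul_smul]
  have hev : (fun y => fderiv ℂ f y v) =ᶠ[𝓝 x] fun y => (2 * Real.pi * Complex.I : ℂ)⁻¹ •
      ∫ θ in (0:ℝ)..2 * Real.pi, (deriv (circleMap 0 r) θ * ((circleMap 0 r θ - 0) ^ 2)⁻¹) •
        f (y + circleMap 0 r θ • v) :=
    Filter.eventually_of_mem (isOpen_ball.mem_nhds (mem_ball_self hs)) hform
  refine DifferentiableAt.congr_of_eventuallyEq ?_ hev
  refine DifferentiableAt.const_smul ?_ _
  set c : ℝ → ℂ := fun θ => deriv (circleMap 0 r) θ * ((circleMap 0 r θ - 0) ^ 2)⁻¹ with hc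
  have hcc : Continuous c := by
    have h0 : ∀ θ, circleMap 0 r θ - 0 ≠ 0 := fun θ => by
      rw [sub_zero]
      exact circleMap_ne_center hr0.ne'
    simp only [hc, deriv_circleMap]
    fun_prop (disch := exact fun _ => pow_ne_zero _ (h0 _))
  have hfc : ContinuousOn f (ball x (2 * s)) := fun w hw =>
    (hdiff w (hsub2 hw)).continuousAt.continuousWithinAt
  have hfdc : ContinuousOn (fderiv ℂ f) (ball x (2 * s)) :=
    (continuousOn_fderiv_of_holomorphic hU hf).mono (hsub2.trans hsub)
  have hcont : ∀ y ∈ ball x s, Continuous fun θ : ℝ => c θ • f (y + circleMap 0 r θ • v) := by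
    intro y hy
    refine hcc.smul ?_
    exact hfc.comp_continuous (by fun_prop) fun θ => hmem y hy _ (hcm θ)
  have hcont' : Continuous fun θ : ℝ => c θ • fderiv ℂ f (x + circleMap 0 r θ • v) := by
    refine hcc.smul ?_
    exact hfdc.comp_continuous (by fun_prop) fun θ => hmem x (mem_ball_self hs) _ (hcm θ)
  have hbd : ∀ w ∈ ball x (2 * s), ‖fderiv ℂ f w‖ ≤ 2 * M / s := by
    intro w hw
    have hsub' : ball w s ⊆ ball x (4 * s) := by
      apply ball_subset_ball'
      rw [mem_ball] at hw
      linarith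
    exact norm_fderiv_le_of_bounded_on_ball hs (hf.mono (hsub'.trans hsub))
      fun y hy => hM y (hsub' hy)
  simp only [intervalIntegral.integral_of_le Real.two_pi_pos.le]
  refine (hasFDerivAt_integral_of_dominated_of_fderiv_le (𝕜 := ℂ)
    (F := fun y θ => c θ • f (y + circleMap 0 r θ • v))
    (F' := fun y θ => c θ • fderiv ℂ f (y + circleMap 0 r θ • v))
    (bound := fun θ => ‖c θ‖ * (2 * M / s))
    (isOpen_ball.mem_nhds (mem_ball_self hs))
    ?_ ?_ ?_ ?_ ?_ ?_).differentiableAt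
  · filter_upwards [isOpen_ball.mem_nhds (mem_ball_self hs)] with y hy
    exact (hcont y hy).aestronglyMeasurable
  · exact ((hcont x (mem_ball_self hs)).integrableOn_Icc).mono_set Ioc_subset_Icc_self
  · exact hcont'.aestronglyMeasurable
  · refine Eventually.of_forall fun θ y hy => ?_
    rw [norm_smul]
    gcongr
    exact hbd _ (hmem y hy _ (hcm θ))
  · have : Continuous fun θ => ‖c θ‖ * (2 * M / s) := by fun_prop
    exact (this.integrableOn_Icc).mono_set Ioc_subset_Icc_self
  · refine Eventually.of_forall fun θ y hy => ?_
    have := (hdiff _ (hsub2 (hmem y hy _ (hcm θ)))).hasFDerivAt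
    exact ((hasFDerivAt_comp_add_right _).2 this).const_smul (c θ)

/-- Holomorphic maps on open subsets of a finite-dimensional space are smooth. -/
theorem contDiffOn_of_holomorphic [FiniteDimensional ℂ E] [CompleteSpace F]
    {f : E → F} {U : Set E} (hU : IsOpen U) (hf : DifferentiableOn ℂ f U) (m : ℕ) :
    ContDiffOn ℂ m f U := by
  induction m generalizing F with
  | zero => exact contDiffOn_zero.2 hf.continuousOn
  | succ m ih =>
    refine (contDiffOn_succ_iff_fderiv_of_isOpen hU).2 ⟨hf,
        fun h => absurd h (WithTop.natCast_ne_top m), ?_⟩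
    refine contDiffOn_clm_apply.2 fun v => ih fun x hx => ?_
    exact (differentiableAt_fderiv_apply hU hf hx v).differentiableWithinAt

end Osgood

section MeanValue

variable {n : ℕ}

theorem measurePreserving_unit_smul {c : ℂ} (hc : ‖c‖ = 1) :
    MeasurePreserving (fun y : Fin n → ℂ => c • y) volume volume := by
  have h1 : MeasurePreserving (fun z : ℂ => c * z) volume volume :=
    (rotation (⟨c, by simp [Submonoid.unitSphere, hc]⟩ : Circle)).measurePreserving
  exact volume_preserving_pi (f := fun _ z => c * z) fun _ => h1

theorem circle_mean_of_holomorphic {F : Type*} [NormedAddCommGroup F] [NormedSpace ℂ F]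
    [CompleteSpace F] {f : (Fin n → ℂ) → F} {z y : Fin n → ℂ} {s : ℝ}
    (hf : DifferentiableOn ℂ f (ball z s)) (hy : ‖y‖ < s) :
    ∫ θ in (0:ℝ)..2 * Real.pi, f (z + Complex.exp (θ * Complex.I) • y) =
      (2 * Real.pi) • f z := by
  have hmem : ∀ ζ : ℂ, ‖ζ‖ ≤ 1 → z + ζ • y ∈ ball z s := by
    intro ζ hζ
    rw [mem_ball, dist_eq_norm, add_sub_cancel_left, norm_smul]
    calc ‖ζ‖ * ‖y‖ ≤ 1 * ‖y‖ := by gcongr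
      _ < s := by linarith
  have hd : ∀ ζ : ℂ, ‖ζ‖ ≤ 1 → DifferentiableAt ℂ (fun t : ℂ => f (z + t • y)) ζ := fun ζ hζ =>
    (hasDerivAt_comp_add_smul ((hf _ (hmem ζ hζ)).differentiableAt
      (isOpen_ball.mem_nhds (hmem ζ hζ)))).differentiableAt
  have hD : DiffContOnCl ℂ (fun t : ℂ => f (z + t • y)) (ball 0 |1|) := by
    rw [abs_one]
    refine DifferentiableOn.diffContOnCl fun ζ hζ => ?_
    have := closure_ball_subset_closedBall hζ
    exact (hd ζ (by simpa using this)).differentiableWithinAt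
  have := hD.circleAverage
  rw [Real.circleAverage] at this
  simp only [circleMap, Complex.ofReal_one, zero_add, one_mul, zero_smul, add_zero] at this
  rw [← this, smul_inv_smul₀ Real.two_pi_pos.ne']

theorem setIntegral_circular_smul {F : Type*} [NormedAddCommGroup F] [NormedSpace ℂ F]
    [CompleteSpace F] {f : (Fin n → ℂ) → F} {z : Fin n → ℂ} {s s' : ℝ}
    (hf : DifferentiableOn ℂ f (ball z s)) (hs : s' < s) {κ : (Fin n → ℂ) → ℝ}
    (hκ : ContinuousOn κ (closedBall 0 s'))
    (hc : ∀ (c : ℂ) (y : Fin n → ℂ), ‖c‖ = 1 → κ (c • y) = κ y) :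
    ∫ y in closedBall 0 s', κ y • f (z + y) = (∫ y in closedBall 0 s', κ y) • f z := by
  set B : Set (Fin n → ℂ) := closedBall 0 s'
  have hB : IsCompact B := isCompact_closedBall _ _
  have hBm : MeasurableSet B := hB.measurableSet
  have hrot : ∀ θ : ℝ, ∫ y in B, κ y • f (z + Complex.exp (θ * Complex.I) • y) =
      ∫ y in B, κ y • f (z + y) := by
    intro θ
    set c := Complex.exp (θ * Complex.I) with hcdef
    have hcn : ‖c‖ = 1 := Complex.norm_exp_ofReal_mul_I θ
    have hc0 : c ≠ 0 := Complex.exp_ne_zero _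
    have hemb : MeasurableEmbedding (fun y : Fin n → ℂ => c • y) :=
      (Homeomorph.smulOfNeZero c hc0).measurableEmbedding
    have := (measurePreserving_unit_smul (n := n) hcn).setIntegral_preimage_emb hemb
      (fun y => κ y • f (z + y)) B
    rw [← this]
    have hpre : (fun y : Fin n → ℂ => c • y) ⁻¹' B = B := by
      ext y; simp [B, norm_smul, hcn]
    rw [hpre]
    simp only [hc c _ hcn]
  have hswap : ∫ θ in (0:ℝ)..2 * Real.pi, (∫ y in B,
      κ y • f (z + Complex.exp (θ * Complex.I) • y)) =
      ∫ y in B, ∫ θ in (0:ℝ)..2 * Real.pi, κ y • f (z + Complex.exp (θ * Complex.I) • y) := by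
    simp only [intervalIntegral.integral_of_le Real.two_pi_pos.le]
    refine integral_integral_swap ?_
    rw [Measure.prod_restrict]
    refine IntegrableOn.mono_set ?_ (prod_mono Ioc_subset_Icc_self Subset.rfl)
    refine ContinuousOn.integrableOn_compact (isCompact_Icc.prod hB) ?_
    refine (hκ.comp continuousOn_snd fun p hp => hp.2).smul ?_
    refine hf.continuousOn.comp (by fun_prop) fun p hp => ?_
    have := hp.2
    simp only [B, mem_closedBall, dist_zero_right] at this
    simp only [mem_ball, dist_self_add_left, norm_smul, Complex.norm_exp_ofReal_mul_I]
    linarith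
  simp only [hrot] at hswap
  have h2 : ∫ y in B, ∫ θ in (0:ℝ)..2 * Real.pi, κ y • f (z + Complex.exp (θ * Complex.I) • y) =
      ∫ y in B, κ y • ((2 * Real.pi) • f z) := by
    refine setIntegral_congr_fun hBm fun y hy => ?_
    simp only [B, mem_closedBall, dist_zero_right] at hy
    simp only [intervalIntegral.integral_smul]
    rw [circle_mean_of_holomorphic hf (hy.trans_lt hs)]
  rw [h2, intervalIntegral.integral_const, sub_zero, integral_smul_const, smul_comm] at hswap
  exact smul_right_injective F Real.two_pi_pos.ne' hswap

theorem integral_circular_smul {F : Type*} [NormedAddCommGroup F] [NormedSpace ℂ F]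
    [CompleteSpace F] {f : (Fin n → ℂ) → F} {z : Fin n → ℂ} {s s' : ℝ}
    (hf : DifferentiableOn ℂ f (ball z s)) (hs : s' < s) {κ : (Fin n → ℂ) → ℝ}
    (hκ : Continuous κ) (hsupp : ∀ y, κ y ≠ 0 → ‖y‖ ≤ s')
    (hc : ∀ (c : ℂ) (y : Fin n → ℂ), ‖c‖ = 1 → κ (c • y) = κ y) :
    ∫ y, κ y • f (z + y) = (∫ y, κ y) • f z := by
  rw [← setIntegral_eq_integral_of_forall_compl_eq_zero (s := closedBall 0 s'),
    ← setIntegral_eq_integral_of_forall_compl_eq_zero (s := closedBall 0 s') (f := κ)]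
  · exact setIntegral_circular_smul hf hs hκ.continuousOn hc
  · intro y hy
    by_contra h
    exact hy (by simpa using hsupp y h)
  · intro y hy
    by_contra h
    refine hy ?_
    have : κ y ≠ 0 := fun h0 => h (by simp [h0])
    simpa using hsupp y this

theorem norm_sq_mul_volume_le {f : (Fin n → ℂ) → ℂ} {z : Fin n → ℂ} {s s' : ℝ}
    (hf : DifferentiableOn ℂ f (ball z s)) (hs : s' < s) :
    ‖f z‖ ^ 2 * volume.real (closedBall (0 : Fin n → ℂ) s') ≤
      ∫ y in closedBall z s', ‖f y‖ ^ 2 := by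
  have h := setIntegral_circular_smul hf hs (κ := fun _ => 1) continuousOn_const (by simp)
  simp only [one_smul, setIntegral_const, smul_eq_mul, mul_one] at h
  have htr : ∫ y in closedBall z s', ‖f y‖ ^ 2 = ∫ y in closedBall 0 s', ‖f (z + y)‖ ^ 2 := by
    have := (measurePreserving_add_left (volume : Measure (Fin n → ℂ)) z).setIntegral_preimage_emb
      (measurableEmbedding_addLeft z) (fun y => ‖f y‖ ^ 2) (closedBall z s')
    rw [← this]
    simp
  rw [htr]
  set a := ‖f z‖
  set V := volume.real (closedBall (0 : Fin n → ℂ) s')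
  have hcont : ContinuousOn (fun y => f (z + y)) (closedBall 0 s') := by
    refine hf.continuousOn.comp (by fun_prop) fun y hy => ?_
    simp only [mem_closedBall, dist_zero_right] at hy
    simp only [mem_ball, dist_self_add_left]
    linarith
  have hcpt : IsCompact (closedBall (0 : Fin n → ℂ) s') := isCompact_closedBall _ _
  have h1 : V * a ≤ ∫ y in closedBall 0 s', ‖f (z + y)‖ := by
    have := norm_integral_le_integral_norm (μ := volume.restrict (closedBall 0 s'))
      (fun y => f (z + y))
    rw [h, norm_smul, Real.norm_of_nonneg measureReal_nonneg] at this
    exact this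
  have hi1 : IntegrableOn (fun y => ‖f (z + y)‖) (closedBall 0 s') :=
    hcont.norm.integrableOn_compact hcpt
  have hi2 : IntegrableOn (fun y => ‖f (z + y)‖ ^ 2) (closedBall 0 s') :=
    (hcont.norm.pow 2).integrableOn_compact hcpt
  have h2 : ∫ y in closedBall 0 s', a * ‖f (z + y)‖ ≤
      ∫ y in closedBall 0 s', (‖f (z + y)‖ ^ 2 / 2 + a ^ 2 / 2) := by
    refine integral_mono (hi1.const_mul a) ((hi2.div_const 2).add ?_) fun y => ?_
    · exact integrableOn_const hcpt.measure_ne_top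
    · simp only
      nlinarith [sq_nonneg (‖f (z + y)‖ - a)]
  rw [integral_const_mul, integral_add (hi2.div_const 2) (integrableOn_const hcpt.measure_ne_top),
    integral_div, setIntegral_const, smul_eq_mul] at h2
  have ha : 0 ≤ a := norm_nonneg _
  nlinarith [mul_le_mul_of_nonneg_left h1 ha]

end MeanValue

/-- The squared Euclidean norm on `ℂⁿ`. -/
def nsq {n : ℕ} (z : Fin n → ℂ) : ℝ := ∑ μ, ‖z μ‖ ^ 2

section Mollifier

open scoped Convolution ContDiff
open ContinuousLinearMap

variable {n : ℕ}

theorem nsq_nonneg (z : Fin n → ℂ) : 0 ≤ nsq z := Finset.sum_nonneg fun _ _ => by positivity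

theorem contDiff_nsq {m : WithTop ℕ∞} : ContDiff ℝ m (nsq : (Fin n → ℂ) → ℝ) := by
  unfold nsq
  exact ContDiff.sum fun μ _ => ContDiff.norm_sq ℝ (contDiff_apply ℝ ℂ μ)

theorem norm_sq_le_nsq (z : Fin n → ℂ) : ‖z‖ ^ 2 ≤ nsq z := by
  have h : ∀ μ, ‖z μ‖ ^ 2 ≤ nsq z := fun μ =>
    Finset.single_le_sum (f := fun μ => ‖z μ‖ ^ 2) (fun _ _ => by positivity) (Finset.mem_univ μ)
  have h2 : ‖z‖ ≤ Real.sqrt (nsq z) :=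
    (pi_norm_le_iff_of_nonneg (Real.sqrt_nonneg _)).2 fun μ => Real.le_sqrt_of_sq_le (h μ)
  calc ‖z‖ ^ 2 ≤ Real.sqrt (nsq z) ^ 2 := by gcongr
    _ = nsq z := Real.sq_sqrt (nsq_nonneg z)

theorem nsq_le (z : Fin n → ℂ) : nsq z ≤ n * ‖z‖ ^ 2 := by
  calc nsq z ≤ ∑ _μ : Fin n, ‖z‖ ^ 2 :=
        Finset.sum_le_sum fun μ _ => by gcongr; exact norm_le_pi_norm z μ
    _ = n * ‖z‖ ^ 2 := by simp

theorem nsq_smul (c : ℂ) (z : Fin n → ℂ) : nsq (c • z) = ‖c‖ ^ 2 * nsq z := by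
  simp [nsq, Finset.mul_sum, mul_pow]

/-- Smooth nonnegative circular kernels of integral one supported in the ball of radius `ε`. -/
structure IsMollifier (ε : ℝ) (κ : (Fin n → ℂ) → ℝ) : Prop where
  smooth : ContDiff ℝ ∞ κ
  nonneg : ∀ y, 0 ≤ κ y
  integral_eq : ∫ y, κ y = 1
  supp : ∀ y, κ y ≠ 0 → ‖y‖ ≤ ε
  circular : ∀ (c : ℂ) (y : Fin n → ℂ), ‖c‖ = 1 → κ (c • y) = κ y

namespace IsMollifier

variable {ε δ : ℝ} {κ κ' : (Fin n → ℂ) → ℝ}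

theorem hasCompactSupport (h : IsMollifier ε κ) : HasCompactSupport κ :=
  HasCompactSupport.of_support_subset_isCompact (isCompact_closedBall 0 ε)
    fun y hy => by simpa using h.supp y hy

theorem continuous (h : IsMollifier ε κ) : Continuous κ := h.smooth.continuous

theorem even (h : IsMollifier ε κ) (y : Fin n → ℂ) : κ (-y) = κ y := by
  simpa using h.circular (-1) y (by simp)

theorem integrable (h : IsMollifier ε κ) : Integrable κ :=
  h.continuous.integrable_of_hasCompactSupport h.hasCompactSupport

end IsMollifier

theorem exists_isMollifier {ε : ℝ} (hε : 0 < ε) :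
    ∃ κ : (Fin n → ℂ) → ℝ, IsMollifier ε κ := by
  set κ₀ : (Fin n → ℂ) → ℝ := fun y => Real.smoothTransition (ε ^ 2 - nsq y)
  have hs : ContDiff ℝ ∞ κ₀ :=
    Real.smoothTransition.contDiff.comp (contDiff_const.sub contDiff_nsq)
  have hsupp : ∀ y, κ₀ y ≠ 0 → ‖y‖ ≤ ε := by
    intro y hy
    by_contra! h
    refine hy (Real.smoothTransition.zero_of_nonpos ?_)
    nlinarith [norm_sq_le_nsq y]
  have hcs : HasCompactSupport κ₀ :=
    HasCompactSupport.of_support_subset_isCompact (isCompact_closedBall 0 ε)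
      fun y hy => by simpa using hsupp y hy
  have hpos : 0 < ∫ y, κ₀ y := by
    refine hs.continuous.integral_pos_of_hasCompactSupport_nonneg_nonzero hcs
      (fun y => Real.smoothTransition.nonneg _) (x := 0) ?_
    refine (Real.smoothTransition.pos_of_pos ?_).ne'
    simpa [nsq] using by positivity
  refine ⟨fun y => (∫ y, κ₀ y)⁻¹ * κ₀ y, contDiff_const.mul hs, fun y => ?_, ?_, fun y hy => ?_,
    fun c y hc => ?_⟩
  · exact mul_nonneg (inv_nonneg.2 hpos.le) (Real.smoothTransition.nonneg _)
  · rw [integral_const_mul, inv_mul_cancel₀ hpos.ne']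
  · exact hsupp y (right_ne_zero_of_mul hy)
  · simp [κ₀, nsq_smul, hc]

/-- Mollification of a function by a kernel. -/
def mollify (κ : (Fin n → ℂ) → ℝ) (u : (Fin n → ℂ) → ℂ) : (Fin n → ℂ) → ℂ :=
  κ ⋆[lsmul ℝ ℝ, volume] u

theorem mollify_apply (κ : (Fin n → ℂ) → ℝ) (u : (Fin n → ℂ) → ℂ) (z : Fin n → ℂ) :
    mollify κ u z = ∫ y, κ y • u (z - y) := rfl

theorem mollify_apply' (κ : (Fin n → ℂ) → ℝ) (u : (Fin n → ℂ) → ℂ) (z : Fin n → ℂ) :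
    mollify κ u z = ∫ y, κ (z - y) • u y := convolution_eq_swap _

namespace IsMollifier

variable {ε δ : ℝ} {κ κ' : (Fin n → ℂ) → ℝ} {u : (Fin n → ℂ) → ℂ}

theorem contDiff_mollify (h : IsMollifier ε κ) (hu : LocallyIntegrable u) :
    ContDiff ℝ ∞ (mollify κ u) :=
  h.hasCompactSupport.contDiff_convolution_left _ h.smooth hu

theorem mollify_comm (h : IsMollifier ε κ) (h' : IsMollifier δ κ') (hu : LocallyIntegrable u) :
    mollify κ (mollify κ' u) = mollify κ' (mollify κ u) := by
  have key : ∀ {ε δ : ℝ} {κ κ' : (Fin n → ℂ) → ℝ}, IsMollifier ε κ → IsMollifier δ κ' →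
      mollify (κ ⋆[lsmul ℝ ℝ, volume] κ') u = mollify κ (mollify κ' u) := by
    intro ε δ κ κ' h h'
    ext x
    refine convolution_assoc _ _ _ _ (fun a b c => by simp [mul_assoc]) 
      h.continuous.aestronglyMeasurable h'.continuous.aestronglyMeasurable
      hu.aestronglyMeasurable ?_ ?_ ?_
    · exact Eventually.of_forall (h.hasCompactSupport.convolutionExists_left _ h.continuous
        h'.continuous.locallyIntegrable)
    · exact Eventually.of_forall (h'.hasCompactSupport.norm.convolutionExists_left _
        h'.continuous.norm fun y => (hu y).norm)
    · refine h.hasCompactSupport.norm.convolutionExists_left _ h.continuous.norm ?_ x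
      exact (h'.hasCompactSupport.norm.continuous_convolution_left _ h'.continuous.norm
        fun y => (hu y).norm).locallyIntegrable
  rw [← key h h', ← key h' h]
  congr 1
  rw [← convolution_flip]
  congr 1
  ext
  simp

theorem mollify_eq_of_holomorphic (h : IsMollifier ε κ) {z : Fin n → ℂ} {s : ℝ} (hs : ε < s)
    (hu : DifferentiableOn ℂ u (ball z s)) : mollify κ u z = u z := by
  have h1 := integral_circular_smul hu hs h.continuous h.supp h.circular
  rw [h.integral_eq, one_smul] at h1
  rw [mollify_apply, ← h1, ← integral_neg_eq_self]
  simp [h.even]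

theorem fderiv_mollify_apply (h : IsMollifier ε κ) (hu : LocallyIntegrable u) (z v : Fin n → ℂ) :
    fderiv ℝ (mollify κ u) z v = ∫ y, (fderiv ℝ κ (z - y) v) • u y := by
  have h1 := (h.hasCompactSupport.hasFDerivAt_convolution_left (lsmul ℝ ℝ)
    (h.smooth.of_le (by norm_cast)) hu z).fderiv
  have h2 : fderiv ℝ (mollify κ u) z = (fderiv ℝ κ ⋆[(lsmul ℝ ℝ).precompL _, volume] u) z := h1
  rw [h2, convolution_eq_swap, ContinuousLinearMap.integral_apply]
  · simp [precompL_apply]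
  · have := (h.hasCompactSupport.fderiv ℝ).convolutionExists_left ((lsmul ℝ ℝ).precompL (Fin n → ℂ))
      (h.smooth.continuous_fderiv (by simp)) hu z
    exact this.integrable_swap

theorem eLpNorm_mollify_sub_le (h : IsMollifier ε κ) (hu : MemLp u 2 volume) {η : ℝ≥0∞}
    (hη : ∀ y, ‖y‖ ≤ ε → eLpNorm (fun z => u (z - y) - u z) 2 volume ≤ η) :
    eLpNorm (mollify κ u - u) 2 volume ≤ η := by
  have hli : LocallyIntegrable u := hu.locallyIntegrable (by norm_num)
  set m : Measure (Fin n → ℂ) := volume.withDensity fun y => ENNReal.ofReal (κ y) with hm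
  have hκm : Measurable fun y => ENNReal.ofReal (κ y) := h.continuous.measurable.ennreal_ofReal
  have hmp : m univ = 1 := by
    rw [hm, withDensity_apply _ MeasurableSet.univ, Measure.restrict_univ,
      ← ofReal_integral_eq_lintegral_ofReal h.integrable (Eventually.of_forall h.nonneg),
      h.integral_eq, ENNReal.ofReal_one]
  have hpm : IsProbabilityMeasure m := ⟨hmp⟩
  have hac : m ≪ volume := withDensity_absolutelyContinuous _ _
  have hmeas2 : AEStronglyMeasurable (fun p : (Fin n → ℂ) × (Fin n → ℂ) => u (p.1 - p.2) - u p.1)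
      (volume.prod volume) := by
    refine AEStronglyMeasurable.sub ?_ hu.1.comp_fst
    exact hu.1.comp_quasiMeasurePreserving (quasiMeasurePreserving_sub volume volume)
  have hmeas : AEStronglyMeasurable (fun p : (Fin n → ℂ) × (Fin n → ℂ) => u (p.1 - p.2) - u p.1)
      (volume.prod m) := hmeas2.mono_ac (Measure.AbsolutelyContinuous.rfl.prod hac)
  have hpt : ∀ z, ‖(mollify κ u - u) z‖ₑ ^ (2:ℝ) ≤ ∫⁻ y, ‖u (z - y) - u z‖ₑ ^ (2:ℝ) ∂m := by
    intro z
    have h_int : Integrable (fun y => κ y • u (z - y)) :=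
      h.hasCompactSupport.convolutionExists_left (lsmul ℝ ℝ) h.continuous hli z
    have h1 : (mollify κ u - u) z = ∫ y, κ y • (u (z - y) - u z) := by
      simp only [smul_sub]
      rw [integral_sub h_int (h.integrable.smul_const _), integral_smul_const, h.integral_eq,
        one_smul]
      rfl
    have hms : AEStronglyMeasurable (fun y => u (z - y) - u z) volume := by
      refine AEStronglyMeasurable.sub ?_ aestronglyMeasurable_const
      exact hu.1.comp_quasiMeasurePreserving (quasiMeasurePreserving_sub_left volume z)
    have h2 : ‖(mollify κ u - u) z‖ₑ ≤ ∫⁻ y, ‖u (z - y) - u z‖ₑ ∂m := by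
      rw [h1]
      refine (enorm_integral_le_lintegral_enorm _).trans_eq ?_
      rw [hm, lintegral_withDensity_eq_lintegral_mul₀ hκm.aemeasurable hms.enorm]
      refine lintegral_congr fun y => ?_
      rw [enorm_smul, Real.enorm_of_nonneg (h.nonneg y)]
      rfl
    have h3 := eLpNorm_le_eLpNorm_of_exponent_le (μ := m) (p := 1) (q := 2) (by norm_num)
      (hms.mono_ac hac)
    rw [eLpNorm_one_eq_lintegral_enorm, eLpNorm_eq_lintegral_rpow_enorm_toReal (by norm_num)
      (by norm_num)] at h3
    have h4 := ENNReal.rpow_le_rpow (h2.trans h3) (z := 2) (by norm_num)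
    rw [← ENNReal.rpow_mul] at h4
    simpa using h4
  have hshift : ∀ᵐ y ∂m, ∫⁻ z, ‖u (z - y) - u z‖ₑ ^ (2:ℝ) ≤ η ^ (2:ℝ) := by
    rw [hm, ae_withDensity_iff hκm]
    refine Eventually.of_forall fun y hy => ?_
    have hy' : κ y ≠ 0 := fun h0 => hy (by simp [h0])
    have := hη y (h.supp y hy')
    rw [eLpNorm_eq_lintegral_rpow_enorm_toReal (by norm_num) (by norm_num)] at this
    have h4 := ENNReal.rpow_le_rpow this (z := 2) (by norm_num)
    rw [← ENNReal.rpow_mul] at h4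
    simpa using h4
  have hfin : ∫⁻ z, ‖(mollify κ u - u) z‖ₑ ^ (2:ℝ) ≤ η ^ (2:ℝ) := by
    calc ∫⁻ z, ‖(mollify κ u - u) z‖ₑ ^ (2:ℝ) ≤
        ∫⁻ z, ∫⁻ y, ‖u (z - y) - u z‖ₑ ^ (2:ℝ) ∂m := lintegral_mono hpt
      _ = ∫⁻ y, (∫⁻ z, ‖u (z - y) - u z‖ₑ ^ (2:ℝ)) ∂m :=
        lintegral_lintegral_swap (hmeas.enorm.pow_const _)
      _ ≤ ∫⁻ _y, η ^ (2:ℝ) ∂m := lintegral_mono_ae hshift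
      _ = η ^ (2:ℝ) := by simp
  rw [eLpNorm_eq_lintegral_rpow_enorm_toReal (by norm_num) (by norm_num)]
  have h5 := ENNReal.rpow_le_rpow hfin (z := 1 / 2) (by norm_num)
  rw [← ENNReal.rpow_mul] at h5
  simpa using h5

end IsMollifier

theorem tendsto_eLpNorm_translate {u : (Fin n → ℂ) → ℂ} (hu : MemLp u 2 volume) :
    Tendsto (fun y => eLpNorm (fun z => u (z - y) - u z) 2 volume) (𝓝 0) (𝓝 0) := by
  let g : C(Fin n → ℂ, C(Fin n → ℂ, Fin n → ℂ)) :=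
    ContinuousMap.curry ⟨fun p : (Fin n → ℂ) × (Fin n → ℂ) => p.2 - p.1, by fun_prop⟩
  have hmp : ∀ y : Fin n → ℂ, MeasurePreserving (g y) volume volume :=
    fun y => measurePreserving_sub_right volume y
  have h1 := (continuous_const (y := hu.toLp u)).compMeasurePreservingLp g.continuous hmp
    (by norm_num)
  have h2 : Tendsto (fun y => ‖Lp.compMeasurePreserving (g y) (hmp y) (hu.toLp u) - hu.toLp u‖ₑ)
      (𝓝 0) (𝓝 0) := by
    have h3 : Tendsto
        (fun y => ‖Lp.compMeasurePreserving (g y) (hmp y) (hu.toLp u) - hu.toLp u‖ₑ) (𝓝 0)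
        (𝓝 ‖Lp.compMeasurePreserving (g 0) (hmp 0) (hu.toLp u) - hu.toLp u‖ₑ) :=
      (h1.sub (continuous_const (y := hu.toLp u))).enorm.tendsto 0
    have h4 : Lp.compMeasurePreserving (g 0) (hmp 0) (hu.toLp u) = hu.toLp u := by
      rw [Lp.toLp_compMeasurePreserving]
      congr 1
      ext z
      simp [g]
    rw [h4, sub_self, enorm_zero] at h3
    exact h3
  refine h2.congr fun y => ?_
  rw [Lp.toLp_compMeasurePreserving, ← MemLp.toLp_sub, Lp.enorm_toLp]
  rfl

theorem tendsto_mollify {u : (Fin n → ℂ) → ℂ} (hu : MemLp u 2 volume)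
    {ε : ℕ → ℝ} (hε : Tendsto ε atTop (𝓝 0)) {κ : ℕ → (Fin n → ℂ) → ℝ}
    (hκ : ∀ k, IsMollifier (ε k) (κ k)) :
    Tendsto (fun k => eLpNorm (mollify (κ k) u - u) 2 volume) atTop (𝓝 0) := by
  rw [ENNReal.tendsto_nhds_zero]
  intro η hη
  obtain ⟨r, hr, h⟩ := Metric.eventually_nhds_iff_ball.1
    ((ENNReal.tendsto_nhds_zero.1 (tendsto_eLpNorm_translate hu)) η hη)
  filter_upwards [hε.eventually_lt_const hr] with k hk
  refine (hκ k).eLpNorm_mollify_sub_le hu fun y hy => h y ?_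
  simpa using hy.trans_lt hk

theorem realLinear_expand {G : Type*} [NormedAddCommGroup G] [NormedSpace ℝ G]
    (L : (Fin n → ℂ) →L[ℝ] G) (ξ : Fin n → ℂ) :
    L ξ = ∑ μ, ((ξ μ).re • L (Pi.single μ 1) + (ξ μ).im • L (Pi.single μ Complex.I)) := by
  have h1 : ξ = ∑ μ, ((ξ μ).re • (Pi.single μ 1 : Fin n → ℂ) +
      (ξ μ).im • (Pi.single μ Complex.I : Fin n → ℂ)) := by
    ext ν
    simp only [Finset.sum_apply, Pi.add_apply, Pi.smul_apply, Pi.single_apply]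
    rw [Finset.sum_eq_single ν (fun b _ hb => by simp [hb.symm]) (by simp)]
    simp
  conv_lhs => rw [h1]
  simp

theorem differentiableAt_of_wderivBar_eq_zero {f : (Fin n → ℂ) → ℂ} {z : Fin n → ℂ}
    (hf : DifferentiableAt ℝ f z) (h : ∀ j, wderivBar j f z = 0) : DifferentiableAt ℂ f z := by
  refine (differentiableAt_iff_restrictScalars ℝ hf).2
    ⟨∑ μ, (ContinuousLinearMap.proj μ : (Fin n → ℂ) →L[ℂ] ℂ).smulRight
      (fderiv ℝ f z (Pi.single μ 1)), ?_⟩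
  ext ξ
  rw [realLinear_expand (fderiv ℝ f z) ξ]
  simp only [coe_restrictScalars', _root_.sum_apply, smulRight_apply, proj_apply]
  refine Finset.sum_congr rfl fun μ _ => ?_
  have h1 := h μ
  rw [wderivBar, div_eq_zero_iff, or_iff_left (by norm_num)] at h1
  have h2 : fderiv ℝ f z (Pi.single μ Complex.I) = Complex.I * fderiv ℝ f z (Pi.single μ 1) := by
    linear_combination (-Complex.I) * h1 + fderiv ℝ f z (Pi.single μ Complex.I) * Complex.I_mul_I
  rw [h2]
  conv_lhs => rw [← Complex.re_add_im (ξ μ)]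
  simp only [smul_eq_mul, Complex.real_smul]
  ring

theorem fderiv_ofReal_comp_sub {κ : (Fin n → ℂ) → ℝ} (hκ : Differentiable ℝ κ)
    (z y v : Fin n → ℂ) :
    fderiv ℝ (fun y => (κ (z - y) : ℂ)) y v = -(fderiv ℝ κ (z - y) v : ℂ) := by
  have h1 : HasFDerivAt (fun y => κ (z - y)) ((fderiv ℝ κ (z - y)).comp
      (-ContinuousLinearMap.id ℝ (Fin n → ℂ))) y :=
    (hκ (z - y)).hasFDerivAt.comp y ((hasFDerivAt_id y).const_sub z)
  have h2 := (Complex.ofRealCLM.hasFDerivAt (x := κ (z - y))).comp y h1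
  have h3 : fderiv ℝ (fun y => (κ (z - y) : ℂ)) y = _ := h2.fderiv
  rw [h3]
  simp

theorem IsMollifier.integrable_fderiv_smul {ε : ℝ} {κ : (Fin n → ℂ) → ℝ} {u : (Fin n → ℂ) → ℂ}
    (h : IsMollifier ε κ) (hu : LocallyIntegrable u) (z v : Fin n → ℂ) :
    Integrable fun y => (fderiv ℝ κ (z - y) v) • u y := by
  have hc : Continuous (fderiv ℝ κ) := h.smooth.continuous_fderiv (by simp)
  refine hu.integrable_smul_left_of_hasCompactSupport (by fun_prop) ?_
  have h1 : HasCompactSupport fun y => fderiv ℝ κ y v :=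
    (h.hasCompactSupport.fderiv ℝ).comp_left (g := fun L : (Fin n → ℂ) →L[ℝ] ℝ => L v) rfl
  exact h1.comp_homeomorph (Homeomorph.subLeft z)

theorem wderivBar_mollify {ε : ℝ} {κ : (Fin n → ℂ) → ℝ} {u : (Fin n → ℂ) → ℂ}
    (h : IsMollifier ε κ) (hu : LocallyIntegrable u) (j : Fin n) (z : Fin n → ℂ) :
    wderivBar j (mollify κ u) z = -∫ y, u y * wderivBar j (fun y => (κ (z - y) : ℂ)) y := by
  have hd : Differentiable ℝ κ := h.smooth.differentiable (by simp)
  rw [wderivBar, h.fderiv_mollify_apply hu, h.fderiv_mollify_apply hu, ← integral_const_mul,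
    ← integral_add (h.integrable_fderiv_smul hu z _)
      ((h.integrable_fderiv_smul hu z _).const_mul _), ← integral_div, ← integral_neg]
  refine integral_congr_ae (Eventually.of_forall fun y => ?_)
  simp only [wderivBar, fderiv_ofReal_comp_sub hd, Complex.real_smul]
  ring

theorem wderiv_mollify {ε : ℝ} {κ : (Fin n → ℂ) → ℝ} {u : (Fin n → ℂ) → ℂ}
    (h : IsMollifier ε κ) (hu : LocallyIntegrable u) (j : Fin n) (z : Fin n → ℂ) :
    wderiv j (mollify κ u) z = -∫ y, u y * wderiv j (fun y => (κ (z - y) : ℂ)) y := by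
  have hd : Differentiable ℝ κ := h.smooth.differentiable (by simp)
  rw [wderiv, h.fderiv_mollify_apply hu, h.fderiv_mollify_apply hu, ← integral_const_mul,
    ← integral_sub (h.integrable_fderiv_smul hu z _)
      ((h.integrable_fderiv_smul hu z _).const_mul _), ← integral_div, ← integral_neg]
  refine integral_congr_ae (Eventually.of_forall fun y => ?_)
  simp only [wderiv, fderiv_ofReal_comp_sub hd, Complex.real_smul]
  ring

theorem IsMollifier.tsupport_comp_sub_subset {ε : ℝ} {κ : (Fin n → ℂ) → ℝ}
    (h : IsMollifier ε κ) (z : Fin n → ℂ) :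
    tsupport (fun y => (κ (z - y) : ℂ)) ⊆ closedBall z ε := by
  refine closure_minimal (fun y hy => ?_) isClosed_closedBall
  have : κ (z - y) ≠ 0 := fun h0 => hy (by simp [h0])
  rw [mem_closedBall, dist_comm, dist_eq_norm]
  exact h.supp _ this

theorem IsMollifier.contDiff_comp_sub {ε : ℝ} {κ : (Fin n → ℂ) → ℝ}
    (h : IsMollifier ε κ) (z : Fin n → ℂ) : ContDiff ℝ ∞ (fun y => (κ (z - y) : ℂ)) :=
  Complex.ofRealCLM.contDiff.comp (h.smooth.comp (contDiff_const.sub contDiff_id))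

/-- Weyl's lemma for the Cauchy–Riemann system. -/
theorem exists_holomorphic_of_weak {u : (Fin n → ℂ) → ℂ} (hu : MemLp u 2 volume)
    {U : Set (Fin n → ℂ)} (hU : IsOpen U)
    (hw : ∀ (j : Fin n) (g : (Fin n → ℂ) → ℂ), ContDiff ℝ 2 g → HasCompactSupport g →
      tsupport g ⊆ U → ∫ y, u y * wderivBar j g y = 0) :
    ∃ h : (Fin n → ℂ) → ℂ, DifferentiableOn ℂ h U ∧ ∀ᵐ z ∂volume.restrict U, u z = h z := by
  have hli : LocallyIntegrable u := hu.locallyIntegrable (by norm_num)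
  have hex : ∀ ε : ℝ, ∃ κ : (Fin n → ℂ) → ℝ, 0 < ε → IsMollifier ε κ := by
    intro ε
    by_cases hε : 0 < ε
    · obtain ⟨κ, hκ⟩ := exists_isMollifier (n := n) hε
      exact ⟨κ, fun _ => hκ⟩
    · exact ⟨0, fun h => absurd h hε⟩
  choose κ hκ using hex
  have hol : ∀ ε > 0, ∀ z, closedBall z ε ⊆ U → DifferentiableAt ℂ (mollify (κ ε) u) z := by
    intro ε hε z hz
    refine differentiableAt_of_wderivBar_eq_zero
      (((hκ ε hε).contDiff_mollify hli).differentiable (by simp) z) fun j => ?_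
    rw [wderivBar_mollify (hκ ε hε) hli, neg_eq_zero]
    have hsub := (hκ ε hε).tsupport_comp_sub_subset z
    exact hw j _ (((hκ ε hε).contDiff_comp_sub z).of_le (by norm_cast))
      (HasCompactSupport.of_support_subset_isCompact (isCompact_closedBall z ε)
        ((subset_tsupport _).trans hsub)) (hsub.trans hz)
  have hmean : ∀ ε > 0, ∀ δ > 0, ∀ s z, closedBall z s ⊆ U → ε + δ < s →
      mollify (κ ε) (mollify (κ δ) u) z = mollify (κ δ) u z := by
    intro ε hε δ hδ s z hz hs
    refine (hκ ε hε).mollify_eq_of_holomorphic (s := s - δ) (by linarith) fun y hy => ?_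
    refine (hol δ hδ y ((closedBall_subset_closedBall' ?_).trans hz)).differentiableWithinAt
    rw [mem_ball] at hy
    linarith
  have heq : ∀ ε > 0, ∀ δ > 0, ∀ s z, closedBall z s ⊆ U → ε + δ < s →
      mollify (κ ε) u z = mollify (κ δ) u z := by
    intro ε hε δ hδ s z hz hs
    rw [← hmean ε hε δ hδ s z hz hs, (hκ ε hε).mollify_comm (hκ δ hδ) hli,
      hmean δ hδ ε hε s z hz (by linarith)]
  have hrex : ∀ z, ∃ r : ℝ, z ∈ U → 0 < r ∧ closedBall z r ⊆ U := by
    intro z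
    by_cases hz : z ∈ U
    · obtain ⟨r, hr, h⟩ := Metric.nhds_basis_closedBall.mem_iff.1 (hU.mem_nhds hz)
      exact ⟨r, fun _ => ⟨hr, h⟩⟩
    · exact ⟨0, fun h => absurd h hz⟩
  choose r hr using hrex
  set h : (Fin n → ℂ) → ℂ := fun z => mollify (κ (r z / 4)) u z
  have hloc : ∀ z₀ ∈ U, ∀ z ∈ ball z₀ (r z₀ / 2), ∀ δ > 0, δ ≤ r z₀ / 8 →
      h z = mollify (κ δ) u z := by
    intro z₀ hz₀ z hz δ hδ hδ'
    obtain ⟨hr0, hsub⟩ := hr z₀ hz₀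
    have hsub' : closedBall z (r z₀ / 2) ⊆ U := by
      refine (closedBall_subset_closedBall' ?_).trans hsub
      rw [mem_ball] at hz
      linarith
    obtain ⟨hr1, hsub1⟩ := hr z (hsub' (mem_closedBall_self (by positivity)))
    rcases le_total (r z) (r z₀ / 2) with hle | hle
    · exact heq _ (by positivity) _ hδ (r z₀ / 2) z hsub' (by linarith)
    · exact heq _ (by positivity) _ hδ (r z) z hsub1 (by linarith)
  refine ⟨h, fun z₀ hz₀ => ?_, ?_⟩
  · obtain ⟨hr0, hsub⟩ := hr z₀ hz₀
    have : h =ᶠ[𝓝 z₀] mollify (κ (r z₀ / 8)) u :=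
      Filter.eventually_of_mem (isOpen_ball.mem_nhds (mem_ball_self (by positivity)))
        fun z hz => hloc z₀ hz₀ z hz _ (by positivity) le_rfl
    refine (DifferentiableAt.congr_of_eventuallyEq (hol _ (by positivity) z₀ ?_)
      this).differentiableWithinAt
    exact (closedBall_subset_closedBall (by linarith)).trans hsub
  · have hae : ∀ z₀ ∈ U, ∀ᵐ z ∂volume.restrict (ball z₀ (r z₀ / 2)), u z = h z := by
      intro z₀ hz₀
      obtain ⟨hr0, hsub⟩ := hr z₀ hz₀
      have hlim := tendsto_mollify hu (ε := fun k => r z₀ / 8 / ((k:ℝ) + 1))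
        (tendsto_const_nhds.div_atTop (tendsto_atTop_add_const_right _ _
          tendsto_natCast_atTop_atTop)) (fun k => hκ _ (by positivity))
      have hle : ∀ k : ℕ, eLpNorm (h - u) 2 (volume.restrict (ball z₀ (r z₀ / 2))) ≤
          eLpNorm (mollify (κ (r z₀ / 8 / ((k:ℝ) + 1))) u - u) 2 volume := by
        intro k
        refine (eLpNorm_congr_ae ?_).trans_le (eLpNorm_restrict_le _ _ _ _)
        filter_upwards [ae_restrict_mem measurableSet_ball] with z hz
        simp only [Pi.sub_apply]
        rw [hloc z₀ hz₀ z hz (r z₀ / 8 / ((k:ℝ) + 1)) (by positivity)]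
        exact div_le_self (by positivity) (by linarith [Nat.cast_nonneg (α := ℝ) k])
      have h0 : eLpNorm (h - u) 2 (volume.restrict (ball z₀ (r z₀ / 2))) = 0 :=
        le_antisymm (ge_of_tendsto' hlim hle) bot_le
      have hcont : AEStronglyMeasurable (h - u) (volume.restrict (ball z₀ (r z₀ / 2))) := by
        refine AEStronglyMeasurable.sub ?_ hu.1.restrict
        have : AEStronglyMeasurable (mollify (κ (r z₀ / 8)) u)
            (volume.restrict (ball z₀ (r z₀ / 2))) :=
          ((hκ _ (by positivity)).contDiff_mollify hli).continuous.aestronglyMeasurable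
        refine this.congr ?_
        filter_upwards [ae_restrict_mem measurableSet_ball] with z hz
        exact (hloc z₀ hz₀ z hz _ (by positivity) le_rfl).symm
      rw [eLpNorm_eq_zero_iff hcont (by norm_num)] at h0
      filter_upwards [h0] with z hz
      exact (sub_eq_zero.1 hz).symm
    have hnull : volume ({z | ¬ u z = h z} ∩ U) = 0 := by
      refine measure_null_of_locally_null _ fun z₀ hz₀ => ?_
      refine ⟨_, inter_mem_nhdsWithin _ (isOpen_ball.mem_nhds
        (mem_ball_self (half_pos (hr z₀ hz₀.2).1))), ?_⟩
      have h2 := hae z₀ hz₀.2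
      rw [ae_iff, Measure.restrict_apply₀' measurableSet_ball.nullMeasurableSet] at h2
      exact measure_mono_null (inter_subset_inter_left _ inter_subset_left) h2
    rw [ae_iff, Measure.restrict_apply₀' hU.measurableSet.nullMeasurableSet]
    exact hnull

end Mollifier

section Wirtinger

open scoped ContDiff

variable {n : ℕ} {f g : (Fin n → ℂ) → ℂ} {z : Fin n → ℂ}

theorem single_I (μ : Fin n) :
    (Pi.single μ Complex.I : Fin n → ℂ) = Complex.I • Pi.single μ 1 := by
  rw [← Pi.single_smul]; simp

theorem sum_wderiv_mul (f : (Fin n → ℂ) → ℂ) (z ξ : Fin n → ℂ) :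
    ∑ μ, wderiv μ f z * ξ μ =
      (fderiv ℝ f z ξ - Complex.I * fderiv ℝ f z (Complex.I • ξ)) / 2 := by
  rw [realLinear_expand (fderiv ℝ f z) ξ, realLinear_expand (fderiv ℝ f z) (Complex.I • ξ),
    Finset.mul_sum, ← Finset.sum_sub_distrib, Finset.sum_div]
  refine Finset.sum_congr rfl fun μ _ => ?_
  conv_lhs => rw [← Complex.re_add_im (ξ μ)]
  simp only [wderiv, Pi.smul_apply, smul_eq_mul, Complex.real_smul, Complex.I_mul_re,
    Complex.I_mul_im, Complex.ofReal_neg]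
  ring_nf
  simp only [Complex.I_sq]
  ring

theorem sum_wderivBar_mul_conj (f : (Fin n → ℂ) → ℂ) (z ξ : Fin n → ℂ) :
    ∑ μ, wderivBar μ f z * (starRingEnd ℂ) (ξ μ) =
      (fderiv ℝ f z ξ + Complex.I * fderiv ℝ f z (Complex.I • ξ)) / 2 := by
  rw [realLinear_expand (fderiv ℝ f z) ξ, realLinear_expand (fderiv ℝ f z) (Complex.I • ξ),
    Finset.mul_sum, ← Finset.sum_add_distrib, Finset.sum_div]
  refine Finset.sum_congr rfl fun μ _ => ?_
  conv_lhs => rw [← Complex.re_add_im (ξ μ)]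
  simp only [wderivBar, Pi.smul_apply, smul_eq_mul, Complex.real_smul, Complex.I_mul_re,
    Complex.I_mul_im, Complex.ofReal_neg, map_add, map_mul, Complex.conj_ofReal, Complex.conj_I]
  ring_nf
  simp only [Complex.I_sq]
  ring

/-- Second real derivative of `f` at `z` applied to `u` and then `v`. -/
def hess {F : Type*} [NormedAddCommGroup F] [NormedSpace ℝ F] (f : (Fin n → ℂ) → F)
    (z u v : Fin n → ℂ) : F :=
  fderiv ℝ (fderiv ℝ f) z u v

theorem hess_symm {F : Type*} [NormedAddCommGroup F] [NormedSpace ℝ F] {f : (Fin n → ℂ) → F}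
    (hf : ContDiffAt ℝ 2 f z) (u v : Fin n → ℂ) : hess f z u v = hess f z v u :=
  (hf.isSymmSndFDerivAt (by simp)) u v

theorem ContDiffAt.differentiableAt_fderiv {F : Type*} [NormedAddCommGroup F] [NormedSpace ℝ F]
    {f : (Fin n → ℂ) → F} (hf : ContDiffAt ℝ 2 f z) : DifferentiableAt ℝ (fderiv ℝ f) z :=
  (hf.fderiv_right (m := 1) (by norm_num)).differentiableAt (by norm_num)

theorem fderiv_fderiv_apply {F : Type*} [NormedAddCommGroup F] [NormedSpace ℝ F]
    {f : (Fin n → ℂ) → F} (hf : ContDiffAt ℝ 2 f z) (u v : Fin n → ℂ) :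
    fderiv ℝ (fun w => fderiv ℝ f w v) z u = hess f z u v := by
  rw [fderiv_clm_apply hf.differentiableAt_fderiv (differentiableAt_const v)]
  simp [hess]

theorem ContDiffAt.wderivBar (hf : ContDiffAt ℝ 2 f z) (ν : Fin n) :
    ContDiffAt ℝ 1 (wderivBar ν f) z := by
  have h := hf.fderiv_right (m := 1) (by norm_num)
  exact ((h.clm_apply contDiffAt_const).add
    (contDiffAt_const.mul (h.clm_apply contDiffAt_const))).div_const 2

theorem ContDiffAt.wderiv (hf : ContDiffAt ℝ 2 f z) (ν : Fin n) :
    ContDiffAt ℝ 1 (wderiv ν f) z := by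
  have h := hf.fderiv_right (m := 1) (by norm_num)
  exact ((h.clm_apply contDiffAt_const).sub
    (contDiffAt_const.mul (h.clm_apply contDiffAt_const))).div_const 2

theorem fderiv_wirtinger_combination (hf : ContDiffAt ℝ 2 f z) (c : ℂ) (a b u : Fin n → ℂ) :
    fderiv ℝ (fun w => (fderiv ℝ f w a + c * fderiv ℝ f w b) * 2⁻¹) z u =
      (hess f z u a + c * hess f z u b) * 2⁻¹ := by
  have h := hf.differentiableAt_fderiv
  have ha := h.clm_apply (differentiableAt_const (𝕜 := ℝ) a)
  have hb := h.clm_apply (differentiableAt_const (𝕜 := ℝ) b)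
  rw [fderiv_mul_const (ha.fun_add (hb.const_mul c)), fderiv_fun_add ha (hb.const_mul c),
    fderiv_const_mul hb]
  simp only [smul_apply, add_apply, fderiv_fderiv_apply hf, smul_eq_mul]
  ring

theorem wderiv_wderivBar (hf : ContDiffAt ℝ 2 f z) (j k : Fin n) :
    wderiv j (wderivBar k f) z = wderivBar k (wderiv j f) z := by
  have hb : wderivBar k f = fun w => (fderiv ℝ f w (Pi.single k 1) +
      Complex.I * fderiv ℝ f w (Pi.single k Complex.I)) * 2⁻¹ := by
    ext w
    rw [wderivBar, div_eq_mul_inv]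
  have hd : wderiv j f = fun w => (fderiv ℝ f w (Pi.single j 1) +
      (-Complex.I) * fderiv ℝ f w (Pi.single j Complex.I)) * 2⁻¹ := by
    ext w
    rw [wderiv, div_eq_mul_inv, neg_mul, ← sub_eq_add_neg]
  rw [hb, hd, wderiv, wderivBar]
  simp only [fderiv_wirtinger_combination hf]
  rw [hess_symm hf (Pi.single k 1),
    hess_symm hf (Pi.single k 1), hess_symm hf (Pi.single k Complex.I),
    hess_symm hf (Pi.single k Complex.I)]
  ring

theorem sum_wderiv_wderivBar (hf : ContDiffAt ℝ 2 f z) (ξ : Fin n → ℂ) :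
    ∑ μ, ∑ ν, wderiv μ (fun w => wderivBar ν f w) z * ξ μ * (starRingEnd ℂ) (ξ ν) =
      (hess f z ξ ξ + hess f z (Complex.I • ξ) (Complex.I • ξ)) / 4 := by
  have h1 : ∀ ν, ∑ μ, wderiv μ (fun w => wderivBar ν f w) z * ξ μ * (starRingEnd ℂ) (ξ ν) =
      (fderiv ℝ (wderivBar ν f) z ξ * (starRingEnd ℂ) (ξ ν)
        - Complex.I * (fderiv ℝ (wderivBar ν f) z (Complex.I • ξ) * (starRingEnd ℂ)
            (ξ ν))) / 2 := by
    intro ν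
    rw [← Finset.sum_mul, sum_wderiv_mul]
    ring
  have h2 : ∀ u, ∑ ν, fderiv ℝ (wderivBar ν f) z u * (starRingEnd ℂ) (ξ ν) =
      (hess f z u ξ + Complex.I * hess f z u (Complex.I • ξ)) / 2 := by
    intro u
    have h3 : HasFDerivAt (fun w => ∑ ν, wderivBar ν f w * (starRingEnd ℂ) (ξ ν))
        (∑ ν, (starRingEnd ℂ) (ξ ν) • fderiv ℝ (wderivBar ν f) z) z :=
      HasFDerivAt.fun_sum fun ν _ =>
        (((hf.wderivBar ν).differentiableAt (by norm_num)).hasFDerivAt).mul_const _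
    have h4 : (fun w => ∑ ν, wderivBar ν f w * (starRingEnd ℂ) (ξ ν)) =
        fun w => (fderiv ℝ f w ξ + Complex.I * fderiv ℝ f w (Complex.I • ξ)) * 2⁻¹ := by
      ext w
      rw [sum_wderivBar_mul_conj, div_eq_mul_inv]
    have h6 := congrArg (fun L : (Fin n → ℂ) →L[ℝ] ℂ => L u) h3.fderiv
    rw [h4] at h6
    simp only [sum_apply, smul_apply, fderiv_wirtinger_combination hf, smul_eq_mul] at h6
    rw [div_eq_mul_inv, h6]
    exact Finset.sum_congr rfl fun ν _ => mul_comm _ _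
  rw [Finset.sum_comm]
  simp_rw [h1]
  rw [← Finset.sum_div, Finset.sum_sub_distrib, ← Finset.mul_sum, h2, h2,
    hess_symm hf (Complex.I • ξ) ξ]
  ring_nf
  simp only [Complex.I_sq]
  ring

theorem fderiv_ofReal_comp {ρ : (Fin n → ℂ) → ℝ} (hρ : DifferentiableAt ℝ ρ z)
    (v : Fin n → ℂ) : fderiv ℝ (fun u => (ρ u : ℂ)) z v = (fderiv ℝ ρ z v : ℂ) := by
  have h2 : fderiv ℝ (fun u => (ρ u : ℂ)) z = _ :=
    ((Complex.ofRealCLM.hasFDerivAt (x := ρ z)).comp z hρ.hasFDerivAt).fderiv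
  rw [h2]
  simp

theorem ContDiffAt.ofReal_comp {ρ : (Fin n → ℂ) → ℝ} {m : WithTop ℕ∞}
    (hρ : ContDiffAt ℝ m ρ z) : ContDiffAt ℝ m (fun u => (ρ u : ℂ)) z :=
  Complex.ofRealCLM.contDiff.contDiffAt.comp z hρ

theorem hess_ofReal_comp {ρ : (Fin n → ℂ) → ℝ} (hρ : ContDiffAt ℝ 2 ρ z)
    (u v : Fin n → ℂ) : hess (fun u => (ρ u : ℂ)) z u v = ((hess ρ z u v : ℝ) : ℂ) := by
  rw [← fderiv_fderiv_apply hρ.ofReal_comp, ← fderiv_fderiv_apply hρ]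
  have h1 : (fun w => fderiv ℝ (fun u => (ρ u : ℂ)) w v) =ᶠ[𝓝 z]
      fun w => ((fderiv ℝ ρ w v : ℝ) : ℂ) := by
    filter_upwards [hρ.eventually (by simp)] with w hw
    exact fderiv_ofReal_comp (hw.differentiableAt (by norm_num)) v
  rw [h1.fderiv_eq]
  exact fderiv_ofReal_comp
    (hρ.differentiableAt_fderiv.clm_apply (differentiableAt_const v)) u

theorem sum_levi_eq {ρ : (Fin n → ℂ) → ℝ} (hρ : ContDiffAt ℝ 2 ρ z) (ξ : Fin n → ℂ) :
    ∑ μ, ∑ ν, wderiv μ (fun w => wderivBar ν (fun u => (ρ u : ℂ)) w) z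
      * ξ μ * (starRingEnd ℂ) (ξ ν) = (leviForm ρ z ξ : ℂ) := by
  rw [leviForm, sum_wderiv_wderivBar hρ.ofReal_comp, hess_ofReal_comp hρ, hess_ofReal_comp hρ]
  norm_cast

theorem leviForm_eq {ρ : (Fin n → ℂ) → ℝ} (hρ : ContDiffAt ℝ 2 ρ z) (ξ : Fin n → ℂ) :
    leviForm ρ z ξ = (hess ρ z ξ ξ + hess ρ z (Complex.I • ξ) (Complex.I • ξ)) / 4 := by
  rw [leviForm, sum_wderiv_wderivBar hρ.ofReal_comp, hess_ofReal_comp hρ, hess_ofReal_comp hρ]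
  norm_cast

theorem sum_wderiv_ofReal_mul {ρ : (Fin n → ℂ) → ℝ} (hρ : DifferentiableAt ℝ ρ z)
    (ξ : Fin n → ℂ) : ∑ μ, wderiv μ (fun u => (ρ u : ℂ)) z * ξ μ =
      ((fderiv ℝ ρ z ξ : ℂ) - Complex.I * (fderiv ℝ ρ z (Complex.I • ξ) : ℂ)) / 2 := by
  rw [sum_wderiv_mul, fderiv_ofReal_comp hρ, fderiv_ofReal_comp hρ]

theorem wderiv_mul (hf : DifferentiableAt ℝ f z) (hg : DifferentiableAt ℝ g z) (j : Fin n) :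
    wderiv j (fun w => f w * g w) z = wderiv j f z * g z + f z * wderiv j g z := by
  simp only [wderiv, fderiv_fun_mul hf hg, add_apply,
    smul_apply, smul_eq_mul]
  ring

theorem wderivBar_mul (hf : DifferentiableAt ℝ f z) (hg : DifferentiableAt ℝ g z) (j : Fin n) :
    wderivBar j (fun w => f w * g w) z = wderivBar j f z * g z + f z * wderivBar j g z := by
  simp only [wderivBar, fderiv_fun_mul hf hg, add_apply,
    smul_apply, smul_eq_mul]
  ring

theorem wderiv_sub (hf : DifferentiableAt ℝ f z) (hg : DifferentiableAt ℝ g z) (j : Fin n) :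
    wderiv j (fun w => f w - g w) z = wderiv j f z - wderiv j g z := by
  simp only [wderiv, fderiv_fun_sub hf hg, sub_apply]
  ring

theorem wderivBar_sub (hf : DifferentiableAt ℝ f z) (hg : DifferentiableAt ℝ g z) (j : Fin n) :
    wderivBar j (fun w => f w - g w) z = wderivBar j f z - wderivBar j g z := by
  simp only [wderivBar, fderiv_fun_sub hf hg, sub_apply]
  ring

theorem fderiv_conj_comp (hf : DifferentiableAt ℝ f z) (v : Fin n → ℂ) :
    fderiv ℝ (fun w => (starRingEnd ℂ) (f w)) z v = (starRingEnd ℂ) (fderiv ℝ f z v) := by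
  have h2 : fderiv ℝ (fun w => (starRingEnd ℂ) (f w)) z = _ :=
    ((Complex.conjCLE.toContinuousLinearMap.hasFDerivAt (x := f z)).comp z hf.hasFDerivAt).fderiv
  rw [h2]
  simp

theorem wderivBar_conj (hf : DifferentiableAt ℝ f z) (j : Fin n) :
    wderivBar j (fun w => (starRingEnd ℂ) (f w)) z = (starRingEnd ℂ) (wderiv j f z) := by
  simp only [wderivBar, wderiv, fderiv_conj_comp hf, map_div₀, map_sub, map_mul, Complex.conj_I,
    map_ofNat]
  ring

theorem wderiv_conj (hf : DifferentiableAt ℝ f z) (j : Fin n) :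
    wderiv j (fun w => (starRingEnd ℂ) (f w)) z = (starRingEnd ℂ) (wderivBar j f z) := by
  simp only [wderivBar, wderiv, fderiv_conj_comp hf, map_div₀, map_add, map_mul, Complex.conj_I,
    map_ofNat]
  ring

theorem wderivBar_eq_zero (hf : DifferentiableAt ℂ f z) (j : Fin n) : wderivBar j f z = 0 := by
  rw [wderivBar, hf.fderiv_restrictScalars ℝ, single_I]
  simp only [ContinuousLinearMap.coe_restrictScalars', map_smul, smul_eq_mul]
  linear_combination fderiv ℂ f z (Pi.single j 1) / 2 * Complex.I_mul_I

theorem continuous_wderiv (hf : ContDiff ℝ 1 f) (j : Fin n) : Continuous (wderiv j f) := by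
  have h : Continuous (fderiv ℝ f) := hf.continuous_fderiv (by norm_num)
  unfold wderiv
  fun_prop

theorem continuous_wderivBar (hf : ContDiff ℝ 1 f) (j : Fin n) : Continuous (wderivBar j f) := by
  have h : Continuous (fderiv ℝ f) := hf.continuous_fderiv (by norm_num)
  unfold wderivBar
  fun_prop

theorem tsupport_wderiv_subset (f : (Fin n → ℂ) → ℂ) (j : Fin n) :
    tsupport (wderiv j f) ⊆ tsupport f := by
  refine closure_minimal (fun z hz => support_fderiv_subset ℝ (f := f) fun h => hz ?_)
    (isClosed_tsupport f)
  simp [wderiv, h]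

theorem tsupport_wderivBar_subset (f : (Fin n → ℂ) → ℂ) (j : Fin n) :
    tsupport (wderivBar j f) ⊆ tsupport f := by
  refine closure_minimal (fun z hz => support_fderiv_subset ℝ (f := f) fun h => hz ?_)
    (isClosed_tsupport f)
  simp [wderivBar, h]

theorem HasCompactSupport.wderiv (hf : HasCompactSupport f) (j : Fin n) :
    HasCompactSupport (wderiv j f) :=
  hf.of_isClosed_subset (isClosed_tsupport _) (tsupport_wderiv_subset f j)

theorem HasCompactSupport.wderivBar (hf : HasCompactSupport f) (j : Fin n) :
    HasCompactSupport (wderivBar j f) :=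
  hf.of_isClosed_subset (isClosed_tsupport _) (tsupport_wderivBar_subset f j)

theorem integral_fderiv_apply_eq_zero (hf : ContDiff ℝ 1 f) (hs : HasCompactSupport f)
    (v : Fin n → ℂ) : ∫ z, fderiv ℝ f z v = 0 := by
  have hc : Continuous fun z => fderiv ℝ f z v :=
    (hf.continuous_fderiv (by norm_num)).clm_apply continuous_const
  have hcs : HasCompactSupport fun z => fderiv ℝ f z v :=
    (hs.fderiv ℝ).comp_left (g := fun L : (Fin n → ℂ) →L[ℝ] ℂ => L v) rfl
  have h := integral_smul_fderiv_eq_neg_fderiv_smul_of_integrable (μ :=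
      (volume : Measure (Fin n → ℂ)))
    (𝕜 := ℝ) (f := fun _ => (1:ℝ)) (g := f) (v := v) (by simp)
    (by simpa using hc.integrable_of_hasCompactSupport hcs)
    (by simpa using hf.continuous.integrable_of_hasCompactSupport hs)
    (fun x _ => differentiableAt_const _) (fun x _ => hf.differentiable (by norm_num) x)
  simpa using h

theorem integral_wderiv_eq_zero (hf : ContDiff ℝ 1 f) (hs : HasCompactSupport f) (j : Fin n) :
    ∫ z, wderiv j f z = 0 := by
  have hi : ∀ v : Fin n → ℂ, Integrable fun z => fderiv ℝ f z v := fun v =>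
    ((hf.continuous_fderiv (by norm_num)).clm_apply
      continuous_const).integrable_of_hasCompactSupport
      ((hs.fderiv ℝ).comp_left (g := fun L : (Fin n → ℂ) →L[ℝ] ℂ => L v) rfl)
  simp only [wderiv]
  rw [integral_div, integral_sub (hi _) ((hi _).const_mul _), integral_const_mul,
    integral_fderiv_apply_eq_zero hf hs, integral_fderiv_apply_eq_zero hf hs]
  simp

theorem integral_wderivBar_eq_zero (hf : ContDiff ℝ 1 f) (hs : HasCompactSupport f)
    (j : Fin n) : ∫ z, wderivBar j f z = 0 := by
  have hi : ∀ v : Fin n → ℂ, Integrable fun z => fderiv ℝ f z v := fun v =>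
    ((hf.continuous_fderiv (by norm_num)).clm_apply
      continuous_const).integrable_of_hasCompactSupport
      ((hs.fderiv ℝ).comp_left (g := fun L : (Fin n → ℂ) →L[ℝ] ℂ => L v) rfl)
  simp only [wderivBar]
  rw [integral_div, integral_add (hi _) ((hi _).const_mul _), integral_const_mul,
    integral_fderiv_apply_eq_zero hf hs, integral_fderiv_apply_eq_zero hf hs]
  simp

end Wirtinger

section BasicEstimate

open scoped ContDiff ComplexConjugate

variable {n : ℕ}

/-- The twisted derivative `e^φ ∂_j (e^{-φ} g)`. -/
def twistedDeriv (φ : (Fin n → ℂ) → ℝ) (j : Fin n) (g : (Fin n → ℂ) → ℂ) (z : Fin n → ℂ) : ℂ :=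
  wderiv j g z - wderiv j (fun u => (φ u : ℂ)) z * g z

variable {φ ψ : (Fin n → ℂ) → ℝ} {g h : (Fin n → ℂ) → ℂ}

theorem fderiv_ofReal_exp_neg (hφ : Differentiable ℝ φ) (z v : Fin n → ℂ) :
    fderiv ℝ (fun u => (Real.exp (-φ u) : ℂ)) z v =
      -((fderiv ℝ φ z v : ℝ) : ℂ) * (Real.exp (-φ z) : ℂ) := by
  rw [fderiv_ofReal_comp (hφ z).fun_neg.exp, ((hφ z).hasFDerivAt.fun_neg.exp).fderiv]
  simp [mul_comm]

theorem wderivBar_ofReal_exp_neg (hφ : Differentiable ℝ φ) (j : Fin n) (z : Fin n → ℂ) :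
    wderivBar j (fun u => (Real.exp (-φ u) : ℂ)) z =
      -conj (wderiv j (fun u => (φ u : ℂ)) z) * (Real.exp (-φ z) : ℂ) := by
  simp only [wderivBar, wderiv, fderiv_ofReal_exp_neg hφ, fderiv_ofReal_comp (hφ z), map_div₀,
    map_sub, map_mul, Complex.conj_ofReal, Complex.conj_I, map_ofNat]
  ring

theorem continuous_ofReal_exp_neg (hφ : Continuous φ) :
    Continuous fun z => (Real.exp (-φ z) : ℂ) :=
  Complex.continuous_ofReal.comp (Real.continuous_exp.comp hφ.neg)

theorem continuous_twistedDeriv (hφ : ContDiff ℝ 1 φ) (hg : ContDiff ℝ 1 g) (j : Fin n) :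
    Continuous (twistedDeriv φ j g) :=
  (continuous_wderiv hg j).sub
    ((continuous_wderiv (Complex.ofRealCLM.contDiff.comp hφ) j).mul hg.continuous)

theorem support_twistedDeriv_subset (φ : (Fin n → ℂ) → ℝ) (j : Fin n) (g : (Fin n → ℂ) → ℂ) :
    Function.support (twistedDeriv φ j g) ⊆ tsupport g := by
  intro z hz
  by_contra hzg
  refine hz ?_
  have h1 : wderiv j g z = 0 := by
    by_contra h2
    exact hzg (tsupport_wderiv_subset g j (subset_tsupport _ h2))
  simp [twistedDeriv, h1, image_eq_zero_of_notMem_tsupport hzg]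

theorem contDiff_wderiv (hg : ContDiff ℝ 2 g) (j : Fin n) : ContDiff ℝ 1 (wderiv j g) :=
  contDiff_iff_contDiffAt.2 fun _ => hg.contDiffAt.wderiv j

theorem contDiff_wderivBar (hg : ContDiff ℝ 2 g) (j : Fin n) : ContDiff ℝ 1 (wderivBar j g) :=
  contDiff_iff_contDiffAt.2 fun _ => hg.contDiffAt.wderivBar j

theorem contDiff_conj_comp {m : WithTop ℕ∞} (hg : ContDiff ℝ m g) :
    ContDiff ℝ m fun z => conj (g z) :=
  Complex.conjCLE.contDiff.comp hg

theorem contDiff_ofReal_comp {m : WithTop ℕ∞} (hφ : ContDiff ℝ m φ) :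
    ContDiff ℝ m fun z => (φ z : ℂ) :=
  Complex.ofRealCLM.contDiff.comp hφ

theorem contDiff_twistedDeriv (hφ : ContDiff ℝ 2 φ) (hg : ContDiff ℝ 2 g) (j : Fin n) :
    ContDiff ℝ 1 (twistedDeriv φ j g) :=
  (contDiff_wderiv hg j).sub
    ((contDiff_wderiv (contDiff_ofReal_comp hφ) j).mul (hg.of_le (by norm_num)))

theorem integral_mul_conj_twistedDeriv (hφ : ContDiff ℝ 1 φ) (hg : ContDiff ℝ 1 g)
    (hh : ContDiff ℝ 1 h) (hs : HasCompactSupport h) (k : Fin n) :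
    ∫ z, g z * conj (twistedDeriv φ k h z) * (Real.exp (-φ z) : ℂ) =
      -∫ z, wderivBar k g z * conj (h z) * (Real.exp (-φ z) : ℂ) := by
  have hW : ContDiff ℝ 1 fun z => (Real.exp (-φ z) : ℂ) := contDiff_ofReal_comp hφ.neg.exp
  have hd := hφ.differentiable (by norm_num)
  have hG : ContDiff ℝ 1 fun z => g z * conj (h z) := hg.mul (contDiff_conj_comp hh)
  have hsc : HasCompactSupport fun z => conj (h z) := hs.comp_left (map_zero _)
  have hzero := integral_wderivBar_eq_zero (hG.mul hW)
    ((hsc.mul_left (f := g)).mul_right (f' := fun z => (Real.exp (-φ z) : ℂ))) k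
  have hpt : ∀ z, wderivBar k (fun z => g z * conj (h z) * (Real.exp (-φ z) : ℂ)) z =
      wderivBar k g z * conj (h z) * (Real.exp (-φ z) : ℂ) +
        g z * conj (twistedDeriv φ k h z) * (Real.exp (-φ z) : ℂ) := by
    intro z
    rw [wderivBar_mul (hG.differentiable (by norm_num) z) (hW.differentiable (by norm_num) z),
      wderivBar_mul (hg.differentiable (by norm_num) z)
        ((contDiff_conj_comp hh).differentiable (by norm_num) z),
      wderivBar_conj (hh.differentiable (by norm_num) z), wderivBar_ofReal_exp_neg hd, twistedDeriv,
      map_sub, map_mul]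
    ring
  have hi1 : Integrable fun z => wderivBar k g z * conj (h z) * (Real.exp (-φ z) : ℂ) :=
    (((continuous_wderivBar hg k).mul (contDiff_conj_comp hh).continuous).mul
      hW.continuous).integrable_of_hasCompactSupport ((hsc.mul_left).mul_right)
  have hst : HasCompactSupport (twistedDeriv φ k h) :=
    HasCompactSupport.of_support_subset_isCompact hs (support_twistedDeriv_subset φ k h)
  have hi2 : Integrable fun z => g z * conj (twistedDeriv φ k h z) * (Real.exp (-φ z) : ℂ) :=
    ((hg.continuous.mul (Complex.continuous_conj.comp (continuous_twistedDeriv hφ hh k))).mul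
      hW.continuous).integrable_of_hasCompactSupport
      (((hst.comp_left (g := conj) (map_zero _)).mul_left).mul_right)
  simp_rw [hpt] at hzero
  rw [integral_add hi1 hi2] at hzero
  linear_combination hzero

theorem integral_twistedDeriv_mul_conj (hφ : ContDiff ℝ 1 φ) (hg : ContDiff ℝ 1 g)
    (hs : HasCompactSupport g) (hh : ContDiff ℝ 1 h) (j : Fin n) :
    ∫ z, twistedDeriv φ j g z * conj (h z) * (Real.exp (-φ z) : ℂ) =
      -∫ z, g z * conj (wderivBar j h z) * (Real.exp (-φ z) : ℂ) := by
  have h1 := congrArg conj (integral_mul_conj_twistedDeriv hφ hh hg hs j)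
  rw [map_neg, ← integral_conj, ← integral_conj] at h1
  simp only [map_mul, Complex.conj_conj, Complex.conj_ofReal] at h1
  simp_rw [mul_comm (conj (h _)), mul_comm (conj (wderivBar j h _))] at h1
  exact h1

theorem wderivBar_twistedDeriv (hφ : ContDiff ℝ 2 φ) (hg : ContDiff ℝ 2 g) (j k : Fin n)
    (z : Fin n → ℂ) : wderivBar k (twistedDeriv φ j g) z =
      twistedDeriv φ j (wderivBar k g) z -
        wderiv j (wderivBar k fun u => (φ u : ℂ)) z * g z := by
  have h1 := (contDiff_wderiv (contDiff_ofReal_comp hφ) j).differentiable (by norm_num) z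
  have h2 := hg.differentiable (by norm_num) z
  unfold twistedDeriv
  rw [wderivBar_sub ((contDiff_wderiv hg j).differentiable (by norm_num) z) (h1.fun_mul h2),
    wderivBar_mul h1 h2, ← wderiv_wderivBar hg.contDiffAt,
    ← wderiv_wderivBar (contDiff_ofReal_comp hφ).contDiffAt]
  ring

theorem integral_twistedDeriv_mul_conj_twistedDeriv (hφ : ContDiff ℝ 2 φ) (hg : ContDiff ℝ 2 g)
    (hgs : HasCompactSupport g) (hh : ContDiff ℝ 2 h) (hhs : HasCompactSupport h) (j k : Fin n) :
    ∫ z, twistedDeriv φ j g z * conj (twistedDeriv φ k h z) * (Real.exp (-φ z) : ℂ) =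
      (∫ z, wderiv j (wderivBar k fun u => (φ u : ℂ)) z * g z * conj (h z) *
        (Real.exp (-φ z) : ℂ)) +
      ∫ z, wderivBar k g z * conj (wderivBar j h z) * (Real.exp (-φ z) : ℂ) := by
  have hφ1 : ContDiff ℝ 1 φ := hφ.of_le (by norm_num)
  have hg1 : ContDiff ℝ 1 g := hg.of_le (by norm_num)
  have hh1 : ContDiff ℝ 1 h := hh.of_le (by norm_num)
  have hWc : Continuous fun z => (Real.exp (-φ z) : ℂ) := continuous_ofReal_exp_neg hφ.continuous
  have hsc : HasCompactSupport fun z => conj (h z) := hhs.comp_left (map_zero _)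
  have hLc : Continuous (wderiv j (wderivBar k fun u => (φ u : ℂ))) :=
    continuous_wderiv (contDiff_wderivBar (contDiff_ofReal_comp hφ) k) j
  have hhc : Continuous fun z => conj (h z) := (contDiff_conj_comp hh).continuous
  have hi1 : Integrable fun z => twistedDeriv φ j (wderivBar k g) z * conj (h z) *
      (Real.exp (-φ z) : ℂ) :=
    (((continuous_twistedDeriv hφ1 (contDiff_wderivBar hg k) j).mul hhc).mul
      hWc).integrable_of_hasCompactSupport ((hsc.mul_left).mul_right)
  have hi2 : Integrable fun z => wderiv j (wderivBar k fun u => (φ u : ℂ)) z * g z * conj (h z) *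
      (Real.exp (-φ z) : ℂ) :=
    (((hLc.mul hg.continuous).mul hhc).mul
      hWc).integrable_of_hasCompactSupport ((hsc.mul_left).mul_right)
  rw [integral_mul_conj_twistedDeriv hφ1 (contDiff_twistedDeriv hφ hg j) hh1 hhs k]
  have h1 : ∀ z, wderivBar k (twistedDeriv φ j g) z * conj (h z) * (Real.exp (-φ z) : ℂ) =
      twistedDeriv φ j (wderivBar k g) z * conj (h z) * (Real.exp (-φ z) : ℂ) -
        wderiv j (wderivBar k fun u => (φ u : ℂ)) z * g z * conj (h z) *
          (Real.exp (-φ z) : ℂ) := by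
    intro z
    rw [wderivBar_twistedDeriv hφ hg]
    ring
  simp_rw [h1]
  rw [integral_sub hi1 hi2,
    integral_twistedDeriv_mul_conj hφ1 (contDiff_wderivBar hg k) (hgs.wderivBar k) hh1 j]
  ring

theorem neg_half_sum_norm_sub_sq_le (a : Fin n → Fin n → ℂ) :
    -((∑ j, ∑ k, ‖a j k - a k j‖ ^ 2) / 2) ≤ (∑ j, ∑ k, a k j * conj (a j k)).re := by
  have h1 : ∀ j k, ‖a j k - a k j‖ ^ 2 =
      ‖a j k‖ ^ 2 + ‖a k j‖ ^ 2 - 2 * (a k j * conj (a j k)).re := by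
    intro j k
    simp only [← Complex.normSq_eq_norm_sq, Complex.normSq_sub, mul_comm (a k j)]
    rw [← Complex.conj_re (a j k * _)]
    simp [mul_comm]
  simp_rw [h1, Finset.sum_sub_distrib, Finset.sum_add_distrib]
  simp only [Complex.re_sum, ← Finset.mul_sum]
  have h2 : 0 ≤ ∑ j, ∑ k, ‖a j k‖ ^ 2 := by positivity
  have h3 : 0 ≤ ∑ j, ∑ k, ‖a k j‖ ^ 2 := by positivity
  linarith

theorem sum_sum_mul_conj (a : Fin n → ℂ) :
    ∑ j, ∑ k, a j * conj (a k) = ((‖∑ j, a j‖ ^ 2 : ℝ) : ℂ) := by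
  rw [← Complex.normSq_eq_norm_sq, ← Complex.mul_conj, map_sum, Finset.sum_mul_sum]

/-- Hörmander's basic estimate for compactly supported `(0,1)`-forms, with three weights. -/
theorem basic_estimate (hφ : ContDiff ℝ 2 φ) (hψ : ContDiff ℝ 1 ψ)
    {f : Fin n → (Fin n → ℂ) → ℂ} (hf : ∀ j, ContDiff ℝ 2 (f j))
    (hfs : ∀ j, HasCompactSupport (f j))
    (hlevi : ∀ z, (∃ j, f j z ≠ 0) → ∀ ξ, 2 * ‖∑ j, wderiv j (fun u => (ψ u : ℂ)) z * ξ j‖ ^ 2 +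
      2 * Real.exp (ψ z) * nsq ξ ≤ leviForm φ z ξ) :
    ∫ z, 2 * Real.exp (ψ z) * nsq (fun j => f j z) * Real.exp (-φ z) ≤
      (∫ z, 2 * ‖∑ j, (twistedDeriv φ j (f j) z +
        wderiv j (fun u => (ψ u : ℂ)) z * f j z)‖ ^ 2 * Real.exp (-φ z)) +
      ∫ z, (∑ j, ∑ k, ‖wderivBar j (f k) z - wderivBar k (f j) z‖ ^ 2) / 2 *
        Real.exp (-φ z) := by
  have hφ1 : ContDiff ℝ 1 φ := hφ.of_le (by norm_num)
  have hf1 : ∀ j, ContDiff ℝ 1 (f j) := fun j => (hf j).of_le (by norm_num)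
  have hWc : Continuous fun z => (Real.exp (-φ z) : ℂ) := continuous_ofReal_exp_neg hφ.continuous
  have hWr : Continuous fun z => Real.exp (-φ z) := Real.continuous_exp.comp hφ.continuous.neg
  set S : Set (Fin n → ℂ) := ⋃ j, tsupport (f j)
  have hS : IsCompact S := isCompact_iUnion fun j => hfs j
  have hf0 : ∀ z ∉ S, ∀ j, f j z = 0 := fun z hz j =>
    image_eq_zero_of_notMem_tsupport fun h => hz (mem_iUnion.2 ⟨j, h⟩)
  have ht0 : ∀ z ∉ S, ∀ j, twistedDeriv φ j (f j) z = 0 := fun z hz j => by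
    by_contra h
    exact hz (mem_iUnion.2 ⟨j, support_twistedDeriv_subset φ j (f j) h⟩)
  have hb0 : ∀ z ∉ S, ∀ j k, wderivBar j (f k) z = 0 := fun z hz j k => by
    by_contra h
    exact hz (mem_iUnion.2 ⟨k, tsupport_wderivBar_subset (f k) j (subset_tsupport _ h)⟩)
  have hcs : ∀ {F : Type} [NormedAddCommGroup F] {G : (Fin n → ℂ) → F}, (∀ z ∉ S, G z = 0) →
      HasCompactSupport G := fun {F} _ {G} h0 => HasCompactSupport.intro hS h0
  have hbc : ∀ j k, Continuous (wderivBar j (f k)) := fun j k => continuous_wderivBar (hf1 k) j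
  have htc : ∀ j, Continuous (twistedDeriv φ j (f j)) :=
    fun j => continuous_twistedDeriv hφ1 (hf1 j) j
  have hpc : ∀ j, Continuous (wderiv j fun u => (ψ u : ℂ)) :=
    fun j => continuous_wderiv (contDiff_ofReal_comp hψ) j
  have hfc : ∀ j, Continuous (f j) := fun j => (hf j).continuous
  have hLc : ∀ j k, Continuous (wderiv j (wderivBar k fun u => (φ u : ℂ))) := fun j k =>
    continuous_wderiv (contDiff_wderivBar (contDiff_ofReal_comp hφ) k) j
  have hcc : Continuous (starRingEnd ℂ) := Complex.continuous_conj
  have hnc : Continuous fun z => nsq (fun j => f j z) :=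
    (contDiff_nsq (m := 0)).continuous.comp (continuous_pi hfc)
  have hec : Continuous fun z => Real.exp (ψ z) := Real.continuous_exp.comp hψ.continuous
  have hX : ∀ j k, Integrable fun z => twistedDeriv φ j (f j) z *
      conj (twistedDeriv φ k (f k) z) * (Real.exp (-φ z) : ℂ) := fun j k =>
    (((htc j).mul (hcc.comp (htc k))).mul hWc).integrable_of_hasCompactSupport
      (hcs fun z hz => by simp [ht0 z hz])
  have hY : ∀ j k, Integrable fun z => wderiv j (wderivBar k fun u => (φ u : ℂ)) z * f j z *
      conj (f k z) * (Real.exp (-φ z) : ℂ) := fun j k =>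
    ((((hLc j k).mul (hfc j)).mul (hcc.comp (hfc k))).mul hWc).integrable_of_hasCompactSupport
      (hcs fun z hz => by simp [hf0 z hz])
  have hZ : ∀ j k, Integrable fun z => wderivBar k (f j) z * conj (wderivBar j (f k) z) *
      (Real.exp (-φ z) : ℂ) := fun j k =>
    (((hbc k j).mul (hcc.comp (hbc j k))).mul hWc).integrable_of_hasCompactSupport
      (hcs fun z hz => by simp [hb0 z hz])
  set T : Fin n → Fin n → (Fin n → ℂ) → ℂ := fun j k z =>
    wderiv j (wderivBar k fun u => (φ u : ℂ)) z * f j z * conj (f k z) * (Real.exp (-φ z) : ℂ) +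
      wderivBar k (f j) z * conj (wderivBar j (f k) z) * (Real.exp (-φ z) : ℂ) -
      twistedDeriv φ j (f j) z * conj (twistedDeriv φ k (f k) z) * (Real.exp (-φ z) : ℂ) with hT
  have hTi : ∀ j k, Integrable (T j k) := fun j k => ((hY j k).add (hZ j k)).sub (hX j k)
  have hTi' : ∀ j, Integrable fun z => ∑ k, T j k z := fun j =>
    integrable_finsetSum _ fun k _ => hTi j k
  have hI0 : Integrable fun z => ∑ j, ∑ k, T j k z := integrable_finsetSum _ fun j _ => hTi' j
  have hXYZ : ∫ z, ∑ j, ∑ k, T j k z = 0 := by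
    rw [integral_finsetSum _ fun j _ => hTi' j]
    refine Finset.sum_eq_zero fun j _ => ?_
    rw [integral_finsetSum _ fun k _ => hTi j k]
    refine Finset.sum_eq_zero fun k _ => ?_
    have h1 := integral_sub ((hY j k).add (hZ j k)) (hX j k)
    have h2 := integral_add (hY j k) (hZ j k)
    have h3 := integral_twistedDeriv_mul_conj_twistedDeriv hφ (hf j) (hfs j) (hf k) (hfs k) j k
    simp only [Pi.add_apply] at h1 h2
    rw [hT, h1, h2, h3, sub_self]
  have hre : ∫ z, (∑ j, ∑ k, T j k z).re = 0 := by
    have h1 := integral_re hI0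
    simp only [RCLike.re_eq_complex_re] at h1
    rw [h1, hXYZ, Complex.zero_re]
  have hI1 : Integrable fun z => 2 * Real.exp (ψ z) * nsq (fun j => f j z) * Real.exp (-φ z) :=
    (((continuous_const.mul hec).mul hnc).mul hWr).integrable_of_hasCompactSupport
      (hcs fun z hz => by simp [hf0 z hz, nsq])
  have hI2 : Integrable fun z => 2 * ‖∑ j, (twistedDeriv φ j (f j) z +
        wderiv j (fun u => (ψ u : ℂ)) z * f j z)‖ ^ 2 * Real.exp (-φ z) :=
    ((continuous_const.mul ((continuous_finsetSum _ fun j _ =>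
      (htc j).add ((hpc j).mul (hfc j))).norm.pow 2)).mul hWr).integrable_of_hasCompactSupport
      (hcs fun z hz => by simp [hf0 z hz, ht0 z hz])
  have hI3 : Integrable fun z => (∑ j, ∑ k, ‖wderivBar j (f k) z - wderivBar k (f j) z‖ ^ 2) / 2 *
        Real.exp (-φ z) :=
    (((continuous_finsetSum _ fun j _ => continuous_finsetSum _ fun k _ =>
      ((hbc j k).sub (hbc k j)).norm.pow 2).div_const 2).mul hWr).integrable_of_hasCompactSupport
      (hcs fun z hz => by simp [hb0 z hz])
  have hsub := integral_sub hI1 (hI2.add hI3)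
  simp only [Pi.add_apply] at hsub
  rw [← integral_add hI2 hI3, ← sub_nonpos, ← hsub, ← hre]
  refine integral_mono (hI1.sub (hI2.add hI3)) hI0.re fun z => ?_
  have hW0 : 0 ≤ Real.exp (-φ z) := (Real.exp_pos _).le
  have hsum : ∑ j, ∑ k, T j k z =
      (((leviForm φ z fun j => f j z : ℝ) : ℂ) +
        ∑ j, ∑ k, wderivBar k (f j) z * conj (wderivBar j (f k) z) -
        ((‖∑ j, twistedDeriv φ j (f j) z‖ ^ 2 : ℝ) : ℂ)) * (Real.exp (-φ z) : ℂ) := by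
    rw [← sum_levi_eq hφ.contDiffAt, ← sum_sum_mul_conj, sub_mul, add_mul]
    simp only [hT, Finset.sum_mul, Finset.sum_sub_distrib, Finset.sum_add_distrib]
  beta_reduce
  rw [hsum, Complex.re_mul_ofReal, Complex.sub_re, Complex.add_re, Complex.ofReal_re,
    Complex.ofReal_re, ← add_mul, ← sub_mul]
  refine mul_le_mul_of_nonneg_right ?_ hW0
  have h3 := neg_half_sum_norm_sub_sq_le fun j k => wderivBar j (f k) z
  have hA : ‖∑ j, twistedDeriv φ j (f j) z‖ ^ 2 ≤ 2 * ‖∑ j, (twistedDeriv φ j (f j) z +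
        wderiv j (fun u => (ψ u : ℂ)) z * f j z)‖ ^ 2 +
        2 * ‖∑ j, wderiv j (fun u => (ψ u : ℂ)) z * f j z‖ ^ 2 := by
    rw [Finset.sum_add_distrib]
    set a := ∑ j, twistedDeriv φ j (f j) z
    set b := ∑ j, wderiv j (fun u => (ψ u : ℂ)) z * f j z
    have h4 : ‖a‖ ≤ ‖a + b‖ + ‖b‖ := by simpa using norm_sub_le (a + b) b
    nlinarith [norm_nonneg a, sq_nonneg (‖a + b‖ - ‖b‖)]
  have hl : 2 * ‖∑ j, wderiv j (fun u => (ψ u : ℂ)) z * f j z‖ ^ 2 +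
      2 * Real.exp (ψ z) * nsq (fun j => f j z) ≤ leviForm φ z fun j => f j z := by
    by_cases hz : ∃ j, f j z ≠ 0
    · exact hlevi z hz _
    · push Not at hz
      simp [hz, nsq, leviForm]
  linarith

end BasicEstimate

section WeakEstimate

open scoped ContDiff

variable {n : ℕ}

theorem integral_norm_sq_eq_norm_toLp {α : Type*} [MeasurableSpace α] {μ : Measure α} {f : α → ℂ}
    (hf : MemLp f 2 μ) : ∫ z, ‖f z‖ ^ 2 ∂μ = ‖hf.toLp f‖ ^ 2 := by
  have h := @L2.inner_def α ℂ ℂ _ _ μ _ _ (hf.toLp f) (hf.toLp f)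
  rw [inner_self_eq_norm_sq_to_K] at h
  have h2 : ∫ z, (inner ℂ (hf.toLp f z) (hf.toLp f z) : ℂ) ∂μ = ∫ z, ((‖f z‖ ^ 2 : ℝ) : ℂ) ∂μ := by
    refine integral_congr_ae (hf.coeFn_toLp.mono fun z hz => ?_)
    simp only [hz, inner_self_eq_norm_sq_to_K]
    simp
  rw [h2, integral_complex_ofReal] at h
  exact Complex.ofReal_injective (h.symm.trans (Complex.ofReal_pow _ _).symm)

theorem MemLp.bounded_mul {α : Type*} [MeasurableSpace α] {μ : Measure α} {f c : α → ℂ}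
    (hf : MemLp f 2 μ) (hc : AEStronglyMeasurable c μ) {C : ℝ} (hC : ∀ z, ‖c z‖ ≤ C) :
    MemLp (fun z => c z * f z) 2 μ :=
  hf.of_le_mul (hc.mul hf.1) (Eventually.of_forall fun z => by
    rw [norm_mul]; exact mul_le_mul_of_nonneg_right (hC z) (norm_nonneg _))

theorem integrable_mul_norm_sq {α : Type*} [MeasurableSpace α] {μ : Measure α} {f : α → ℂ}
    {w : α → ℝ} (hf : MemLp f 2 μ) (hw : AEStronglyMeasurable w μ) {C : ℝ} (hC : ∀ z, |w z| ≤ C) :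
    Integrable (fun z => w z * ‖f z‖ ^ 2) μ := by
  have h : Integrable (fun z => ‖f z‖ ^ 2) μ := hf.norm.integrable_sq
  exact h.bdd_mul hw (Eventually.of_forall hC)

theorem tendsto_eLpNorm_bounded_mul {α : Type*} [MeasurableSpace α] {μ : Measure α}
    {c : α → ℂ} {C : ℝ} (hC : ∀ z, ‖c z‖ ≤ C) {g : ℕ → α → ℂ} {g0 : α → ℂ}
    (h : Tendsto (fun m => eLpNorm (g m - g0) 2 μ) atTop (𝓝 0)) :
    Tendsto (fun m => eLpNorm ((fun z => c z * g m z) - fun z => c z * g0 z) 2 μ) atTop (𝓝 0) := by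
  have h1 : Tendsto (fun m => ENNReal.ofReal C * eLpNorm (g m - g0) 2 μ) atTop (𝓝 0) := by
    simpa using ENNReal.Tendsto.const_mul h (Or.inr ENNReal.ofReal_ne_top)
  refine tendsto_of_tendsto_of_tendsto_of_le_of_le tendsto_const_nhds h1 (fun _ => zero_le)
    fun m => eLpNorm_le_mul_eLpNorm_of_ae_le_mul (Eventually.of_forall fun z => ?_) 2
  simp only [Pi.sub_apply, ← mul_sub, norm_mul]
  exact mul_le_mul_of_nonneg_right (hC z) (norm_nonneg _)

theorem tendsto_integral_mul_norm_sq {α : Type*} [MeasurableSpace α] {μ : Measure α}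
    {w : α → ℝ} (hw : Measurable w) (h0 : ∀ z, 0 ≤ w z) {C : ℝ} (hC : ∀ z, w z ≤ C)
    {g : ℕ → α → ℂ} {g0 : α → ℂ} (hg : ∀ m, MemLp (g m) 2 μ) (hg0 : MemLp g0 2 μ)
    (h : Tendsto (fun m => eLpNorm (g m - g0) 2 μ) atTop (𝓝 0)) :
    Tendsto (fun m => ∫ z, w z * ‖g m z‖ ^ 2 ∂μ) atTop (𝓝 (∫ z, w z * ‖g0 z‖ ^ 2 ∂μ)) := by
  have hcm : AEStronglyMeasurable (fun z => (√(w z) : ℂ)) μ := by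
    have : Measurable (fun z => (√(w z) : ℂ)) := by fun_prop
    exact this.aestronglyMeasurable
  have hcC : ∀ z, ‖(√(w z) : ℂ)‖ ≤ √C := fun z => by
    rw [Complex.norm_real, Real.norm_of_nonneg (Real.sqrt_nonneg _)]
    exact Real.sqrt_le_sqrt (hC z)
  have key : ∀ f : α → ℂ, ∀ hf : MemLp f 2 μ, ∫ z, w z * ‖f z‖ ^ 2 ∂μ =
      ‖(MemLp.bounded_mul hf hcm hcC).toLp _‖ ^ 2 := by
    intro f hf
    rw [← integral_norm_sq_eq_norm_toLp]
    refine integral_congr_ae (Eventually.of_forall fun z => ?_)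
    simp only [norm_mul, mul_pow, Complex.norm_real, Real.norm_of_nonneg (Real.sqrt_nonneg _),
      Real.sq_sqrt (h0 z)]
  simp only [fun m => key _ (hg m), key _ hg0]
  refine ((continuous_norm.tendsto _).comp ?_).pow 2
  rw [Lp.tendsto_Lp_iff_tendsto_eLpNorm'']
  exact tendsto_eLpNorm_bounded_mul hcC h

theorem eq_zero_of_mollify_ne {ε : ℝ} {κ : (Fin n → ℂ) → ℝ} (h : IsMollifier ε κ)
    {u : (Fin n → ℂ) → ℂ} {K : Set (Fin n → ℂ)} (hu : ∀ z ∉ K, u z = 0) {z : Fin n → ℂ}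
    (hz : mollify κ u z ≠ 0) : z ∈ cthickening ε K := by
  by_contra hK
  apply hz
  rw [mollify_apply']
  refine integral_eq_zero_of_ae (Eventually.of_forall fun y => ?_)
  by_cases hy : y ∈ K
  · have : κ (z - y) = 0 := by
      by_contra hne
      apply hK
      refine mem_cthickening_of_dist_le z y ε K hy ?_
      rw [dist_eq_norm]
      exact h.supp _ hne
    simp [this]
  · simp [hu y hy]

theorem hasCompactSupport_mollify {ε : ℝ} {κ : (Fin n → ℂ) → ℝ} (h : IsMollifier ε κ)
    {u : (Fin n → ℂ) → ℂ} {K : Set (Fin n → ℂ)} (hK : IsCompact K) (hu : ∀ z ∉ K, u z = 0) :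
    HasCompactSupport (mollify κ u) :=
  HasCompactSupport.of_support_subset_isCompact hK.cthickening
    fun _ hz => eq_zero_of_mollify_ne h hu hz

theorem IsMollifier.hasCompactSupport_comp_sub {ε : ℝ} {κ : (Fin n → ℂ) → ℝ}
    (h : IsMollifier ε κ) (z : Fin n → ℂ) : HasCompactSupport (fun y => (κ (z - y) : ℂ)) :=
  HasCompactSupport.of_support_subset_isCompact (isCompact_closedBall z ε)
    (subset_closure.trans (h.tsupport_comp_sub_subset z))

theorem integral_const_mul_sum_norm_sq {α : Type*} [MeasurableSpace α] {μ : Measure α} {ι : Type*}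
    (s : Finset ι) {f : ι → α → ℂ} {w : α → ℝ} (hf : ∀ i, MemLp (f i) 2 μ)
    (hw : AEStronglyMeasurable w μ) {C : ℝ} (hC : ∀ z, |w z| ≤ C) :
    ∫ z, w z * ∑ i ∈ s, ‖f i z‖ ^ 2 ∂μ = ∑ i ∈ s, ∫ z, w z * ‖f i z‖ ^ 2 ∂μ := by
  simp only [Finset.mul_sum]
  exact integral_finsetSum _ fun i _ => integrable_mul_norm_sq (hf i) hw hC

theorem weak_basic_estimate {φ ψ : (Fin n → ℂ) → ℝ} (hφ : ContDiff ℝ 2 φ) (hψ : ContDiff ℝ 2 ψ)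
    (hφs : HasCompactSupport φ) (hψs : HasCompactSupport ψ) {U K : Set (Fin n → ℂ)}
    (hU : IsOpen U) (hK : IsCompact K) (hKU : K ⊆ U)
    (hlevi : ∀ z ∈ U, ∀ ξ, 2 * ‖∑ j, wderiv j (fun u => (ψ u : ℂ)) z * ξ j‖ ^ 2 +
      2 * Real.exp (ψ z) * nsq ξ ≤ leviForm φ z ξ)
    {F : Fin n → (Fin n → ℂ) → ℂ} {A : (Fin n → ℂ) → ℂ} {B : Fin n → Fin n → (Fin n → ℂ) → ℂ}
    (hF : ∀ j, MemLp (F j) 2 volume) (hA : MemLp A 2 volume) (hB : ∀ j k, MemLp (B j k) 2 volume)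
    (hFK : ∀ j, ∀ z ∉ K, F j z = 0) (hAK : ∀ z ∉ K, A z = 0) (hBK : ∀ j k, ∀ z ∉ K, B j k z = 0)
    (hdiv : ∀ χ : (Fin n → ℂ) → ℂ, ContDiff ℝ 2 χ → HasCompactSupport χ →
      ∑ j, ∫ y, F j y * wderiv j χ y = -∫ y, A y * χ y)
    (hcurl : ∀ j k, ∀ χ : (Fin n → ℂ) → ℂ, ContDiff ℝ 2 χ → HasCompactSupport χ →
      (∫ y, F k y * wderivBar j χ y) - ∫ y, F j y * wderivBar k χ y = -∫ y, B j k y * χ y) :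
    ∫ z, 2 * Real.exp (ψ z) * Real.exp (-φ z) * ∑ j, ‖F j z‖ ^ 2 ≤
      (∫ z, 2 * Real.exp (-φ z) * ‖A z - ∑ j, (wderiv j (fun u => (φ u : ℂ)) z -
        wderiv j (fun u => (ψ u : ℂ)) z) * F j z‖ ^ 2) +
      ∑ j, ∑ k, ∫ z, 1 / 2 * Real.exp (-φ z) * ‖B j k z‖ ^ 2 := by
  obtain ⟨ε₀, hε₀, hεU⟩ := hK.exists_cthickening_subset_open hU hKU
  have hε : ∀ m : ℕ, 0 < ε₀ / (m + 1) := fun m => by positivity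
  choose κ hκ using fun m => exists_isMollifier (n := n) (hε m)
  have hεt : Tendsto (fun m : ℕ => ε₀ / ((m : ℝ) + 1)) atTop (𝓝 0) := by
    simpa using (tendsto_one_div_add_atTop_nhds_zero_nat (𝕜 := ℝ)).const_mul ε₀ |>.congr
      fun m => by ring
  have hle : ∀ m : ℕ, ε₀ / ((m : ℝ) + 1) ≤ ε₀ := fun m =>
    div_le_self hε₀.le (by linarith [Nat.cast_nonneg (α := ℝ) m])
  have hmem : ∀ u : (Fin n → ℂ) → ℂ, MemLp u 2 volume → (∀ z ∉ K, u z = 0) →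
      ∀ m, MemLp (mollify (κ m) u) 2 volume := fun u hu huK m =>
    ((hκ m).contDiff_mollify (hu.locallyIntegrable (by
        norm_num))).continuous.memLp_of_hasCompactSupport
      (hasCompactSupport_mollify (hκ m) hK huK)
  have hlim : ∀ u : (Fin n → ℂ) → ℂ, MemLp u 2 volume →
      Tendsto (fun m => eLpNorm (mollify (κ m) u - u) 2 volume) atTop (𝓝 0) :=
    fun u hu => tendsto_mollify hu hεt hκ
  have hFl : ∀ j, LocallyIntegrable (F j) := fun j => (hF j).locallyIntegrable (by norm_num)
  obtain ⟨Cφ, hCφ⟩ := hφs.exists_bound_of_continuous hφ.continuous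
  obtain ⟨Cψ, hCψ⟩ := hψs.exists_bound_of_continuous hψ.continuous
  have hφ1 : ContDiff ℝ 1 φ := hφ.of_le (by norm_num)
  have hψ1 : ContDiff ℝ 1 ψ := hψ.of_le (by norm_num)
  set c : Fin n → (Fin n → ℂ) → ℂ := fun j z => wderiv j (fun u => (φ u : ℂ)) z -
        wderiv j (fun u => (ψ u : ℂ)) z with hc
  have hcc : ∀ j, Continuous (c j) := fun j =>
    (continuous_wderiv (contDiff_ofReal_comp hφ1) j).sub
      (continuous_wderiv (contDiff_ofReal_comp hψ1) j)
  have hcb : ∀ j, ∃ C, ∀ z, ‖c j z‖ ≤ C := fun j => by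
    have h1 : HasCompactSupport (fun u => (φ u : ℂ)) := hφs.comp_left (g :=
        fun t : ℝ => (t : ℂ)) rfl
    have h2 : HasCompactSupport (fun u => (ψ u : ℂ)) := hψs.comp_left (g :=
        fun t : ℝ => (t : ℂ)) rfl
    exact ((h1.wderiv j).sub (h2.wderiv j)).exists_bound_of_continuous (hcc j)
  choose Cc hCc using hcb
  have hexp : ∀ z, Real.exp (-φ z) ≤ Real.exp Cφ := fun z =>
    Real.exp_le_exp.2 ((neg_le_abs _).trans (hCφ z))
  have hexp' : ∀ z, Real.exp (ψ z) ≤ Real.exp Cψ := fun z =>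
    Real.exp_le_exp.2 ((le_abs_self _).trans (hCψ z))
  have hφc := hφ.continuous
  have hψc := hψ.continuous
  have hw1 : ∀ z, |2 * Real.exp (ψ z) * Real.exp (-φ z)| ≤ 2 * Real.exp Cψ * Real.exp Cφ :=
      fun z => by
    rw [abs_of_nonneg (by positivity)]
    have := hexp z; have := hexp' z
    gcongr
  have hw2 : ∀ z, |2 * Real.exp (-φ z)| ≤ 2 * Real.exp Cφ := fun z => by
    rw [abs_of_nonneg (by positivity)]; have := hexp z; gcongr
  have hw3 : ∀ z, |1 / 2 * Real.exp (-φ z)| ≤ 1 / 2 * Real.exp Cφ := fun z => by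
    rw [abs_of_nonneg (by positivity)]; have := hexp z; gcongr
  have hm1 : Continuous fun z => 2 * Real.exp (ψ z) * Real.exp (-φ z) := by fun_prop
  have hm2 : Continuous fun z => 2 * Real.exp (-φ z) := by fun_prop
  have hm3 : Continuous fun z => 1 / 2 * Real.exp (-φ z) := by fun_prop
  set f : ℕ → Fin n → (Fin n → ℂ) → ℂ := fun m j => mollify (κ m) (F j) with hf
  have hfdiff : ∀ m j, ContDiff ℝ 2 (f m j) := fun m j =>
    ((hκ m).contDiff_mollify (hFl j)).of_le (by norm_cast)
  have hdiv' : ∀ m z, ∑ j, wderiv j (f m j) z = mollify (κ m) A z := fun m z => by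
    have := hdiv _ (((hκ m).contDiff_comp_sub z).of_le (by norm_cast))
      ((hκ m).hasCompactSupport_comp_sub z)
    simp only [hf, wderiv_mollify (hκ m) (hFl _)]
    rw [Finset.sum_neg_distrib, this, neg_neg, mollify_apply']
    exact integral_congr_ae (Eventually.of_forall fun y => by simp [mul_comm])
  have hcurl' : ∀ m j k z, wderivBar j (f m k) z - wderivBar k (f m j) z =
      mollify (κ m) (B j k) z :=
    fun m j k z => by
    have := hcurl j k _ (((hκ m).contDiff_comp_sub z).of_le (by norm_cast))
      ((hκ m).hasCompactSupport_comp_sub z)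
    simp only [hf, wderivBar_mollify (hκ m) (hFl _)]
    rw [neg_sub_neg, ← neg_sub, this, neg_neg, mollify_apply']
    exact integral_congr_ae (Eventually.of_forall fun y => by simp [mul_comm])
  have hest : ∀ m, ∑ j, ∫ z, 2 * Real.exp (ψ z) * Real.exp (-φ z) * ‖f m j z‖ ^ 2 ≤
      (∫ z, 2 * Real.exp (-φ z) * ‖mollify (κ m) A z - ∑ j, c j z * f m j z‖ ^ 2) +
      ∑ j, ∑ k, ∫ z, 1 / 2 * Real.exp (-φ z) * ‖mollify (κ m) (B j k) z‖ ^ 2 := fun m => by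
    have h := basic_estimate hφ hψ1 (hfdiff m)
      (fun j => hasCompactSupport_mollify (hκ m) hK (hFK j)) (fun z hz ξ => by
        obtain ⟨j, hj⟩ := hz
        exact hlevi z (hεU (cthickening_mono (hle m) _
          (eq_zero_of_mollify_ne (hκ m) (hFK j) hj))) ξ)
    rw [← integral_const_mul_sum_norm_sq _ (fun j => hmem _ (hF j) (hFK j) m)
      hm1.aestronglyMeasurable hw1]
    have e3 : ∀ j, ∑ k, ∫ z, 1 / 2 * Real.exp (-φ z) * ‖mollify (κ m) (B j k) z‖ ^ 2 =
        ∫ z, 1 / 2 * Real.exp (-φ z) * ∑ k, ‖mollify (κ m) (B j k) z‖ ^ 2 := fun j =>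
      (integral_const_mul_sum_norm_sq _ (fun k => hmem _ (hB j k) (hBK j k) m)
        hm3.aestronglyMeasurable hw3).symm
    rw [Finset.sum_congr rfl fun j _ => e3 j, ← integral_finsetSum _ fun j _ => by
      simp only [Finset.mul_sum]
      exact integrable_finsetSum _ fun k _ => integrable_mul_norm_sq (hmem _ (hB j k) (hBK j k) m)
        hm3.aestronglyMeasurable hw3]
    refine (le_of_eq (integral_congr_ae (Eventually.of_forall fun z => ?_))).trans (h.trans
      (le_of_eq (congr_arg₂ _ (integral_congr_ae (Eventually.of_forall fun z => ?_))
        (integral_congr_ae (Eventually.of_forall fun z => ?_)))))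
    · simp only [nsq, hf]; ring
    · have : ∑ j, (twistedDeriv φ j (f m j) z + wderiv j (fun u => (ψ u : ℂ)) z * f m j z) =
          mollify (κ m) A z - ∑ j, c j z * f m j z := by
        rw [← hdiv', ← Finset.sum_sub_distrib]
        refine Finset.sum_congr rfl fun j _ => ?_
        simp only [twistedDeriv, hc]; ring
      simp only [this]; ring
    · simp only [hcurl', ← Finset.mul_sum]; ring
  rw [integral_const_mul_sum_norm_sq _ hF hm1.aestronglyMeasurable hw1]
  refine le_of_tendsto_of_tendsto' (b := atTop) ?_
    (Tendsto.add ?_ (tendsto_finsetSum _ fun j _ => tendsto_finsetSum _ fun k _ => ?_)) hest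
  · refine tendsto_finsetSum _ fun j _ => ?_
    exact tendsto_integral_mul_norm_sq hm1.measurable (fun z => by positivity)
      (fun z => (le_abs_self _).trans (hw1 z)) (hmem _ (hF j) (hFK j)) (hF j) (hlim _ (hF j))
  · have hcF : ∀ (g : Fin n → (Fin n → ℂ) → ℂ), (∀ j, MemLp (g j) 2 volume) →
        MemLp (fun z => ∑ j, c j z * g j z) 2 volume := fun g hg =>
      memLp_finsetSum _ fun j _ => MemLp.bounded_mul (hg j) (hcc j).aestronglyMeasurable (hCc j)
    refine tendsto_integral_mul_norm_sq hm2.measurable (fun z => by positivity)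
      (fun z => (le_abs_self _).trans (hw2 z))
      (fun m => (hmem _ hA hAK m).sub (hcF _ fun j =>
          hmem _ (hF j) (hFK j) m)) (hA.sub (hcF _ hF)) ?_
    have hb : Tendsto (fun m => eLpNorm (mollify (κ m) A - A) 2 volume +
        ∑ j, eLpNorm ((fun z => c j z * f m j z) - fun z => c j z * F j z) 2 volume)
        atTop (𝓝 0) := by
      have := (hlim A hA).add (tendsto_finsetSum Finset.univ fun j _ =>
        tendsto_eLpNorm_bounded_mul (hCc j) (hlim _ (hF j)))
      simpa using this
    refine tendsto_of_tendsto_of_tendsto_of_le_of_le tendsto_const_nhds hb (fun _ => zero_le)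
      fun m => ?_
    have hmeas : ∀ j, AEStronglyMeasurable ((fun z => c j z * f m j z) - fun z => c j z * F j z)
        volume := fun j =>
      ((MemLp.bounded_mul (hmem _ (hF j) (hFK j) m) (hcc j).aestronglyMeasurable (hCc j)).sub
        (MemLp.bounded_mul (hF j) (hcc j).aestronglyMeasurable (hCc j))).1
    refine le_trans ?_ (add_le_add_right (eLpNorm_sum_le (fun j _ => hmeas j) (by norm_num)) _)
    refine le_trans (le_of_eq ?_) (eLpNorm_sub_le ((hmem _ hA hAK m).sub hA).1
      (Finset.aestronglyMeasurable_sum _ fun j _ => hmeas j) (by norm_num))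
    congr 1
    ext z
    simp only [Pi.sub_apply, Finset.sum_apply, Finset.sum_sub_distrib]
    ring
  · exact tendsto_integral_mul_norm_sq hm3.measurable (fun z => by positivity)
      (fun z => (le_abs_self _).trans (hw3 z)) (hmem _ (hB j k) (hBK j k)) (hB j k)
          (hlim _ (hB j k))

end WeakEstimate

section CutoffEstimate

open scoped ContDiff

variable {n : ℕ}

/-- Twice continuously differentiable functions with compact support in `Ω`. -/
structure IsTest (Ω : Set (Fin n → ℂ)) (χ : (Fin n → ℂ) → ℂ) : Prop where
  smooth : ContDiff ℝ 2 χ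
  compact : HasCompactSupport χ
  subset : tsupport χ ⊆ Ω

theorem exists_cutoff {K Ω : Set (Fin n → ℂ)} (hK : IsCompact K) (hΩ : IsOpen Ω) (hKΩ : K ⊆ Ω) :
    ∃ θ : (Fin n → ℂ) → ℝ, ContDiff ℝ ∞ θ ∧ HasCompactSupport θ ∧ tsupport θ ⊆ Ω ∧
      (∀ᶠ x in 𝓝ˢ K, θ x = 1) ∧ ∀ x, θ x ∈ Icc (0 : ℝ) 1 := by
  obtain ⟨δ, hδ, hδΩ⟩ := hK.exists_cthickening_subset_open hΩ hKΩ
  obtain ⟨f, hf1, hf0, hf⟩ := exists_contMDiffMap_one_nhds_of_subset_interior (n := (⊤ : ℕ∞))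
    (modelWithCornersSelf ℝ (Fin n → ℂ)) (s := K) (t := cthickening δ K) hK.isClosed
    ((self_subset_thickening hδ K).trans
      (interior_maximal (thickening_subset_cthickening δ K) isOpen_thickening))
  have hs : tsupport f ⊆ cthickening δ K :=
    closure_minimal (fun x hx => by_contra fun h => hx (hf0 x h)) isClosed_cthickening
  exact ⟨f, f.contMDiff.contDiff, hK.cthickening.of_isClosed_subset (isClosed_tsupport _) hs,
    hs.trans hδΩ, hf1, hf⟩

theorem contDiff_mul_of_tsupport_subset {A : Type*} [NormedRing A] [NormedAlgebra ℝ A]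
    {m : WithTop ℕ∞} {θ f : (Fin n → ℂ) → A} {Ω : Set (Fin n → ℂ)} (hΩ : IsOpen Ω)
    (hθ : ContDiff ℝ m θ) (hs : tsupport θ ⊆ Ω) (hf : ContDiffOn ℝ m f Ω) :
    ContDiff ℝ m fun z => θ z * f z := by
  rw [contDiff_iff_contDiffAt]
  intro z
  by_cases hz : z ∈ tsupport θ
  · exact hθ.contDiffAt.mul (hf.contDiffAt (hΩ.mem_nhds (hs hz)))
  · refine contDiffAt_const (c := (0 : A)) |>.congr_of_eventuallyEq ?_
    filter_upwards [(isClosed_tsupport θ).isOpen_compl.mem_nhds hz] with w hw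
    rw [image_eq_zero_of_notMem_tsupport hw, zero_mul]

theorem exists_contDiff_globalization {φ ψ : (Fin n → ℂ) → ℝ} {K Ω : Set (Fin n → ℂ)}
    (hK : IsCompact K) (hΩ : IsOpen Ω) (hKΩ : K ⊆ Ω) (hφ : ContDiffOn ℝ 2 φ Ω)
    (hψ : ContDiffOn ℝ 2 ψ Ω) :
    ∃ (φ' ψ' : (Fin n → ℂ) → ℝ) (V : Set (Fin n → ℂ)), ContDiff ℝ 2 φ' ∧ ContDiff ℝ 2 ψ' ∧
      HasCompactSupport φ' ∧ HasCompactSupport ψ' ∧ IsOpen V ∧ K ⊆ V ∧ V ⊆ Ω ∧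
      EqOn φ' φ V ∧ EqOn ψ' ψ V := by
  obtain ⟨θ, hθ, hθc, hθΩ, hθ1, -⟩ := exists_cutoff hK hΩ hKΩ
  have hθ2 : ContDiff ℝ 2 θ := hθ.of_le (by norm_cast)
  obtain ⟨V, hV, hKV, hV1⟩ := (eventually_nhdsSet_iff_exists).1 hθ1
  refine ⟨fun z => θ z * φ z, fun z => θ z * ψ z, V ∩ Ω,
    contDiff_mul_of_tsupport_subset hΩ hθ2 hθΩ hφ, contDiff_mul_of_tsupport_subset hΩ hθ2 hθΩ hψ,
    hθc.mul_right, hθc.mul_right, hV.inter hΩ, subset_inter hKV hKΩ, inter_subset_right,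
    fun z hz => ?_, fun z hz => ?_⟩
  all_goals simp [hV1 z hz.1]

theorem wderiv_congr_of_eventuallyEq {f g : (Fin n → ℂ) → ℂ} {z : Fin n → ℂ} (h : f =ᶠ[𝓝 z] g)
    (j : Fin n) : wderiv j f z = wderiv j g z := by
  simp only [wderiv, h.fderiv_eq]

theorem wderivBar_congr_of_eventuallyEq {f g : (Fin n → ℂ) → ℂ} {z : Fin n → ℂ} (h : f =ᶠ[𝓝 z] g)
    (j : Fin n) : wderivBar j f z = wderivBar j g z := by
  simp only [wderivBar, h.fderiv_eq]

theorem leviForm_congr_of_eventuallyEq {f g : (Fin n → ℂ) → ℝ} {z : Fin n → ℂ} (h : f =ᶠ[𝓝 z] g)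
    (ξ : Fin n → ℂ) : leviForm f z ξ = leviForm g z ξ := by
  have h2 : ∀ ν, (fun w => wderivBar ν (fun u => (f u : ℂ)) w) =ᶠ[𝓝 z]
      fun w => wderivBar ν (fun u => (g u : ℂ)) w := fun ν =>
    (h.eventuallyEq_nhds.mono fun w hw =>
      wderivBar_congr_of_eventuallyEq (hw.fun_comp fun t : ℝ => (t : ℂ)) ν)
  simp only [leviForm]
  congr 1
  exact Finset.sum_congr rfl fun μ _ => Finset.sum_congr rfl fun ν _ => by
    rw [wderiv_congr_of_eventuallyEq (h2 ν)]

theorem memLp_bounded_mul_of_hasCompactSupport {c f : (Fin n → ℂ) → ℂ} (hf : MemLp f 2 volume)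
    (hc : Continuous c) (hcs : HasCompactSupport c) : MemLp (fun z => c z * f z) 2 volume := by
  obtain ⟨C, hC⟩ := hcs.exists_bound_of_continuous hc
  exact MemLp.bounded_mul hf hc.aestronglyMeasurable hC

theorem integrable_mul_of_hasCompactSupport {c f : (Fin n → ℂ) → ℂ} (hf : MemLp f 2 volume)
    (hc : Continuous c) (hcs : HasCompactSupport c) : Integrable (fun z => f z * c z) volume :=
  (hf.integrable_mul (hc.memLp_of_hasCompactSupport hcs (p := 2)))

theorem wderiv_ofReal_exp_neg {q : (Fin n → ℂ) → ℝ} (hq : Differentiable ℝ q) (j : Fin n)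
    (z : Fin n → ℂ) : wderiv j (fun u => (Real.exp (-q u) : ℂ)) z =
      -wderiv j (fun u => (q u : ℂ)) z * Real.exp (-q z) := by
  have h : ∀ v, fderiv ℝ (fun u => (q u : ℂ)) z v = (fderiv ℝ q z v : ℂ) := fun v => by
    rw [fderiv_ofReal_comp (hq z)]
  simp only [wderiv, fderiv_ofReal_exp_neg hq, h]
  ring

theorem ofReal_exp_mul_ofReal_exp (a b : ℝ) :
    (Real.exp a : ℂ) * (Real.exp b : ℂ) = (Real.exp (a + b) : ℂ) := by
  rw [Real.exp_add, Complex.ofReal_mul]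

theorem norm_ofReal_exp_mul_sq (a : ℝ) (x : ℂ) :
    ‖(Real.exp a : ℂ) * x‖ ^ 2 = Real.exp (2 * a) * ‖x‖ ^ 2 := by
  rw [norm_mul, Complex.norm_real, Real.norm_of_nonneg (Real.exp_pos _).le, mul_pow, two_mul,
    Real.exp_add, sq (Real.exp a)]

theorem cutoff_estimate {φ ψ : (Fin n → ℂ) → ℝ} {Ω : Set (Fin n → ℂ)} (hΩ : IsOpen Ω)
    (hφ : ContDiffOn ℝ 2 φ Ω) (hψ : ContDiffOn ℝ 2 ψ Ω)
    (hlevi : ∀ z ∈ Ω, ∀ ξ, 2 * ‖∑ j, wderiv j (fun u => (ψ u : ℂ)) z * ξ j‖ ^ 2 +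
      2 * Real.exp (ψ z) * nsq ξ ≤ leviForm φ z ξ)
    {η : (Fin n → ℂ) → ℝ} (hη : ContDiff ℝ 2 η) (hηc : HasCompactSupport η)
    (hηΩ : tsupport η ⊆ Ω) {e : Fin n → (Fin n → ℂ) → ℂ} (he : ∀ j, MemLp (e j) 2 volume)
    {G : (Fin n → ℂ) → ℂ} (hG : MemLp G 2 volume)
    (hcurl : ∀ j k χ, IsTest Ω χ → ∫ y, (Real.exp ((φ y - ψ y) / 2) : ℂ) *
      (e k y * wderivBar j χ y - e j y * wderivBar k χ y) = 0)
    (hdiv : ∀ χ, IsTest Ω χ → ∑ j, ∫ y, (Real.exp (-((φ y - ψ y) / 2)) : ℂ) *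
      (e j y * wderiv j χ y) = -∫ y, G y * χ y) :
    ∫ z, 2 * η z ^ 2 * ∑ j, ‖e j z‖ ^ 2 ≤
      (∫ z, 2 * ‖(η z : ℂ) * (Real.exp (φ z / 2 - ψ z) : ℂ) * G z + (Real.exp (-ψ z / 2) : ℂ) *
        ∑ j, wderiv j (fun u => (η u : ℂ)) z * e j z‖ ^ 2) +
      ∑ j, ∑ k, ∫ z, 1 / 2 * ‖(Real.exp (-ψ z / 2) : ℂ) *
        (wderivBar j (fun u => (η u : ℂ)) z * e k z -
          wderivBar k (fun u => (η u : ℂ)) z * e j z)‖ ^ 2 := by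
  obtain ⟨φ', ψ', V, hφ', hψ', hφc, hψc, hV, hKV, hVΩ, hφV, hψV⟩ :=
    exists_contDiff_globalization (K := tsupport η) hηc hΩ hηΩ hφ hψ
  set q : (Fin n → ℂ) → ℝ := fun z => ψ' z - φ' z with hq
  have hq2 : ContDiff ℝ 2 q := hψ'.sub hφ'
  have hqd : Differentiable ℝ q := hq2.differentiable (by norm_num)
  set ηc : (Fin n → ℂ) → ℂ := fun z => (η z : ℂ) with hηcdef
  have hηc2 : ContDiff ℝ 2 ηc := contDiff_ofReal_comp hη
  have hηcs : HasCompactSupport ηc := hηc.comp_left (g := fun t : ℝ => (t : ℂ)) rfl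
  have hηct : tsupport ηc ⊆ tsupport η := closure_mono fun z hz h0 => hz (by simp [ηc, h0])
  have hη0 : ∀ z ∉ tsupport η, ηc z = 0 := fun z hz => by
    simp [ηc, image_eq_zero_of_notMem_tsupport hz]
  have hηw0 : ∀ j, ∀ z ∉ tsupport η, wderiv j ηc z = 0 := fun j z hz =>
    image_eq_zero_of_notMem_tsupport fun h => hz (hηct (tsupport_wderiv_subset ηc j h))
  have hηb0 : ∀ j, ∀ z ∉ tsupport η, wderivBar j ηc z = 0 := fun j z hz =>
    image_eq_zero_of_notMem_tsupport fun h => hz (hηct (tsupport_wderivBar_subset ηc j h))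
  have h21 : ∀ {f : (Fin n → ℂ) → ℂ}, ContDiff ℝ 2 f → ContDiff ℝ 1 f := fun h =>
    h.of_le (by norm_num)
  have hd : ∀ {f : (Fin n → ℂ) → ℂ}, ContDiff ℝ 2 f → Differentiable ℝ f := fun h =>
    h.differentiable (by norm_num)
  set P2 : (Fin n → ℂ) → ℂ := fun z => (Real.exp (-q z) : ℂ) with hP2
  set P : (Fin n → ℂ) → ℂ := fun z => (Real.exp (-q z / 2) : ℂ) with hP
  set Q : (Fin n → ℂ) → ℂ := fun z => (Real.exp (q z / 2) : ℂ) with hQ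
  have hP2c : ContDiff ℝ 2 P2 := contDiff_ofReal_comp (Real.contDiff_exp.comp hq2.neg)
  have hqc : Continuous q := hq2.continuous
  have hPc : Continuous P := by fun_prop
  have hQc : Continuous Q := by fun_prop
  have hQP2 : ∀ z, Q z * P2 z = P z := fun z => by
    simp only [hP2, hQ, hP, ofReal_exp_mul_ofReal_exp]; congr 2; ring
  have hPK : ∀ z ∈ tsupport η, (Real.exp ((φ z - ψ z) / 2) : ℂ) = P z := fun z hz => by
    simp only [hP, hq, hφV (hKV hz), hψV (hKV hz)]; congr 2; ring
  have hQK : ∀ z ∈ tsupport η, (Real.exp (-((φ z - ψ z) / 2)) : ℂ) = Q z := fun z hz => by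
    simp only [hQ, hq, hφV (hKV hz), hψV (hKV hz)]; congr 2; ring
  set μ : (Fin n → ℂ) → ℂ := fun z => ηc z * P2 z with hμ
  have hμe : ∀ z, μ z = ηc z * P2 z := fun z => rfl
  have hμ2 : ContDiff ℝ 2 μ := hηc2.mul hP2c
  have hμs : HasCompactSupport μ := hηcs.mul_right
  have hμw : ∀ j z, wderiv j μ z = P2 z * (wderiv j ηc z + ηc z *
      (wderiv j (fun u => (φ' u : ℂ)) z - wderiv j (fun u => (ψ' u : ℂ)) z)) := fun j z => by
    have h1 : wderiv j (fun u => (q u : ℂ)) z =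
        wderiv j (fun u => (ψ' u : ℂ)) z - wderiv j (fun u => (φ' u : ℂ)) z := by
      rw [← wderiv_sub (hd (contDiff_ofReal_comp hψ') z) (hd (contDiff_ofReal_comp hφ') z)]
      simp only [hq, Complex.ofReal_sub]
    rw [hμ, wderiv_mul (hd hηc2 z) (hd hP2c z), hP2, wderiv_ofReal_exp_neg hqd, h1]
    ring
  have hPe : ∀ c : (Fin n → ℂ) → ℂ, Continuous c → HasCompactSupport c → ∀ j,
      MemLp (fun z => c z * e j z) 2 volume := fun c hc hcs j =>
    memLp_bounded_mul_of_hasCompactSupport (he j) hc hcs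
  set F : Fin n → (Fin n → ℂ) → ℂ := fun j z => ηc z * P z * e j z with hF
  have hFm : ∀ j, MemLp (F j) 2 volume := fun j =>
    hPe (fun z => ηc z * P z) (hηc2.continuous.mul hPc) hηcs.mul_right j
  set A : (Fin n → ℂ) → ℂ := fun z => μ z * G z + ∑ j, Q z * wderiv j μ z * e j z with hA
  have hAm : MemLp A 2 volume := by
    refine (memLp_bounded_mul_of_hasCompactSupport hG hμ2.continuous hμs).add
      (memLp_finsetSum _ fun j _ => hPe (fun z => Q z * wderiv j μ z)
        (hQc.mul (continuous_wderiv (h21 hμ2) j)) (hμs.wderiv j).mul_left j)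
  set B : Fin n → Fin n → (Fin n → ℂ) → ℂ := fun j k z =>
    P z * wderivBar j ηc z * e k z - P z * wderivBar k ηc z * e j z with hB
  have hBm : ∀ j k, MemLp (B j k) 2 volume := fun j k =>
    (hPe (fun z => P z * wderivBar j ηc z) (hPc.mul (continuous_wderivBar (h21 hηc2) j))
      (hηcs.wderivBar j).mul_left k).sub
    (hPe (fun z => P z * wderivBar k ηc z) (hPc.mul (continuous_wderivBar (h21 hηc2) k))
      (hηcs.wderivBar k).mul_left j)
  have hμw0 : ∀ j, ∀ z ∉ tsupport η, wderiv j μ z = 0 := fun j z hz => by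
    rw [hμw, hη0 z hz, hηw0 j z hz]; ring
  have hcurl' : ∀ j k, ∀ χ : (Fin n → ℂ) → ℂ, ContDiff ℝ 2 χ → HasCompactSupport χ →
      (∫ y, F k y * wderivBar j χ y) - ∫ y, F j y * wderivBar k χ y = -∫ y, B j k y * χ y := by
    intro j k χ hχ hχc
    have h := hcurl j k (fun z => ηc z * χ z) ⟨hηc2.mul hχ, hηcs.mul_right,
      (closure_mono (Function.support_mul_subset_left _ _)).trans (hηct.trans hηΩ)⟩
    have i1 := fun j k => integrable_mul_of_hasCompactSupport (hFm k)
      (continuous_wderivBar (h21 hχ) j) (hχc.wderivBar j)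
    have i2 := integrable_mul_of_hasCompactSupport (hBm j k) hχ.continuous hχc
    rw [eq_neg_iff_add_eq_zero, ← integral_sub (i1 j k) (i1 k j)]
    have i3 := integral_add ((i1 j k).sub (i1 k j)) i2
    simp only [Pi.sub_apply] at i3
    rw [← i3, ← h]
    refine integral_congr_ae (Eventually.of_forall fun z => ?_)
    simp only [wderivBar_mul (hd hηc2 z) (hd hχ z)]
    by_cases hz : z ∈ tsupport η
    · rw [hPK z hz]; simp only [hF, hB]; ring
    · simp only [hF, hB, hη0 z hz, hηb0 _ z hz]; ring
  have hdiv' : ∀ χ : (Fin n → ℂ) → ℂ, ContDiff ℝ 2 χ → HasCompactSupport χ →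
      ∑ j, ∫ y, F j y * wderiv j χ y = -∫ y, A y * χ y := by
    intro χ hχ hχc
    have h := hdiv (fun z => μ z * χ z) ⟨hμ2.mul hχ, hμs.mul_right,
      (closure_mono ((Function.support_mul_subset_left _ _).trans
        (Function.support_mul_subset_left _ _))).trans (hηct.trans hηΩ)⟩
    have i1 := fun j => integrable_mul_of_hasCompactSupport (hFm j)
      (continuous_wderiv (h21 hχ) j) (hχc.wderiv j)
    have i2 := fun j => integrable_mul_of_hasCompactSupport (hPe (fun z => Q z * wderiv j μ z)
        (hQc.mul (continuous_wderiv (h21 hμ2) j)) (hμs.wderiv j).mul_left j) hχ.continuous hχc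
    have i3 := integrable_mul_of_hasCompactSupport
      (memLp_bounded_mul_of_hasCompactSupport hG hμ2.continuous hμs) hχ.continuous hχc
    have e1 : ∫ y, A y * χ y = (∫ y, μ y * G y * χ y) +
        ∑ j, ∫ y, Q y * wderiv j μ y * e j y * χ y := by
      rw [← integral_finsetSum _ fun j _ => i2 j,
        ← integral_add i3 (integrable_finsetSum _ fun j _ => i2 j)]
      refine integral_congr_ae (Eventually.of_forall fun z => ?_)
      simp only [hA, add_mul, Finset.sum_mul]
    have e2 : ∀ j, ∫ y, (Real.exp (-((φ y - ψ y) / 2)) : ℂ) *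
        (e j y * wderiv j (fun z => μ z * χ z) y) =
        (∫ y, F j y * wderiv j χ y) + ∫ y, Q y * wderiv j μ y * e j y * χ y := fun j => by
      rw [← integral_add (i1 j) (i2 j)]
      refine integral_congr_ae (Eventually.of_forall fun z => ?_)
      simp only [wderiv_mul (hd hμ2 z) (hd hχ z)]
      by_cases hz : z ∈ tsupport η
      · rw [hQK z hz]; simp only [hF, hμe, ← hQP2]; ring
      · simp only [hF, hμw0 _ z hz, hμe, hη0 z hz]; ring
    have e3 : ∫ y, G y * (μ y * χ y) = ∫ y, μ y * G y * χ y :=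
      integral_congr_ae (Eventually.of_forall fun z => by ring)
    simp only [e2, e3, Finset.sum_add_distrib] at h
    rw [e1, neg_add, ← h]; ring
  have hlevi' : ∀ z ∈ V, ∀ ξ, 2 * ‖∑ j, wderiv j (fun u => (ψ' u : ℂ)) z * ξ j‖ ^ 2 +
      2 * Real.exp (ψ' z) * nsq ξ ≤ leviForm φ' z ξ := fun z hz ξ => by
    have e1 : ψ' =ᶠ[𝓝 z] ψ := hψV.eventuallyEq_of_mem (hV.mem_nhds hz)
    have e2 : φ' =ᶠ[𝓝 z] φ := hφV.eventuallyEq_of_mem (hV.mem_nhds hz)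
    have e3 : ∀ j, wderiv j (fun u => (ψ' u : ℂ)) z = wderiv j (fun u => (ψ u : ℂ)) z := fun j =>
      wderiv_congr_of_eventuallyEq (e1.fun_comp fun t : ℝ => (t : ℂ)) j
    simp only [e3, leviForm_congr_of_eventuallyEq e2, hψV hz]
    exact hlevi z (hVΩ hz) ξ
  have h := weak_basic_estimate hφ' hψ' hφc hψc hV hηc hKV hlevi' hFm hAm hBm
    (fun j z hz => by simp only [hF, hη0 z hz]; ring)
    (fun z hz => by simp only [hA, hμw0 _ z hz, hμe, hη0 z hz]; simp)
    (fun j k z hz => by simp only [hB, hηb0 _ z hz]; ring) hdiv' hcurl'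
  refine (le_of_eq (integral_congr_ae (Eventually.of_forall fun z => ?_))).trans (h.trans
      (le_of_eq (congr_arg₂ _ (integral_congr_ae (Eventually.of_forall fun z => ?_))
        (Finset.sum_congr rfl fun j _ => Finset.sum_congr rfl fun k _ =>
          integral_congr_ae (Eventually.of_forall fun z => ?_)))))
  · have : ∀ j, ‖F j z‖ ^ 2 = Real.exp (-q z) * (η z ^ 2 * ‖e j z‖ ^ 2) := fun j => by
      simp only [hF]
      rw [show ηc z * P z * e j z = P z * (ηc z * e j z) by ring, hP, norm_ofReal_exp_mul_sq,
        norm_mul, mul_pow, Complex.norm_real, Real.norm_eq_abs, sq_abs]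
      congr 2; ring
    simp only [this, ← Finset.mul_sum]
    have h1 : Real.exp (ψ' z) * Real.exp (-φ' z) * Real.exp (-q z) = 1 := by
      rw [← Real.exp_add, ← Real.exp_add, hq, ← Real.exp_zero]; congr 1; ring
    linear_combination (-2 * η z ^ 2 * ∑ j, ‖e j z‖ ^ 2) * h1
  · have h1 : A z - ∑ j, (wderiv j (fun u => (φ' u : ℂ)) z - wderiv j (fun u => (ψ' u : ℂ)) z) *
        F j z = ηc z * P2 z * G z + P z * ∑ j, wderiv j ηc z * e j z := by
      simp only [hA, hμw, hF, hμe, Finset.mul_sum, add_sub_assoc, ← Finset.sum_sub_distrib]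
      congr 1
      refine Finset.sum_congr rfl fun j _ => ?_
      rw [← hQP2]; ring
    beta_reduce
    rw [h1]
    by_cases hz : z ∈ tsupport η
    · have h2 : (Real.exp (-φ' z / 2) : ℂ) * (ηc z * P2 z * G z + P z * ∑ j,
        wderiv j ηc z * e j z) =
          ηc z * (Real.exp (φ z / 2 - ψ z) : ℂ) * G z +
            (Real.exp (-ψ z / 2) : ℂ) * ∑ j, wderiv j ηc z * e j z := by
        have h3 : (Real.exp (φ z / 2 - ψ z) : ℂ) = (Real.exp (-φ' z / 2) : ℂ) * P2 z := by
          rw [hP2, ofReal_exp_mul_ofReal_exp, hq, ← hφV (hKV hz), ← hψV (hKV hz)]; congr 2; ring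
        have h4 : (Real.exp (-ψ z / 2) : ℂ) = (Real.exp (-φ' z / 2) : ℂ) * P z := by
          rw [hP, ofReal_exp_mul_ofReal_exp, hq, ← hψV (hKV hz)]; congr 2; ring
        rw [h3, h4]; ring
      beta_reduce
      rw [← h2, norm_ofReal_exp_mul_sq, mul_assoc]
      congr 3; ring
    · simp [image_eq_zero_of_notMem_tsupport hz, hη0 z hz, hηw0 _ z hz]
  · by_cases hz : z ∈ tsupport η
    · have h4 : (Real.exp (-ψ z / 2) : ℂ) * (wderivBar j ηc z * e k z - wderivBar k ηc z * e j z) =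
          (Real.exp (-φ' z / 2) : ℂ) * B j k z := by
        have : (Real.exp (-ψ z / 2) : ℂ) = (Real.exp (-φ' z / 2) : ℂ) * P z := by
          rw [hP, ofReal_exp_mul_ofReal_exp, hq, ← hψV (hKV hz)]; congr 2; ring
        rw [this, hB]; ring
      beta_reduce
      rw [h4, norm_ofReal_exp_mul_sq, mul_assoc]
      congr 3; ring
    · simp [hB, hηb0 _ z hz]

end CutoffEstimate

section WeightedEstimate

variable {n : ℕ}

theorem norm_wderivBar_ofReal {η : (Fin n → ℂ) → ℝ} {z : Fin n → ℂ}
    (hη : DifferentiableAt ℝ η z) (j : Fin n) :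
    ‖wderivBar j (fun u => (η u : ℂ)) z‖ = ‖wderiv j (fun u => (η u : ℂ)) z‖ := by
  have h := wderivBar_conj (f := fun u => (η u : ℂ)) (z := z)
    (Complex.ofRealCLM.differentiableAt.comp z hη) j
  simp only [Complex.conj_ofReal] at h
  rw [h, RCLike.norm_conj]

/-- An exhaustion of `Ω` by cutoff functions whose gradients are controlled by `exp (ψ / 2)`. -/
structure IsCutoffSequence (Ω : Set (Fin n → ℂ)) (ψ : (Fin n → ℂ) → ℝ)
    (η : ℕ → (Fin n → ℂ) → ℝ) : Prop where
  smooth : ∀ m, ContDiff ℝ 2 (η m)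
  compact : ∀ m, HasCompactSupport (η m)
  subset : ∀ m, tsupport (η m) ⊆ Ω
  abs_le : ∀ m z, |η m z| ≤ 1
  gradient_le : ∀ m, ∀ z ∈ Ω,
    ∑ j, ‖wderiv j (fun u => (η m u : ℂ)) z‖ ^ 2 ≤ Real.exp (ψ z)
  eventually_one : ∀ z ∈ Ω, ∀ᶠ m in atTop, η m =ᶠ[𝓝 z] 1

theorem norm_sum_mul_sq_le (a b : Fin n → ℂ) :
    ‖∑ j, a j * b j‖ ^ 2 ≤ (∑ j, ‖a j‖ ^ 2) * ∑ j, ‖b j‖ ^ 2 := by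
  have h1 : ‖∑ j, a j * b j‖ ≤ ∑ j, ‖a j‖ * ‖b j‖ :=
    (norm_sum_le _ _).trans (le_of_eq (Finset.sum_congr rfl fun _ _ => norm_mul _ _))
  exact (pow_le_pow_left₀ (norm_nonneg _) h1 2).trans (Finset.sum_mul_sq_le_sq_mul_sq _ _ _)

theorem norm_add_sq_le_two_mul (a b : ℂ) : ‖a + b‖ ^ 2 ≤ 2 * ‖a‖ ^ 2 + 2 * ‖b‖ ^ 2 := by
  have := pow_le_pow_left₀ (norm_nonneg _) (norm_add_le a b) 2
  nlinarith [sq_nonneg (‖a‖ - ‖b‖)]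

theorem weighted_estimate {φ ψ : (Fin n → ℂ) → ℝ} {Ω : Set (Fin n → ℂ)} (hΩ : IsOpen Ω)
    (hφ : ContDiffOn ℝ 2 φ Ω) (hψ : ContDiffOn ℝ 2 ψ Ω)
    (hlevi : ∀ z ∈ Ω, ∀ ξ, 2 * ‖∑ j, wderiv j (fun u => (ψ u : ℂ)) z * ξ j‖ ^ 2 +
      2 * Real.exp (ψ z) * nsq ξ ≤ leviForm φ z ξ)
    {η : ℕ → (Fin n → ℂ) → ℝ} (hη : IsCutoffSequence Ω ψ η)
    {e : Fin n → (Fin n → ℂ) → ℂ} (he : ∀ j, MemLp (e j) 2 (volume.restrict Ω))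
    {G : (Fin n → ℂ) → ℂ} (hG : Continuous G) (hGc : HasCompactSupport G) (hGΩ : tsupport G ⊆ Ω)
    (hcurl : ∀ j k χ, IsTest Ω χ → ∫ y in Ω, (Real.exp ((φ y - ψ y) / 2) : ℂ) *
      (e k y * wderivBar j χ y - e j y * wderivBar k χ y) = 0)
    (hdiv : ∀ χ, IsTest Ω χ → ∑ j, ∫ y in Ω, (Real.exp (-((φ y - ψ y) / 2)) : ℂ) *
      (e j y * wderiv j χ y) = -∫ y in Ω, G y * χ y) :
    ∫ z in Ω, ∑ j, ‖e j z‖ ^ 2 ≤ ∫ z in Ω, ‖(Real.exp (φ z / 2 - ψ z) : ℂ) * G z‖ ^ 2 := by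
  have hΩm := hΩ.measurableSet
  set a : (Fin n → ℂ) → ℂ := fun z => (Real.exp (φ z / 2 - ψ z) : ℂ) * G z with ha
  set b : ℕ → (Fin n → ℂ) → ℂ := fun m z => (Real.exp (-ψ z / 2) : ℂ) *
        ∑ j, wderiv j (fun u => (η m u : ℂ)) z * e j z with hb
  set c : ℕ → Fin n → Fin n → (Fin n → ℂ) → ℂ := fun m j k z => (Real.exp (-ψ z / 2) : ℂ) *
        (wderivBar j (fun u => (η m u : ℂ)) z * e k z -
          wderivBar k (fun u => (η m u : ℂ)) z * e j z) with hc
  set s : (Fin n → ℂ) → ℝ := fun z => ∑ j, ‖e j z‖ ^ 2 with hs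
  have hηd : ∀ m z, DifferentiableAt ℝ (η m) z := fun m z =>
    ((hη.smooth m).differentiable (by norm_num)) z
  have hηc1 : ∀ m, ContDiff ℝ 1 fun u => (η m u : ℂ) := fun m =>
    contDiff_ofReal_comp ((hη.smooth m).of_le (by norm_num))
  have hηts : ∀ m, tsupport (fun u => (η m u : ℂ)) ⊆ Ω := fun m => by
    have h : tsupport (fun u => (η m u : ℂ)) ⊆ tsupport (η m) :=
      closure_mono fun z hz h0 => hz (by simp [h0])
    exact h.trans (hη.subset m)
  have hηw0 : ∀ m j, ∀ z ∉ Ω, wderiv j (fun u => (η m u : ℂ)) z = 0 := fun m j z hz =>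
    image_eq_zero_of_notMem_tsupport fun h => hz (hηts m (tsupport_wderiv_subset _ j h))
  have hηb0 : ∀ m j, ∀ z ∉ Ω, wderivBar j (fun u => (η m u : ℂ)) z = 0 := fun m j z hz =>
    image_eq_zero_of_notMem_tsupport fun h => hz (hηts m (tsupport_wderivBar_subset _ j h))
  have hη0 : ∀ m, ∀ z ∉ Ω, η m z = 0 := fun m z hz =>
    image_eq_zero_of_notMem_tsupport fun h => hz (hη.subset m h)
  -- extension by zero
  have hest : ∀ m, ∫ z in Ω, 2 * η m z ^ 2 * s z ≤
      (∫ z in Ω, 2 * ‖(η m z : ℂ) * a z + b m z‖ ^ 2) +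
        ∑ j, ∑ k, ∫ z in Ω, 1 / 2 * ‖c m j k z‖ ^ 2 := fun m => by
    have hχ0 : ∀ {χ : (Fin n → ℂ) → ℂ}, IsTest Ω χ → ∀ z ∉ Ω, χ z = 0 := fun h z hz =>
      image_eq_zero_of_notMem_tsupport fun h' => hz (h.subset h')
    have hχw0 : ∀ {χ : (Fin n → ℂ) → ℂ}, IsTest Ω χ → ∀ j, ∀ z ∉ Ω, wderiv j χ z = 0 :=
      fun h j z hz => image_eq_zero_of_notMem_tsupport fun h' =>
        hz (h.subset (tsupport_wderiv_subset _ j h'))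
    have hχb0 : ∀ {χ : (Fin n → ℂ) → ℂ}, IsTest Ω χ → ∀ j, ∀ z ∉ Ω, wderivBar j χ z = 0 :=
      fun h j z hz => image_eq_zero_of_notMem_tsupport fun h' =>
        hz (h.subset (tsupport_wderivBar_subset _ j h'))
    have h := cutoff_estimate hΩ hφ hψ hlevi (hη.smooth m) (hη.compact m) (hη.subset m)
      (e := fun j => Ω.indicator (e j)) (G := G)
      (fun j => (memLp_indicator_iff_restrict hΩm).2 (he j)) (hG.memLp_of_hasCompactSupport hGc)
      (fun j k χ hχ => by
        rw [← hcurl j k χ hχ, ← setIntegral_eq_integral_of_forall_compl_eq_zero (s := Ω)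
          fun z hz => by simp [hz]]
        exact setIntegral_congr_fun hΩm fun z hz => by simp [hz])
      (fun χ hχ => by
        rw [← setIntegral_eq_integral_of_forall_compl_eq_zero (s := Ω) (f := fun y => G y * χ y)
          fun z hz => by simp [hχ0 hχ z hz], ← hdiv χ hχ]
        refine Finset.sum_congr rfl fun j _ => ?_
        rw [← setIntegral_eq_integral_of_forall_compl_eq_zero (s := Ω)
          fun z hz => by simp [hz]]
        exact setIntegral_congr_fun hΩm fun z hz => by simp [hz])
    rw [← setIntegral_eq_integral_of_forall_compl_eq_zero (s := Ω)
      (f := fun z => 2 * η m z ^ 2 * ∑ j, ‖Ω.indicator (e j) z‖ ^ 2) fun z hz => by simp [hz],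
      ← setIntegral_eq_integral_of_forall_compl_eq_zero (s := Ω) (f := fun z =>
        2 * ‖(η m z : ℂ) * (Real.exp (φ z / 2 - ψ z) : ℂ) * G z + (Real.exp (-ψ z / 2) : ℂ) *
        ∑ j, wderiv j (fun u => (η m u : ℂ)) z * Ω.indicator (e j) z‖ ^ 2)
        fun z hz => by simp [hz, hη0 m z hz]] at h
    have e3 : ∀ j k, ∫ z, 1 / 2 * ‖(Real.exp (-ψ z / 2) : ℂ) *
        (wderivBar j (fun u => (η m u : ℂ)) z * Ω.indicator (e k) z -
          wderivBar k (fun u => (η m u : ℂ)) z * Ω.indicator (e j) z)‖ ^ 2 =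
        ∫ z in Ω, 1 / 2 * ‖c m j k z‖ ^ 2 := fun j k => by
      rw [← setIntegral_eq_integral_of_forall_compl_eq_zero (s := Ω) fun z hz => by simp [hz]]
      exact setIntegral_congr_fun hΩm fun z hz => by simp [hz, hc]
    simp only [e3] at h
    refine (le_of_eq (setIntegral_congr_fun hΩm fun z hz => ?_)).trans
      (h.trans (le_of_eq (congr_arg₂ _ (setIntegral_congr_fun hΩm fun z hz => ?_) rfl)))
    · simp [hz, hs]
    · simp [hz, hb, ha, mul_assoc]
  have hexpψ : ContinuousOn (fun z => (Real.exp (-ψ z / 2) : ℂ)) Ω := by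
    have := hψ.continuousOn
    fun_prop
  have hexpa : ContinuousOn a Ω := by
    have h1 := hψ.continuousOn
    have h2 := hφ.continuousOn
    have h3 := hG.continuousOn (s := Ω)
    fun_prop
  have ham : AEStronglyMeasurable a (volume.restrict Ω) := hexpa.aestronglyMeasurable hΩm
  have hψm := hexpψ.aestronglyMeasurable hΩm (μ := volume)
  have hbm : ∀ m, AEStronglyMeasurable (b m) (volume.restrict Ω) := fun m =>
    hψm.mul (Finset.aestronglyMeasurable_fun_sum _ fun j _ =>
      (continuous_wderiv (hηc1 m) j).aestronglyMeasurable.mul (he j).1)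
  have hcm : ∀ m j k, AEStronglyMeasurable (c m j k) (volume.restrict Ω) := fun m j k =>
    hψm.mul (((continuous_wderivBar (hηc1 m) j).aestronglyMeasurable.mul (he k).1).sub
      ((continuous_wderivBar (hηc1 m) k).aestronglyMeasurable.mul (he j).1))
  have hsi : Integrable s (volume.restrict Ω) :=
    integrable_finsetSum _ fun j _ => (he j).norm.integrable_sq
  have hai : Integrable (fun z => ‖a z‖ ^ 2) (volume.restrict Ω) := by
    have hcont : Continuous a := by
      have h1 : Continuous fun z => G z * (Real.exp (φ z / 2 - ψ z) : ℂ) := by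
        refine (contDiff_mul_of_tsupport_subset (m := 0) hΩ (contDiff_zero.2 hG) hGΩ
          (contDiffOn_zero.2 ?_)).continuous
        have h1 := hψ.continuousOn
        have h2 := hφ.continuousOn
        fun_prop
      simpa only [ha, mul_comm] using h1
    exact ((hcont.memLp_of_hasCompactSupport (p := 2) hGc.mul_left).norm.integrable_sq).restrict
  have hbb : ∀ m, ∀ z ∈ Ω, ‖b m z‖ ^ 2 ≤ s z := fun m z hz => by
    simp only [hb]
    rw [norm_ofReal_exp_mul_sq]
    have h1 := norm_sum_mul_sq_le (fun j => wderiv j (fun u => (η m u : ℂ)) z) fun j => e j z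
    have h2 : Real.exp (2 * (-ψ z / 2)) * Real.exp (ψ z) = 1 := by
      rw [← Real.exp_add, ← Real.exp_zero]; congr 1; ring
    have hs0 : 0 ≤ s z := Finset.sum_nonneg fun _ _ => by positivity
    calc _ ≤ Real.exp (2 * (-ψ z / 2)) * (Real.exp (ψ z) * s z) :=
          mul_le_mul_of_nonneg_left (h1.trans
            (mul_le_mul_of_nonneg_right (hη.gradient_le m z hz) hs0)) (Real.exp_pos _).le
      _ = s z := by rw [← mul_assoc, h2, one_mul]
  have hcb : ∀ m j k, ∀ z ∈ Ω, ‖c m j k z‖ ^ 2 ≤ 4 * s z := fun m j k z hz => by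
    simp only [hc]
    rw [norm_ofReal_exp_mul_sq]
    have h2 : Real.exp (2 * (-ψ z / 2)) * Real.exp (ψ z) = 1 := by
      rw [← Real.exp_add, ← Real.exp_zero]; congr 1; ring
    have hw : ∀ i, ‖wderivBar i (fun u => (η m u : ℂ)) z‖ ^ 2 ≤ Real.exp (ψ z) := fun i => by
      rw [norm_wderivBar_ofReal (hηd m z)]
      exact (Finset.single_le_sum (f := fun i => ‖wderiv i (fun u => (η m u : ℂ)) z‖ ^ 2)
        (fun _ _ => by positivity) (Finset.mem_univ i)).trans (hη.gradient_le m z hz)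
    have hes : ∀ i, ‖e i z‖ ^ 2 ≤ s z := fun i =>
      Finset.single_le_sum (f := fun i => ‖e i z‖ ^ 2) (fun _ _ => by positivity)
        (Finset.mem_univ i)
    have hp : ∀ i l, ‖wderivBar i (fun u => (η m u : ℂ)) z * e l z‖ ^ 2 ≤ Real.exp (ψ z) * s z :=
      fun i l => by
      rw [norm_mul, mul_pow]
      exact mul_le_mul (hw i) (hes l) (by positivity) (Real.exp_pos _).le
    have h3 := norm_add_sq_le_two_mul (wderivBar j (fun u => (η m u : ℂ)) z * e k z)
      (-(wderivBar k (fun u => (η m u : ℂ)) z * e j z))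
    rw [norm_neg, ← sub_eq_add_neg] at h3
    calc _ ≤ Real.exp (2 * (-ψ z / 2)) * (Real.exp (ψ z) * (4 * s z)) :=
          mul_le_mul_of_nonneg_left (by linarith [hp j k, hp k j]) (Real.exp_pos _).le
      _ = 4 * s z := by rw [← mul_assoc, h2, one_mul]
  have hgrad : ∀ z ∈ Ω, ∀ᶠ m in atTop, (∀ j, wderiv j (fun u => (η m u : ℂ)) z = 0) ∧
      (∀ j, wderivBar j (fun u => (η m u : ℂ)) z = 0) ∧ η m z = 1 := fun z hz =>
    (hη.eventually_one z hz).mono fun m hm => by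
      have h1 : (fun u => (η m u : ℂ)) =ᶠ[𝓝 z] fun _ => (1 : ℂ) :=
        hm.mono fun u hu => by simp [hu]
      refine ⟨fun j => ?_, fun j => ?_, hm.self_of_nhds⟩
      · rw [wderiv_congr_of_eventuallyEq h1]; simp [wderiv]
      · rw [wderivBar_congr_of_eventuallyEq h1]; simp [wderivBar]
  have hηsq : ∀ m z, η m z ^ 2 ≤ 1 := fun m z => by
    rw [← sq_abs]; exact pow_le_one₀ (abs_nonneg _) (hη.abs_le m z)
  have hs0 : ∀ z, 0 ≤ s z := fun z => Finset.sum_nonneg fun _ _ => by positivity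
  have hηm : ∀ m, AEStronglyMeasurable (η m) (volume.restrict Ω) := fun m =>
    (hη.smooth m).continuous.aestronglyMeasurable
  have hηcm : ∀ m, AEStronglyMeasurable (fun z => (η m z : ℂ)) (volume.restrict Ω) := fun m =>
    (hηc1 m).continuous.aestronglyMeasurable
  have hΩae : ∀ᵐ z ∂volume.restrict Ω, z ∈ Ω := ae_restrict_mem hΩm
  have L1 : Tendsto (fun m => ∫ z in Ω, 2 * η m z ^ 2 * s z) atTop (𝓝 (∫ z in Ω, 2 * s z)) := by
    refine tendsto_integral_of_dominated_convergence (fun z => 2 * s z)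
      (fun m => (((hηm m).pow 2).const_mul 2).mul hsi.1) (hsi.const_mul 2)
      (fun m => Eventually.of_forall fun z => ?_) (hΩae.mono fun z hz => ?_)
    · rw [Real.norm_of_nonneg (by have := hs0 z; positivity)]
      have := mul_le_mul_of_nonneg_right (hηsq m z) (hs0 z)
      linarith
    · refine tendsto_const_nhds.congr' ((hgrad z hz).mono fun m hm => ?_)
      simp [hm.2.2]
  have L2 : Tendsto (fun m => ∫ z in Ω, 2 * ‖(η m z : ℂ) * a z + b m z‖ ^ 2) atTop
      (𝓝 (∫ z in Ω, 2 * ‖a z‖ ^ 2)) := by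
    refine tendsto_integral_of_dominated_convergence (fun z => 4 * ‖a z‖ ^ 2 + 4 * s z)
      (fun m => ((((hηcm m).mul ham).add (hbm m)).norm.pow 2).const_mul 2)
      ((hai.const_mul 4).add (hsi.const_mul 4))
      (fun m => hΩae.mono fun z hz => ?_) (hΩae.mono fun z hz => ?_)
    · rw [Real.norm_of_nonneg (by positivity)]
      have h1 := norm_add_sq_le_two_mul ((η m z : ℂ) * a z) (b m z)
      have h2 : ‖(η m z : ℂ) * a z‖ ^ 2 ≤ ‖a z‖ ^ 2 := by
        rw [norm_mul, mul_pow, Complex.norm_real, Real.norm_eq_abs, sq_abs]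
        exact mul_le_of_le_one_left (by positivity) (hηsq m z)
      linarith [hbb m z hz]
    · refine tendsto_const_nhds.congr' ((hgrad z hz).mono fun m hm => ?_)
      simp [hm.2.2, hb, hm.1]
  have L3 : ∀ j k, Tendsto (fun m => ∫ z in Ω, 1 / 2 * ‖c m j k z‖ ^ 2) atTop (𝓝 0) := by
    intro j k
    have : Tendsto (fun m => ∫ z in Ω, 1 / 2 * ‖c m j k z‖ ^ 2) atTop (𝓝 (∫ z in Ω, (0 : ℝ))) := by
      refine tendsto_integral_of_dominated_convergence (fun z => 2 * s z)
        (fun m => ((hcm m j k).norm.pow 2).const_mul _) (hsi.const_mul 2)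
        (fun m => hΩae.mono fun z hz => ?_) (hΩae.mono fun z hz => ?_)
      · rw [Real.norm_of_nonneg (by positivity)]
        linarith [hcb m j k z hz]
      · refine tendsto_const_nhds.congr' ((hgrad z hz).mono fun m hm => ?_)
        simp [hc, hm.2.1]
    simpa using this
  have L3' := tendsto_finsetSum Finset.univ fun j (_ : j ∈ Finset.univ) =>
    tendsto_finsetSum Finset.univ fun k (_ : k ∈ Finset.univ) => L3 j k
  have hfin := le_of_tendsto_of_tendsto' L1 (L2.add L3') hest
  simp only [integral_const_mul, Finset.sum_const_zero, add_zero] at hfin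
  linarith

end WeightedEstimate

section WeakSolution

variable {n : ℕ}

local notation "conj" => starRingEnd ℂ

/-- Riesz representation of a functional dominated by the norm of a linear image. -/
theorem exists_inner_eq_of_norm_le {V H : Type*} [AddCommGroup V] [Module ℂ V]
    [NormedAddCommGroup H] [InnerProductSpace ℂ H] [CompleteSpace H]
    (T : V →ₗ[ℂ] H) (l : V →ₗ[ℂ] ℂ) {C : ℝ} (hC : 0 ≤ C) (h : ∀ v, ‖l v‖ ≤ C * ‖T v‖) :
    ∃ u : H, ‖u‖ ≤ C ∧ ∀ v, inner ℂ u (T v) = l v := by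
  have hker : LinearMap.ker T ≤ LinearMap.ker l := fun v hv => by
    rw [LinearMap.mem_ker] at hv ⊢
    have := h v
    rw [hv, norm_zero, mul_zero] at this
    exact norm_le_zero_iff.1 this
  set g : LinearMap.range T →ₗ[ℂ] ℂ :=
    ((LinearMap.ker T).liftQ l hker).comp T.quotKerEquivRange.symm.toLinearMap with hg
  have hgv : ∀ v, g ⟨T v, LinearMap.mem_range_self T v⟩ = l v := fun v => by
    have : T.quotKerEquivRange.symm ⟨T v, LinearMap.mem_range_self T v⟩ =
        (LinearMap.ker T).mkQ v := by
      rw [LinearEquiv.symm_apply_eq]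
      rfl
    simp [hg, this]
  have hgb : ∀ x, ‖g x‖ ≤ C * ‖x‖ := by
    rintro ⟨_, v, rfl⟩
    rw [hgv]
    exact h v
  obtain ⟨G, hG, hGn⟩ := exists_extension_norm_eq (𝕜 := ℂ) _ (g.mkContinuous C hgb)
  refine ⟨(InnerProductSpace.toDual ℂ H).symm G, ?_, fun v => ?_⟩
  · rw [LinearIsometryEquiv.norm_map, hGn]
    exact g.mkContinuous_norm_le hC hgb
  · rw [InnerProductSpace.toDual_symm_apply]
    exact (hG ⟨T v, LinearMap.mem_range_self T v⟩).trans (hgv v)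

theorem memLp_mul_of_tsupport_subset {Ω : Set (Fin n → ℂ)} (hΩ : IsOpen Ω)
    {c g : (Fin n → ℂ) → ℂ} (hc : ContinuousOn c Ω) (hg : Continuous g) (hgc : HasCompactSupport g)
    (hgΩ : tsupport g ⊆ Ω) : MemLp (fun z => c z * g z) 2 (volume.restrict Ω) := by
  have h : ContDiff ℝ 0 fun z => g z * c z := contDiff_mul_of_tsupport_subset hΩ
    (contDiff_zero.2 hg) hgΩ (contDiffOn_zero.2 hc)
  have := (h.continuous.memLp_of_hasCompactSupport (μ := volume) (p := 2) hgc.mul_right).restrict Ω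
  exact this.congr_norm (by simpa only [mul_comm] using this.1) (.of_forall fun z =>
      by rw [mul_comm])

/-- The element of a product of `L²` spaces given by a family of square integrable functions. -/
def l2Vec {μ : Measure (Fin n → ℂ)} (f : Fin n → (Fin n → ℂ) → ℂ) (hf : ∀ j, MemLp (f j) 2 μ) :
    PiLp 2 fun _ : Fin n => Lp ℂ 2 μ :=
  WithLp.toLp 2 fun j => (hf j).toLp (f j)

theorem inner_toLp {μ : Measure (Fin n → ℂ)} {f : (Fin n → ℂ) → ℂ} (hf : MemLp f 2 μ)
    (e : Lp ℂ 2 μ) : inner ℂ (hf.toLp f) e = ∫ z, e z * conj (f z) ∂μ := by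
  rw [L2.inner_def]
  refine integral_congr_ae (hf.coeFn_toLp.mono fun z hz => ?_)
  simp only [hz, RCLike.inner_apply]

theorem inner_l2Vec {μ : Measure (Fin n → ℂ)} {f : Fin n → (Fin n → ℂ) → ℂ}
    (hf : ∀ j, MemLp (f j) 2 μ) (e : PiLp 2 fun _ : Fin n => Lp ℂ 2 μ) :
    inner ℂ (l2Vec f hf) e = ∑ j, ∫ z, e j z * conj (f j z) ∂μ := by
  rw [PiLp.inner_apply]
  exact Finset.sum_congr rfl fun j _ => inner_toLp (hf j) (e j)

theorem inner_l2Vec_l2Vec {μ : Measure (Fin n → ℂ)} {f g : Fin n → (Fin n → ℂ) → ℂ}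
    (hf : ∀ j, MemLp (f j) 2 μ) (hg : ∀ j, MemLp (g j) 2 μ) :
    inner ℂ (l2Vec f hf) (l2Vec g hg) = ∑ j, ∫ z, g j z * conj (f j z) ∂μ := by
  rw [inner_l2Vec]
  refine Finset.sum_congr rfl fun j _ => integral_congr_ae ?_
  exact (hg j).coeFn_toLp.mono fun z hz => by
    simp only [l2Vec]
    rw [hz]

theorem norm_sq_l2 {μ : Measure (Fin n → ℂ)} (e : PiLp 2 fun _ : Fin n => Lp ℂ 2 μ) :
    ‖e‖ ^ 2 = ∑ j, ∫ z, ‖e j z‖ ^ 2 ∂μ := by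
  rw [PiLp.norm_sq_eq_of_L2]
  refine Finset.sum_congr rfl fun j _ => ?_
  rw [integral_norm_sq_eq_norm_toLp (Lp.memLp (e j)), Lp.toLp_coeFn]

theorem norm_sq_l2Vec {μ : Measure (Fin n → ℂ)} {f : Fin n → (Fin n → ℂ) → ℂ}
    (hf : ∀ j, MemLp (f j) 2 μ) : ‖l2Vec f hf‖ ^ 2 = ∑ j, ∫ z, ‖f j z‖ ^ 2 ∂μ := by
  rw [PiLp.norm_sq_eq_of_L2]
  exact Finset.sum_congr rfl fun j _ => (integral_norm_sq_eq_norm_toLp (hf j)).symm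

theorem wderivBar_comm {f : (Fin n → ℂ) → ℂ} {z : Fin n → ℂ} (hf : ContDiffAt ℝ 2 f z)
    (j k : Fin n) : wderivBar j (wderivBar k f) z = wderivBar k (wderivBar j f) z := by
  have hb : ∀ k, wderivBar k f = fun w => (fderiv ℝ f w (Pi.single k 1) +
      Complex.I * fderiv ℝ f w (Pi.single k Complex.I)) * 2⁻¹ := fun k => by
    ext w
    rw [wderivBar, div_eq_mul_inv]
  rw [hb, hb, wderivBar, wderivBar]
  simp only [fderiv_wirtinger_combination hf]
  rw [hess_symm hf (Pi.single k 1), hess_symm hf (Pi.single k 1),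
    hess_symm hf (Pi.single k Complex.I), hess_symm hf (Pi.single k Complex.I)]
  ring

theorem integral_wderivBar_mul {f g : (Fin n → ℂ) → ℂ} (hf : ContDiff ℝ 1 f) (hg : ContDiff ℝ 1 g)
    (hs : HasCompactSupport f) (j : Fin n) :
    ∫ z, wderivBar j f z * g z = -∫ z, f z * wderivBar j g z := by
  have h0 := integral_wderivBar_eq_zero (hf.mul hg) hs.mul_right j
  have hm : ∀ z, wderivBar j (fun u => f u * g u) z =
      wderivBar j f z * g z + f z * wderivBar j g z := fun z => by
    rw [wderivBar_mul (hf.differentiable (by norm_num) z) (hg.differentiable (by norm_num) z)]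
  simp only [hm] at h0
  rw [integral_add] at h0
  · exact eq_neg_of_add_eq_zero_left h0
  · exact ((continuous_wderivBar hf j).mul hg.continuous).integrable_of_hasCompactSupport
      (hs.wderivBar j).mul_right
  · exact (hf.continuous.mul (continuous_wderivBar hg j)).integrable_of_hasCompactSupport
      hs.mul_right

theorem integral_wderivBar_mul_wderivBar {f g : (Fin n → ℂ) → ℂ} (hf : ContDiff ℝ 2 f)
    (hg : ContDiff ℝ 2 g) (hs : HasCompactSupport f) (j k : Fin n) :
    ∫ z, wderivBar j f z * wderivBar k g z = ∫ z, wderivBar k f z * wderivBar j g z := by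
  rw [integral_wderivBar_mul (hf.of_le (by norm_num)) (contDiff_wderivBar hg k) hs,
    integral_wderivBar_mul (hf.of_le (by norm_num)) (contDiff_wderivBar hg j) hs]
  simp only [wderivBar_comm hg.contDiffAt j k]

theorem inner_toLp_single {μ : Measure (Fin n → ℂ)} (k : Fin n) (x : Lp ℂ 2 μ)
    (e : PiLp 2 fun _ : Fin n => Lp ℂ 2 μ) :
    inner ℂ (WithLp.toLp 2 (Pi.single k x) : PiLp 2 fun _ : Fin n => Lp ℂ 2 μ) e =
      inner ℂ x (e k) := by
  rw [PiLp.inner_apply, Finset.sum_eq_single k]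
  · simp
  · intro j _ hj
    simp [hj]
  · simp

theorem wderiv_add {f g : (Fin n → ℂ) → ℂ} {z : Fin n → ℂ} (hf : DifferentiableAt ℝ f z)
    (hg : DifferentiableAt ℝ g z) (j : Fin n) :
    wderiv j (f + g) z = wderiv j f z + wderiv j g z := by
  simp only [wderiv, fderiv_add hf hg, add_apply]
  ring

theorem wderiv_const_smul {f : (Fin n → ℂ) → ℂ} {z : Fin n → ℂ} (hf : DifferentiableAt ℝ f z)
    (a : ℂ) (j : Fin n) : wderiv j (a • f) z = a * wderiv j f z := by
  simp only [wderiv, fderiv_const_smul hf, smul_apply, smul_eq_mul]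
  ring

theorem IsTest.add {Ω : Set (Fin n → ℂ)} {f g : (Fin n → ℂ) → ℂ} (hf : IsTest Ω f)
    (hg : IsTest Ω g) : IsTest Ω (f + g) :=
  ⟨hf.smooth.add hg.smooth, hf.compact.add hg.compact,
    (tsupport_add f g).trans (union_subset hf.subset hg.subset)⟩

theorem IsTest.const_smul {Ω : Set (Fin n → ℂ)} {f : (Fin n → ℂ) → ℂ} (hf : IsTest Ω f) (a : ℂ) :
    IsTest Ω (a • f) :=
  ⟨hf.smooth.const_smul a, hf.compact.smul_left (f := fun _ => a),
    (closure_mono (Function.support_const_smul_subset a f)).trans hf.subset⟩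

theorem isTest_zero (Ω : Set (Fin n → ℂ)) : IsTest Ω (0 : (Fin n → ℂ) → ℂ) :=
  ⟨contDiff_const, HasCompactSupport.zero, by simp [tsupport]⟩

theorem IsTest.conj {Ω : Set (Fin n → ℂ)} {f : (Fin n → ℂ) → ℂ} (hf : IsTest Ω f) :
    IsTest Ω fun z => conj (f z) :=
  ⟨contDiff_conj_comp hf.smooth, hf.compact.comp_left (g := conj) (map_zero _),
    have h : tsupport (fun z => conj (f z)) ⊆ tsupport f :=
      closure_mono fun z hz h0 => hz (by simp [h0])
    h.trans hf.subset⟩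

/-- Families of test functions indexed by the coordinates. -/
def testForms (Ω : Set (Fin n → ℂ)) : Submodule ℂ (Fin n → (Fin n → ℂ) → ℂ) where
  carrier := {v | ∀ j, IsTest Ω (v j)}
  add_mem' hv hw j := (hv j).add (hw j)
  zero_mem' _ := isTest_zero Ω
  smul_mem' a _ hv j := (hv j).const_smul a

/-- The divergence of a test form. -/
def testDiv (v : Fin n → (Fin n → ℂ) → ℂ) (z : Fin n → ℂ) : ℂ := ∑ j, wderiv j (v j) z

theorem continuous_testDiv {Ω : Set (Fin n → ℂ)} {v : Fin n → (Fin n → ℂ) → ℂ}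
    (hv : ∀ j, IsTest Ω (v j)) : Continuous (testDiv v) :=
  continuous_finsetSum _ fun j _ => continuous_wderiv ((hv j).smooth.of_le (by norm_num)) j

theorem tsupport_testDiv_subset (v : Fin n → (Fin n → ℂ) → ℂ) :
    tsupport (testDiv v) ⊆ ⋃ j, tsupport (v j) := by
  refine closure_minimal (fun z hz => ?_) (isClosed_iUnion_of_finite fun j => isClosed_tsupport _)
  by_contra h
  simp only [mem_iUnion, not_exists] at h
  exact hz (Finset.sum_eq_zero fun j _ => image_eq_zero_of_notMem_tsupport fun h' =>
    h j (tsupport_wderiv_subset _ j h'))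

theorem hasCompactSupport_testDiv {Ω : Set (Fin n → ℂ)} {v : Fin n → (Fin n → ℂ) → ℂ}
    (hv : ∀ j, IsTest Ω (v j)) : HasCompactSupport (testDiv v) :=
  (isCompact_iUnion fun j => (hv j).compact.isCompact).of_isClosed_subset (isClosed_tsupport _)
    (tsupport_testDiv_subset v)

theorem exists_orthogonal_part {H : Type*} [NormedAddCommGroup H] [InnerProductSpace ℂ H]
    [CompleteSpace H] (S : Set H) : ∃ P : H → H, (∀ x, ∀ s ∈ S, inner ℂ s (P x) = 0) ∧
      ∀ x y, (∀ s ∈ S, inner ℂ s y = 0) → inner ℂ y (P x) = inner ℂ y x := by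
  set N := (Submodule.span ℂ S)ᗮ with hN
  have : CompleteSpace N := Submodule.instOrthogonalCompleteSpace _
  refine ⟨fun x => N.starProjection x, fun x s hs => ?_, fun x y hy => ?_⟩
  · exact (Submodule.mem_orthogonal (Submodule.span ℂ S) _).1 (N.starProjection_apply_mem x) s
      (Submodule.subset_span hs)
  · have hyN : y ∈ N := by
      rw [hN, Submodule.mem_orthogonal]
      intro s hs
      induction hs using Submodule.span_induction with
      | mem s hs => exact hy s hs
      | zero => exact inner_zero_left _
      | add a b _ _ ha hb => rw [inner_add_left, ha, hb, add_zero]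
      | smul c a _ ha => rw [inner_smul_left, ha, mul_zero]
    have h := (Submodule.mem_orthogonal _ _).1 (N.sub_starProjection_mem_orthogonal x) y hyN
    rw [inner_sub_right, sub_eq_zero] at h
    exact h.symm

theorem integral_wderiv_mul {f g : (Fin n → ℂ) → ℂ} (hf : ContDiff ℝ 1 f) (hg : ContDiff ℝ 1 g)
    (hs : HasCompactSupport f) (j : Fin n) :
    ∫ z, wderiv j f z * g z = -∫ z, f z * wderiv j g z := by
  have h0 := integral_wderiv_eq_zero (hf.mul hg) hs.mul_right j
  have hm : ∀ z, wderiv j (fun u => f u * g u) z =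
      wderiv j f z * g z + f z * wderiv j g z := fun z => by
    rw [wderiv_mul (hf.differentiable (by norm_num) z) (hg.differentiable (by norm_num) z)]
  simp only [hm] at h0
  rw [integral_add] at h0
  · exact eq_neg_of_add_eq_zero_left h0
  · exact ((continuous_wderiv hf j).mul hg.continuous).integrable_of_hasCompactSupport
      (hs.wderiv j).mul_right
  · exact (hf.continuous.mul (continuous_wderiv hg j)).integrable_of_hasCompactSupport
      hs.mul_right

theorem IsTest.eq_zero {Ω : Set (Fin n → ℂ)} {f : (Fin n → ℂ) → ℂ} (hf : IsTest Ω f)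
    {z : Fin n → ℂ} (hz : z ∉ Ω) : f z = 0 :=
  image_eq_zero_of_notMem_tsupport fun h => hz (hf.subset h)

theorem IsTest.wderivBar_eq_zero {Ω : Set (Fin n → ℂ)} {f : (Fin n → ℂ) → ℂ} (hf : IsTest Ω f)
    {z : Fin n → ℂ} (hz : z ∉ Ω) (j : Fin n) : wderivBar j f z = 0 :=
  image_eq_zero_of_notMem_tsupport fun h => hz (hf.subset (tsupport_wderivBar_subset _ j h))

/-- Hörmander's theorem on the weak solvability of the inhomogeneous Cauchy-Riemann equations. -/
theorem exists_weak_solution {φ ψ : (Fin n → ℂ) → ℝ} {Ω : Set (Fin n → ℂ)} (hΩ : IsOpen Ω)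
    (hφ : ContDiffOn ℝ 2 φ Ω) (hψ : ContDiffOn ℝ 2 ψ Ω)
    (hlevi : ∀ z ∈ Ω, ∀ ξ, 2 * ‖∑ j, wderiv j (fun u => (ψ u : ℂ)) z * ξ j‖ ^ 2 +
      2 * Real.exp (ψ z) * nsq ξ ≤ leviForm φ z ξ)
    {η : ℕ → (Fin n → ℂ) → ℝ} (hη : IsCutoffSequence Ω ψ η)
    {α : Fin n → (Fin n → ℂ) → ℂ}
    (hα : ∀ j, MemLp (fun z => (Real.exp (-((φ z - ψ z) / 2)) : ℂ) * α j z) 2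
      (volume.restrict Ω))
    (hclosed : ∀ j k χ, IsTest Ω χ →
      ∫ y in Ω, α k y * wderivBar j χ y = ∫ y in Ω, α j y * wderivBar k χ y) :
    ∃ u : (Fin n → ℂ) → ℂ,
      MemLp (fun z => (Real.exp (-(φ z / 2 - ψ z)) : ℂ) * u z) 2 (volume.restrict Ω) ∧
      (∫ z in Ω, ‖(Real.exp (-(φ z / 2 - ψ z)) : ℂ) * u z‖ ^ 2 ≤
        ∑ j, ∫ z in Ω, ‖(Real.exp (-((φ z - ψ z) / 2)) : ℂ) * α j z‖ ^ 2) ∧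
      ∀ j χ, IsTest Ω χ → ∫ y in Ω, u y * wderivBar j χ y = -∫ y in Ω, α j y * χ y := by
  have hΩm := hΩ.measurableSet
  have hcp : ContinuousOn (fun z => (Real.exp ((φ z - ψ z) / 2) : ℂ)) Ω :=
    Complex.continuous_ofReal.comp_continuousOn
      (Real.continuous_exp.comp_continuousOn
        ((hφ.continuousOn.sub hψ.continuousOn).div_const 2))
  have hcm : ContinuousOn (fun z => (Real.exp (-((φ z - ψ z) / 2)) : ℂ)) Ω :=
    Complex.continuous_ofReal.comp_continuousOn
      (Real.continuous_exp.comp_continuousOn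
        ((hφ.continuousOn.sub hψ.continuousOn).div_const 2).neg)
  have hc1 : ContinuousOn (fun z => (Real.exp (φ z / 2 - ψ z) : ℂ)) Ω :=
    Complex.continuous_ofReal.comp_continuousOn
      (Real.continuous_exp.comp_continuousOn
        ((hφ.continuousOn.div_const 2).sub hψ.continuousOn))
  have hcurlMem : ∀ χ, IsTest Ω χ → ∀ j, MemLp (fun z => (Real.exp ((φ z - ψ z) / 2) : ℂ) *
      conj (wderivBar j χ z)) 2 (volume.restrict Ω) := fun χ hχ j => by
    have hts : tsupport (fun z => conj (wderivBar j χ z)) ⊆ tsupport (wderivBar j χ) :=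
      closure_mono fun z hz h0 => hz (by simp [h0])
    exact memLp_mul_of_tsupport_subset hΩ hcp (Complex.continuous_conj.comp
      (continuous_wderivBar (hχ.smooth.of_le (by norm_num)) j))
      ((hχ.compact.wderivBar j).comp_left (g := conj) (map_zero _))
      (hts.trans ((tsupport_wderivBar_subset _ j).trans hχ.subset))
  have hdivMem : ∀ χ, IsTest Ω χ → ∀ j, MemLp (fun z => (Real.exp (-((φ z - ψ z) / 2)) : ℂ) *
      conj (wderiv j χ z)) 2 (volume.restrict Ω) := fun χ hχ j => by
    have hts : tsupport (fun z => conj (wderiv j χ z)) ⊆ tsupport (wderiv j χ) :=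
      closure_mono fun z hz h0 => hz (by simp [h0])
    exact memLp_mul_of_tsupport_subset hΩ hcm (Complex.continuous_conj.comp
      (continuous_wderiv (hχ.smooth.of_le (by norm_num)) j))
      ((hχ.compact.wderiv j).comp_left (g := conj) (map_zero _))
      (hts.trans ((tsupport_wderiv_subset _ j).trans hχ.subset))
  have hFMem : ∀ v ∈ testForms Ω, ∀ j, MemLp (fun z => (Real.exp ((φ z - ψ z) / 2) : ℂ) *
      v j z) 2 (volume.restrict Ω) := fun v hv j =>
    memLp_mul_of_tsupport_subset hΩ hcp (hv j).smooth.continuous (hv j).compact (hv j).subset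
  have hGMem : ∀ v ∈ testForms Ω, MemLp (fun z => (Real.exp (φ z / 2 - ψ z) : ℂ) *
      testDiv v z) 2 (volume.restrict Ω) := fun v hv =>
    memLp_mul_of_tsupport_subset hΩ hc1 (continuous_testDiv hv) (hasCompactSupport_testDiv hv)
      ((tsupport_testDiv_subset v).trans (iUnion_subset fun j => (hv j).subset))
  set F : testForms Ω →ₗ[ℂ] PiLp 2 (fun _ : Fin n => Lp ℂ 2 (volume.restrict Ω)) :=
    { toFun := fun v => l2Vec _ (hFMem v.1 v.2)
      map_add' := fun v w => by
        refine PiLp.ext fun j => ?_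
        simp only [l2Vec, WithLp.ofLp_add, Pi.add_apply]
        rw [← MemLp.toLp_add]
        exact MemLp.toLp_congr _ _ (.of_forall fun z => by
          simp only [Submodule.coe_add, Pi.add_apply]; ring)
      map_smul' := fun a v => by
        refine PiLp.ext fun j => ?_
        simp only [l2Vec, WithLp.ofLp_smul, Pi.smul_apply, RingHom.id_apply]
        rw [← MemLp.toLp_const_smul]
        exact MemLp.toLp_congr _ _ (.of_forall fun z => by
          simp only [Submodule.coe_smul, Pi.smul_apply, smul_eq_mul]; ring) } with hF
  set T : testForms Ω →ₗ[ℂ] Lp ℂ 2 (volume.restrict Ω) :=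
    { toFun := fun v => (hGMem v.1 v.2).toLp _
      map_add' := fun v w => by
        rw [← MemLp.toLp_add]
        refine MemLp.toLp_congr _ _ (.of_forall fun z => ?_)
        simp only [testDiv, Submodule.coe_add, Pi.add_apply]
        rw [← mul_add, ← Finset.sum_add_distrib]
        congr 1
        exact Finset.sum_congr rfl fun j _ => wderiv_add
          ((v.2 j).smooth.differentiable (by norm_num) z)
          ((w.2 j).smooth.differentiable (by norm_num) z) j
      map_smul' := fun a v => by
        rw [← MemLp.toLp_const_smul]
        refine MemLp.toLp_congr _ _ (.of_forall fun z => ?_)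
        simp only [testDiv, Submodule.coe_smul, Pi.smul_apply, RingHom.id_apply, smul_eq_mul]
        rw [mul_left_comm]
        congr 1
        rw [Finset.mul_sum]
        refine Finset.sum_congr rfl fun j _ => ?_
        exact wderiv_const_smul ((v.2 j).smooth.differentiable (by norm_num) z) a j } with hT
  set A := l2Vec _ hα with hA
  set S : Set (PiLp 2 fun _ : Fin n => Lp ℂ 2 (volume.restrict Ω)) :=
    {x | ∃ χ, ∃ hχ : IsTest Ω χ, ∃ j k,
      x = WithLp.toLp 2 (Pi.single k ((hcurlMem χ hχ j).toLp _)) -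
        WithLp.toLp 2 (Pi.single j ((hcurlMem χ hχ k).toLp _))} with hS
  have hexp1 : ∀ z, (Real.exp (-((φ z - ψ z) / 2)) : ℂ) * (Real.exp ((φ z - ψ z) / 2) : ℂ) = 1 :=
    fun z => by rw [ofReal_exp_mul_ofReal_exp, neg_add_cancel, Real.exp_zero, Complex.ofReal_one]
  have memN : ∀ e : PiLp 2 fun _ : Fin n => Lp ℂ 2 (volume.restrict Ω), (∀ s ∈ S,
      inner ℂ s e = 0) ↔ (∀ χ, IsTest Ω χ → ∀ j k,
      ∫ z in Ω, e k z * ((Real.exp ((φ z - ψ z) / 2) : ℂ) * wderivBar j χ z) =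
      ∫ z in Ω, e j z * ((Real.exp ((φ z - ψ z) / 2) : ℂ) * wderivBar k χ z)) := by
    intro e
    have key : ∀ χ (hχ : IsTest Ω χ) j k,
        inner ℂ (WithLp.toLp 2 (Pi.single k ((hcurlMem χ hχ j).toLp _)) -
        WithLp.toLp 2 (Pi.single j ((hcurlMem χ hχ k).toLp _)) :
          PiLp 2 fun _ : Fin n => Lp ℂ 2 (volume.restrict Ω)) e = 0 ↔
      ∫ z in Ω, e k z * ((Real.exp ((φ z - ψ z) / 2) : ℂ) * wderivBar j χ z) =
      ∫ z in Ω, e j z * ((Real.exp ((φ z - ψ z) / 2) : ℂ) * wderivBar k χ z) := by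
      intro χ hχ j k
      rw [inner_sub_left, inner_toLp_single, inner_toLp_single, inner_toLp, inner_toLp,
        sub_eq_zero]
      simp only [map_mul, Complex.conj_ofReal, Complex.conj_conj]
    constructor
    · intro h χ hχ j k
      exact (key χ hχ j k).1 (h _ ⟨χ, hχ, j, k, rfl⟩)
    · rintro h _ ⟨χ, hχ, j, k, rfl⟩
      exact (key χ hχ j k).2 (h χ hχ j k)
  have hAN : ∀ s ∈ S, inner ℂ s A = 0 := by
    refine (memN A).2 fun χ hχ j k => ?_
    have h : ∀ j k, ∫ z in Ω, A k z * ((Real.exp ((φ z - ψ z) / 2) : ℂ) * wderivBar j χ z) =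
        ∫ z in Ω, α k z * wderivBar j χ z := fun j k => by
      refine integral_congr_ae ((hα k).coeFn_toLp.mono fun z hz => ?_)
      simp only [hA, l2Vec]
      rw [hz]
      linear_combination (α k z * wderivBar j χ z) * hexp1 z
    rw [h, h]
    exact hclosed j k χ hχ
  have hDN : ∀ χ (hχ : IsTest Ω χ), ∀ s ∈ S, inner ℂ s (l2Vec _ (hdivMem χ hχ)) = 0 := by
    intro θ hθ
    refine (memN _).2 fun χ hχ j k => ?_
    have h : ∀ j k, ∫ z in Ω, l2Vec _ (hdivMem θ hθ) k z *
        ((Real.exp ((φ z - ψ z) / 2) : ℂ) * wderivBar j χ z) =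
        ∫ z, wderivBar k (fun u => conj (θ u)) z * wderivBar j χ z := fun j k => by
      have h0 : ∀ z ∉ Ω, wderivBar k (fun u => conj (θ u)) z * wderivBar j χ z = 0 :=
        fun z hz => by rw [hχ.wderivBar_eq_zero hz, mul_zero]
      rw [← setIntegral_eq_integral_of_forall_compl_eq_zero h0]
      refine integral_congr_ae ((hdivMem θ hθ k).coeFn_toLp.mono fun z hz => ?_)
      simp only [l2Vec]
      rw [hz, wderivBar_conj (hθ.smooth.differentiable (by norm_num) z)]
      linear_combination (conj (wderiv k θ z) * wderivBar j χ z) * hexp1 z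
    rw [h, h]
    exact integral_wderivBar_mul_wderivBar hθ.conj.smooth hχ.smooth hθ.conj.compact k j
  obtain ⟨P, hPS, hPy⟩ := exists_orthogonal_part S
  have hbound : ∀ v, ‖P (F v)‖ ≤ ‖T v‖ := by
    intro v
    set e := P (F v) with he
    have hcurl := (memN e).1 (hPS (F v))
    have hw := weighted_estimate hΩ hφ hψ hlevi hη (e := fun j => e j) (fun j => Lp.memLp (e j))
      (continuous_testDiv v.2) (hasCompactSupport_testDiv v.2)
      ((tsupport_testDiv_subset v.1).trans (iUnion_subset fun j => (v.2 j).subset))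
      (fun j k χ hχ => by
        have hi : ∀ j k, Integrable (fun z => e k z *
            ((Real.exp ((φ z - ψ z) / 2) : ℂ) * wderivBar j χ z)) (volume.restrict Ω) :=
          fun j k => by
            have h := (hcurlMem χ hχ j).star
            have h2 := (Lp.memLp (e k)).integrable_mul h
            refine h2.congr (.of_forall fun z => ?_)
            simp only [Pi.mul_apply, Pi.star_apply, RCLike.star_def, map_mul, Complex.conj_ofReal,
              Complex.conj_conj]
        have h := integral_sub (hi j k) (hi k j)
        rw [hcurl χ hχ j k, sub_self] at h
        rw [← h]
        refine integral_congr_ae (.of_forall fun z => ?_)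
        beta_reduce
        ring)
      (fun χ hχ => by
        have h1 := hPy (F v) _ (hDN χ hχ)
        have h2 : inner ℂ (l2Vec _ (hdivMem χ hχ)) (F v) =
            ∑ j, ∫ z in Ω, v.1 j z * wderiv j χ z := by
          rw [hF]
          refine (inner_l2Vec_l2Vec (hdivMem χ hχ)
              (hFMem _ v.2)).trans (Finset.sum_congr rfl fun j _ => ?_)
          refine integral_congr_ae (.of_forall fun z => ?_)
          simp only [map_mul, Complex.conj_ofReal, Complex.conj_conj]
          linear_combination (v.1 j z * wderiv j χ z) * hexp1 z
        rw [h2, ← he, inner_l2Vec] at h1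
        have h3 : ∀ j, ∫ z in Ω, v.1 j z * wderiv j χ z = -∫ z in Ω, wderiv j (v.1 j) z * χ z :=
          fun j => by
            rw [setIntegral_eq_integral_of_forall_compl_eq_zero fun z hz => by
              rw [(v.2 j).eq_zero hz, zero_mul],
              setIntegral_eq_integral_of_forall_compl_eq_zero fun z hz => by
                rw [hχ.eq_zero hz, mul_zero],
              integral_wderiv_mul ((v.2 j).smooth.of_le (by norm_num))
                (hχ.smooth.of_le (by norm_num)) (v.2 j).compact, neg_neg]
        simp only [h3, Finset.sum_neg_distrib] at h1
        have hi : ∀ j, Integrable (fun z => wderiv j (v.1 j) z * χ z) (volume.restrict Ω) :=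
          fun j => (((continuous_wderiv ((v.2 j).smooth.of_le (by norm_num)) j).mul
            hχ.smooth.continuous).integrable_of_hasCompactSupport hχ.compact.mul_left).restrict
        simp only [testDiv, Finset.sum_mul]
        rw [integral_finsetSum _ fun j _ => hi j, ← h1]
        refine Finset.sum_congr rfl fun j _ => integral_congr_ae (.of_forall fun z => ?_)
        simp only [map_mul, Complex.conj_ofReal, Complex.conj_conj]
        ring)
    rw [integral_finsetSum _ fun j _ => (Lp.memLp (e j)).integrable_norm_pow (by norm_num),
      ← norm_sq_l2, integral_norm_sq_eq_norm_toLp (hGMem v.1 v.2)] at hw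
    exact (sq_le_sq₀ (norm_nonneg _) (norm_nonneg _)).1 hw
  obtain ⟨w, hw, hwT⟩ := exists_inner_eq_of_norm_le T ((innerₛₗ ℂ A).comp F) (norm_nonneg A)
    fun v => by
      have h := hPy (F v) A hAN
      simp only [LinearMap.comp_apply, innerₛₗ_apply_apply]
      rw [← h]
      exact (norm_inner_le_norm _ _).trans (mul_le_mul_of_nonneg_left (hbound v) (norm_nonneg _))
  have hexp2 : ∀ z, (Real.exp (-(φ z / 2 - ψ z)) : ℂ) * (Real.exp (φ z / 2 - ψ z) : ℂ) = 1 :=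
    fun z => by rw [ofReal_exp_mul_ofReal_exp, neg_add_cancel, Real.exp_zero, Complex.ofReal_one]
  have huw : (fun z => (Real.exp (-(φ z / 2 - ψ z)) : ℂ) *
      (-(Real.exp (φ z / 2 - ψ z) : ℂ) * w z)) = fun z => -w z := by
    funext z
    linear_combination -w z * hexp2 z
  refine ⟨fun z => -(Real.exp (φ z / 2 - ψ z) : ℂ) * w z, ?_, ?_, fun j χ hχ => ?_⟩
  · rw [huw]
    exact (Lp.memLp w).neg
  · have huw' := fun z => congrFun huw z
    simp only [huw', norm_neg]
    rw [integral_norm_sq_eq_norm_toLp (Lp.memLp w), Lp.toLp_coeFn, ← norm_sq_l2Vec hα]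
    exact pow_le_pow_left₀ (norm_nonneg _) hw 2
  · have hv : (Pi.single j fun z => conj (χ z)) ∈ testForms Ω := fun i => by
      by_cases h : i = j
      · subst h
        rw [Pi.single_eq_same]
        exact hχ.conj
      · rw [Pi.single_eq_of_ne h]
        exact isTest_zero Ω
    have h1 := congrArg conj (hwT ⟨_, hv⟩)
    have h2 : inner ℂ (T ⟨_, hv⟩) w = -∫ y in Ω, -(Real.exp (φ y / 2 - ψ y) : ℂ) * w y *
        wderivBar j χ y := by
      rw [hT]
      refine (inner_toLp (hGMem _ hv) w).trans ?_
      rw [← integral_neg]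
      refine integral_congr_ae (.of_forall fun z => ?_)
      have h3 : testDiv (Pi.single j fun z => conj (χ z)) z = conj (wderivBar j χ z) := by
        rw [testDiv, Finset.sum_eq_single j, Pi.single_eq_same,
          wderiv_conj (hχ.smooth.differentiable (by norm_num) z)]
        · intro i _ hi
          rw [Pi.single_eq_of_ne hi]
          simp [wderiv]
        · simp
      simp only [h3, map_mul, Complex.conj_ofReal, Complex.conj_conj]
      ring
    have h4 : inner ℂ (F ⟨_, hv⟩) A = ∫ y in Ω, α j y * χ y := by
      rw [hF, hA]
      refine (inner_l2Vec_l2Vec (hFMem _ hv) hα).trans ?_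
      rw [Finset.sum_eq_single j]
      · refine integral_congr_ae (.of_forall fun z => ?_)
        simp only [Pi.single_eq_same, map_mul, Complex.conj_ofReal, Complex.conj_conj]
        linear_combination (α j z * χ z) * hexp1 z
      · intro i _ hi
        simp [Pi.single_eq_of_ne hi]
      · simp
    simp only [LinearMap.comp_apply, innerₛₗ_apply_apply, inner_conj_symm] at h1
    rw [h2, h4] at h1
    rw [← h1, neg_neg]

end WeakSolution

section BergmanSpace

variable {n : ℕ}

local notation "conj" => starRingEnd ℂ

theorem differentiableOn_of_weak {E X : Type*} [NormedAddCommGroup E] [NormedSpace ℂ E]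
    [NormedAddCommGroup X] [NormedSpace ℂ X] {Λ : E → X →L[ℂ] ℂ} {U : Set E} (hU : IsOpen U)
    (hw : ∀ f, DifferentiableOn ℂ (fun w => Λ w f) U)
    (hb : ∀ z ∈ U, ∃ s > 0, ∃ M, ∀ w ∈ ball z s, ‖Λ w‖ ≤ M) : DifferentiableOn ℂ Λ U := by
  intro z hz
  obtain ⟨s₁, hs₁, M, hM⟩ := hb z hz
  obtain ⟨s₂, hs₂, hs₂U⟩ := Metric.isOpen_iff.1 hU z hz
  set s := min s₁ s₂ / 4 with hs
  have hs0 : 0 < s := by positivity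
  have h4s : 4 * s = min s₁ s₂ := by ring
  have hsU : ball z (4 * s) ⊆ U :=
    (ball_subset_ball (h4s.le.trans (min_le_right _ _))).trans hs₂U
  have hM0 : 0 ≤ M := (norm_nonneg _).trans (hM z (mem_ball_self hs₁))
  have hMf : ∀ f, ∀ w ∈ ball z (4 * s), ‖Λ w f‖ ≤ M * ‖f‖ := fun f w hw =>
    (Λ w).le_of_opNorm_le (hM w (ball_subset_ball (h4s.le.trans (min_le_left _ _)) hw)) f
  have hdz : ∀ f, DifferentiableAt ℂ (fun w => Λ w f) z := fun f =>
    (hw f z hz).differentiableAt (hU.mem_nhds hz)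
  have hbound : ∀ f, ‖fderiv ℂ (fun w => Λ w f) z‖ ≤ 2 * (M * ‖f‖) / (4 * s) := fun f =>
    norm_fderiv_le_of_bounded_on_ball (by positivity) ((hw f).mono hsU) (hMf f)
  set L : E →L[ℂ] X →L[ℂ] ℂ := LinearMap.mkContinuous₂
    { toFun := fun h =>
        { toFun := fun f => fderiv ℂ (fun w => Λ w f) z h
          map_add' := fun f g => by
            simp only [map_add]
            rw [fderiv_fun_add (hdz f) (hdz g), add_apply]
          map_smul' := fun a f => by
            simp only [map_smul]
            rw [fderiv_fun_const_smul (hdz f), smul_apply, RingHom.id_apply] }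
      map_add' := fun h k => by
        ext f
        exact (fderiv ℂ (fun w => Λ w f) z).map_add h k
      map_smul' := fun a h => by
        ext f
        exact (fderiv ℂ (fun w => Λ w f) z).map_smul a h } (2 * M / (4 * s)) fun h f => by
      refine ((fderiv ℂ (fun w => Λ w f) z).le_of_opNorm_le (hbound f) h).trans (le_of_eq ?_)
      ring with hL
  have hLf : ∀ h f, L h f = fderiv ℂ (fun w => Λ w f) z h := fun _ _ => rfl
  suffices HasFDerivAt Λ L z from this.differentiableAt.differentiableWithinAt
  rw [hasFDerivAt_iff_isLittleO_nhds_zero]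
  refine (Asymptotics.IsBigO.of_bound (g :=
      fun h : E => ‖h‖ ^ 2) (4 * M / s ^ 2) ?_).trans_isLittleO
    ?_
  · filter_upwards [ball_mem_nhds (0 : E) hs0] with h hh
    rw [mem_ball_zero_iff] at hh
    refine ContinuousLinearMap.opNorm_le_bound _ (by positivity) fun f => ?_
    have hsub : closedBall z ‖h‖ ⊆ ball z s := closedBall_subset_ball hh
    have hss : ball z s ⊆ ball z (4 * s) := ball_subset_ball (by linarith)
    have key := (convex_closedBall z ‖h‖).norm_image_sub_le_of_norm_hasFDerivWithin_le'
      (f := fun w => Λ w f) (f' := fun w => fderiv ℂ (fun w => Λ w f) w)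
      (φ := fderiv ℂ (fun w => Λ w f) z) (C := 4 * (M * ‖f‖) / s ^ 2 * ‖h‖) (x := z) (y := z + h)
      (fun w hw' => (((hw f w (hsU (hss (hsub hw')))).differentiableAt
        (hU.mem_nhds (hsU (hss (hsub hw'))))).hasFDerivAt).hasFDerivWithinAt)
      (fun w hw' => by
        refine (fderiv_lipschitz_of_bounded_on_ball hs0 ((hw f).mono hsU) (hMf f) (hsub hw')
          (mem_ball_self hs0)).trans ?_
        gcongr
        exact mem_closedBall_iff_norm.1 hw')
      (mem_closedBall_self (norm_nonneg _)) (by simp)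
    simp only [add_sub_cancel_left] at key
    simp only [sub_apply, hLf]
    refine key.trans (le_of_eq ?_)
    rw [norm_pow, norm_norm]
    ring
  · exact Asymptotics.isLittleO_norm_pow_id one_lt_two

variable {D : Set (Fin n → ℂ)}

theorem IsTest.memLp_conj_wderivBar {χ : (Fin n → ℂ) → ℂ} (hχ : IsTest D χ) (j : Fin n) :
    MemLp (fun z => conj (wderivBar j χ z)) 2 (volume.restrict D) :=
  ((Complex.continuous_conj.comp
    (continuous_wderivBar (hχ.smooth.of_le (by norm_num)) j)).memLp_of_hasCompactSupport
    (((hχ.compact.wderivBar j).comp_left (g := conj) (map_zero _)))).restrict D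

/-- The square integrable holomorphic functions, as a subspace of `L²`. -/
def holoL2 (D : Set (Fin n → ℂ)) : Submodule ℂ (Lp ℂ 2 (volume.restrict D)) :=
  (Submodule.span ℂ {x | ∃ χ, ∃ hχ : IsTest D χ, ∃ j,
    x = (hχ.memLp_conj_wderivBar j).toLp _})ᗮ

instance : CompleteSpace (holoL2 D) := Submodule.instOrthogonalCompleteSpace _

theorem mem_holoL2_iff {f : Lp ℂ 2 (volume.restrict D)} :
    f ∈ holoL2 D ↔ ∀ χ, IsTest D χ → ∀ j, ∫ z in D, f z * wderivBar j χ z = 0 := by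
  have key : ∀ χ (hχ : IsTest D χ) j, inner ℂ ((hχ.memLp_conj_wderivBar j).toLp _) f =
      ∫ z in D, f z * wderivBar j χ z := fun χ hχ j => by
    rw [inner_toLp]
    simp only [Complex.conj_conj]
  rw [holoL2, Submodule.mem_orthogonal]
  constructor
  · intro h χ hχ j
    rw [← key χ hχ j]
    exact h _ (Submodule.subset_span ⟨χ, hχ, j, rfl⟩)
  · intro h x hx
    induction hx using Submodule.span_induction with
    | mem x hx =>
      obtain ⟨χ, hχ, j, rfl⟩ := hx
      rw [key χ hχ]
      exact h χ hχ j
    | zero => exact inner_zero_left _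
    | add a b _ _ ha hb => rw [inner_add_left, ha, hb, add_zero]
    | smul c a _ ha => rw [inner_smul_left, ha, mul_zero]

theorem contDiffOn_real_of_holomorphic {f : (Fin n → ℂ) → ℂ} (hD : IsOpen D)
    (hf : DifferentiableOn ℂ f D) (m : ℕ) : ContDiffOn ℝ m f D :=
  (contDiffOn_of_holomorphic hD hf m).restrict_scalars ℝ

theorem setIntegral_mul_wderivBar_eq_zero {f χ : (Fin n → ℂ) → ℂ} (hD : IsOpen D)
    (hf : DifferentiableOn ℂ f D) (hχ : IsTest D χ) (j : Fin n) :
    ∫ z in D, f z * wderivBar j χ z = 0 := by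
  have hc : ContDiff ℝ 1 fun z => χ z * f z := contDiff_mul_of_tsupport_subset hD
    (hχ.smooth.of_le (by norm_num)) hχ.subset (contDiffOn_real_of_holomorphic hD hf 1)
  rw [setIntegral_eq_integral_of_forall_compl_eq_zero fun z hz => by
    rw [hχ.wderivBar_eq_zero hz, mul_zero],
    ← integral_wderivBar_eq_zero hc hχ.compact.mul_right j]
  refine integral_congr_ae (.of_forall fun z => ?_)
  beta_reduce
  by_cases hz : z ∈ D
  · have hfz := (hf z hz).differentiableAt (hD.mem_nhds hz)
    rw [wderivBar_mul (hχ.smooth.differentiable (by norm_num) z) (hfz.restrictScalars ℝ),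
      wderivBar_eq_zero hfz]
    ring
  · have h0 : (fun z => χ z * f z) =ᶠ[𝓝 z] 0 := by
      filter_upwards [(isClosed_tsupport χ).isOpen_compl.mem_nhds fun h => hz (hχ.subset h)]
        with w hw
      simp [image_eq_zero_of_notMem_tsupport hw]
    rw [hχ.wderivBar_eq_zero hz, wderivBar_congr_of_eventuallyEq h0]
    simp [wderivBar]

theorem toLp_mem_holoL2 {f : (Fin n → ℂ) → ℂ} (hD : IsOpen D) (hf : MemA2 D f) :
    hf.2.toLp f ∈ holoL2 D := by
  refine mem_holoL2_iff.2 fun χ hχ j => ?_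
  rw [← setIntegral_mul_wderivBar_eq_zero hD hf.1 hχ j]
  exact integral_congr_ae (hf.2.coeFn_toLp.mono fun z hz => by simp only [hz])

theorem exists_memA2_of_mem_holoL2 {f : Lp ℂ 2 (volume.restrict D)} (hD : IsOpen D)
    (hf : f ∈ holoL2 D) : ∃ h, MemA2 D h ∧ f =ᵐ[volume.restrict D] h := by
  have hm : MemLp (D.indicator f) 2 volume :=
    (memLp_indicator_iff_restrict hD.measurableSet).2 (Lp.memLp f)
  obtain ⟨h, hh, hfh⟩ := exists_holomorphic_of_weak hm hD fun j g hg hgc hgD => by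
    rw [← mem_holoL2_iff.1 hf g ⟨hg, hgc, hgD⟩ j, ← integral_indicator hD.measurableSet]
    refine integral_congr_ae (.of_forall fun z => ?_)
    by_cases hz : z ∈ D <;> simp [hz]
  have hfh' : f =ᵐ[volume.restrict D] h := by
    filter_upwards [hfh, ae_restrict_mem hD.measurableSet] with z hz hzD
    rw [← hz, indicator_of_mem hzD]
  exact ⟨h, ⟨hh, (memLp_congr_ae hfh').1 (Lp.memLp f)⟩, hfh'⟩

variable {K : (Fin n → ℂ) → (Fin n → ℂ) → ℂ}

open Classical in
/-- The reproducing elements of the space of square integrable holomorphic functions. -/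
def kernelVec (hD : IsOpen D) (hK : IsBergmanKernel D K) (w : Fin n → ℂ) : holoL2 D :=
  if hw : w ∈ D then ⟨(hK.1 w hw).2.toLp _, toLp_mem_holoL2 hD (hK.1 w hw)⟩ else 0

theorem inner_kernelVec (hD : IsOpen D) (hK : IsBergmanKernel D K) {w : Fin n → ℂ} (hw : w ∈ D)
    {f : holoL2 D} {h : (Fin n → ℂ) → ℂ} (hh : MemA2 D h)
    (hfh : (f : Lp ℂ 2 (volume.restrict D)) =ᵐ[volume.restrict D] h) :
    inner ℂ (kernelVec hD hK w) f = h w := by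
  rw [kernelVec, dif_pos hw, Submodule.coe_inner, inner_toLp, hK.2 h hh w hw]
  exact integral_congr_ae (hfh.mono fun z hz => by simp only [hz])

theorem kernelVec_ae_eq (hD : IsOpen D) (hK : IsBergmanKernel D K) {w : Fin n → ℂ} (hw : w ∈ D) :
    (kernelVec hD hK w : Lp ℂ 2 (volume.restrict D)) =ᵐ[volume.restrict D] fun z => K z w := by
  rw [kernelVec, dif_pos hw]
  exact (hK.1 w hw).2.coeFn_toLp

theorem kernel_eq_inner (hD : IsOpen D) (hK : IsBergmanKernel D K) {z w : Fin n → ℂ} (hz : z ∈ D)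
    (hw : w ∈ D) : K z w = inner ℂ (kernelVec hD hK z) (kernelVec hD hK w) :=
  (inner_kernelVec hD hK hz (hK.1 w hw) (kernelVec_ae_eq hD hK hw)).symm

theorem kernel_self (hD : IsOpen D) (hK : IsBergmanKernel D K) {z : Fin n → ℂ} (hz : z ∈ D) :
    K z z = ((‖kernelVec hD hK z‖ ^ 2 : ℝ) : ℂ) := by
  rw [kernel_eq_inner hD hK hz hz]
  exact (inner_self_eq_norm_sq_to_K (𝕜 := ℂ) (kernelVec hD hK z)).trans (by simp)

theorem exists_norm_kernelVec_le (hD : IsOpen D) (hK : IsBergmanKernel D K) {z : Fin n → ℂ}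
    (hz : z ∈ D) : ∃ s > 0, ∃ M, ∀ w ∈ ball z s, ‖kernelVec hD hK w‖ ≤ M := by
  obtain ⟨s, hs, hsD⟩ := Metric.isOpen_iff.1 hD z hz
  set v := volume.real (closedBall (0 : Fin n → ℂ) (s / 4)) with hv
  have hv0 : 0 < v := by
    rw [hv, measureReal_def]
    exact ENNReal.toReal_pos (measure_closedBall_pos _ _ (by positivity)).ne'
      measure_closedBall_lt_top.ne
  refine ⟨s / 2, by positivity, Real.sqrt (1 / v), fun w hw => Real.le_sqrt_of_sq_le ?_⟩
  have hsub : ball w (s / 2) ⊆ D := (ball_subset_ball' (by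
    have := mem_ball.1 hw
    linarith)).trans hsD
  have hwD : w ∈ D := hsub (mem_ball_self (by positivity))
  have h1 := norm_sq_mul_volume_le ((hK.1 w hwD).1.mono hsub) (s' := s / 4) (by linarith)
  rw [kernel_self hD hK hwD, ← hv] at h1
  have h2 : ∫ y in closedBall w (s / 4), ‖K y w‖ ^ 2 ≤ ∫ y in D, ‖K y w‖ ^ 2 :=
    setIntegral_mono_set ((hK.1 w hwD).2.integrable_norm_pow (by norm_num))
      (.of_forall fun _ => by positivity)
      (LE.le.eventuallyLE ((closedBall_subset_ball (by linarith)).trans hsub))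
  have h3 : ∫ y in D, ‖K y w‖ ^ 2 = ‖kernelVec hD hK w‖ ^ 2 := by
    rw [integral_norm_sq_eq_norm_toLp (hK.1 w hwD).2, kernelVec, dif_pos hwD]
    rfl
  rw [h3] at h2
  have h4 := h1.trans h2
  rw [Complex.norm_real, Real.norm_of_nonneg (by positivity)] at h4
  rw [le_div_iff₀ hv0]
  rcases (norm_nonneg (kernelVec hD hK w)).eq_or_lt with h0 | h0
  · rw [← h0]
    norm_num
  · have h5 : 0 < ‖kernelVec hD hK w‖ ^ 2 := by positivity
    nlinarith

theorem contDiffOn_of_innerSL {E H : Type*} [NormedAddCommGroup E] [NormedSpace ℝ E]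
    [NormedAddCommGroup H] [InnerProductSpace ℂ H] [CompleteSpace H] {k : E → H} {U : Set E}
    {m : WithTop ℕ∞} (h : ContDiffOn ℝ m (fun w => innerSL ℂ (k w)) U) : ContDiffOn ℝ m k U := by
  have h3 : k = fun w => (InnerProductSpace.toDual ℂ H).symm (innerSL ℂ (k w)) := by
    funext w
    rw [LinearIsometryEquiv.eq_symm_apply]
    rfl
  have : ContinuousSMul ℝ (StrongDual ℂ H) :=
    IsBoundedSMul.continuousSMul (α := ℝ) (β := H →L[ℂ] ℂ)
  rw [h3]
  have hc : Continuous (InnerProductSpace.toDual ℂ H).symm :=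
    (InnerProductSpace.toDual ℂ H).symm.continuous
  exact (AddMonoidHom.toRealLinearMap ((InnerProductSpace.toDual ℂ
    H).symm.toLinearEquiv.toAddEquiv.toAddMonoidHom) hc).contDiff.comp_contDiffOn h

theorem contDiffOn_kernelVec (hD : IsOpen D) (hK : IsBergmanKernel D K) :
    DifferentiableOn ℂ (fun w => innerSL ℂ (kernelVec hD hK w)) D ∧
      ContDiffOn ℝ 2 (kernelVec hD hK) D := by
  have h1 : DifferentiableOn ℂ (fun w => innerSL ℂ (kernelVec hD hK w)) D := by
    refine differentiableOn_of_weak hD (fun f => ?_) fun z hz => ?_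
    · obtain ⟨h, hh, hfh⟩ := exists_memA2_of_mem_holoL2 hD f.2
      exact hh.1.congr fun w hw => inner_kernelVec hD hK hw hh hfh
    · obtain ⟨s, hs, M, hM⟩ := exists_norm_kernelVec_le hD hK hz
      exact ⟨s, hs, M, fun w hw => by
        rw [innerSL_apply_norm]
        exact hM w hw⟩
  refine ⟨h1, ?_⟩
  have h2 := (contDiffOn_of_holomorphic (E := Fin n → ℂ) (F := holoL2 D →L[ℂ] ℂ) hD h1
    2).restrict_scalars ℝ
  exact contDiffOn_of_innerSL h2

end BergmanSpace

section LogNorm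

variable {n : ℕ}

local notation "conj" => starRingEnd ℂ

section Hilbert

variable {H : Type*} [NormedAddCommGroup H] [InnerProductSpace ℂ H]
  {k : (Fin n → ℂ) → H} {z : Fin n → ℂ}

theorem hasFDerivAt_inner_apply {F : Type*} [NormedAddCommGroup F] [NormedSpace ℝ F]
    {f g : F → H} {z : F} (hf : DifferentiableAt ℝ f z) (hg : DifferentiableAt ℝ g z) :
    ∃ L : F →L[ℝ] ℂ, HasFDerivAt (fun w => inner ℂ (f w) (g w)) L z ∧
      ∀ v, L v = inner ℂ (f z) (fderiv ℝ g z v) + inner ℂ (fderiv ℝ f z v) (g z) :=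
  ⟨_, hf.hasFDerivAt.inner ℂ hg.hasFDerivAt, fun v => by simp⟩

theorem fderiv_log_norm_sq (hk : DifferentiableAt ℝ k z) (h0 : k z ≠ 0) (v : Fin n → ℂ) :
    fderiv ℝ (fun w => Real.log (‖k w‖ ^ 2)) z v =
      2 * (inner ℂ (k z) (fderiv ℝ k z v)).re / ‖k z‖ ^ 2 := by
  obtain ⟨L, hL, hLv⟩ := hasFDerivAt_inner_apply hk hk
  have h1 : HasFDerivAt (fun w => ‖k w‖ ^ 2) (Complex.reCLM.comp L) z := by
    refine (Complex.reCLM.hasFDerivAt.comp z hL).congr_of_eventuallyEq (.of_forall fun w => ?_)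
    exact (inner_self_eq_norm_sq (𝕜 := ℂ) (k w)).symm
  have h2 : ‖k z‖ ^ 2 ≠ 0 := by positivity
  rw [(h1.log h2).fderiv]
  simp only [smul_apply, ContinuousLinearMap.comp_apply, hLv, Complex.reCLM_apply, smul_eq_mul,
    Complex.add_re]
  rw [← inner_conj_symm (fderiv ℝ k z v) (k z), Complex.conj_re]
  ring

theorem hess_log_norm_sq (hk : ContDiffAt ℝ 2 k z) (h0 : k z ≠ 0) (v : Fin n → ℂ) :
    hess (fun w => Real.log (‖k w‖ ^ 2)) z v v =
      2 * (‖fderiv ℝ k z v‖ ^ 2 + (inner ℂ (k z) (hess k z v v)).re) / ‖k z‖ ^ 2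
        - 4 * (inner ℂ (k z) (fderiv ℝ k z v)).re ^ 2 / ‖k z‖ ^ 4 := by
  have hN : ContDiffAt ℝ 2 (fun w => ‖k w‖ ^ 2) z := by
    have h1 : ContDiffAt ℝ 2 (fun w => (inner ℂ (k w) (k w)).re) z :=
      Complex.reCLM.contDiff.contDiffAt.comp z (hk.inner ℂ hk)
    exact h1.congr_of_eventuallyEq (.of_forall fun w =>
      (inner_self_eq_norm_sq (𝕜 := ℂ) (k w)).symm)
  have h2 : ‖k z‖ ^ 2 ≠ 0 := by positivity
  have hg : ContDiffAt ℝ 2 (fun w => Real.log (‖k w‖ ^ 2)) z := hN.log h2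
  have hev : (fun w => fderiv ℝ (fun w => Real.log (‖k w‖ ^ 2)) w v) =ᶠ[𝓝 z]
      fun w => 2 * (inner ℂ (k w) (fderiv ℝ k w v)).re * (‖k w‖ ^ 2)⁻¹ := by
    filter_upwards [hk.continuousAt.eventually_ne h0, hk.eventually (by simp)] with w hw hw2
    rw [fderiv_log_norm_sq (hw2.differentiableAt (by norm_num)) hw, div_eq_mul_inv]
  rw [← fderiv_fderiv_apply hg, hev.fderiv_eq]
  have hk1 : DifferentiableAt ℝ k z := hk.differentiableAt (by norm_num)
  have hF : DifferentiableAt ℝ (fun w => fderiv ℝ k w v) z :=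
    hk.differentiableAt_fderiv.clm_apply (differentiableAt_const v)
  obtain ⟨L, hL, hLv⟩ := hasFDerivAt_inner_apply hk1 hk1
  obtain ⟨M, hM, hMv⟩ := hasFDerivAt_inner_apply hk1 hF
  have e1 : HasFDerivAt (fun w => ‖k w‖ ^ 2) (Complex.reCLM.comp L) z := by
    refine (Complex.reCLM.hasFDerivAt.comp z hL).congr_of_eventuallyEq (.of_forall fun w => ?_)
    exact (inner_self_eq_norm_sq (𝕜 := ℂ) (k w)).symm
  have e2 : HasFDerivAt (fun w => (inner ℂ (k w) (fderiv ℝ k w v)).re) (Complex.reCLM.comp M) z :=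
    Complex.reCLM.hasFDerivAt.comp z hM
  have e3 := (hasDerivAt_inv h2).comp_hasFDerivAt z e1
  have e6 : fderiv ℝ (fun w => 2 * (inner ℂ (k w) (fderiv ℝ k w v)).re * (‖k w‖ ^ 2)⁻¹) z = _ :=
    ((e2.const_mul 2).mul e3).fderiv
  rw [e6]
  have e4 : (inner ℂ (fderiv ℝ k z v) (k z)).re = (inner ℂ (k z) (fderiv ℝ k z v)).re := by
    rw [← inner_conj_symm (fderiv ℝ k z v) (k z), Complex.conj_re]
  have e5 : (inner ℂ (fderiv ℝ k z v) (fderiv ℝ k z v)).re = ‖fderiv ℝ k z v‖ ^ 2 :=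
    inner_self_eq_norm_sq (𝕜 := ℂ) _
  simp only [add_apply, smul_apply, ContinuousLinearMap.comp_apply, hLv, hMv,
    Complex.reCLM_apply, smul_eq_mul, Complex.add_re, fderiv_fderiv_apply hk, e4, e5,
    Function.comp_apply]
  field_simp
  ring

theorem leviForm_log_norm_sq {U : Set (Fin n → ℂ)} (hU : IsOpen U) (hk : ContDiffOn ℝ 2 k U)
    (hI : ∀ w ∈ U, ∀ ξ, fderiv ℝ k w (Complex.I • ξ) = -(Complex.I • fderiv ℝ k w ξ))
    (hz : z ∈ U) (h0 : k z ≠ 0) (ξ : Fin n → ℂ) :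
    leviForm (fun w => Real.log (‖k w‖ ^ 2)) z ξ =
      (‖fderiv ℝ k z ξ‖ ^ 2 * ‖k z‖ ^ 2 - ‖inner ℂ (k z) (fderiv ℝ k z ξ)‖ ^ 2) / ‖k z‖ ^ 4 := by
  have hkz := hk.contDiffAt (hU.mem_nhds hz)
  have h2 : ‖k z‖ ^ 2 ≠ 0 := by positivity
  have hN : ContDiffAt ℝ 2 (fun w => ‖k w‖ ^ 2) z := by
    have h1 : ContDiffAt ℝ 2 (fun w => (inner ℂ (k w) (k w)).re) z :=
      Complex.reCLM.contDiff.contDiffAt.comp z (hkz.inner ℂ hkz)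
    exact h1.congr_of_eventuallyEq (.of_forall fun w =>
      (inner_self_eq_norm_sq (𝕜 := ℂ) (k w)).symm)
  have hh : hess k z (Complex.I • ξ) (Complex.I • ξ) = -hess k z ξ ξ := by
    have h3 : ∀ u, hess k z u (Complex.I • ξ) = -(Complex.I • hess k z u ξ) := fun u => by
      have hev : (fun w => fderiv ℝ k w (Complex.I • ξ)) =ᶠ[𝓝 z]
          fun w => -(Complex.I • fderiv ℝ k w ξ) := by
        filter_upwards [hU.mem_nhds hz] with w hw using hI w hw ξ
      have hF : DifferentiableAt ℝ (fun w => fderiv ℝ k w ξ) z :=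
        hkz.differentiableAt_fderiv.clm_apply (differentiableAt_const ξ)
      rw [← fderiv_fderiv_apply hkz, hev.fderiv_eq,
          (hF.hasFDerivAt.fun_const_smul Complex.I).fun_neg.fderiv,
        ← fderiv_fderiv_apply hkz]
      rfl
    rw [h3, hess_symm hkz, h3, smul_neg, neg_neg, smul_smul, Complex.I_mul_I, neg_one_smul]
  rw [leviForm_eq (hN.log h2), hess_log_norm_sq hkz h0, hess_log_norm_sq hkz h0, hh, hI z hz,
    norm_neg, norm_smul, Complex.norm_I, one_mul, inner_neg_right, inner_neg_right,
    inner_smul_right, ← Complex.normSq_eq_norm_sq (inner ℂ (k z) _), Complex.normSq_apply]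
  simp only [Complex.neg_re, Complex.mul_re, Complex.I_re, Complex.I_im]
  field_simp
  ring

theorem fderiv_I_smul_of_innerSL {w : Fin n → ℂ} (hk : DifferentiableAt ℝ k w)
    (hΛ : DifferentiableAt ℂ (fun w => innerSL ℂ (k w)) w) (ξ : Fin n → ℂ) :
    fderiv ℝ k w (Complex.I • ξ) = -(Complex.I • fderiv ℝ k w ξ) := by
  refine ext_inner_right ℂ fun f => ?_
  have h1 : DifferentiableAt ℂ (fun w => inner ℂ (k w) f) w :=
    hΛ.clm_apply (differentiableAt_const f)
  obtain ⟨L, hL, hLv⟩ := hasFDerivAt_inner_apply hk (differentiableAt_const (𝕜 := ℝ) f)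
  have h2 : L = (fderiv ℂ (fun w => inner ℂ (k w) f) w).restrictScalars ℝ :=
    hL.unique (h1.hasFDerivAt.restrictScalars ℝ)
  have h3 : ∀ v, inner ℂ (fderiv ℝ k w v) f = fderiv ℂ (fun w => inner ℂ (k w) f) w v := fun v => by
    have h4 := hLv v
    rw [h2] at h4
    simpa using h4.symm
  rw [h3, map_smul, ← h3, inner_neg_left, inner_smul_left]
  simp

theorem norm_inner_sq_mul_le {a b f : H} (h : inner ℂ a f = 0) :
    ‖inner ℂ b f‖ ^ 2 * ‖a‖ ^ 2 ≤ (‖b‖ ^ 2 * ‖a‖ ^ 2 - ‖inner ℂ a b‖ ^ 2) * ‖f‖ ^ 2 := by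
  by_cases ha : a = 0
  · simp [ha]
  have ha' : 0 < ‖a‖ ^ 2 := by positivity
  set c := inner ℂ a b with hc
  set p := ((‖a‖ ^ 2 : ℝ) : ℂ) • b - c • a with hp
  have h1 : ‖inner ℂ p f‖ = ‖a‖ ^ 2 * ‖inner ℂ b f‖ := by
    rw [hp, inner_sub_left, inner_smul_left, inner_smul_left, h, mul_zero, sub_zero, norm_mul,
      Complex.conj_ofReal, Complex.norm_real, Real.norm_of_nonneg ha'.le]
  have h2 : ‖p‖ ^ 2 = ‖a‖ ^ 2 * (‖b‖ ^ 2 * ‖a‖ ^ 2 - ‖c‖ ^ 2) := by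
    rw [hp, norm_sub_sq (𝕜 := ℂ), norm_smul, norm_smul, inner_smul_left, inner_smul_right,
      Complex.conj_ofReal, Complex.norm_real, Real.norm_of_nonneg ha'.le,
      ← inner_conj_symm b a, ← hc, Complex.mul_conj, Complex.normSq_eq_norm_sq]
    have : RCLike.re (((‖a‖ ^ 2 : ℝ) : ℂ) * ((‖c‖ ^ 2 : ℝ) : ℂ)) = ‖a‖ ^ 2 * ‖c‖ ^ 2 := by
      rw [← Complex.ofReal_mul]
      exact Complex.ofReal_re _
    rw [this]
    ring
  have h3 := norm_inner_le_norm (𝕜 := ℂ) p f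
  have h4 : (‖a‖ ^ 2 * ‖inner ℂ b f‖) ^ 2 ≤ (‖p‖ * ‖f‖) ^ 2 := by
    rw [← h1]
    gcongr
  rw [mul_pow, mul_pow, h2] at h4
  have h5 : ‖a‖ ^ 2 * (‖inner ℂ b f‖ ^ 2 * ‖a‖ ^ 2) ≤
      ‖a‖ ^ 2 * ((‖b‖ ^ 2 * ‖a‖ ^ 2 - ‖c‖ ^ 2) * ‖f‖ ^ 2) := by
    calc _ = (‖a‖ ^ 2) ^ 2 * ‖inner ℂ b f‖ ^ 2 := by ring
      _ ≤ _ := h4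
      _ = _ := by ring
  exact le_of_mul_le_mul_left h5 ha'

end Hilbert

section Kernel

variable {D : Set (Fin n → ℂ)} {K : (Fin n → ℂ) → (Fin n → ℂ) → ℂ} {z : Fin n → ℂ}

theorem memA2_one (hbdd : Bornology.IsBounded D) : MemA2 D fun _ => (1 : ℂ) := by
  have : IsFiniteMeasure (volume.restrict D) := ⟨by
    rw [Measure.restrict_apply_univ]
    exact hbdd.measure_lt_top⟩
  exact ⟨differentiableOn_const _, memLp_const 1⟩

theorem kernelVec_ne_zero (hD : IsOpen D) (hbdd : Bornology.IsBounded D)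
    (hK : IsBergmanKernel D K) (hz : z ∈ D) : kernelVec hD hK z ≠ 0 := by
  intro h
  have h1 := inner_kernelVec hD hK (f := ⟨_, toLp_mem_holoL2 hD (memA2_one hbdd)⟩) hz
    (memA2_one hbdd) (memA2_one hbdd).2.coeFn_toLp
  rw [h, inner_zero_left] at h1
  exact zero_ne_one h1

theorem bergmanQuad_eq_leviForm (hD : IsOpen D) (hK : IsBergmanKernel D K) (hz : z ∈ D)
    (ξ : Fin n → ℂ) :
    bergmanQuad K z ξ = leviForm (fun w => Real.log (‖kernelVec hD hK w‖ ^ 2)) z ξ := by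
  have h1 : ∀ ν, (fun w => wderivBar ν (fun u => Complex.log (K u u)) w) =ᶠ[𝓝 z]
      fun w => wderivBar ν (fun u => ((Real.log (‖kernelVec hD hK u‖ ^ 2) : ℝ) : ℂ)) w :=
          fun ν => by
    filter_upwards [hD.mem_nhds hz] with w hw
    refine wderivBar_congr_of_eventuallyEq ?_ ν
    filter_upwards [hD.mem_nhds hw] with u hu
    rw [kernel_self hD hK hu, Complex.ofReal_log (by positivity)]
  simp only [bergmanQuad, leviForm, bergmanTensor]
  congr 1
  exact Finset.sum_congr rfl fun μ _ => Finset.sum_congr rfl fun ν _ => by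
    rw [wderiv_congr_of_eventuallyEq (h1 ν)]

theorem norm_sub_le_norm_add_conj {a b : ℂ} (ha : 0 < a.re) (hb : 0 < b.re) :
    ‖a - b‖ ≤ ‖a + conj b‖ := by
  rw [← sq_le_sq₀ (norm_nonneg _) (norm_nonneg _), ← Complex.normSq_eq_norm_sq,
    ← Complex.normSq_eq_norm_sq, Complex.normSq_apply, Complex.normSq_apply]
  simp only [Complex.sub_re, Complex.sub_im, Complex.add_re, Complex.add_im, Complex.conj_re,
    Complex.conj_im]
  nlinarith [mul_pos ha hb]

theorem sq_le_bergmanQuad (hD : IsOpen D) (hbdd : Bornology.IsBounded D)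
    (hK : IsBergmanKernel D K) (hz : z ∈ D) {h : (Fin n → ℂ) → ℂ} (hh : DifferentiableOn ℂ h D)
    (hpos : ∀ w ∈ D, 0 < (h w).re) (ξ : Fin n → ℂ) :
    (‖fderiv ℂ h z ξ‖ / (2 * (h z).re)) ^ 2 ≤ bergmanQuad K z ξ := by
  set k := kernelVec hD hK with hk
  obtain ⟨hΛ, hk2⟩ := contDiffOn_kernelVec hD hK
  have hDz := hD.mem_nhds hz
  have hk1 : ∀ w ∈ D, DifferentiableAt ℝ k w := fun w hw =>
    (hk2.contDiffAt (hD.mem_nhds hw)).differentiableAt (by norm_num)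
  have hkz : k z ≠ 0 := kernelVec_ne_zero hD hbdd hK hz
  rw [bergmanQuad_eq_leviForm hD hK hz, leviForm_log_norm_sq hD hk2
    (fun w hw => fderiv_I_smul_of_innerSL (hk1 w hw) (hΛ.differentiableAt (hD.mem_nhds hw)))
    hz hkz, ← hk]
  have hne : ∀ w ∈ D, h w + conj (h z) ≠ 0 := fun w hw h0 => by
    have := congrArg Complex.re h0
    simp only [Complex.add_re, Complex.conj_re, Complex.zero_re] at this
    linarith [hpos w hw, hpos z hz]
  set f₀ : (Fin n → ℂ) → ℂ := fun w => (h w - h z) / (h w + conj (h z)) * K w z with hf₀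
  have hq : DifferentiableOn ℂ (fun w => (h w - h z) / (h w + conj (h z))) D := by
    simp only [div_eq_mul_inv]
    exact (hh.sub_const (h z)).mul ((hh.add_const (conj (h z))).inv hne)
  have hle : ∀ w ∈ D, ‖f₀ w‖ ≤ ‖K w z‖ := fun w hw => by
    rw [hf₀]
    simp only [norm_mul, norm_div]
    refine mul_le_of_le_one_left (norm_nonneg _) (div_le_one_of_le₀ ?_ (norm_nonneg _))
    exact norm_sub_le_norm_add_conj (hpos w hw) (hpos z hz)
  have hfm : MemA2 D f₀ := by
    have h1 : DifferentiableOn ℂ f₀ D := hq.mul (hK.1 z hz).1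
    exact ⟨h1, (hK.1 z hz).2.mono (h1.continuousOn.aestronglyMeasurable hD.measurableSet)
      (ae_restrict_of_forall_mem hD.measurableSet hle)⟩
  set f : holoL2 D := ⟨_, toLp_mem_holoL2 hD hfm⟩ with hf
  have hin : ∀ w ∈ D, inner ℂ (k w) f = f₀ w := fun w hw =>
    inner_kernelVec hD hK hw hfm hfm.2.coeFn_toLp
  have hnf : ‖f‖ ≤ ‖k z‖ := by
    have h1 : ‖(f : Lp ℂ 2 (volume.restrict D))‖ ≤ ‖(k z : Lp ℂ 2 (volume.restrict D))‖ := by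
      refine Lp.norm_le_norm_of_ae_le ?_
      filter_upwards [hfm.2.coeFn_toLp, kernelVec_ae_eq hD hK hz,
        ae_restrict_mem hD.measurableSet] with w h1 h2 h3
      rw [hf, h1, h2]
      exact hle w h3
    exact h1
  have h0 : inner ℂ (k z) f = 0 := by simp [hin z hz, hf₀]
  have hd : inner ℂ (fderiv ℝ k z ξ) f = fderiv ℂ h z ξ / (2 * (h z).re : ℝ) * (‖k z‖ ^ 2 : ℝ) := by
    obtain ⟨L, hL, hLv⟩ := hasFDerivAt_inner_apply (hk1 z hz) (differentiableAt_const (𝕜 := ℝ) f)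
    have hhz := (hh.differentiableAt hDz).hasFDerivAt
    have hKz := ((hK.1 z hz).1.differentiableAt hDz).hasFDerivAt
    have h1 : HasFDerivAt f₀ _ z :=
      (((hhz.sub_const (h z)).mul ((hasDerivAt_inv (hne z hz)).comp_hasFDerivAt z
        (hhz.add_const (conj (h z))))).mul hKz)
    have h2 := hL.unique ((h1.restrictScalars ℝ).congr_of_eventuallyEq
      ((hD.eventually_mem hz).mono hin))
    have h3 := hLv ξ
    rw [h2] at h3
    simp only [fderiv_fun_const, Pi.zero_apply, zero_apply,
      inner_zero_right, zero_add] at h3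
    refine h3.symm.trans ?_
    rw [kernel_self hD hK hz]
    have h4 : h z + conj (h z) = ((2 * (h z).re : ℝ) : ℂ) := Complex.add_conj _
    simp only [ContinuousLinearMap.coe_restrictScalars', add_apply, smul_apply,
      smul_eq_mul, sub_self, Pi.mul_apply, Function.comp_apply, zero_mul, zero_add, h4]
    have h5 : ((2 * (h z).re : ℝ) : ℂ) ≠ 0 := by rw [← h4]; exact hne z hz
    field_simp
    ring
  have hmain := norm_inner_sq_mul_le (b := fderiv ℝ k z ξ) h0
  rw [hd, norm_mul, norm_div, Complex.norm_real, Complex.norm_real,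
    Real.norm_of_nonneg (sq_nonneg ‖k z‖),
    Real.norm_of_nonneg (mul_pos two_pos (hpos z hz)).le] at hmain
  have hkp : 0 < ‖k z‖ ^ 2 := by positivity
  have h6 : ‖f‖ ^ 2 ≤ ‖k z‖ ^ 2 := by gcongr
  have h7 : 0 ≤ ‖fderiv ℝ k z ξ‖ ^ 2 * ‖k z‖ ^ 2 - ‖inner ℂ (k z) (fderiv ℝ k z ξ)‖ ^ 2 := by
    have := norm_inner_le_norm (𝕜 := ℂ) (k z) (fderiv ℝ k z ξ)
    have h8 : ‖inner ℂ (k z) (fderiv ℝ k z ξ)‖ ^ 2 ≤ (‖k z‖ * ‖fderiv ℝ k z ξ‖) ^ 2 := by gcongr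
    rw [mul_pow] at h8
    linarith
  rw [le_div_iff₀ (by positivity)]
  refine le_of_mul_le_mul_right ?_ hkp
  calc _ = (‖fderiv ℂ h z ξ‖ / (2 * (h z).re) * ‖k z‖ ^ 2) ^ 2 * ‖k z‖ ^ 2 := by ring
    _ ≤ _ := hmain
    _ ≤ _ := mul_le_mul_of_nonneg_left h6 h7

end Kernel

end LogNorm

section Curves

variable {n : ℕ} {D : Set (Fin n → ℂ)} {K : (Fin n → ℂ) → (Fin n → ℂ) → ℂ} {z : Fin n → ℂ}

local notation "conj" => starRingEnd ℂ

theorem continuousOn_bergmanMetric (hD : IsOpen D) (hbdd : Bornology.IsBounded D)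
    (hK : IsBergmanKernel D K) :
    ContinuousOn (fun p : (Fin n → ℂ) × (Fin n → ℂ) => bergmanMetric K p.1 p.2)
      (D ×ˢ univ) := by
  have hlog : ∀ z ∈ D, ContDiffAt ℝ 2 (fun u => Complex.log (K u u)) z := fun z hz => by
    have hkz := (contDiffOn_kernelVec hD hK).2.contDiffAt (hD.mem_nhds hz)
    have hne := kernelVec_ne_zero hD hbdd hK hz
    have h1 : ContDiffAt ℝ 2 (fun w => (inner ℂ (kernelVec hD hK w) (kernelVec hD hK w)).re) z :=
      Complex.reCLM.contDiff.contDiffAt.comp z (hkz.inner ℂ hkz)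
    have h2 : ContDiffAt ℝ 2 (fun w => ‖kernelVec hD hK w‖ ^ 2) z :=
      h1.congr_of_eventuallyEq (.of_forall fun w =>
        (inner_self_eq_norm_sq (𝕜 := ℂ) (kernelVec hD hK w)).symm)
    refine (h2.log (by positivity)).ofReal_comp.congr_of_eventuallyEq ?_
    filter_upwards [hD.mem_nhds hz] with u hu
    rw [kernel_self hD hK hu, Complex.ofReal_log (by positivity)]
  have ht : ∀ μ ν, ContinuousOn (bergmanTensor K μ ν) D := fun μ ν z hz => by
    have h1 := (((hlog z hz).wderivBar ν).fderiv_right (m := 0) (by norm_num)).continuousAt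
    have h2 : ContinuousAt (bergmanTensor K μ ν) z :=
      ((h1.clm_apply continuousAt_const).sub
        (continuousAt_const.mul (h1.clm_apply continuousAt_const))).div_const 2
    exact h2.continuousWithinAt
  refine Real.continuous_sqrt.comp_continuousOn (Complex.continuous_re.comp_continuousOn ?_)
  refine continuousOn_finsetSum _ fun μ _ => continuousOn_finsetSum _ fun ν _ => ?_
  refine (ContinuousOn.mul ?_ ?_).mul ?_
  · exact (ht μ ν).comp continuousOn_fst fun p hp => hp.1
  · exact ((continuous_apply μ).comp continuous_snd).continuousOn
  · exact (Complex.continuous_conj.comp ((continuous_apply ν).comp continuous_snd)).continuousOn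

theorem intervalIntegrable_bergmanMetric (hD : IsOpen D) (hbdd : Bornology.IsBounded D)
    (hK : IsBergmanKernel D K) {γ : ℝ → Fin n → ℂ} {a b : ℝ} (hab : a < b)
    (hγ : ContDiffOn ℝ 1 γ (Icc a b)) (hγD : ∀ t ∈ Icc a b, γ t ∈ D) :
    IntervalIntegrable (fun t => bergmanMetric K (γ t) (deriv γ t)) volume a b := by
  have h1 : ContinuousOn (fun t =>
      bergmanMetric K (γ t) (derivWithin γ (Icc a b) t)) (Icc a b) := by
    have h3 : ContinuousOn (fun t => (γ t, derivWithin γ (Icc a b) t)) (Icc a b) :=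
      hγ.continuousOn.prodMk (hγ.continuousOn_derivWithin (uniqueDiffOn_Icc hab) le_rfl)
    have h4 : MapsTo (fun t => (γ t, derivWithin γ (Icc a b) t)) (Icc a b) (D ×ˢ univ) :=
      fun t ht => ⟨hγD t ht, mem_univ _⟩
    have h5 := continuousOn_bergmanMetric hD hbdd hK
    have h6 := h5.comp h3 h4
    simpa only [Function.comp_def] using h6
  have h2 : IntervalIntegrable (fun t => bergmanMetric K (γ t) (derivWithin γ (Icc a b) t))
      volume a b := ContinuousOn.intervalIntegrable (by rwa [uIcc_of_le hab.le])
  refine h2.congr_uIoo fun t ht => ?_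
  rw [uIoo_of_le hab.le] at ht
  simp only [derivWithin_of_mem_nhds (Icc_mem_nhds ht.1 ht.2)]

theorem abs_log_norm_sub_le_of_contDiffOn (hD : IsOpen D) (hbdd : Bornology.IsBounded D)
    (hK : IsBergmanKernel D K) {h : (Fin n → ℂ) → ℂ} (hh : DifferentiableOn ℂ h D)
    (hpos : ∀ w ∈ D, 0 < (h w).re) {γ : ℝ → Fin n → ℂ} {a b : ℝ} (hab : a < b)
    (hγ : ContDiffOn ℝ 1 γ (Icc a b)) (hγD : ∀ t ∈ Icc a b, γ t ∈ D) :
    |Real.log ‖h (γ b)‖ - Real.log ‖h (γ a)‖| ≤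
      2 * ∫ t in a..b, bergmanMetric K (γ t) (deriv γ t) := by
  have h_int : IntegrableOn (fun t => 2 * bergmanMetric K (γ t) (deriv γ t)) (Icc a b) := by
    rw [← intervalIntegrable_iff_integrableOn_Icc_of_le hab.le]
    exact (intervalIntegrable_bergmanMetric hD hbdd hK hab hγ hγD).const_mul 2
  have hc : ContinuousOn (fun t => Real.log ‖h (γ t)‖) (Icc a b) := by
    refine ContinuousOn.log ((hh.continuousOn.comp hγ.continuousOn hγD).norm) fun t ht => ?_
    exact norm_ne_zero_iff.2 fun h0 => by simpa [h0] using hpos _ (hγD t ht)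
  set F' : ℝ → ℝ := fun t => (fderiv ℂ h (γ t) (deriv γ t) / h (γ t)).re with hF'
  have hd : ∀ t ∈ Ioo a b, HasDerivAt (fun t => Real.log ‖h (γ t)‖) (F' t) t := fun t ht => by
    have htI := Ioo_subset_Icc_self ht
    have h1 : HasDerivAt γ (deriv γ t) t :=
      ((hγ.contDiffAt (Icc_mem_nhds ht.1 ht.2)).differentiableAt (by norm_num)).hasDerivAt
    have h2 : HasFDerivAt h (fderiv ℂ h (γ t)) (γ t) :=
      (hh.differentiableAt (hD.mem_nhds (hγD t htI))).hasFDerivAt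
    have h3 : HasDerivAt (fun t => h (γ t)) (fderiv ℂ h (γ t) (deriv γ t)) t :=
      (h2.restrictScalars ℝ).comp_hasDerivAt t h1
    have h4 := h3.clog_real (Or.inl (hpos _ (hγD t htI)))
    exact (Complex.reCLM.hasFDerivAt.comp_hasDerivAt t h4).congr_of_eventuallyEq
      (.of_forall fun s => (Complex.log_re _).symm)
  have hb : ∀ t ∈ Ioo a b, |F' t| ≤ 2 * bergmanMetric K (γ t) (deriv γ t) := fun t ht => by
    have hp := hpos _ (hγD t (Ioo_subset_Icc_self ht))
    have h1 : ‖fderiv ℂ h (γ t) (deriv γ t)‖ / (2 * (h (γ t)).re) ≤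
        bergmanMetric K (γ t) (deriv γ t) :=
      Real.le_sqrt_of_sq_le
        (sq_le_bergmanQuad hD hbdd hK (hγD t (Ioo_subset_Icc_self ht)) hh hpos _)
    have h2 : ‖fderiv ℂ h (γ t) (deriv γ t)‖ / ‖h (γ t)‖ ≤
        ‖fderiv ℂ h (γ t) (deriv γ t)‖ / (h (γ t)).re :=
      div_le_div_of_nonneg_left (norm_nonneg _) hp (Complex.re_le_norm _)
    calc |F' t| ≤ ‖fderiv ℂ h (γ t) (deriv γ t) / h (γ t)‖ := Complex.abs_re_le_norm _
      _ ≤ ‖fderiv ℂ h (γ t) (deriv γ t)‖ / (h (γ t)).re := by rw [norm_div]; exact h2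
      _ = 2 * (‖fderiv ℂ h (γ t) (deriv γ t)‖ / (2 * (h (γ t)).re)) := by field_simp
      _ ≤ _ := by linarith
  rw [← intervalIntegral.integral_const_mul, abs_le]
  have e1 := intervalIntegral.sub_le_integral_of_hasDeriv_right_of_le hab.le hc
    (fun t ht => (hd t ht).hasDerivWithinAt) h_int fun t ht => (le_abs_self _).trans (hb t ht)
  have e2 := intervalIntegral.sub_le_integral_of_hasDeriv_right_of_le hab.le hc.neg
    (fun t ht => (hd t ht).neg.hasDerivWithinAt) h_int fun t ht =>
      (neg_le_abs _).trans (hb t ht)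
  simp only [Pi.neg_apply] at e2
  exact ⟨by linarith, e1⟩

theorem abs_log_norm_sub_le (hD : IsOpen D) (hbdd : Bornology.IsBounded D)
    (hK : IsBergmanKernel D K) {h : (Fin n → ℂ) → ℂ} (hh : DifferentiableOn ℂ h D)
    (hpos : ∀ w ∈ D, 0 < (h w).re) {γ : ℝ → Fin n → ℂ} (hγ : PiecewiseC1 γ)
    (hγD : ∀ t ∈ Icc (0 : ℝ) 1, γ t ∈ D) :
    |Real.log ‖h (γ 1)‖ - Real.log ‖h (γ 0)‖| ≤ 2 * bergmanLength K γ := by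
  obtain ⟨-, k, t, ht, ht0, ht1, hpw⟩ := hγ
  have key : ∀ i : Fin (k + 1),
      IntervalIntegrable (fun t => bergmanMetric K (γ t) (deriv γ t)) volume 0 (t i) ∧
      |Real.log ‖h (γ (t i))‖ - Real.log ‖h (γ 0)‖| ≤
        2 * ∫ s in (0 : ℝ)..t i, bergmanMetric K (γ s) (deriv γ s) := by
    intro i
    induction i using Fin.induction with
    | zero => simp [ht0]
    | succ i ih =>
      have hlt : t i.castSucc < t i.succ := ht i.castSucc_lt_succ
      have hsub : ∀ s ∈ Icc (t i.castSucc) (t i.succ), γ s ∈ D := fun s hs =>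
        hγD s ⟨le_trans (ht0.ge.trans (ht.monotone (Fin.zero_le _))) hs.1,
          hs.2.trans ((ht.monotone (Fin.le_last _)).trans ht1.le)⟩
      have h1 := intervalIntegrable_bergmanMetric hD hbdd hK hlt (hpw i) hsub
      have h2 := abs_log_norm_sub_le_of_contDiffOn hD hbdd hK hh hpos hlt (hpw i) hsub
      refine ⟨ih.1.trans h1, ?_⟩
      rw [← intervalIntegral.integral_add_adjacent_intervals ih.1 h1, mul_add]
      refine (abs_sub_le _ (Real.log ‖h (γ (t i.castSucc))‖) _).trans ?_
      linarith [ih.2]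
  have := (key (Fin.last k)).2
  rwa [ht1] at this

theorem exists_contDiff_curve (hD : IsOpen D) (hconn : IsConnected D) {z w : Fin n → ℂ}
    (hz : z ∈ D) (hw : w ∈ D) : ∃ γ : ℝ → Fin n → ℂ, ContDiff ℝ 1 γ ∧ γ 0 = z ∧ γ 1 = w ∧
      ∀ t ∈ Icc (0 : ℝ) 1, γ t ∈ D := by
  obtain ⟨p, hp⟩ := (hD.isConnected_iff_isPathConnected.1 hconn).joinedIn z hz w hw
  obtain ⟨ε, hε, hεD⟩ := (isCompact_range p.continuous).exists_thickening_subset_open hD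
    (range_subset_iff.2 hp)
  set f : C(unitInterval, Fin n → ℂ) := ⟨p, p.continuous⟩ with hf
  have h1 := Metric.tendsto_atTop.1 (bernsteinApproximation_uniform f) ε hε
  obtain ⟨N, hN⟩ := h1
  set m := N + 1 with hm
  have hd := hN m (by omega)
  set γ : ℝ → Fin n → ℂ := fun t => ∑ k : Fin (m + 1),
    ((m.choose k : ℝ) * t ^ (k : ℕ) * (1 - t) ^ (m - k)) •
      f (bernstein.z k) with hγ
  have hγf : ∀ t : unitInterval, γ t = bernsteinApproximation m f t := fun t => by
    rw [bernsteinApproximation.apply]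
    simp only [hγ, bernstein_apply]
  refine ⟨γ, ?_, ?_, ?_, fun t ht => ?_⟩
  · exact ContDiff.sum fun k _ => by fun_prop
  · have := hγf 0
    rw [bernsteinApproximation.apply_zero] at this
    simpa [hf] using this
  · have := hγf 1
    rw [bernsteinApproximation.apply_one (by omega)] at this
    simpa [hf] using this
  · refine hεD (mem_thickening_iff.2 ⟨p ⟨t, ht⟩, mem_range_self _, ?_⟩)
    rw [hγf ⟨t, ht⟩]
    exact (ContinuousMap.dist_apply_le_dist (f := bernsteinApproximation m f) (g :=
        f) ⟨t, ht⟩).trans_lt hd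

theorem abs_log_norm_sub_le_of_mem_bergmanBall (hD : IsOpen D) (hconn : IsConnected D)
    (hbdd : Bornology.IsBounded D) (hK : IsBergmanKernel D K) {h : (Fin n → ℂ) → ℂ}
    (hh : DifferentiableOn ℂ h D) (hpos : ∀ w ∈ D, 0 < (h w).re) {p : Fin n → ℂ} (hp : p ∈ D)
    {r : ℝ} (hz : z ∈ bergmanBall D K p r) :
    |Real.log ‖h z‖ - Real.log ‖h p‖| ≤ 2 * r := by
  obtain ⟨γ₀, hγ₀, h0, h1, hD0⟩ := exists_contDiff_curve hD hconn hp hz.1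
  have hne : {L : ℝ | ∃ γ : ℝ → (Fin n → ℂ), γ 0 = p ∧ γ 1 = z ∧
      (∀ t ∈ Set.Icc (0:ℝ) 1, γ t ∈ D) ∧ PiecewiseC1 γ ∧ L = bergmanLength K γ}.Nonempty := by
    refine ⟨_, γ₀, h0, h1, hD0, ⟨hγ₀.continuous.continuousOn, 1, ![0, 1], ?_, rfl, rfl,
      fun i => hγ₀.contDiffOn⟩, rfl⟩
    rw [Fin.strictMono_iff_lt_succ]
    intro i
    fin_cases i
    simp
  obtain ⟨_, ⟨γ, e0, e1, eD, epw, rfl⟩, hlt⟩ := exists_lt_of_csInf_lt hne hz.2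
  have := abs_log_norm_sub_le hD hbdd hK hh hpos epw eD
  rw [e0, e1] at this
  linarith

end Curves

section LeviCalculus

variable {n : ℕ} {f g : (Fin n → ℂ) → ℝ} {z : Fin n → ℂ}

local notation "conj" => starRingEnd ℂ

theorem norm_sq_sum_wderiv_mul (hf : DifferentiableAt ℝ f z) (ξ : Fin n → ℂ) :
    ‖∑ μ, wderiv μ (fun u => (f u : ℂ)) z * ξ μ‖ ^ 2 =
      (fderiv ℝ f z ξ ^ 2 + fderiv ℝ f z (Complex.I • ξ) ^ 2) / 4 := by
  rw [sum_wderiv_ofReal_mul hf, ← Complex.normSq_eq_norm_sq, Complex.normSq_div,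
    Complex.normSq_apply]
  simp
  norm_num
  ring

theorem sum_norm_wderiv_sq_le (f : (Fin n → ℂ) → ℝ) (z : Fin n → ℂ) :
    ∑ j, ‖wderiv j (fun u => (f u : ℂ)) z‖ ^ 2 ≤ n * ‖fderiv ℝ f z‖ ^ 2 := by
  by_cases hf : DifferentiableAt ℝ f z
  · calc _ ≤ ∑ _j : Fin n, ‖fderiv ℝ f z‖ ^ 2 := Finset.sum_le_sum fun j _ => ?_
      _ = _ := by simp
    have h := norm_sq_sum_wderiv_mul hf (Pi.single j 1)
    have h1 : ∑ μ, wderiv μ (fun u => (f u : ℂ)) z * (Pi.single j 1 : Fin n → ℂ) μ =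
        wderiv j (fun u => (f u : ℂ)) z := by
      simp [Pi.single_apply]
    rw [h1] at h
    have h2 : ∀ v : Fin n → ℂ, ‖v‖ = 1 → fderiv ℝ f z v ^ 2 ≤ ‖fderiv ℝ f z‖ ^ 2 := fun v hv => by
      have := (fderiv ℝ f z).le_opNorm v
      rw [hv, mul_one] at this
      rw [← sq_abs]
      exact pow_le_pow_left₀ (abs_nonneg _) this 2
    have h3 : ‖(Pi.single j 1 : Fin n → ℂ)‖ = 1 := by
      rw [Pi.norm_single, norm_one]
    have h4 := h2 (Pi.single j 1) h3
    have h5 := h2 (Complex.I • Pi.single j 1) (by rw [norm_smul, h3]; simp)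
    rw [h]
    nlinarith [sq_nonneg ‖fderiv ℝ f z‖]
  · have h0 : ∀ j, wderiv j (fun u => (f u : ℂ)) z = 0 := fun j => by
      have : ¬ DifferentiableAt ℝ (fun u => (f u : ℂ)) z := fun h =>
        hf (Complex.reCLM.differentiableAt.comp z h)
      simp [wderiv, fderiv_zero_of_not_differentiableAt this]
    simp only [h0, norm_zero, ne_eq, OfNat.ofNat_ne_zero, not_false_eq_true, zero_pow,
        Finset.sum_const_zero]
    positivity

theorem hess_comp {h : ℝ → ℝ} (hh : ContDiffAt ℝ 2 h (f z)) (hf : ContDiffAt ℝ 2 f z)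
    (u : Fin n → ℂ) : hess (fun w => h (f w)) z u u =
      deriv h (f z) * hess f z u u + deriv (deriv h) (f z) * fderiv ℝ f z u ^ 2 := by
  have hc : ContDiffAt ℝ 2 (fun w => h (f w)) z := hh.comp z hf
  have hfz : HasFDerivAt f (fderiv ℝ f z) z := (hf.differentiableAt (by norm_num)).hasFDerivAt
  have hev : (fun w => fderiv ℝ (fun w => h (f w)) w u) =ᶠ[𝓝 z]
      fun w => deriv h (f w) * fderiv ℝ f w u := by
    filter_upwards [hf.eventually (by simp), hf.continuousAt.eventually (hh.eventually (by simp))]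
      with w h1 h2
    have h3 := (h2.differentiableAt (by norm_num)).hasDerivAt.comp_hasFDerivAt w
      (h1.differentiableAt (by norm_num)).hasFDerivAt
    have h4 : fderiv ℝ (fun w => h (f w)) w = _ := h3.fderiv
    rw [h4]
    rfl
  have hd : HasDerivAt (deriv h) (deriv (deriv h) (f z)) (f z) := by
    have h5 : ContDiffAt ℝ 1 (deriv h) (f z) := by
      have h8 := (hh.fderiv_right (m := 1) (by norm_num)).clm_apply (contDiffAt_const (c :=
          (1 : ℝ)))
      exact h8
    exact (h5.differentiableAt (by norm_num)).hasDerivAt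
  have h6 : HasFDerivAt (fun w => fderiv ℝ f w u) _ z :=
    (hf.differentiableAt_fderiv.clm_apply (differentiableAt_const u)).hasFDerivAt
  have h7 : fderiv ℝ (fun w => deriv h (f w) * fderiv ℝ f w u) z = _ :=
    ((hd.comp_hasFDerivAt z hfz).mul h6).fderiv
  rw [← fderiv_fderiv_apply hc, hev.fderiv_eq, h7]
  simp only [add_apply, smul_apply, fderiv_fderiv_apply hf, smul_eq_mul, Function.comp_apply]
  ring

theorem leviForm_comp {h : ℝ → ℝ} (hh : ContDiffAt ℝ 2 h (f z)) (hf : ContDiffAt ℝ 2 f z)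
    (ξ : Fin n → ℂ) : leviForm (fun w => h (f w)) z ξ = deriv h (f z) * leviForm f z ξ +
      deriv (deriv h) (f z) * ‖∑ μ, wderiv μ (fun u => (f u : ℂ)) z * ξ μ‖ ^ 2 := by
  have hc : ContDiffAt ℝ 2 (fun w => h (f w)) z := hh.comp z hf
  rw [leviForm_eq hc, leviForm_eq hf, hess_comp hh hf, hess_comp hh hf,
    norm_sq_sum_wderiv_mul (hf.differentiableAt (by norm_num))]
  ring

theorem hess_add (hf : ContDiffAt ℝ 2 f z) (hg : ContDiffAt ℝ 2 g z) (u v : Fin n → ℂ) :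
    hess (fun w => f w + g w) z u v = hess f z u v + hess g z u v := by
  have h1 : fderiv ℝ (fun w => f w + g w) =ᶠ[𝓝 z] fun w => fderiv ℝ f w + fderiv ℝ g w := by
    filter_upwards [hf.eventually (by simp), hg.eventually (by simp)] with w h1 h2
    exact fderiv_fun_add (h1.differentiableAt (by norm_num)) (h2.differentiableAt (by norm_num))
  rw [hess, h1.fderiv_eq, fderiv_fun_add hf.differentiableAt_fderiv hg.differentiableAt_fderiv]
  rfl

theorem leviForm_add (hf : ContDiffAt ℝ 2 f z) (hg : ContDiffAt ℝ 2 g z) (ξ : Fin n → ℂ) :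
    leviForm (fun w => f w + g w) z ξ = leviForm f z ξ + leviForm g z ξ := by
  have hc : ContDiffAt ℝ 2 (fun w => f w + g w) z := hf.add hg
  rw [leviForm_eq hc, leviForm_eq hf, leviForm_eq hg, hess_add hf hg, hess_add hf hg]
  ring

theorem leviForm_const_mul (hf : ContDiffAt ℝ 2 f z) (c : ℝ) (ξ : Fin n → ℂ) :
    leviForm (fun w => c * f w) z ξ = c * leviForm f z ξ := by
  have h1 : deriv (fun x : ℝ => c * x) = fun _ => c := by ext x; simp
  rw [leviForm_comp (h := fun x => c * x) (by fun_prop) hf, h1]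
  simp

theorem continuous_hess (hf : ContDiff ℝ 2 f) :
    Continuous fun p : (Fin n → ℂ) × (Fin n → ℂ) × (Fin n → ℂ) => hess f p.1 p.2.1 p.2.2 := by
  have h1 : Continuous (fderiv ℝ (fderiv ℝ f)) :=
    (hf.fderiv_right (m := 1) (by norm_num)).continuous_fderiv (by norm_num)
  exact ((h1.comp continuous_fst).clm_apply continuous_snd.fst).clm_apply continuous_snd.snd

theorem continuous_leviForm (hf : ContDiff ℝ 2 f) :
    Continuous fun p : (Fin n → ℂ) × (Fin n → ℂ) => leviForm f p.1 p.2 := by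
  simp only [leviForm_eq hf.contDiffAt]
  have h1 := (continuous_hess hf).comp (f := fun p : (Fin n → ℂ) × (Fin n → ℂ) => (p.1, p.2, p.2))
    (by fun_prop)
  have h2 := (continuous_hess hf).comp (f := fun p : (Fin n → ℂ) × (Fin n → ℂ) =>
    (p.1, Complex.I • p.2, Complex.I • p.2)) (by fun_prop)
  exact (h1.add h2).div_const 4

theorem leviForm_smul (hf : ContDiffAt ℝ 2 f z) (c : ℝ) (ξ : Fin n → ℂ) :
    leviForm f z ((c : ℂ) • ξ) = c ^ 2 * leviForm f z ξ := by
  have h1 : ∀ v : Fin n → ℂ, hess f z (c • v) (c • v) = c ^ 2 * hess f z v v := fun v => by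
    simp only [hess, map_smul, smul_apply, smul_eq_mul]
    ring
  rw [leviForm_eq hf, leviForm_eq hf, smul_comm, Complex.coe_smul, Complex.coe_smul, h1, h1]
  ring

theorem hess_nsq (z u v : Fin n → ℂ) :
    hess nsq z u v = ∑ μ, 2 * (conj (u μ) * v μ).re := by
  have h1 : ∀ w : Fin n → ℂ, HasFDerivAt (nsq : (Fin n → ℂ) → ℝ)
      (∑ μ, (2 : ℝ) • Complex.reCLM.comp
        ((conj (w μ) • ContinuousLinearMap.proj (R := ℂ) (φ :=
            fun _ : Fin n => ℂ) μ).restrictScalars ℝ))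
      w := fun w => by
    refine HasFDerivAt.fun_sum fun μ _ => ?_
    have h2 : HasFDerivAt (fun z : Fin n → ℂ => z μ)
      ((ContinuousLinearMap.proj (R := ℂ) (φ := fun _ : Fin n => ℂ) μ).restrictScalars ℝ) w :=
      ((ContinuousLinearMap.proj (R := ℂ) (φ :=
          fun _ : Fin n => ℂ) μ).restrictScalars ℝ).hasFDerivAt
    refine (h2.norm_sq).congr_fderiv ?_
    ext v
    simp [Complex.inner]
    ring
  have h3 : ∀ w, fderiv ℝ nsq w v = ∑ μ, 2 * (conj (w μ) * v μ).re := fun w => by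
    rw [(h1 w).fderiv]
    simp
  rw [← fderiv_fderiv_apply contDiff_nsq.contDiffAt]
  simp only [h3]
  have h4 : HasFDerivAt (fun w : Fin n → ℂ => ∑ μ, 2 * (conj (w μ) * v μ).re)
      (∑ μ, (2 : ℝ) • Complex.reCLM.comp
        (((v μ) • ContinuousLinearMap.id ℂ ℂ).restrictScalars ℝ |>.comp
          (Complex.conjCLE.toContinuousLinearMap.comp
        ((ContinuousLinearMap.proj (R := ℂ) (φ :=
            fun _ : Fin n => ℂ) μ).restrictScalars ℝ)))) z := by
    have h5 := (∑ μ, (2 : ℝ) • Complex.reCLM.comp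
        (((v μ) • ContinuousLinearMap.id ℂ ℂ).restrictScalars ℝ |>.comp
          (Complex.conjCLE.toContinuousLinearMap.comp
        ((ContinuousLinearMap.proj (R := ℂ) (φ := fun _ : Fin n => ℂ) μ).restrictScalars
          ℝ)))).hasFDerivAt (x := z)
    refine h5.congr_of_eventuallyEq (.of_forall fun w => ?_)
    simp [mul_comm]
  rw [h4.fderiv]
  simp [mul_comm]

theorem leviForm_nsq (z ξ : Fin n → ℂ) : leviForm nsq z ξ = nsq ξ := by
  rw [leviForm_eq contDiff_nsq.contDiffAt, hess_nsq, hess_nsq, ← Finset.sum_add_distrib,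
    Finset.sum_div, nsq]
  refine Finset.sum_congr rfl fun μ _ => ?_
  rw [← Complex.normSq_eq_norm_sq, Complex.normSq_apply]
  simp
  ring

end LeviCalculus

section GlobalDefining

variable {n : ℕ} {D : Set (Fin n → ℂ)}

theorem IsCompact.exists_le_add_mul {X : Type*} [TopologicalSpace X] {S : Set X}
    (hS : IsCompact S) {f g : X → ℝ} (hf : Continuous f) (hg : Continuous g)
    (hg0 : ∀ x ∈ S, 0 ≤ g x) (h : ∀ x ∈ S, g x = 0 → 0 < f x) :
    ∃ A > 0, ∃ m > 0, ∀ x ∈ S, m ≤ f x + A * g x := by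
  have hmono : ∀ {a b : ℕ}, a ≤ b → ∀ x ∈ S, 0 < f x + (a + 1) * g x → 0 < f x + (b + 1) * g x :=
    fun {a b} hab x hx h1 => by
      have h2 : (a : ℝ) ≤ b := by exact_mod_cast hab
      nlinarith [hg0 x hx]
  obtain ⟨A, hA⟩ : ∃ A : ℕ, ∀ x ∈ S, 0 < f x + (A + 1) * g x := by
    obtain ⟨t, ht⟩ := hS.elim_finite_subcover (fun A : ℕ => {x | 0 < f x + (A + 1) * g x})
      (fun A => isOpen_lt continuous_const (hf.add (continuous_const.mul hg))) fun x hx => by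
        rw [mem_iUnion]
        rcases (hg0 x hx).eq_or_lt with h0 | h0
        · exact ⟨0, by simpa [← h0] using h x hx h0.symm⟩
        · obtain ⟨m, hm⟩ := exists_nat_gt (-f x / g x)
          rw [div_lt_iff₀ h0] at hm
          exact ⟨m, by simp only [mem_ofPred_eq]; linarith⟩
    refine ⟨t.sup id, fun x hx => ?_⟩
    obtain ⟨i, hi, hxi⟩ := mem_iUnion₂.1 (ht hx)
    exact hmono (Finset.le_sup (f := id) hi) x hx hxi
  refine ⟨A + 1, by positivity, ?_⟩
  rcases S.eq_empty_or_nonempty with rfl | hne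
  · exact ⟨1, one_pos, by simp⟩
  obtain ⟨x₀, hx₀, hmin⟩ := hS.exists_isMinOn hne (hf.add (continuous_const.mul hg)).continuousOn
  exact ⟨_, hA x₀ hx₀, fun x hx => hmin hx⟩

theorem le_leviForm_of_unit {r : (Fin n → ℂ) → ℝ} {z : Fin n → ℂ} (hr : ContDiffAt ℝ 2 r z)
    {m : ℝ} (hm : 0 ≤ m) (h : ∀ ξ : Fin n → ℂ, ‖ξ‖ = 1 → m ≤ leviForm r z ξ) (ξ : Fin n → ℂ) :
    m / (n + 1) * nsq ξ ≤ leviForm r z ξ := by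
  have h1 : m * ‖ξ‖ ^ 2 ≤ leviForm r z ξ := by
    by_cases h0 : ξ = 0
    · have h2 := leviForm_smul hr 0 ξ
      rw [Complex.ofReal_zero, zero_smul] at h2
      rw [h0, h2, norm_zero]
      simp
    have h2 : ξ = ((‖ξ‖ : ℝ) : ℂ) • (((‖ξ‖⁻¹ : ℝ) : ℂ) • ξ) := by
      rw [smul_smul, ← Complex.ofReal_mul, mul_inv_cancel₀ (norm_ne_zero_iff.2 h0)]
      simp
    have h3 := h (((‖ξ‖⁻¹ : ℝ) : ℂ) • ξ) (by
      rw [norm_smul, Complex.norm_real, norm_inv, norm_norm,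
        inv_mul_cancel₀ (norm_ne_zero_iff.2 h0)])
    rw [h2, leviForm_smul hr, ← h2]
    nlinarith [sq_nonneg ‖ξ‖]
  have h4 := nsq_le ξ
  have h5 : m / (n + 1) * nsq ξ ≤ m / (n + 1) * ((n + 1) * ‖ξ‖ ^ 2) := by
    gcongr
    nlinarith [sq_nonneg ‖ξ‖]
  have h6 : m / (n + 1) * ((n + 1) * ‖ξ‖ ^ 2) = m * ‖ξ‖ ^ 2 := by
    field_simp
  linarith

theorem eq_zero_of_mem_frontier {ρ : (Fin n → ℂ) → ℝ} (hρ : Continuous ρ)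
    (hdef : ∀ z, z ∈ D ↔ ρ z < 0) {z : Fin n → ℂ} (hz : z ∈ frontier D) : ρ z = 0 := by
  have hD : D = {z | ρ z < 0} := Set.ext hdef
  rw [hD] at hz
  exact frontier_lt_subset_eq hρ continuous_const hz

/-- A bounded strongly pseudoconvex domain has a global defining function with relatively compact
sublevel sets which is strictly plurisubharmonic near the boundary. -/
theorem exists_strictly_psh_defining_function {ρ : (Fin n → ℂ) → ℝ}
    (hbdd : Bornology.IsBounded D) (hρ : ContDiff ℝ 2 ρ) (hdef : IsDefiningFunction D ρ)
    (hspc : ∀ z ∈ frontier D, StronglyPseudoconvexAt ρ z) :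
    ∃ r : (Fin n → ℂ) → ℝ, ContDiff ℝ 2 r ∧ (∀ z, z ∈ D ↔ r z < 0) ∧
      (∀ z, z ∈ frontier D ↔ r z = 0) ∧ IsCompact {z | r z ≤ 1 / 2} ∧
      (∀ z ∈ frontier D, fderiv ℝ r z ≠ 0) ∧
      ∃ ε > 0, ∃ c > 0, ∀ z, |r z| ≤ ε → ∀ ξ, c * nsq ξ ≤ leviForm r z ξ := by
  obtain ⟨hDρ, hdρ⟩ := hdef
  have hD : IsOpen D := by
    rw [Set.ext hDρ]
    exact isOpen_lt hρ.continuous continuous_const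
  have hK : IsCompact (closure D) := hbdd.isCompact_closure
  have hF : IsCompact (frontier D) :=
      hK.of_isClosed_subset isClosed_frontier frontier_subset_closure
  have hdiff : Differentiable ℝ ρ := hρ.differentiable (by norm_num)
  have hfd : Continuous (fderiv ℝ ρ) := hρ.continuous_fderiv (by norm_num)
  have hgc : Continuous fun p : (Fin n → ℂ) × (Fin n → ℂ) =>
      ‖∑ μ, wderiv μ (fun u => (ρ u : ℂ)) p.1 * p.2 μ‖ ^ 2 := by
    simp only [norm_sq_sum_wderiv_mul (hdiff _)]
    have h1 := (hfd.comp continuous_fst).clm_apply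
      (continuous_snd (X := Fin n → ℂ) (Y := Fin n → ℂ))
    have h2 := (hfd.comp continuous_fst).clm_apply
      ((continuous_snd (X := Fin n → ℂ) (Y := Fin n → ℂ)).const_smul Complex.I)
    exact ((h1.pow 2).add (h2.pow 2)).div_const 4
  obtain ⟨A, hA, m, hm, hAm⟩ := (hF.prod (isCompact_sphere (0 : Fin n → ℂ) 1)).exists_le_add_mul
    (continuous_leviForm hρ) hgc (fun _ _ => by positivity) fun p hp h0 => by
      refine hspc p.1 hp.1 p.2 ?_ fun h => ?_
      · exact norm_eq_zero.1 (pow_eq_zero_iff two_ne_zero |>.1 h0)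
      · have := hp.2
        simp [h] at this
  set V : Set (Fin n → ℂ) := D ∪ {z | fderiv ℝ ρ z ≠ 0} with hV
  have hVo : IsOpen V := hD.union (isOpen_ne_fun hfd continuous_const)
  have hKV : closure D ⊆ V := fun z hz => by
    by_cases hzD : z ∈ D
    · exact Or.inl hzD
    · exact Or.inr (hdρ z ⟨hz, by rwa [hD.interior_eq]⟩)
  obtain ⟨θ, hθ, hθc, hθV, hθ1, hθI⟩ := exists_cutoff hK hVo hKV
  set r : (Fin n → ℂ) → ℝ := fun z => θ z * (Real.exp (A * ρ z) - 1) + (1 - θ z) with hr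
  have hθ2 : ContDiff ℝ 2 θ := hθ.of_le (by norm_cast)
  have hrC : ContDiff ℝ 2 r :=
    (hθ2.mul ((contDiff_const.mul hρ).exp.sub contDiff_const)).add (contDiff_const.sub hθ2)
  have hrD : ∀ z ∈ closure D, r =ᶠ[𝓝 z] fun w => Real.exp (A * ρ w) - 1 := fun z hz => by
    filter_upwards [hθ1.filter_mono (nhds_le_nhdsSet hz)] with w hw
    simp [hr, hw]
  have hneg : ∀ z, z ∈ D → r z < 0 := fun z hz => by
    have h1 : A * ρ z < 0 := mul_neg_of_pos_of_neg hA ((hDρ z).1 hz)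
    rw [(hrD z (subset_closure hz)).eq_of_nhds, sub_neg]
    exact Real.exp_lt_one_iff.2 h1
  have hexp : ∀ z, z ∉ D → 0 ≤ Real.exp (A * ρ z) - 1 := fun z hz => by
    have h1 : 0 ≤ A * ρ z := mul_nonneg hA.le (not_lt.1 fun h => hz ((hDρ z).2 h))
    linarith [Real.add_one_le_exp (A * ρ z)]
  have hnonneg : ∀ z, z ∉ D → 0 ≤ r z := fun z hz =>
    add_nonneg (mul_nonneg (hθI z).1 (hexp z hz)) (sub_nonneg.2 (hθI z).2)
  have hzero : ∀ z, z ∈ frontier D → r z = 0 := fun z hz => by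
    rw [(hrD z (frontier_subset_closure hz)).eq_of_nhds,
      eq_zero_of_mem_frontier hρ.continuous hDρ hz]
    simp
  have hfront : ∀ z, r z = 0 → z ∈ frontier D := fun z hz => by
    have hzD : z ∉ D := fun h => (hneg z h).ne hz
    have e1 := mul_nonneg (hθI z).1 (hexp z hzD)
    have e2 := sub_nonneg.2 (hθI z).2
    simp only [hr] at hz
    have hθz : θ z = 1 := by linarith
    rw [hθz] at hz
    have h3 : ρ z = 0 := by
      have h4 : Real.exp (A * ρ z) = 1 := by linarith
      rcases mul_eq_zero.1 (Real.exp_eq_one_iff _ |>.1 h4) with h | h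
      · exact absurd h hA.ne'
      · exact h
    have hzV : fderiv ℝ ρ z ≠ 0 := (hθV (subset_tsupport _ (by simp [hθz]))).resolve_left hzD
    refine ⟨by_contra fun hcl => hzV ?_, by rwa [hD.interior_eq]⟩
    refine IsLocalMin.fderiv_eq_zero ?_
    filter_upwards [isClosed_closure.isOpen_compl.mem_nhds hcl] with w hw
    rw [h3]
    exact not_lt.1 fun h => hw (subset_closure ((hDρ w).2 h))
  have hcpt : IsCompact {z | r z ≤ 1 / 2} := by
    refine hθc.isCompact.of_isClosed_subset (isClosed_le hrC.continuous continuous_const)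
      fun z hz => by_contra fun h => ?_
    have h0 := image_eq_zero_of_notMem_tsupport h
    simp only [mem_ofPred_eq, hr, h0] at hz
    norm_num at hz
  have hh : ContDiff ℝ 2 fun x : ℝ => Real.exp (A * x) - 1 := by fun_prop
  have hh1 : deriv (fun x : ℝ => Real.exp (A * x) - 1) = fun x => A * Real.exp (A * x) := by
    ext x
    have := (((hasDerivAt_id x).const_mul A).exp.sub_const 1).deriv
    simp only [id_eq, mul_one] at this
    rw [this, mul_comm]
  have hh2 : deriv (fun x : ℝ => A * Real.exp (A * x)) = fun x => A * (A * Real.exp (A * x)) := by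
    ext x
    have := (((hasDerivAt_id x).const_mul A).exp.const_mul A).deriv
    simp only [id_eq, mul_one] at this
    rw [this, mul_comm (Real.exp _)]
  have hlevi : ∀ z ∈ frontier D, ∀ ξ : Fin n → ℂ, ‖ξ‖ = 1 → 0 < leviForm r z ξ :=
    fun z hz ξ hξ => by
      rw [leviForm_congr_of_eventuallyEq (hrD z (frontier_subset_closure hz)),
        leviForm_comp hh.contDiffAt hρ.contDiffAt, hh1, hh2,
        eq_zero_of_mem_frontier hρ.continuous hDρ hz]
      simp only [mul_zero, Real.exp_zero, mul_one]
      have := hAm (z, ξ) ⟨hz, by simpa using hξ⟩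
      simp only at this
      have h2 : 0 < A * (leviForm ρ z ξ + A * ‖∑ μ, wderiv μ (fun u => (ρ u : ℂ)) z * ξ μ‖ ^ 2) :=
        mul_pos hA (hm.trans_le this)
      linarith
  obtain ⟨A', hA', m', hm', hAm'⟩ :=
    (hcpt.prod (isCompact_sphere (0 : Fin n → ℂ) 1)).exists_le_add_mul (continuous_leviForm hrC)
    ((hrC.continuous.comp continuous_fst).abs) (fun _ _ => abs_nonneg _) fun p hp h0 =>
      hlevi p.1 (hfront _ (abs_eq_zero.1 h0)) p.2 (by simpa using hp.2)
  refine ⟨r, hrC, fun z => ⟨hneg z, fun h => by_contra fun h' => (hnonneg z h').not_gt h⟩,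
    fun z => ⟨hzero z, hfront z⟩, hcpt, fun z hz => ?_, min (1 / 2) (m' / (2 * A')),
    by positivity, m' / 2 / (n + 1), by positivity, fun z hz ξ => ?_⟩
  · rw [(hrD z (frontier_subset_closure hz)).fderiv_eq]
    have h1 := (hh.differentiable (by norm_num) (ρ z)).hasDerivAt.comp_hasFDerivAt z
      (hdiff z).hasFDerivAt
    have h2 : fderiv ℝ (fun w => Real.exp (A * ρ w) - 1) z = _ := h1.fderiv
    rw [h2, hh1]
    exact smul_ne_zero (mul_pos hA (Real.exp_pos _)).ne' (hdρ z hz)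
  · refine le_leviForm_of_unit hrC.contDiffAt (by positivity) (fun ξ hξ => ?_) ξ
    have h1 := hAm' (z, ξ) ⟨(le_abs_self _).trans (hz.trans (min_le_left _ _)), by simpa using hξ⟩
    simp only [Function.comp_apply] at h1
    have h2 : A' * |r z| ≤ m' / 2 := by
      calc A' * |r z| ≤ A' * (m' / (2 * A')) := by
            gcongr
            exact hz.trans (min_le_right _ _)
        _ = m' / 2 := by field_simp
    linarith

end GlobalDefining

section Sublevel

variable {n : ℕ} {r : (Fin n → ℂ) → ℝ} {c ε : ℝ}

theorem deriv_smoothTransition_of_one_lt {x : ℝ} (hx : 1 < x) :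
    deriv Real.smoothTransition x = 0 := by
  have h : Real.smoothTransition =ᶠ[𝓝 x] fun _ => 1 := by
    filter_upwards [lt_mem_nhds hx] with y hy using Real.smoothTransition.one_of_one_le hy.le
  rw [h.deriv_eq, deriv_const]

theorem exists_abs_deriv_smoothTransition_le : ∃ B, ∀ x, |deriv Real.smoothTransition x| ≤ B := by
  have hc : Continuous (deriv Real.smoothTransition) :=
    (Real.smoothTransition.contDiff (n := 1)).continuous_deriv (by norm_num)
  obtain ⟨B, hB⟩ := (isCompact_Icc (a := (0 : ℝ)) (b := 1)).exists_bound_of_continuousOn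
    hc.continuousOn
  have hB0 : 0 ≤ B := (norm_nonneg _).trans (hB 0 (by simp))
  refine ⟨B, fun x => ?_⟩
  rcases lt_or_ge x 0 with h | h
  · have h0 : Real.smoothTransition =ᶠ[𝓝 x] fun _ => 0 := by
      filter_upwards [gt_mem_nhds h] with y hy using Real.smoothTransition.zero_of_nonpos hy.le
    rw [h0.deriv_eq, deriv_const, abs_zero]
    exact hB0
  · rcases lt_or_ge 1 x with h1 | h1
    · rw [deriv_smoothTransition_of_one_lt h1, abs_zero]
      exact hB0
    · exact hB x ⟨h, h1⟩

theorem exists_isCutoffSequence (hr : ContDiff ℝ 2 r) (hcpt : IsCompact {z | r z ≤ 1 / 2})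
    (hε : ε ≤ 1 / 2) : ∃ C > 0, ∃ η, IsCutoffSequence {z | r z < ε}
      (fun z => Real.log C - 2 * Real.log (ε - r z)) η := by
  obtain ⟨B, hB⟩ := exists_abs_deriv_smoothTransition_le
  have hB0 : 0 ≤ B := (abs_nonneg _).trans (hB 0)
  obtain ⟨G, hG⟩ := hcpt.exists_bound_of_continuousOn
    (hr.continuous_fderiv (by norm_num)).continuousOn
  have hsub : ∀ m : ℕ, {z | r z ≤ ε - 1 / (m + 1)} ⊆ {z | r z < ε} := fun m z hz => by
    have h1 : (0 : ℝ) < 1 / (m + 1) := by positivity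
    simp only [mem_ofPred_eq] at hz ⊢
    linarith
  have hcl : ∀ m : ℕ, IsCompact {z | r z ≤ ε - 1 / (m + 1)} := fun m =>
    hcpt.of_isClosed_subset (isClosed_le hr.continuous continuous_const) fun z hz => by
      have := hsub m hz
      simp only [mem_ofPred_eq] at this ⊢
      linarith
  set η : ℕ → (Fin n → ℂ) → ℝ := fun m z =>
    Real.smoothTransition ((m + 1) * (ε - r z) - 1) with hη
  have hts : ∀ m, tsupport (η m) ⊆ {z | r z ≤ ε - 1 / (m + 1)} := fun m =>
    closure_minimal (fun z hz => by
      by_contra h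
      simp only [mem_ofPred_eq, not_le] at h
      refine hz (Real.smoothTransition.zero_of_nonpos ?_)
      have h1 : (0 : ℝ) < m + 1 := by positivity
      have h2 : ε - r z < 1 / (m + 1) := by linarith
      rw [lt_div_iff₀ h1] at h2
      linarith) (isClosed_le hr.continuous continuous_const)
  refine ⟨n * (2 * B * G) ^ 2 + 1, by positivity, η, fun m => ?_, fun m => ?_, fun m => ?_,
    fun m z => ?_, fun m z hz => ?_, fun z hz => ?_⟩
  · exact Real.smoothTransition.contDiff.comp
      ((contDiff_const.mul (contDiff_const.sub hr)).sub contDiff_const)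
  · exact (hcl m).of_isClosed_subset (isClosed_tsupport _) (hts m)
  · exact (hts m).trans (hsub m)
  · rw [abs_of_nonneg (Real.smoothTransition.nonneg _)]
    exact Real.smoothTransition.le_one _
  · have hσ : 0 < ε - r z := sub_pos.2 hz
    have hd : HasFDerivAt (η m) (deriv Real.smoothTransition ((m + 1) * (ε - r z) - 1) •
        ((m + 1 : ℝ) • -fderiv ℝ r z)) z := by
      have h1 := ((((hr.differentiable (by norm_num)) z).hasFDerivAt.const_sub ε).const_mul
        (m + 1 : ℝ)).sub_const 1
      exact (((Real.smoothTransition.contDiff (n := 1)).differentiable (by norm_num))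
        _).hasDerivAt.comp_hasFDerivAt z h1
    have hn : ‖fderiv ℝ (η m) z‖ ≤ 2 * B * G / (ε - r z) := by
      rw [hd.fderiv, norm_smul, norm_smul, norm_neg, Real.norm_eq_abs, Real.norm_eq_abs]
      have hGz := hG z (by simp only [mem_ofPred_eq] at hz ⊢; linarith)
      have hG0 := (norm_nonneg _).trans hGz
      rcases lt_or_ge 1 ((m + 1) * (ε - r z) - 1) with h | h
      · rw [deriv_smoothTransition_of_one_lt h, abs_zero, zero_mul]
        positivity
      · have h2 : (m + 1 : ℝ) ≤ 2 / (ε - r z) := by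
          rw [le_div_iff₀ hσ]
          linarith
        rw [abs_of_pos (show (0 : ℝ) < m + 1 by positivity)]
        calc _ ≤ B * (2 / (ε - r z) * G) := by gcongr; exact hB _
          _ = _ := by ring
    refine (sum_norm_wderiv_sq_le _ _).trans ?_
    have he : Real.exp (Real.log (n * (2 * B * G) ^ 2 + 1) - 2 * Real.log (ε - r z)) =
        (n * (2 * B * G) ^ 2 + 1) / (ε - r z) ^ 2 := by
      rw [Real.exp_sub, Real.exp_log (by positivity), two_mul (Real.log _), Real.exp_add,
        Real.exp_log hσ, sq (ε - r z)]
    rw [he]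
    calc _ ≤ n * (2 * B * G / (ε - r z)) ^ 2 := by gcongr
      _ = n * (2 * B * G) ^ 2 / (ε - r z) ^ 2 := by rw [div_pow]; ring
      _ ≤ _ := by gcongr; linarith
  · have hσ : 0 < ε - r z := sub_pos.2 hz
    obtain ⟨m₀, hm₀⟩ := exists_nat_gt (2 / (ε - r z))
    filter_upwards [eventually_ge_atTop m₀] with m hm
    have h2 : 2 < (m + 1) * (ε - r z) := by
      rw [div_lt_iff₀ hσ] at hm₀
      have : (m₀ : ℝ) ≤ m := by exact_mod_cast hm
      nlinarith
    filter_upwards [(continuous_const.mul (continuous_const.sub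
        hr.continuous)).continuousAt.eventually
      (lt_mem_nhds h2)] with w hw
    have hw' : 2 < (m + 1 : ℝ) * (ε - r w) := hw
    exact Real.smoothTransition.one_of_one_le (by linarith)

theorem leviForm_inv_sub (hr : ContDiff ℝ 2 r) {z : Fin n → ℂ} (hz : r z < ε) (ξ : Fin n → ℂ) :
    leviForm (fun w => (ε - r w)⁻¹) z ξ = ((ε - r z) ^ 2)⁻¹ * leviForm r z ξ +
      2 * ((ε - r z) ^ 3)⁻¹ * ‖∑ μ, wderiv μ (fun u => (r u : ℂ)) z * ξ μ‖ ^ 2 := by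
  have hσ : ε - r z ≠ 0 := (sub_pos.2 hz).ne'
  have h1 : deriv (fun t : ℝ => (ε - t)⁻¹) = fun t => ((ε - t) ^ 2)⁻¹ := by
    ext t
    rw [deriv_comp_const_sub (f := fun t : ℝ => t⁻¹), deriv_inv, neg_neg]
  have h2 : HasDerivAt (fun t : ℝ => ((ε - t) ^ 2)⁻¹) (2 * ((ε - r z) ^ 3)⁻¹) (r z) := by
    have h : HasDerivAt (fun t : ℝ => ((ε - t) ^ 2)⁻¹) _ (r z) :=
      (((hasDerivAt_id' (r z)).const_sub ε).fun_pow 2).fun_inv (pow_ne_zero 2 hσ)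
    refine h.congr_deriv ?_
    field_simp
    norm_num
    ring
  rw [leviForm_comp (h := fun t => (ε - t)⁻¹) ((contDiffAt_const.sub contDiffAt_id).inv hσ)
    hr.contDiffAt, h1, h2.deriv]

theorem exists_mul_nsq_le_leviForm_inv_sub (hr : ContDiff ℝ 2 r)
    (hcpt : IsCompact {z | r z ≤ 1 / 2}) (hc : 0 < c) (hε0 : 0 < ε) (hε : ε ≤ 1 / 2)
    (hlevi : ∀ z, |r z| ≤ ε → ∀ ξ, c * nsq ξ ≤ leviForm r z ξ) :
    ∃ κ > 0, ∃ c' > 0, ∀ z, r z < ε → ∀ ξ,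
      c' / (ε - r z) ^ 2 * nsq ξ ≤ nsq ξ + κ * (((ε - r z) ^ 2)⁻¹ * leviForm r z ξ) := by
  obtain ⟨M, hM0, hM⟩ : ∃ M > 0, ∀ z, r z ≤ 1 / 2 → ∀ ξ, -M * nsq ξ ≤ leviForm r z ξ := by
    obtain ⟨M, hM⟩ := (hcpt.prod (isCompact_sphere (0 : Fin n → ℂ) 1)).exists_bound_of_continuousOn
      (continuous_leviForm hr).continuousOn
    refine ⟨|M| + 1, by positivity, fun z hz ξ => ?_⟩
    rcases eq_or_ne ξ 0 with rfl | h0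
    · have h2 := leviForm_smul (hr.contDiffAt (x := z)) 0 0
      rw [Complex.ofReal_zero, zero_smul] at h2
      rw [h2]
      simp [nsq]
    have h2 : ξ = ((‖ξ‖ : ℝ) : ℂ) • (((‖ξ‖⁻¹ : ℝ) : ℂ) • ξ) := by
      rw [smul_smul, ← Complex.ofReal_mul, mul_inv_cancel₀ (norm_ne_zero_iff.2 h0)]
      simp
    have h3 := hM (z, ((‖ξ‖⁻¹ : ℝ) : ℂ) • ξ) ⟨hz, by
      rw [mem_sphere_zero_iff_norm, norm_smul, Complex.norm_real, norm_inv, norm_norm,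
        inv_mul_cancel₀ (norm_ne_zero_iff.2 h0)]⟩
    have h4 := (abs_le.1 (Real.norm_eq_abs _ ▸ h3)).1
    rw [h2, leviForm_smul hr.contDiffAt, ← h2]
    have h5 := norm_sq_le_nsq ξ
    have h6 := le_abs_self M
    have h7 : -(|M| + 1) * ‖ξ‖ ^ 2 ≤ ‖ξ‖ ^ 2 * leviForm r z (((‖ξ‖⁻¹ : ℝ) : ℂ) • ξ) := by
      nlinarith [sq_nonneg ‖ξ‖]
    nlinarith [abs_nonneg M]
  refine ⟨2 * ε ^ 2 / M, by positivity, min (2 * ε ^ 2 / M * c) (2 * ε ^ 2), by positivity,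
    fun z hz ξ => ?_⟩
  have hσ : 0 < ε - r z := sub_pos.2 hz
  have hn := nsq_nonneg ξ
  rcases le_or_gt (ε - r z) (2 * ε) with h | h
  · have h1 := hlevi z (abs_le.2 ⟨by linarith, hz.le⟩) ξ
    calc _ ≤ (2 * ε ^ 2 / M * c) / (ε - r z) ^ 2 * nsq ξ := by gcongr; exact min_le_left _ _
      _ = 0 + 2 * ε ^ 2 / M * (((ε - r z) ^ 2)⁻¹ * (c * nsq ξ)) := by ring
      _ ≤ _ := by gcongr
  · have h1 := hM z (by linarith) ξ
    have h2 : 2 * ε ^ 2 / (ε - r z) ^ 2 ≤ 1 / 2 := by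
      rw [div_le_iff₀ (by positivity)]
      nlinarith
    calc _ ≤ 2 * ε ^ 2 / (ε - r z) ^ 2 * nsq ξ := by gcongr; exact min_le_right _ _
      _ ≤ nsq ξ - 2 * ε ^ 2 / (ε - r z) ^ 2 * nsq ξ := by nlinarith
      _ = nsq ξ + 2 * ε ^ 2 / M * (((ε - r z) ^ 2)⁻¹ * (-M * nsq ξ)) := by field_simp; ring
      _ ≤ _ := by gcongr

theorem exists_weak_solution_of_bounded (hr : ContDiff ℝ 2 r)
    (hcpt : IsCompact {z | r z ≤ 1 / 2}) (hc : 0 < c) (hε0 : 0 < ε) (hε : ε ≤ 1 / 2)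
    (hlevi : ∀ z, |r z| ≤ ε → ∀ ξ, c * nsq ξ ≤ leviForm r z ξ) :
    ∃ K > 0, ∀ (B : ℝ) (α : Fin n → (Fin n → ℂ) → ℂ),
      (∀ j, AEStronglyMeasurable (α j) (volume.restrict {z | r z < ε})) →
      (∀ j z, r z < ε → ‖α j z‖ ≤ B) →
      (∀ j k χ, IsTest {z | r z < ε} χ →
        ∫ y in {z | r z < ε}, α k y * wderivBar j χ y =
          ∫ y in {z | r z < ε}, α j y * wderivBar k χ y) →
      ∃ u : (Fin n → ℂ) → ℂ, MemLp u 2 (volume.restrict {z | r z < ε / 2}) ∧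
        ∫ z in {z | r z < ε / 2}, ‖u z‖ ^ 2 ≤ K * B ^ 2 ∧
        ∀ j χ, IsTest {z | r z < ε} χ → ∫ y in {z | r z < ε}, u y * wderivBar j χ y =
          -∫ y in {z | r z < ε}, α j y * χ y := by
  set Ω : Set (Fin n → ℂ) := {z | r z < ε} with hΩe
  have hΩ : IsOpen Ω := isOpen_lt hr.continuous continuous_const
  have hΩm := hΩ.measurableSet
  have hΩf : volume Ω ≠ ∞ := ne_top_of_le_ne_top hcpt.measure_lt_top.ne
    (measure_mono fun z (hz : r z < ε) => (hz.le.trans hε : r z ≤ 1 / 2))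
  obtain ⟨C, hC, η, hη⟩ := exists_isCutoffSequence hr hcpt hε
  obtain ⟨κ, hκ, c', hc', hκc⟩ := exists_mul_nsq_le_leviForm_inv_sub hr hcpt hc hε0 hε hlevi
  obtain ⟨S, hS0, hS⟩ : ∃ S > 0, ∀ z ∈ Ω, ε - r z ≤ S := by
    obtain ⟨S, hS⟩ := hcpt.exists_bound_of_continuousOn
      (continuous_const.sub hr.continuous : Continuous fun z => ε - r z).continuousOn
    refine ⟨|S| + 1, by positivity, fun z hz => ?_⟩
    have h1 : ε - r z ≤ S :=
      (Real.le_norm_self _).trans (hS z ((le_of_lt hz).trans hε : r z ≤ 1 / 2))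
    linarith [le_abs_self S]
  set N : ℝ := 4 * S / κ + 2 * C / c' with hN
  have hN0 : 0 < N := by positivity
  have hN1 : 4 * S ≤ N * κ := by
    rw [hN, add_mul, div_mul_cancel₀ _ hκ.ne']
    have : 0 < 2 * C / c' * κ := by positivity
    linarith
  have hN2 : 2 * C ≤ N * c' := by
    rw [hN, add_mul, div_mul_cancel₀ (2 * C) hc'.ne']
    have : 0 < 4 * S / κ * c' := by positivity
    linarith
  set ψ : (Fin n → ℂ) → ℝ := fun z => Real.log C - 2 * Real.log (ε - r z) with hψe
  set φ : (Fin n → ℂ) → ℝ := fun z => N * (nsq z + κ * (ε - r z)⁻¹) with hφe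
  have hσ : ∀ z ∈ Ω, 0 < ε - r z := fun z hz => sub_pos.2 hz
  have hexpψ : ∀ z ∈ Ω, Real.exp (ψ z) = C / (ε - r z) ^ 2 := fun z hz => by
    simp only [hψe]
    rw [Real.exp_sub, Real.exp_log hC, two_mul, Real.exp_add, Real.exp_log (hσ z hz), sq]
  have hψ : ContDiffOn ℝ 2 ψ Ω := contDiffOn_const.sub (contDiffOn_const.mul
    ((contDiffOn_const.sub hr.contDiffOn).log fun z hz => (hσ z hz).ne'))
  have hinv : ∀ z ∈ Ω, ContDiffAt ℝ 2 (fun w => (ε - r w)⁻¹) z := fun z hz =>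
    (contDiffAt_const.sub hr.contDiffAt).inv (hσ z hz).ne'
  have hφ : ContDiffOn ℝ 2 φ Ω := fun z hz => (contDiffAt_const.mul
    (contDiff_nsq.contDiffAt.add (contDiffAt_const.mul (hinv z hz)))).contDiffWithinAt
  have hmain : ∀ z ∈ Ω, ∀ ξ, 2 * ‖∑ j, wderiv j (fun u => (ψ u : ℂ)) z * ξ j‖ ^ 2 +
      2 * Real.exp (ψ z) * nsq ξ ≤ leviForm φ z ξ := fun z hz ξ => by
    have hs := hσ z hz
    have hdr := hr.differentiable (by norm_num) z
    have hdψ : HasFDerivAt ψ ((2 / (ε - r z)) • fderiv ℝ r z) z := by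
      have h : HasFDerivAt (fun w => Real.log C - 2 * Real.log (ε - r w)) _ z :=
        (((hdr.hasFDerivAt.const_sub ε).log hs.ne').const_mul 2).const_sub (Real.log C)
      refine h.congr_fderiv ?_
      ext v
      simp
      ring
    have e1 : ‖∑ j, wderiv j (fun u => (ψ u : ℂ)) z * ξ j‖ ^ 2 = 4 / (ε - r z) ^ 2 *
        ‖∑ j, wderiv j (fun u => (r u : ℂ)) z * ξ j‖ ^ 2 := by
      rw [norm_sq_sum_wderiv_mul hdψ.differentiableAt, norm_sq_sum_wderiv_mul hdr, hdψ.fderiv]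
      simp only [smul_apply, smul_eq_mul]
      field_simp
      norm_num
      ring
    have e2 : leviForm φ z ξ = N * (nsq ξ + κ * (((ε - r z) ^ 2)⁻¹ * leviForm r z ξ +
        2 * ((ε - r z) ^ 3)⁻¹ * ‖∑ j, wderiv j (fun u => (r u : ℂ)) z * ξ j‖ ^ 2)) := by
      have hi := hinv z hz
      rw [hφe, leviForm_const_mul (contDiff_nsq.contDiffAt.add (contDiffAt_const.mul hi)),
        leviForm_add contDiff_nsq.contDiffAt (contDiffAt_const.mul hi), leviForm_nsq,
        leviForm_const_mul hi, leviForm_inv_sub hr hz]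
    rw [e1, e2, hexpψ z hz]
    set T := ‖∑ j, wderiv j (fun u => (r u : ℂ)) z * ξ j‖ ^ 2 with hT
    have hT0 : 0 ≤ T := by positivity
    have h1 := mul_le_mul_of_nonneg_left (hκc z hz ξ) hN0.le
    have h2 : 2 * (C / (ε - r z) ^ 2) * nsq ξ ≤ N * (c' / (ε - r z) ^ 2 * nsq ξ) := by
      have h3 : 2 * C * (nsq ξ / (ε - r z) ^ 2) ≤ N * c' * (nsq ξ / (ε - r z) ^ 2) :=
        mul_le_mul_of_nonneg_right hN2 (div_nonneg (nsq_nonneg ξ) (by positivity))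
      calc _ = 2 * C * (nsq ξ / (ε - r z) ^ 2) := by ring
        _ ≤ _ := h3
        _ = _ := by ring
    have h3 : 2 * (4 / (ε - r z) ^ 2 * T) ≤ N * (κ * (2 * ((ε - r z) ^ 3)⁻¹ * T)) := by
      have h4 : 4 * (ε - r z) ≤ N * κ := by linarith [hS z hz]
      calc _ = 4 * (ε - r z) * (2 * ((ε - r z) ^ 3)⁻¹ * T) := by field_simp
        _ ≤ N * κ * (2 * ((ε - r z) ^ 3)⁻¹ * T) := by gcongr
        _ = _ := by ring
    linarith
  have hwle : ∀ z ∈ Ω, Real.exp (-((φ z - ψ z) / 2)) ^ 2 ≤ 2 * C / (N * κ) ^ 2 := fun z hz => by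
    have hs := hσ z hz
    have e1 : Real.exp (-((φ z - ψ z) / 2)) ^ 2 = C / (ε - r z) ^ 2 / Real.exp (φ z) := by
      rw [← hexpψ z hz, ← Real.exp_sub, ← Real.exp_nat_mul]
      congr 1
      push_cast
      ring
    have e2 : (N * κ / (ε - r z)) ^ 2 / 2 ≤ Real.exp (φ z) := by
      have h0 : 0 ≤ N * κ / (ε - r z) := by positivity
      have h1 := Real.quadratic_le_exp_of_nonneg h0
      have h2 : N * κ / (ε - r z) ≤ φ z := by
        have : 0 ≤ N * nsq z := mul_nonneg hN0.le (nsq_nonneg z)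
        simp only [hφe]
        rw [mul_add, div_eq_mul_inv, mul_assoc]
        linarith
      linarith [Real.exp_le_exp.2 h2]
    rw [e1]
    calc _ ≤ C / (ε - r z) ^ 2 / ((N * κ / (ε - r z)) ^ 2 / 2) := by gcongr
      _ = _ := by field_simp
  obtain ⟨w₀, hw₀, hw⟩ := (hcpt.of_isClosed_subset (isClosed_le hr.continuous continuous_const)
    (fun z (hz : r z ≤ ε / 2) => (by linarith : r z ≤ 1 / 2))).exists_forall_le' (a := 0)
    (f := fun z => Real.exp (-(φ z / 2 - ψ z)))
    (fun z (hz : r z ≤ ε / 2) => by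
      have hzΩ : z ∈ Ω := by
        change r z < ε
        linarith
      exact ((((hφ.continuousOn.div_const 2).sub hψ.continuousOn).neg.rexp).continuousAt
        (hΩ.mem_nhds hzΩ)).continuousWithinAt) (fun _ _ => Real.exp_pos _)
  have hsub : {z | r z < ε / 2} ⊆ Ω := fun z (hz : r z < ε / 2) => by
    change r z < ε
    linarith
  refine ⟨n * (2 * C / (N * κ) ^ 2 * volume.real Ω) / w₀ ^ 2 + 1, by positivity,
    fun B α hαm hαB hcl => ?_⟩
  have hb : ∀ j, ∀ z ∈ Ω, ‖(Real.exp (-((φ z - ψ z) / 2)) : ℂ) * α j z‖ ^ 2 ≤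
      2 * C / (N * κ) ^ 2 * B ^ 2 := fun j z hz => by
    rw [norm_mul, Complex.norm_real, Real.norm_eq_abs, mul_pow, sq_abs]
    have := hαB j z hz
    gcongr
    exact hwle z hz
  have hcw : ContinuousOn (fun z => (Real.exp (-((φ z - ψ z) / 2)) : ℂ)) Ω :=
    Complex.continuous_ofReal.comp_continuousOn
      ((hφ.continuousOn.sub hψ.continuousOn).div_const 2).neg.rexp
  obtain ⟨u, hu, hle, hweak⟩ := exists_weak_solution hΩ hφ hψ hmain hη (α := α) (fun j => by
    have hfin : IsFiniteMeasure (volume.restrict Ω) := ⟨by simpa using hΩf.lt_top⟩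
    refine MemLp.of_bound ((hcw.aestronglyMeasurable hΩm).mul (hαm j))
      (Real.sqrt (2 * C / (N * κ) ^ 2 * B ^ 2)) ?_
    filter_upwards [ae_restrict_mem hΩm] with z hz
    exact Real.le_sqrt_of_sq_le (hb j z hz)) hcl
  have hule : ∀ z, r z < ε / 2 → ‖u z‖ ≤ w₀⁻¹ * ‖(Real.exp (-(φ z / 2 - ψ z)) : ℂ) * u z‖ :=
    fun z hz => by
      rw [norm_mul, Complex.norm_real, Real.norm_eq_abs, abs_of_pos (Real.exp_pos _), ← mul_assoc]
      have h1 := hw z (le_of_lt hz : r z ≤ ε / 2)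
      have h2 : 1 ≤ w₀⁻¹ * Real.exp (-(φ z / 2 - ψ z)) := by
        rw [← div_eq_inv_mul, one_le_div hw₀]
        exact h1
      exact le_mul_of_one_le_left (norm_nonneg _) h2
  have hm' : MeasurableSet {z | r z < ε / 2} :=
    (isOpen_lt hr.continuous continuous_const).measurableSet
  have hum : AEStronglyMeasurable u (volume.restrict Ω) := by
    have hc2 : ContinuousOn (fun z => (Real.exp (φ z / 2 - ψ z) : ℂ)) Ω :=
      Complex.continuous_ofReal.comp_continuousOn
        ((hφ.continuousOn.div_const 2).sub hψ.continuousOn).rexp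
    refine ((hc2.aestronglyMeasurable hΩm).mul hu.1).congr (.of_forall fun z => ?_)
    simp only [Pi.mul_apply]
    rw [← mul_assoc, ← Complex.ofReal_mul, ← Real.exp_add, add_neg_cancel, Real.exp_zero,
      Complex.ofReal_one, one_mul]
  have huw := hu.mono_measure (Measure.restrict_mono hsub le_rfl)
  have huL : MemLp u 2 (volume.restrict {z | r z < ε / 2}) :=
    huw.of_le_mul (hum.mono_measure (Measure.restrict_mono hsub le_rfl)) (by
      filter_upwards [ae_restrict_mem hm'] with z hz using hule z hz)
  refine ⟨u, huL, ?_, hweak⟩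
  have hi1 := huL.integrable_norm_pow two_ne_zero
  have hi2 := huw.integrable_norm_pow two_ne_zero
  have hi3 := hu.integrable_norm_pow two_ne_zero
  calc ∫ z in {z | r z < ε / 2}, ‖u z‖ ^ 2
      ≤ ∫ z in {z | r z < ε / 2}, w₀⁻¹ ^ 2 * ‖(Real.exp (-(φ z / 2 - ψ z)) : ℂ) * u z‖ ^ 2 := by
        refine setIntegral_mono_on hi1 (hi2.const_mul _) hm' fun z hz => ?_
        rw [← mul_pow]
        exact pow_le_pow_left₀ (norm_nonneg _) (hule z hz) 2
    _ = w₀⁻¹ ^ 2 * ∫ z in {z | r z < ε / 2}, ‖(Real.exp (-(φ z / 2 - ψ z)) : ℂ) * u z‖ ^ 2 :=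
        integral_const_mul _ _
    _ ≤ w₀⁻¹ ^ 2 * ∫ z in Ω, ‖(Real.exp (-(φ z / 2 - ψ z)) : ℂ) * u z‖ ^ 2 := by
        refine mul_le_mul_of_nonneg_left (setIntegral_mono_set hi3
          (.of_forall fun z => by positivity) hsub.eventuallyLE) (by positivity)
    _ ≤ w₀⁻¹ ^ 2 * ∑ j : Fin n, 2 * C / (N * κ) ^ 2 * B ^ 2 * volume.real Ω := by
        refine mul_le_mul_of_nonneg_left (hle.trans (Finset.sum_le_sum fun j _ => ?_))
          (by positivity)
        refine (Real.le_norm_self _).trans (norm_setIntegral_le_of_norm_le_const hΩf.lt_top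
          fun z hz => ?_)
        rw [Real.norm_eq_abs, abs_of_nonneg (by positivity)]
        exact hb j z hz
    _ = n * (2 * C / (N * κ) ^ 2 * volume.real Ω) / w₀ ^ 2 * B ^ 2 := by
        rw [Finset.sum_const, Finset.card_univ, Fintype.card_fin, nsmul_eq_mul]
        field_simp
    _ ≤ _ := by
        gcongr
        linarith

end Sublevel

section Cousin

variable {n : ℕ} {U : Set (Fin n → ℂ)} {u g h χ χ₀ : (Fin n → ℂ) → ℂ}

theorem exists_holomorphic_of_weak_on (hU : IsOpen U) (hu : MemLp u 2 (volume.restrict U))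
    (hw : ∀ j χ, IsTest U χ → ∫ y in U, u y * wderivBar j χ y = 0) :
    ∃ h : (Fin n → ℂ) → ℂ, DifferentiableOn ℂ h U ∧ ∀ᵐ z ∂volume.restrict U, u z = h z := by
  obtain ⟨h, hh, hae⟩ := exists_holomorphic_of_weak (u := U.indicator u)
    ((memLp_indicator_iff_restrict hU.measurableSet).2 hu) hU fun j χ h1 h2 h3 => by
      have h4 := hw j χ ⟨h1, h2, h3⟩
      rw [← integral_indicator hU.measurableSet] at h4
      rw [← h4]
      refine integral_congr_ae (.of_forall fun y => ?_)
      beta_reduce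
      rw [← indicator_mul_left]
  refine ⟨h, hh, ?_⟩
  filter_upwards [hae, ae_restrict_mem hU.measurableSet] with z hz hzU
  rw [← hz, indicator_of_mem hzU]

theorem norm_sq_mul_volume_le_setIntegral (hh : DifferentiableOn ℂ h U)
    (hL : MemLp h 2 (volume.restrict U)) {z : Fin n → ℂ} {s : ℝ} (hs : 0 < s)
    (hz : ball z s ⊆ U) :
    ‖h z‖ ^ 2 * volume.real (closedBall (0 : Fin n → ℂ) (s / 2)) ≤ ∫ y in U, ‖h y‖ ^ 2 :=
  (norm_sq_mul_volume_le (hh.mono hz) (half_lt_self hs)).trans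
    (setIntegral_mono_set (hL.integrable_norm_pow two_ne_zero) (.of_forall fun _ => by positivity)
      ((closedBall_subset_ball (half_lt_self hs)).trans hz).eventuallyLE)

theorem IsTest.contDiff_mul (hU : IsOpen U) (hχ : IsTest U χ) (hg : ContDiffOn ℝ 2 g U) :
    ContDiff ℝ 2 fun z => χ z * g z :=
  contDiff_mul_of_tsupport_subset hU hχ.smooth hχ.subset hg

theorem IsTest.wderivBar_mul_contDiffOn (hU : IsOpen U) (hχ : IsTest U χ)
    (hg : ContDiffOn ℝ 2 g U) {z : Fin n → ℂ} (hz : z ∈ U) (j : Fin n) :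
    wderivBar j (fun w => χ w * g w) z = wderivBar j χ z * g z + χ z * wderivBar j g z :=
  wderivBar_mul (hχ.smooth.differentiable (by norm_num) z)
    ((hg.contDiffAt (hU.mem_nhds hz)).differentiableAt (by norm_num)) j

theorem IsTest.wderivBar_mul_eq_zero (hχ : IsTest U χ) {z : Fin n → ℂ} (hz : z ∉ U) (j : Fin n) :
    wderivBar j (fun w => χ w * g w) z = 0 :=
  image_eq_zero_of_notMem_tsupport fun h => hz (hχ.subset
    (closure_mono (Function.support_mul_subset_left _ _) (tsupport_wderivBar_subset _ j h)))

theorem setIntegral_wderivBar_mul_comm (hU : IsOpen U) (hχ₀ : ContDiff ℝ 2 χ₀)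
    (hs : HasCompactSupport χ₀) (hg : ContDiffOn ℝ 2 g U)
    (h0 : ∀ j k, ∀ z ∈ U, wderivBar k χ₀ z * wderivBar j g z = 0) (hχ : IsTest U χ) (j k : Fin n) :
    ∫ y in U, wderivBar k χ₀ y * g y * wderivBar j χ y =
      ∫ y in U, wderivBar j χ₀ y * g y * wderivBar k χ y := by
  have h1 : ∀ j k, ∫ y in U, wderivBar k χ₀ y * g y * wderivBar j χ y =
      ∫ y, wderivBar k χ₀ y * wderivBar j (fun w => χ w * g w) y := fun j k => by
    have h2 := setIntegral_eq_integral_of_forall_compl_eq_zero (μ := volume) (s := U)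
      (f := fun y => wderivBar k χ₀ y * wderivBar j (fun w => χ w * g w) y)
      fun z hz => by rw [hχ.wderivBar_mul_eq_zero hz, mul_zero]
    rw [← h2]
    refine setIntegral_congr_fun hU.measurableSet fun z hz => ?_
    beta_reduce
    rw [hχ.wderivBar_mul_contDiffOn hU hg hz]
    linear_combination -χ z * h0 j k z hz
  rw [h1, h1, integral_wderivBar_mul_wderivBar hχ₀ (hχ.contDiff_mul hU hg) hs]

theorem setIntegral_mul_wderivBar_test (hU : IsOpen U) (hχ₀ : ContDiff ℝ 2 χ₀)
    (hs : HasCompactSupport χ₀) (hg : ContDiffOn ℝ 2 g U)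
    (h0 : ∀ j, ∀ z ∈ U, χ₀ z * wderivBar j g z = 0) (hχ : IsTest U χ) (j : Fin n) :
    ∫ y in U, χ₀ y * g y * wderivBar j χ y = -∫ y in U, wderivBar j χ₀ y * g y * χ y := by
  have h1 := integral_wderivBar_mul (hχ₀.of_le (by norm_num))
    ((hχ.contDiff_mul hU hg).of_le (by norm_num)) hs j
  have e1 := setIntegral_eq_integral_of_forall_compl_eq_zero (μ := volume) (s := U)
    (f := fun y => wderivBar j χ₀ y * (χ y * g y))
    fun z hz => by rw [hχ.eq_zero hz, zero_mul, mul_zero]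
  have e2 := setIntegral_eq_integral_of_forall_compl_eq_zero (μ := volume) (s := U)
    (f := fun y => χ₀ y * wderivBar j (fun w => χ w * g w) y)
    fun z hz => by rw [hχ.wderivBar_mul_eq_zero hz, mul_zero]
  rw [← e1, ← e2] at h1
  have h2 : ∫ y in U, wderivBar j χ₀ y * g y * χ y = ∫ y in U, wderivBar j χ₀ y * (χ y * g y) :=
    integral_congr_ae (.of_forall fun y => by beta_reduce; ring)
  rw [h2, h1, neg_neg]
  refine setIntegral_congr_fun hU.measurableSet fun z hz => ?_
  beta_reduce
  rw [hχ.wderivBar_mul_contDiffOn hU hg hz]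
  linear_combination -χ z * h0 j z hz

theorem IsTest.setIntegral_mul_wderivBar_eq {V : Set (Fin n → ℂ)} (hχ : IsTest U χ) (hUV : U ⊆ V)
    (f : (Fin n → ℂ) → ℂ) (j : Fin n) :
    ∫ y in V, f y * wderivBar j χ y = ∫ y in U, f y * wderivBar j χ y := by
  rw [setIntegral_eq_integral_of_forall_compl_eq_zero (μ := volume) (s := U) fun z hz => by
      rw [hχ.wderivBar_eq_zero hz, mul_zero],
    setIntegral_eq_integral_of_forall_compl_eq_zero (μ := volume) (s := V) fun z hz => by
      rw [hχ.wderivBar_eq_zero fun h => hz (hUV h), mul_zero]]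

/-- Solution of an additive Cousin problem with bounds on a strongly pseudoconvex sublevel set. -/
theorem exists_cousin_solution {r : (Fin n → ℂ) → ℝ} {c ε s b : ℝ} (hr : ContDiff ℝ 2 r)
    (hcpt : IsCompact {z | r z ≤ 1 / 2}) (hc : 0 < c) (hε0 : 0 < ε) (hε : ε ≤ 1 / 2)
    (hlevi : ∀ z, |r z| ≤ ε → ∀ ξ, c * nsq ξ ≤ leviForm r z ξ) (p₀ : Fin n → ℂ) (hs : 0 < s)
    (hb : 0 ≤ b) : ∃ M > 0, ∀ f : (Fin n → ℂ) → ℂ,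
      DifferentiableOn ℂ f {z | r z < 0 ∧ dist z p₀ < 10 * s} →
      DifferentiableOn ℂ f {z | r z < ε ∧ 2 * s < dist z p₀ ∧ dist z p₀ < 10 * s} →
      (∀ z, r z < ε → 2 * s < dist z p₀ → dist z p₀ < 10 * s → ‖f z‖ ≤ b) →
      ∃ H : (Fin n → ℂ) → ℂ, DifferentiableOn ℂ H {z | r z < 0} ∧
        (∀ z, r z < 0 → dist z p₀ < 5 * s → ‖H z - f z‖ ≤ M) ∧
        ∀ z, r z < 0 → 5 * s ≤ dist z p₀ → ‖H z‖ ≤ M := by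
  set Ω : Set (Fin n → ℂ) := {z | r z < ε} with hΩe
  set Ω' : Set (Fin n → ℂ) := {z | r z < ε / 2} with hΩe'
  have hΩ : IsOpen Ω := isOpen_lt hr.continuous continuous_const
  have hΩ' : IsOpen Ω' := isOpen_lt hr.continuous continuous_const
  have hsub : Ω' ⊆ Ω := fun z (hz : r z < ε / 2) => by
    change r z < ε
    linarith
  have hΩf : volume Ω' ≠ ∞ := ne_top_of_le_ne_top hcpt.measure_lt_top.ne
    (measure_mono fun z (hz : r z < ε / 2) => (by linarith : r z ≤ 1 / 2))
  have hdist : Continuous fun z : Fin n → ℂ => dist z p₀ := continuous_id.dist continuous_const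
  obtain ⟨K, hK, hdbar⟩ := exists_weak_solution_of_bounded hr hcpt hc hε0 hε hlevi
  obtain ⟨χr, hχrC, hχrs, hχr8, hχr1, hχrI⟩ := exists_cutoff
    (isCompact_closedBall p₀ (6 * s)) (isOpen_ball (x := p₀) (ε := 8 * s))
    (closedBall_subset_ball (by linarith))
  obtain ⟨θ, hθC, -, hθA, hθ1, hθI⟩ := exists_cutoff
    (K := {z : Fin n → ℂ | 4 * s ≤ dist z p₀} ∩ closedBall p₀ (8 * s))
    (Ω := {z | 2 * s < dist z p₀} ∩ ball p₀ (10 * s))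
    ((isCompact_closedBall p₀ (8 * s)).inter_left (isClosed_le continuous_const hdist))
    ((isOpen_lt continuous_const hdist).inter isOpen_ball) fun z hz => by
      have h1 : 4 * s ≤ dist z p₀ := hz.1
      have h2 : dist z p₀ ≤ 8 * s := hz.2
      exact ⟨(by linarith : 2 * s < dist z p₀), (by linarith : dist z p₀ < 10 * s)⟩
  set χ₀ : (Fin n → ℂ) → ℂ := fun z => (χr z : ℂ) with hχ₀e
  have hχ₀ : ContDiff ℝ 2 χ₀ := Complex.ofRealCLM.contDiff.comp (hχrC.of_le (by norm_cast))
  have hχ₀s : HasCompactSupport χ₀ := hχrs.comp_left (g := Complex.ofReal) Complex.ofReal_zero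
  have hχ₀n : ∀ z, ‖χ₀ z‖ ≤ 1 := fun z => by
    rw [hχ₀e, Complex.norm_real, Real.norm_eq_abs, abs_of_nonneg (hχrI z).1]
    exact (hχrI z).2
  have hχ₀1 : ∀ z, dist z p₀ ≤ 6 * s → χ₀ =ᶠ[𝓝 z] fun _ => 1 := fun z hz => by
    filter_upwards [hχr1.filter_mono (nhds_le_nhdsSet (show z ∈ closedBall p₀ (6 * s) from hz))]
      with w hw
    simp [hχ₀e, hw]
  have hχ₀0 : ∀ z, 8 * s ≤ dist z p₀ → χ₀ =ᶠ[𝓝 z] fun _ => 0 := fun z hz => by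
    have h1 : z ∉ tsupport χr := fun h => absurd (hχr8 h : dist z p₀ < 8 * s) (not_lt.2 hz)
    filter_upwards [notMem_tsupport_iff_eventuallyEq.1 h1] with w hw
    simp [hχ₀e, hw]
  have hdχ : ∀ k z, wderivBar k χ₀ z ≠ 0 → 6 * s < dist z p₀ ∧ dist z p₀ < 8 * s :=
    fun k z h => by
      refine ⟨not_le.1 fun h1 => h ?_, not_le.1 fun h1 => h ?_⟩
      · rw [wderivBar_congr_of_eventuallyEq (hχ₀1 z h1)]
        exact wderivBar_eq_zero (differentiableAt_const _) k
      · rw [wderivBar_congr_of_eventuallyEq (hχ₀0 z h1)]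
        exact wderivBar_eq_zero (differentiableAt_const _) k
  obtain ⟨B, hB⟩ : ∃ B, ∀ k z, ‖wderivBar k χ₀ z‖ ≤ B := by
    have h1 : ∀ k, ∃ B, ∀ z, ‖wderivBar k χ₀ z‖ ≤ B := fun k =>
      (hχ₀s.wderivBar k).exists_bound_of_continuous (contDiff_wderivBar hχ₀ k).continuous
    choose B hB using h1
    refine ⟨∑ k, |B k|, fun k z => (hB k z).trans ((le_abs_self _).trans ?_)⟩
    exact Finset.single_le_sum (f := fun k => |B k|) (fun _ _ => abs_nonneg _) (Finset.mem_univ k)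
  obtain ⟨ρ, hρ, hρsub⟩ := (hcpt.of_isClosed_subset (isClosed_le hr.continuous continuous_const)
    (fun z (hz : r z ≤ 0) => (by linarith : r z ≤ 1 / 2))).exists_thickening_subset_open hΩ'
    (fun z (hz : r z ≤ 0) => (by linarith : r z < ε / 2))
  set U₁ : Set (Fin n → ℂ) := Ω' ∩ {z | dist z p₀ < 6 * s} with hU₁e
  set U₂ : Set (Fin n → ℂ) := Ω' ∩ {z | 4 * s < dist z p₀} with hU₂e
  have hU₁ : IsOpen U₁ := hΩ'.inter (isOpen_lt hdist continuous_const)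
  have hU₂ : IsOpen U₂ := hΩ'.inter (isOpen_lt continuous_const hdist)
  set d := min ρ s with hd
  have hd0 : 0 < d := lt_min hρ hs
  have hball : ∀ z, r z < 0 → ball z d ⊆ Ω' := fun z hz =>
    ((ball_subset_ball (min_le_left _ _)).trans
      (ball_subset_thickening (show z ∈ {z | r z ≤ 0} from hz.le) ρ)).trans hρsub
  have hball₁ : ∀ z, r z < 0 → dist z p₀ < 5 * s → ball z d ⊆ U₁ := fun z hz h5 y hy => by
    refine ⟨hball z hz hy, (?_ : dist y p₀ < 6 * s)⟩
    have h1 : dist y z < s := lt_of_lt_of_le hy (min_le_right _ _)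
    linarith [dist_triangle y z p₀]
  have hball₂ : ∀ z, r z < 0 → 5 * s ≤ dist z p₀ → ball z d ⊆ U₂ := fun z hz h5 y hy => by
    refine ⟨hball z hz hy, (?_ : 4 * s < dist y p₀)⟩
    have h1 : dist y z < s := lt_of_lt_of_le hy (min_le_right _ _)
    linarith [dist_triangle z y p₀, dist_comm y z]
  set V := volume.real (closedBall (0 : Fin n → ℂ) (d / 2)) with hV
  have hV0 : 0 < V := ENNReal.toReal_pos (measure_closedBall_pos _ _ (half_pos hd0)).ne'
    measure_closedBall_lt_top.ne
  set T : ℝ := 2 * (b ^ 2 * volume.real Ω' + K * (B * b) ^ 2) with hT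
  refine ⟨Real.sqrt (T / V) + 1, by positivity, fun f hf1 hf2 hfb => ?_⟩
  have hA : IsOpen {z | r z < ε ∧ 2 * s < dist z p₀ ∧ dist z p₀ < 10 * s} :=
    hΩ.inter ((isOpen_lt continuous_const hdist).inter (isOpen_lt hdist continuous_const))
  set g : (Fin n → ℂ) → ℂ := fun z => (θ z : ℂ) * f z with hge
  have hgC : ContDiffOn ℝ 2 g Ω := fun z hz => by
    refine ContDiffAt.contDiffWithinAt ?_
    by_cases hzt : z ∈ tsupport θ
    · have h1 : z ∈ {z | r z < ε ∧ 2 * s < dist z p₀ ∧ dist z p₀ < 10 * s} :=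
        ⟨hz, (hθA hzt).1, (hθA hzt).2⟩
      exact (Complex.ofRealCLM.contDiff.comp (hθC.of_le (by norm_cast))).contDiffAt.mul
        ((contDiffOn_real_of_holomorphic hA hf2 2).contDiffAt (hA.mem_nhds h1))
    · refine (contDiffAt_const (c := (0 : ℂ))).congr_of_eventuallyEq ?_
      filter_upwards [notMem_tsupport_iff_eventuallyEq.1 hzt] with w hw
      simp [hge, hw]
  have hgf : ∀ z, 4 * s ≤ dist z p₀ → dist z p₀ ≤ 8 * s → g =ᶠ[𝓝 z] f := fun z h4 h8 => by
    filter_upwards [hθ1.filter_mono (nhds_le_nhdsSet (show z ∈ {z : Fin n → ℂ | 4 * s ≤ dist z p₀} ∩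
      closedBall p₀ (8 * s) from ⟨h4, h8⟩))] with w hw
    simp [hge, hw]
  have hgn : ∀ z ∈ Ω, ‖g z‖ ≤ b := fun z hz => by
    by_cases hzt : z ∈ tsupport θ
    · rw [hge, norm_mul, Complex.norm_real, Real.norm_eq_abs, abs_of_nonneg (hθI z).1]
      exact (mul_le_of_le_one_left (norm_nonneg _) (hθI z).2).trans
        (hfb z hz (hθA hzt).1 (hθA hzt).2)
    · simpa [hge, image_eq_zero_of_notMem_tsupport hzt] using hb
  have hg0 : ∀ j, ∀ z ∈ Ω, 4 * s < dist z p₀ → dist z p₀ < 8 * s → wderivBar j g z = 0 :=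
    fun j z hz h4 h8 => by
      rw [wderivBar_congr_of_eventuallyEq (hgf z h4.le h8.le)]
      exact wderivBar_eq_zero (hf2.differentiableAt
        (hA.mem_nhds ⟨hz, by linarith, by linarith⟩)) j
  obtain ⟨u, huL, hule, hweak⟩ := hdbar (B * b) (fun j z => wderivBar j χ₀ z * g z)
    (fun j => ((contDiff_wderivBar hχ₀ j).continuous.continuousOn.mul
      hgC.continuousOn).aestronglyMeasurable hΩ.measurableSet)
    (fun j z hz => by
      rw [norm_mul]
      exact mul_le_mul (hB j z) (hgn z hz) (norm_nonneg _) ((norm_nonneg _).trans (hB j z)))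
    (fun j k χ hχ => setIntegral_wderivBar_mul_comm hΩ hχ₀ hχ₀s hgC (fun j k z hz => by
      by_cases h : wderivBar k χ₀ z = 0
      · rw [h, zero_mul]
      · rw [hg0 j z hz (by linarith [(hdχ k z h).1]) (hdχ k z h).2, mul_zero]) hχ j k)
  have hU₁Ω : U₁ ⊆ Ω := fun z hz => hsub hz.1
  have hU₂Ω : U₂ ⊆ Ω := fun z hz => hsub hz.1
  have huL₁ : MemLp u 2 (volume.restrict U₁) :=
    huL.mono_measure (Measure.restrict_mono inter_subset_left le_rfl)
  have huL₂ : MemLp u 2 (volume.restrict U₂) :=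
    huL.mono_measure (Measure.restrict_mono inter_subset_left le_rfl)
  have hui := huL.integrable_norm_pow two_ne_zero
  obtain ⟨h₁, hh₁, hae₁⟩ := exists_holomorphic_of_weak_on hU₁ huL₁ fun j χ hχ => by
    rw [← hχ.setIntegral_mul_wderivBar_eq hU₁Ω, hweak j χ ⟨hχ.smooth, hχ.compact,
      hχ.subset.trans hU₁Ω⟩, neg_eq_zero]
    refine (integral_congr_ae (.of_forall fun z => ?_)).trans (integral_zero _ _)
    beta_reduce
    by_cases h : wderivBar j χ₀ z = 0
    · rw [h, zero_mul, zero_mul]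
    · rw [hχ.eq_zero fun hz => absurd (hz.2 : dist z p₀ < 6 * s)
        (not_lt.2 (hdχ j z h).1.le), mul_zero]
  have hvC : ContinuousOn (fun z => χ₀ z * g z) U₂ :=
    hχ₀.continuous.continuousOn.mul (hgC.continuousOn.mono hU₂Ω)
  have hvn : ∀ z ∈ U₂, ‖χ₀ z * g z‖ ≤ b := fun z hz => by
    rw [norm_mul]
    exact (mul_le_of_le_one_left (norm_nonneg _) (hχ₀n z)).trans (hgn z (hU₂Ω hz))
  have hfin : IsFiniteMeasure (volume.restrict U₂) :=
    ⟨by simpa using (measure_mono inter_subset_left).trans_lt hΩf.lt_top⟩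
  have hvL : MemLp (fun z => χ₀ z * g z) 2 (volume.restrict U₂) :=
    MemLp.of_bound (hvC.aestronglyMeasurable hU₂.measurableSet) b (by
      filter_upwards [ae_restrict_mem hU₂.measurableSet] with z hz using hvn z hz)
  obtain ⟨h₂, hh₂, hae₂⟩ := exists_holomorphic_of_weak_on hU₂ (hvL.sub huL₂) fun j χ hχ => by
    have hχΩ : IsTest Ω χ := ⟨hχ.smooth, hχ.compact, hχ.subset.trans hU₂Ω⟩
    have e1 := setIntegral_mul_wderivBar_test hU₂ hχ₀ hχ₀s (hgC.mono hU₂Ω) (fun j z hz => by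
      rcases lt_or_ge (dist z p₀) (8 * s) with h | h
      · rw [hg0 j z (hU₂Ω hz) hz.2 h, mul_zero]
      · rw [(hχ₀0 z h).eq_of_nhds, zero_mul]) hχ j
    have e2 := hweak j χ hχΩ
    rw [hχ.setIntegral_mul_wderivBar_eq hU₂Ω] at e2
    have e3 : ∫ y in Ω, wderivBar j χ₀ y * g y * χ y = ∫ y in U₂, wderivBar j χ₀ y * g y * χ y := by
      rw [setIntegral_eq_integral_of_forall_compl_eq_zero (μ := volume) (s := U₂) fun z hz => by
          rw [hχ.eq_zero hz, mul_zero],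
        setIntegral_eq_integral_of_forall_compl_eq_zero (μ := volume) (s := Ω) fun z hz => by
          rw [hχΩ.eq_zero hz, mul_zero]]
    have hwL : MemLp (wderivBar j χ) 2 (volume.restrict U₂) :=
      ((contDiff_wderivBar hχ.smooth j).continuous.memLp_of_hasCompactSupport
        (hχ.compact.wderivBar j)).restrict _
    simp only [Pi.sub_apply, sub_mul]
    have i1 : Integrable (fun y => χ₀ y * g y * wderivBar j χ y) (volume.restrict U₂) :=
      hvL.integrable_mul hwL
    have i2 : Integrable (fun y => u y * wderivBar j χ y) (volume.restrict U₂) :=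
      huL₂.integrable_mul hwL
    rw [integral_sub i1 i2, e1, e2, e3, sub_self]
  have hbound : ∀ {h : (Fin n → ℂ) → ℂ} {W : Set (Fin n → ℂ)} {z}, DifferentiableOn ℂ h W →
      MemLp h 2 (volume.restrict W) → ∫ y in W, ‖h y‖ ^ 2 ≤ T → ball z d ⊆ W →
      ‖h z‖ ≤ Real.sqrt (T / V) + 1 := fun {h W z} hd hL hT hz => by
    have h1 := norm_sq_mul_volume_le_setIntegral hd hL hd0 hz
    have h2 : ‖h z‖ ^ 2 ≤ T / V := (le_div_iff₀ hV0).2 (h1.trans hT)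
    linarith [Real.le_sqrt_of_sq_le h2]
  have hb₁ : ∀ z, r z < 0 → dist z p₀ < 5 * s → ‖h₁ z‖ ≤ Real.sqrt (T / V) + 1 :=
    fun z hz h5 => by
      refine hbound hh₁ ((memLp_congr_ae hae₁).1 huL₁) ?_ (hball₁ z hz h5)
      have e1 : ∫ y in U₁, ‖h₁ y‖ ^ 2 = ∫ y in U₁, ‖u y‖ ^ 2 :=
        integral_congr_ae (by filter_upwards [hae₁] with y hy; rw [hy])
      rw [e1]
      have e2 : ∫ y in U₁, ‖u y‖ ^ 2 ≤ ∫ y in Ω', ‖u y‖ ^ 2 :=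
        setIntegral_mono_set hui (.of_forall fun _ => by positivity)
          (inter_subset_left : U₁ ⊆ Ω').eventuallyLE
      have e3 : 0 ≤ b ^ 2 * volume.real Ω' := by positivity
      have e4 : 0 ≤ K * (B * b) ^ 2 := by positivity
      linarith
  have hb₂ : ∀ z, r z < 0 → 5 * s ≤ dist z p₀ → ‖h₂ z‖ ≤ Real.sqrt (T / V) + 1 :=
    fun z hz h5 => by
      refine hbound hh₂ ((memLp_congr_ae hae₂).1 (hvL.sub huL₂)) ?_ (hball₂ z hz h5)
      have hui₂ := huL₂.integrable_norm_pow two_ne_zero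
      have hci : Integrable (fun _ : Fin n → ℂ => b ^ 2) (volume.restrict U₂) :=
        integrable_const _
      calc ∫ y in U₂, ‖h₂ y‖ ^ 2 ≤ ∫ y in U₂, 2 * (b ^ 2 + ‖u y‖ ^ 2) := by
            refine integral_mono_ae (((memLp_congr_ae hae₂).1
              (hvL.sub huL₂)).integrable_norm_pow two_ne_zero) ((hci.add hui₂).const_mul 2) ?_
            filter_upwards [hae₂, ae_restrict_mem hU₂.measurableSet] with y hy hyU
            rw [← hy]
            have h1 := norm_sub_le (χ₀ y * g y) (u y)
            have h2 := hvn y hyU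
            have h3 : ‖χ₀ y * g y - u y‖ ≤ b + ‖u y‖ := by linarith
            calc _ ≤ (b + ‖u y‖) ^ 2 := pow_le_pow_left₀ (norm_nonneg _) h3 2
              _ ≤ _ := by nlinarith [sq_nonneg (b - ‖u y‖)]
        _ = 2 * (b ^ 2 * volume.real U₂ + ∫ y in U₂, ‖u y‖ ^ 2) := by
            rw [integral_const_mul, integral_add hci hui₂, setIntegral_const, smul_eq_mul,
              mul_comm (b ^ 2)]
        _ ≤ T := by
            have e2 : ∫ y in U₂, ‖u y‖ ^ 2 ≤ ∫ y in Ω', ‖u y‖ ^ 2 :=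
              setIntegral_mono_set hui (.of_forall fun _ => by positivity)
                (inter_subset_left : U₂ ⊆ Ω').eventuallyLE
            have e3 : volume.real U₂ ≤ volume.real Ω' := measureReal_mono inter_subset_left hΩf
            have e4 : b ^ 2 * volume.real U₂ ≤ b ^ 2 * volume.real Ω' := by gcongr
            linarith
  have hWo : IsOpen (U₁ ∩ U₂) := hU₁.inter hU₂
  have hW : EqOn (fun z => f z - h₁ z) h₂ (U₁ ∩ U₂) := by
    refine Measure.eqOn_open_of_ae_eq (μ :=
        volume) ?_ hWo ?_ (hh₂.continuousOn.mono inter_subset_right)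
    · filter_upwards [ae_restrict_of_ae_restrict_of_subset inter_subset_left hae₁,
        ae_restrict_of_ae_restrict_of_subset inter_subset_right hae₂,
        ae_restrict_mem hWo.measurableSet] with z h1 h2 hz
      have h6 : dist z p₀ < 6 * s := hz.1.2
      have h4 : 4 * s < dist z p₀ := hz.2.2
      rw [← h2, ← h1, Pi.sub_apply, (hχ₀1 z h6.le).eq_of_nhds,
        (hgf z h4.le (by linarith)).eq_of_nhds, one_mul]
    · refine ContinuousOn.sub (hf2.continuousOn.mono fun z hz => ?_)
        (hh₁.continuousOn.mono inter_subset_left)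
      have h6 : dist z p₀ < 6 * s := hz.1.2
      have h4 : 4 * s < dist z p₀ := hz.2.2
      exact ⟨hsub hz.1.1, by linarith, by linarith⟩
  classical
  have hΩ0 : ∀ z, r z < 0 → z ∈ Ω' := fun z hz => by
    change r z < ε / 2
    linarith
  refine ⟨fun z => if dist z p₀ < 6 * s then f z - h₁ z else h₂ z, fun z hz => ?_,
    fun z hz h5 => ?_, fun z hz h5 => ?_⟩
  · refine DifferentiableAt.differentiableWithinAt ?_
    have hz0 : r z < 0 := hz
    rcases lt_or_ge (dist z p₀) (6 * s) with h | h
    · have ho : IsOpen {z | r z < 0 ∧ dist z p₀ < 10 * s} :=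
        (isOpen_lt hr.continuous continuous_const).inter (isOpen_lt hdist continuous_const)
      refine ((hf1.differentiableAt (ho.mem_nhds ⟨hz0, by linarith⟩)).sub
        (hh₁.differentiableAt (hU₁.mem_nhds ⟨hΩ0 z hz0, h⟩))).congr_of_eventuallyEq ?_
      filter_upwards [(isOpen_lt hdist continuous_const).mem_nhds h] with w hw
      exact if_pos hw
    · have hzU : z ∈ U₂ := ⟨hΩ0 z hz0, (by linarith : 4 * s < dist z p₀)⟩
      refine (hh₂.differentiableAt (hU₂.mem_nhds hzU)).congr_of_eventuallyEq ?_
      filter_upwards [hU₂.mem_nhds hzU] with w hw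
      split_ifs with h6
      · exact hW ⟨⟨hw.1, h6⟩, hw⟩
      · rfl
  · have h6 : dist z p₀ < 6 * s := by linarith
    beta_reduce
    rw [if_pos h6, sub_sub_cancel_left, norm_neg]
    exact hb₁ z hz h5
  · beta_reduce
    split_ifs with h6
    · have h4 : 4 * s < dist z p₀ := by linarith
      rw [show f z - h₁ z = h₂ z from hW ⟨⟨hΩ0 z hz, h6⟩, hΩ0 z hz, h4⟩]
      exact hb₂ z hz h5
    · exact hb₂ z hz h5

end Cousin

section LeviPolynomial

variable {n : ℕ}

theorem smul_eq_re_smul_add (a : ℂ) (h : Fin n → ℂ) :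
    a • h = a.re • h + a.im • (Complex.I • h) := by
  ext i
  simp only [Pi.smul_apply, Pi.add_apply, smul_eq_mul, Complex.real_smul]
  nth_rewrite 1 [← Complex.re_add_im a]
  ring

theorem I_smul_smul (a : ℂ) (h : Fin n → ℂ) :
    Complex.I • (a • h) = a.re • (Complex.I • h) - a.im • h := by
  ext i
  simp only [Pi.smul_apply, Pi.sub_apply, smul_eq_mul, Complex.real_smul]
  nth_rewrite 1 [← Complex.re_add_im a]
  linear_combination (a.im : ℂ) * h i * Complex.I_mul_I

/-- The complex linear form `ξ ↦ 2 ∂r_q(ξ)`. -/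
def complexGradient (r : (Fin n → ℂ) → ℝ) (q : Fin n → ℂ) : (Fin n → ℂ) →L[ℂ] ℂ :=
  LinearMap.toContinuousLinearMap
    { toFun := fun h => (fderiv ℝ r q h : ℂ) - Complex.I * (fderiv ℝ r q (Complex.I • h) : ℂ)
      map_add' := fun h k => by
        simp only [smul_add, map_add, Complex.ofReal_add]
        ring
      map_smul' := fun a h => by
        rw [I_smul_smul, smul_eq_re_smul_add]
        simp only [map_add, map_sub, map_smul, smul_eq_mul, Complex.ofReal_add, Complex.ofReal_sub,
          Complex.ofReal_mul, RingHom.id_apply]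
        nth_rewrite 5 [← Complex.re_add_im a]
        linear_combination (a.im : ℂ) * (fderiv ℝ r q (Complex.I • h) : ℂ) * Complex.I_mul_I }

theorem complexGradient_apply (r : (Fin n → ℂ) → ℝ) (q h : Fin n → ℂ) :
    complexGradient r q h
      = (fderiv ℝ r q h : ℂ) - Complex.I * (fderiv ℝ r q (Complex.I • h) : ℂ) := rfl

theorem complexGradient_re (r : (Fin n → ℂ) → ℝ) (q h : Fin n → ℂ) :
    (complexGradient r q h).re = fderiv ℝ r q h := by
  simp [complexGradient_apply]

/-- Twice the complex bilinear form `∑ ∂²r/∂z_μ∂z_ν(q) h_μ k_ν`. -/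
def complexHessian (r : (Fin n → ℂ) → ℝ) (q : Fin n → ℂ) :
    (Fin n → ℂ) →ₗ[ℂ] (Fin n → ℂ) →ₗ[ℂ] ℂ :=
  LinearMap.mk₂ ℂ (fun h k => (((hess r q h k - hess r q (Complex.I • h) (Complex.I • k) : ℝ) : ℂ)
    - Complex.I * ((hess r q h (Complex.I • k) + hess r q (Complex.I • h) k : ℝ) : ℂ)) / 2)
    (fun h h' k => by
      simp only [hess, smul_add, map_add, add_apply, Complex.ofReal_add, Complex.ofReal_sub]
      ring)
    (fun a h k => by
      rw [I_smul_smul, smul_eq_re_smul_add]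
      simp only [hess, map_add, map_sub, map_smul, add_apply, sub_apply, smul_apply, smul_eq_mul,
        Complex.ofReal_add, Complex.ofReal_sub, Complex.ofReal_mul]
      nth_rewrite 9 [← Complex.re_add_im a]
      ring_nf
      simp only [Complex.I_sq]
      ring)
    (fun h k k' => by
      simp only [hess, smul_add, map_add, Complex.ofReal_add, Complex.ofReal_sub]
      ring)
    (fun a h k => by
      rw [I_smul_smul, smul_eq_re_smul_add]
      simp only [hess, map_add, map_sub, map_smul, smul_eq_mul,
        Complex.ofReal_add, Complex.ofReal_sub, Complex.ofReal_mul]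
      nth_rewrite 9 [← Complex.re_add_im a]
      ring_nf
      simp only [Complex.I_sq]
      ring)

theorem complexHessian_apply (r : (Fin n → ℂ) → ℝ) (q h k : Fin n → ℂ) :
    complexHessian r q h k
      = (((hess r q h k - hess r q (Complex.I • h) (Complex.I • k) : ℝ) : ℂ)
    - Complex.I * ((hess r q h (Complex.I • k) + hess r q (Complex.I • h) k : ℝ) : ℂ)) / 2 := rfl

theorem complexHessian_self_re (r : (Fin n → ℂ) → ℝ) (q h : Fin n → ℂ) :
    (complexHessian r q h h).re
      = (hess r q h h - hess r q (Complex.I • h) (Complex.I • h)) / 2 := by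
  rw [complexHessian_apply]
  have : ∀ a b : ℝ, (((a : ℂ) - Complex.I * (b : ℂ)) / 2).re = a / 2 := fun a b => by
    simp
  exact this _ _

theorem differentiable_complexHessian (r : (Fin n → ℂ) → ℝ) (q : Fin n → ℂ) :
    Differentiable ℂ fun h => complexHessian r q h h :=
  ((complexHessian r q).toContinuousBilinearMap.differentiable).clm_apply differentiable_id

theorem exists_taylor_le {r : (Fin n → ℂ) → ℝ} (hr : ContDiff ℝ 2 r) (p₀ : Fin n → ℂ) {η : ℝ}
    (hη : 0 < η) : ∃ s > 0, ∀ q ∈ ball p₀ s, ∀ z ∈ ball p₀ s,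
      |r z - r q - fderiv ℝ r q (z - q) - hess r q (z - q) (z - q) / 2| ≤ η * ‖z - q‖ ^ 2 := by
  have hr1 : ContDiff ℝ 1 (fderiv ℝ r) := hr.fderiv_right (by norm_num)
  have hr2 : Continuous (fderiv ℝ (fderiv ℝ r)) := hr1.continuous_fderiv one_ne_zero
  obtain ⟨s, hs, hsb⟩ := (Metric.continuousAt_iff (f := fderiv ℝ (fderiv ℝ r)) (a := p₀)).1
    hr2.continuousAt (η / 2) (half_pos hη)
  refine ⟨s, hs, fun q hq z hz => ?_⟩
  have hclose : ∀ y ∈ ball p₀ s, ‖fderiv ℝ (fderiv ℝ r) y - fderiv ℝ (fderiv ℝ r) q‖ ≤ η :=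
    fun y hy => by
      have h1 := hsb hy
      have h2 := hsb hq
      have h3 : dist (fderiv ℝ (fderiv ℝ r) y) (fderiv ℝ (fderiv ℝ r) q) ≤ η := by
        linarith [dist_triangle_right (fderiv ℝ (fderiv ℝ r) y) (fderiv ℝ (fderiv ℝ r) q)
          (fderiv ℝ (fderiv ℝ r) p₀)]
      exact (dist_eq_norm (fderiv ℝ (fderiv ℝ r) y) (fderiv ℝ (fderiv ℝ r) q)).symm.trans_le h3
  have hgrad : ∀ y ∈ ball p₀ s,
      ‖fderiv ℝ r y - fderiv ℝ r q - fderiv ℝ (fderiv ℝ r) q (y - q)‖ ≤ η * ‖y - q‖ :=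
    fun y hy => (convex_ball p₀ s).norm_image_sub_le_of_norm_hasFDerivWithin_le'
      (fun x _ => ((hr1.differentiable one_ne_zero) x).hasFDerivAt.hasFDerivWithinAt) hclose hq hy
  have hseg : segment ℝ q z ⊆ ball p₀ s := (convex_ball p₀ s).segment_subset hq hz
  have hder : ∀ y ∈ segment ℝ q z, HasFDerivWithinAt
      (fun y => r y - fderiv ℝ r q y - hess r q (y - q) (y - q) / 2)
      (fderiv ℝ r y - fderiv ℝ r q - fderiv ℝ (fderiv ℝ r) q (y - q)) (segment ℝ q z) y := by
    intro y _
    have h1 : HasFDerivAt (fun y => y - q) (ContinuousLinearMap.id ℝ (Fin n → ℂ)) y :=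
      (hasFDerivAt_id y).sub_const q
    have h2 := ((fderiv ℝ (fderiv ℝ r) q).hasFDerivAt.comp y h1).clm_apply h1
    refine (((((hr.differentiable two_ne_zero) y).hasFDerivAt.sub
      (fderiv ℝ r q).hasFDerivAt).sub (h2.mul_const (1 / 2))).congr_fderiv ?_).congr_of_eventuallyEq
      ?_ |>.hasFDerivWithinAt
    · ext v
      have := hess_symm (hr.contDiffAt (x := q)) v (y - q)
      simp only [hess, map_sub, sub_apply] at this
      simp
      linear_combination this / 2
    · exact .of_forall fun w => by simp [hess, div_eq_mul_inv]
  have hmv := (convex_segment q z).norm_image_sub_le_of_norm_hasFDerivWithin_le (C := η * ‖z - q‖)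
    hder (fun y hy => (hgrad y (hseg hy)).trans (by
      have : ‖y - q‖ ≤ ‖z - q‖ := norm_sub_le_of_mem_segment hy
      gcongr)) (left_mem_segment ℝ q z) (right_mem_segment ℝ q z)
  rw [Real.norm_eq_abs] at hmv
  refine le_trans (le_of_eq ?_) (hmv.trans (by rw [pow_two, mul_assoc]))
  congr 1
  simp [hess]
  ring

/-- The Levi polynomial of `r` at `q`, with the sign making its real part positive on the side
`r < 0` of a strictly pseudoconvex hypersurface `r = 0`. -/
def leviPoly (r : (Fin n → ℂ) → ℝ) (q z : Fin n → ℂ) : ℂ :=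
  -complexGradient r q (z - q) - complexHessian r q (z - q) (z - q) / 2

theorem differentiable_leviPoly (r : (Fin n → ℂ) → ℝ) (q : Fin n → ℂ) :
    Differentiable ℂ (leviPoly r q) := by
  have h1 : Differentiable ℂ fun z : Fin n → ℂ => z - q := differentiable_id.sub_const q
  have h2 : Differentiable ℂ fun z => complexHessian r q (z - q) (z - q) :=
    (differentiable_complexHessian r q).comp h1
  exact (((complexGradient r q).differentiable.comp h1).neg).sub
    (by simpa only [div_eq_mul_inv] using h2.mul_const (2⁻¹ : ℂ))

theorem leviPoly_re_sub_leviForm {r : (Fin n → ℂ) → ℝ} (hr : ContDiff ℝ 2 r) (q z : Fin n → ℂ) :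
    (leviPoly r q z).re - leviForm r q (z - q)
      = -fderiv ℝ r q (z - q) - hess r q (z - q) (z - q) / 2 := by
  rw [leviForm_eq hr.contDiffAt, leviPoly, Complex.sub_re, Complex.neg_re, complexGradient_re]
  have : (complexHessian r q (z - q) (z - q) / 2).re
      = (complexHessian r q (z - q) (z - q)).re / 2 := by simp
  rw [this, complexHessian_self_re]
  ring

theorem exists_abs_add_leviPoly_re_sub_le {r : (Fin n → ℂ) → ℝ} (hr : ContDiff ℝ 2 r)
    (p₀ : Fin n → ℂ) {η : ℝ} (hη : 0 < η) : ∃ s > 0, ∀ q ∈ ball p₀ s, ∀ z ∈ ball p₀ s,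
      |r z - r q + (leviPoly r q z).re - leviForm r q (z - q)| ≤ η * ‖z - q‖ ^ 2 := by
  obtain ⟨s, hs, h⟩ := exists_taylor_le hr p₀ hη
  refine ⟨s, hs, fun q hq z hz => ?_⟩
  have h1 := leviPoly_re_sub_leviForm hr q z
  have h2 := h q hq z hz
  rwa [add_sub_assoc, h1, ← add_sub_assoc, ← sub_eq_add_neg]

theorem exists_norm_leviPoly_add_complexGradient_le {r : (Fin n → ℂ) → ℝ} (hr : ContDiff ℝ 2 r)
    (p₀ : Fin n → ℂ) : ∃ C > 0, ∀ q ∈ ball p₀ 1,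
      (∀ h, ‖complexGradient r q h‖ ≤ C * ‖h‖) ∧
      ∀ h, ‖complexHessian r q h h‖ ≤ C * ‖h‖ ^ 2 := by
  have hr1 : ContDiff ℝ 1 (fderiv ℝ r) := hr.fderiv_right (by norm_num)
  have hr2 : Continuous (fderiv ℝ (fderiv ℝ r)) := hr1.continuous_fderiv one_ne_zero
  obtain ⟨C₁, h₁⟩ := (isCompact_closedBall p₀ 1).exists_bound_of_continuousOn
    hr1.continuous.continuousOn
  obtain ⟨C₂, h₂⟩ := (isCompact_closedBall p₀ 1).exists_bound_of_continuousOn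
    (f := fderiv ℝ (fderiv ℝ r)) hr2.continuousOn
  have hI : ∀ h : Fin n → ℂ, ‖Complex.I • h‖ = ‖h‖ := fun h => by rw [norm_smul]; simp
  refine ⟨max 1 (max (2 * C₁) (2 * C₂)), lt_max_of_lt_left one_pos, fun q hq => ⟨fun h => ?_,
    fun h => ?_⟩⟩
  · have hd : ∀ k, ‖fderiv ℝ r q k‖ ≤ C₁ * ‖k‖ := fun k =>
      (fderiv ℝ r q).le_of_opNorm_le (h₁ q (ball_subset_closedBall hq)) k
    have h3 : ‖complexGradient r q h‖ ≤ 2 * C₁ * ‖h‖ := by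
      rw [complexGradient_apply]
      refine (norm_sub_le _ _).trans ?_
      rw [norm_mul, Complex.norm_I, one_mul, Complex.norm_real, Complex.norm_real]
      have := hd (Complex.I • h)
      rw [hI] at this
      linarith [hd h]
    exact h3.trans (by gcongr; exact (le_max_left _ _).trans (le_max_right _ _))
  · have hd : ∀ k l, ‖hess r q k l‖ ≤ C₂ * ‖k‖ * ‖l‖ := fun k l =>
      ((fderiv ℝ (fderiv ℝ r) q).le_opNorm₂ k l).trans
        (by gcongr; exact h₂ q (ball_subset_closedBall hq))
    have h3 : ‖complexHessian r q h h‖ ≤ 2 * C₂ * ‖h‖ ^ 2 := by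
      rw [complexHessian_apply, norm_div]
      have e1 := hd h h
      have e2 := hd (Complex.I • h) (Complex.I • h)
      have e3 := hd h (Complex.I • h)
      have e4 := hd (Complex.I • h) h
      simp only [hI] at e2 e3 e4
      have e5 := norm_sub_le ((hess r q h h - hess r q (Complex.I • h) (Complex.I • h) : ℝ) : ℂ)
        (Complex.I * ((hess r q h (Complex.I • h) + hess r q (Complex.I • h) h : ℝ) : ℂ))
      rw [norm_mul, Complex.norm_I, one_mul, Complex.norm_real, Complex.norm_real] at e5
      have e6 := norm_sub_le (hess r q h h) (hess r q (Complex.I • h) (Complex.I • h))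
      have e7 := norm_add_le (hess r q h (Complex.I • h)) (hess r q (Complex.I • h) h)
      rw [Complex.norm_ofNat, div_le_iff₀ two_pos]
      nlinarith
    exact h3.trans (by gcongr; exact (le_max_right _ _).trans (le_max_right _ _))

theorem exists_support_function {r : (Fin n → ℂ) → ℝ} (hr : ContDiff ℝ 2 r)
    (hcpt : IsCompact {z | r z ≤ 1 / 2}) {ε c : ℝ} (hε : 0 < ε) (hc : 0 < c)
    (hlevi : ∀ z, |r z| ≤ ε → ∀ ξ, c * nsq ξ ≤ leviForm r z ξ) (p₀ : Fin n → ℂ) :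
    ∃ s > 0, ∃ M > 0, ∀ q, r q = 0 → dist q p₀ < s →
      (∀ z, dist z p₀ < 10 * s → -r z + c / 2 * ‖z - q‖ ^ 2 ≤ (leviPoly r q z).re) ∧
      ∃ H, DifferentiableOn ℂ H {z | r z < 0} ∧ (∀ z, r z < 0 → 0 < (H z).re) ∧
        (∀ z, r z < 0 → dist z p₀ < 5 * s → ‖H z - (leviPoly r q z)⁻¹‖ ≤ M) ∧
        ∀ z, r z < 0 → 5 * s ≤ dist z p₀ → ‖H z‖ ≤ M := by
  obtain ⟨S, hS, hT⟩ := exists_abs_add_leviPoly_re_sub_le hr p₀ (half_pos hc)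
  set s := S / 10 with hs_def
  have hs : 0 < s := by positivity
  have hS' : 10 * s = S := by rw [hs_def]; ring
  set ε' := min (min ε (1 / 2)) (c * s ^ 2 / 4) with hε'_def
  have hε' : 0 < ε' := by positivity
  have hε'ε : ε' ≤ ε := (min_le_left _ _).trans (min_le_left _ _)
  have hε'h : ε' ≤ 1 / 2 := (min_le_left _ _).trans (min_le_right _ _)
  have hε's : ε' ≤ c * s ^ 2 / 4 := min_le_right _ _
  obtain ⟨M, hM, hcousin⟩ := exists_cousin_solution hr hcpt hc hε' hε'h
    (fun z hz => hlevi z (hz.trans hε'ε)) p₀ hs (b := (c * s ^ 2 / 4)⁻¹) (by positivity)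
  refine ⟨s, hs, 2 * M + 1, by positivity, fun q hq hqs => ?_⟩
  have hre : ∀ z, dist z p₀ < 10 * s → -r z + c / 2 * ‖z - q‖ ^ 2 ≤ (leviPoly r q z).re := by
    intro z hz
    have h1 := hT q (by rw [mem_ball]; linarith) z (by rw [mem_ball]; linarith)
    have h2 := hlevi q (by rw [hq, abs_zero]; exact hε.le) (z - q)
    have h3 := mul_le_mul_of_nonneg_left (norm_sq_le_nsq (z - q)) hc.le
    rw [hq] at h1
    linarith [(abs_le.1 h1).1]
  refine ⟨hre, ?_⟩
  have hnorm : ∀ z, r z < ε' → 2 * s < dist z p₀ → dist z p₀ < 10 * s →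
      c * s ^ 2 / 4 ≤ (leviPoly r q z).re := by
    intro z hz h2 h10
    have h1 : s ≤ ‖z - q‖ := by
      rw [← dist_eq_norm]
      linarith [dist_triangle_right z p₀ q, dist_comm q p₀, dist_triangle z q p₀]
    have h3 : c / 2 * s ^ 2 ≤ c / 2 * ‖z - q‖ ^ 2 := by gcongr
    linarith [hre z h10]
  have hpos : ∀ z, r z < 0 → dist z p₀ < 10 * s → 0 < (leviPoly r q z).re := fun z hz h10 =>
    lt_of_lt_of_le (by have : 0 ≤ c / 2 * ‖z - q‖ ^ 2 := by positivity
                       linarith) (hre z h10)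
  have hne : ∀ {w : ℂ}, 0 < w.re → w ≠ 0 := fun h h0 => by simp [h0] at h
  obtain ⟨H, hH, hH1, hH2⟩ := hcousin (fun z => (leviPoly r q z)⁻¹)
    (fun z hz => ((differentiable_leviPoly r q z).inv (hne (hpos z hz.1
        hz.2))).differentiableWithinAt)
    (fun z hz => ((differentiable_leviPoly r q z).inv (hne (lt_of_lt_of_le (by positivity)
      (hnorm z hz.1 hz.2.1 hz.2.2)))).differentiableWithinAt)
    (fun z h h2 h10 => by
      rw [norm_inv]
      exact inv_anti₀ (by positivity) ((hnorm z h h2 h10).trans (Complex.re_le_norm _)))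
  refine ⟨fun z => H z + ((M + 1 : ℝ) : ℂ), hH.add_const _, fun z hz => ?_, fun z hz h5 => ?_,
    fun z hz h5 => ?_⟩
  · rw [Complex.add_re, Complex.ofReal_re]
    rcases lt_or_ge (dist z p₀) (5 * s) with h5 | h5
    · have h1 := (Complex.abs_re_le_norm _).trans (hH1 z hz h5)
      have h2 : 0 < ((leviPoly r q z)⁻¹).re := by
        rw [Complex.inv_re]
        have h3 := hpos z hz (by linarith)
        exact div_pos h3 (Complex.normSq_pos.2 (hne h3))
      rw [Complex.sub_re] at h1
      linarith [(abs_le.1 h1).1]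
    · linarith [(abs_le.1 ((Complex.abs_re_le_norm _).trans (hH2 z hz h5))).1]
  · have h1 := norm_add_le (H z - (leviPoly r q z)⁻¹) ((M + 1 : ℝ) : ℂ)
    rw [Complex.norm_real, Real.norm_of_nonneg (by positivity : 0 ≤ M + 1)] at h1
    rw [add_sub_right_comm]
    linarith [hH1 z hz h5]
  · have h1 := norm_add_le (H z) ((M + 1 : ℝ) : ℂ)
    rw [Complex.norm_real, Real.norm_of_nonneg (by positivity : 0 ≤ M + 1)] at h1
    linarith [hH2 z hz h5]

end LeviPolynomial

section HermitianForm

variable {n : ℕ}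

open scoped Matrix MatrixOrder ComplexOrder

theorem exists_linearEquiv_nsq_eq {N : Matrix (Fin n) (Fin n) ℂ}
    (hN : ∀ h ≠ 0, 0 < (star h ⬝ᵥ N *ᵥ h).re) :
    ∃ B : (Fin n → ℂ) ≃ₗ[ℂ] (Fin n → ℂ), ∀ h, (star h ⬝ᵥ N *ᵥ h).re = nsq (B h) := by
  have hconj : ∀ h : Fin n → ℂ, star h ⬝ᵥ Nᴴ *ᵥ h = star (star h ⬝ᵥ N *ᵥ h) := fun h => by
    rw [Matrix.star_dotProduct, Matrix.star_mulVec, Matrix.conjTranspose_conjTranspose,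
      ← Matrix.dotProduct_mulVec]
  set H : Matrix (Fin n) (Fin n) ℂ := (1 / 2 : ℝ) • (N + Nᴴ) with hH_def
  have hH : ∀ h : Fin n → ℂ, star h ⬝ᵥ H *ᵥ h = ((star h ⬝ᵥ N *ᵥ h).re : ℂ) := fun h => by
    rw [hH_def, Matrix.smul_mulVec, Matrix.add_mulVec, dotProduct_smul, dotProduct_add, hconj,
      RCLike.star_def, Complex.add_conj, Complex.real_smul]
    push_cast
    ring
  have hsa : H.IsHermitian := by
    rw [hH_def, Matrix.IsHermitian, Matrix.conjTranspose_smul, Matrix.conjTranspose_add,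
      Matrix.conjTranspose_conjTranspose, star_trivial, add_comm]
  have hpos : H.PosSemidef := .of_dotProduct_mulVec_nonneg hsa fun h => by
    rw [hH]
    rcases eq_or_ne h 0 with rfl | h0
    · simp
    · exact Complex.zero_le_real.2 (hN h h0).le
  obtain ⟨B, hB⟩ := CStarAlgebra.nonneg_iff_eq_star_mul_self.mp hpos.nonneg
  have hBn : ∀ h, (star h ⬝ᵥ N *ᵥ h).re = nsq (B *ᵥ h) := fun h => by
    rw [← Complex.ofReal_re ((star h ⬝ᵥ N *ᵥ h).re), ← hH, hB, Matrix.star_eq_conjTranspose,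
      ← Matrix.mulVec_mulVec, Matrix.dotProduct_mulVec, ← Matrix.star_mulVec, nsq, dotProduct,
      Complex.re_sum]
    refine Finset.sum_congr rfl fun μ _ => ?_
    rw [Pi.star_apply, RCLike.star_def, Complex.conj_mul', ← Complex.ofReal_pow, Complex.ofReal_re]
  have hinj : Function.Injective (Matrix.mulVecLin B) := by
    refine (injective_iff_map_eq_zero _).2 fun h hh => ?_
    by_contra h0
    have h1 := hN h h0
    rw [hBn, show B *ᵥ h = 0 from hh] at h1
    simp [nsq] at h1
  exact ⟨LinearEquiv.ofInjectiveEndo _ hinj, hBn⟩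

theorem leviForm_eq_dotProduct (r : (Fin n → ℂ) → ℝ) (q h : Fin n → ℂ) :
    leviForm r q h = (star h ⬝ᵥ (Matrix.of fun ν μ =>
      wderiv μ (fun w => wderivBar ν (fun u => (r u : ℂ)) w) q) *ᵥ h).re := by
  rw [leviForm, Finset.sum_comm]
  congr 1
  simp only [dotProduct, Matrix.mulVec, Matrix.of_apply, Pi.star_apply, Finset.mul_sum]
  refine Finset.sum_congr rfl fun ν _ => Finset.sum_congr rfl fun μ _ => ?_
  rw [RCLike.star_def]
  ring

theorem leviForm_complex_smul (r : (Fin n → ℂ) → ℝ) (q : Fin n → ℂ) (a : ℂ) (h : Fin n → ℂ) :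
    leviForm r q (a • h) = ‖a‖ ^ 2 * leviForm r q h := by
  rw [leviForm_eq_dotProduct, leviForm_eq_dotProduct, star_smul, Matrix.mulVec_smul,
    smul_dotProduct, dotProduct_smul, smul_eq_mul, smul_eq_mul, ← mul_assoc, RCLike.star_def,
    Complex.conj_mul', ← Complex.ofReal_pow, Complex.re_ofReal_mul]

theorem exists_linearEquiv_nsq_eq_leviForm {r : (Fin n → ℂ) → ℝ} {q : Fin n → ℂ} {c : ℝ}
    (hc : 0 < c) (hlevi : ∀ ξ, c * nsq ξ ≤ leviForm r q ξ) (l : (Fin n → ℂ) →L[ℂ] ℂ)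
    (e : Fin n → ℂ) :
    ∃ B : (Fin n → ℂ) ≃ₗ[ℂ] (Fin n → ℂ), ∀ h,
      ‖l h‖ ^ 2 + leviForm r q (h - l h • e) = nsq (B h) := by
  set N := Matrix.of fun ν μ => wderiv μ (fun w => wderivBar ν (fun u => (r u : ℂ)) w) q
  set T : Matrix (Fin n) (Fin n) ℂ :=
    LinearMap.toMatrix' (LinearMap.id - (l : (Fin n → ℂ) →ₗ[ℂ] ℂ).smulRight e)
  set L : Fin n → ℂ := fun μ => l (Pi.single μ 1)
  have hT : ∀ h, T *ᵥ h = h - l h • e := fun h => by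
    rw [← Matrix.toLin'_apply, Matrix.toLin'_toMatrix']
    simp
  have hL : ∀ h, L ⬝ᵥ h = l h := fun h => by
    nth_rewrite 2 [pi_eq_sum_univ' h]
    simp only [map_sum, map_smul, dotProduct, smul_eq_mul]
    exact Finset.sum_congr rfl fun μ _ => mul_comm _ _
  have key : ∀ h, ‖l h‖ ^ 2 + leviForm r q (h - l h • e)
      = (star h ⬝ᵥ (Matrix.vecMulVec (star L) L + Tᴴ * N * T) *ᵥ h).re := fun h => by
    rw [leviForm_eq_dotProduct, ← hT, Matrix.add_mulVec, dotProduct_add, Complex.add_re]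
    congr 1
    · rw [Matrix.vecMulVec_mulVec, dotProduct_smul, Matrix.star_dotProduct_star, hL,
        op_smul_eq_mul, RCLike.star_def, Complex.conj_mul', ← Complex.ofReal_pow,
        Complex.ofReal_re]
    · rw [← Matrix.mulVec_mulVec, ← Matrix.mulVec_mulVec, Matrix.dotProduct_mulVec (star h),
        ← Matrix.star_mulVec]
  have hpos : ∀ h ≠ 0, 0 < ‖l h‖ ^ 2 + leviForm r q (h - l h • e) := fun h hh => by
    have h1 := hlevi (h - l h • e)
    have h2 := mul_le_mul_of_nonneg_left (norm_sq_le_nsq (h - l h • e)) hc.le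
    rcases eq_or_ne (l h) 0 with h0 | h0
    · rw [h0, zero_smul, sub_zero] at h1 h2
      rw [h0, zero_smul, sub_zero, norm_zero]
      have : 0 < c * ‖h‖ ^ 2 := by positivity
      linarith
    · have : 0 < ‖l h‖ ^ 2 := by positivity
      have : 0 ≤ c * ‖h - l h • e‖ ^ 2 := by positivity
      linarith
  obtain ⟨B, hB⟩ := exists_linearEquiv_nsq_eq fun h hh => (hpos h hh).trans_eq (key h)
  exact ⟨B, fun h => (key h).trans (hB h)⟩

end HermitianForm

section BoundaryModel

variable {n : ℕ} {r : (Fin n → ℂ) → ℝ} {p₀ : Fin n → ℂ}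

theorem exists_half_lt_fderiv (hr : ContDiff ℝ 2 r) (hd : fderiv ℝ r p₀ ≠ 0) :
    ∃ v : Fin n → ℂ, ∃ s > 0, ∀ w ∈ ball p₀ s, 1 / 2 < fderiv ℝ r w v := by
  obtain ⟨v, hv⟩ : ∃ v, fderiv ℝ r p₀ v ≠ 0 := by
    by_contra! h
    exact hd (ContinuousLinearMap.ext h)
  have hc : Continuous fun w => fderiv ℝ r w ((fderiv ℝ r p₀ v)⁻¹ • v) :=
    (hr.continuous_fderiv two_ne_zero).clm_apply continuous_const
  have h1 : 1 / 2 < fderiv ℝ r p₀ ((fderiv ℝ r p₀ v)⁻¹ • v) := by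
    rw [map_smul, smul_eq_mul, inv_mul_cancel₀ hv]
    norm_num
  obtain ⟨s, hs, h⟩ := Metric.eventually_nhds_iff_ball.1
    (hc.continuousAt.eventually_const_lt h1)
  exact ⟨_, s, hs, h⟩

theorem exists_zero_norm_sub_le (hr : ContDiff ℝ 2 r) (hp : r p₀ = 0) (hd : fderiv ℝ r p₀ ≠ 0) :
    ∃ s > 0, ∃ C > 0, ∀ z ∈ ball p₀ s, r z < 0 → ∃ q, r q = 0 ∧ ‖z - q‖ ≤ C * -r z := by
  obtain ⟨v, s₁, hs₁, hv⟩ := exists_half_lt_fderiv hr hd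
  have h1 : -r p₀ < s₁ / (4 * (‖v‖ + 1)) := by
    rw [hp, neg_zero]
    positivity
  obtain ⟨s₂, hs₂, h2⟩ := Metric.eventually_nhds_iff_ball.1
    (hr.continuous.neg.continuousAt.eventually_lt_const h1)
  refine ⟨min (s₁ / 2) s₂, by positivity, 2 * (‖v‖ + 1), by positivity, fun z hz hz0 => ?_⟩
  set T := 2 * -r z with hT_def
  have hT : 0 ≤ T := by linarith
  have hTv : T * (‖v‖ + 1) < s₁ / 2 := by
    have h3 := (lt_div_iff₀ (by positivity)).1 (h2 z (ball_subset_ball (min_le_right _ _) hz))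
    rw [Pi.neg_apply] at h3
    linarith
  have hmem : ∀ t ∈ Icc 0 T, z + t • v ∈ ball p₀ s₁ := fun t ht => by
    have h3 : dist z p₀ < s₁ / 2 := lt_of_lt_of_le hz (min_le_left _ _)
    have h4 : ‖t • v‖ ≤ T * (‖v‖ + 1) := by
      rw [norm_smul, Real.norm_of_nonneg ht.1]
      have := ht.2
      gcongr
      linarith
    rw [mem_ball, dist_eq_norm, add_sub_right_comm]
    rw [dist_eq_norm] at h3
    linarith [norm_add_le (z - p₀) (t • v)]
  have hder : ∀ t : ℝ, HasDerivAt (fun t : ℝ => r (z + t • v)) (fderiv ℝ r (z + t • v) v) t :=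
    fun t => by
      have h3 : HasDerivAt (fun t : ℝ => z + t • v) v t := by
        simpa using ((hasDerivAt_id t).smul_const v).const_add z
      exact (hr.differentiable two_ne_zero _).hasFDerivAt.comp_hasDerivAt t h3
  have hcont : Continuous fun t : ℝ => r (z + t • v) :=
    continuous_iff_continuousAt.2 fun t => (hder t).continuousAt
  have hmv := (convex_Icc (0 : ℝ) T).mul_sub_le_image_sub_of_le_deriv hcont.continuousOn
    (fun t _ => (hder t).differentiableAt.differentiableWithinAt)
    (fun t ht => by
      rw [(hder t).deriv]
      exact (hv _ (hmem t (interior_subset ht))).le) 0 (left_mem_Icc.2 hT) T (right_mem_Icc.2 hT) hT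
  simp only [zero_smul, add_zero] at hmv
  obtain ⟨t, ht, ht0⟩ := intermediate_value_Icc hT hcont.continuousOn
    (show (0 : ℝ) ∈ Icc (r (z + (0 : ℝ) • v)) (r (z + T • v)) from
      ⟨by simpa using hz0.le, by linarith⟩)
  refine ⟨z + t • v, ht0, ?_⟩
  rw [sub_add_cancel_left, norm_neg, norm_smul, Real.norm_of_nonneg ht.1]
  have := ht.2
  calc t * ‖v‖ ≤ T * (‖v‖ + 1) := by gcongr; linarith
    _ = _ := by rw [hT_def]; ring

theorem exists_complexGradient_eq_one (hr : ContDiff ℝ 2 r) (hd : fderiv ℝ r p₀ ≠ 0) :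
    ∃ s > 0, ∃ E > 0, ∀ q ∈ ball p₀ s, ∃ e, ‖e‖ ≤ E ∧ complexGradient r q e = 1 := by
  obtain ⟨v, s, hs, hv⟩ := exists_half_lt_fderiv hr hd
  refine ⟨s, hs, 2 * (‖v‖ + 1), by positivity, fun q hq => ⟨(complexGradient r q v)⁻¹ • v, ?_, ?_⟩⟩
  · have h1 : 1 / 2 ≤ ‖complexGradient r q v‖ :=
      ((complexGradient_re r q v).symm ▸ (hv q hq).le).trans (Complex.re_le_norm _)
    rw [norm_smul, norm_inv]
    have h2 : ‖complexGradient r q v‖⁻¹ ≤ 2 := by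
      rw [inv_le_comm₀ (by linarith) two_pos]
      linarith
    gcongr
    linarith
  · have h1 : complexGradient r q v ≠ 0 := fun h0 => by
      have h2 := hv q hq
      rw [← complexGradient_re, h0, Complex.zero_re] at h2
      linarith
    rw [map_smul, smul_eq_mul, inv_mul_cancel₀ h1]

theorem exists_norm_hess_le (hr : ContDiff ℝ 2 r) (p₀ : Fin n → ℂ) :
    ∃ C > 0, ∀ q ∈ ball p₀ 1, ∀ k l, |hess r q k l| ≤ C * ‖k‖ * ‖l‖ := by
  have hr2 : Continuous (fderiv ℝ (fderiv ℝ r)) :=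
    (hr.fderiv_right (m := 1) (by norm_num)).continuous_fderiv one_ne_zero
  obtain ⟨C, h⟩ := (isCompact_closedBall p₀ 1).exists_bound_of_continuousOn
    (f := fderiv ℝ (fderiv ℝ r)) hr2.continuousOn
  refine ⟨max 1 C, lt_max_of_lt_left one_pos, fun q hq k l => ?_⟩
  exact ((fderiv ℝ (fderiv ℝ r) q).le_opNorm₂ k l).trans
    (by gcongr; exact (h q (ball_subset_closedBall hq)).trans (le_max_right _ _))

theorem exists_boundary_model (hr : ContDiff ℝ 2 r) (p₀ : Fin n → ℂ) {C E κ : ℝ} (hC : 0 < C)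
    (hE : 0 < E) (hκ : 0 < κ) : ∃ s > 0, ∀ q ∈ ball p₀ s, r q = 0 → ∀ e, ‖e‖ ≤ E →
      complexGradient r q e = 1 → ∀ δ, 0 < δ → δ < s → ∀ k, ∀ t : ℂ, complexGradient r q k = 0 →
      ‖k‖ ^ 2 ≤ C * δ → ‖t‖ ≤ C * δ →
      |r (q + (k + t • e)) - t.re - (complexHessian r q k k).re / 2 - leviForm r q k| ≤ κ * δ := by
  set C₃ := 2 * C + 2 * (C * E) ^ 2 with hC₃
  have hC₃0 : 0 < C₃ := by positivity
  obtain ⟨s₁, hs₁, hT⟩ := exists_taylor_le hr p₀ (η := κ / (2 * C₃)) (by positivity)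
  obtain ⟨C₂, hC₂, hB⟩ := exists_norm_hess_le hr p₀
  have hlim₁ : Tendsto (fun δ : ℝ => Real.sqrt (C₃ * δ)) (𝓝 0) (𝓝 0) := by
    have : Continuous fun δ : ℝ => Real.sqrt (C₃ * δ) := by fun_prop
    simpa using this.tendsto 0
  have hlim₂ : Tendsto (fun δ : ℝ => C₂ * (2 * Real.sqrt (C * δ) * (C * E) + (C * E) ^ 2 * δ))
      (𝓝 0) (𝓝 0) := by
    have : Continuous fun δ : ℝ => C₂ * (2 * Real.sqrt (C * δ) * (C * E) + (C * E) ^ 2 * δ) := by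
      fun_prop
    simpa using this.tendsto 0
  obtain ⟨s₂, hs₂, hs⟩ := Metric.eventually_nhds_iff_ball.1
    ((hlim₁.eventually_lt_const (half_pos hs₁)).and (hlim₂.eventually_lt_const hκ))
  refine ⟨min (min 1 (s₁ / 2)) s₂, by positivity,
      fun q hq hq0 e he hle δ hδ hδs k t hk hkn ht => ?_⟩
  have hδ1 : δ < 1 := hδs.trans_le ((min_le_left _ _).trans (min_le_left _ _))
  have hq1 : q ∈ ball p₀ 1 := ball_subset_ball ((min_le_left _ _).trans (min_le_left _ _)) hq
  have hqs : dist q p₀ < s₁ / 2 := ball_subset_ball ((min_le_left _ _).trans (min_le_right _ _)) hq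
  obtain ⟨hd₁, hd₂⟩ := hs δ (by
    rw [mem_ball, Real.dist_0_eq_abs, abs_of_pos hδ]
    exact hδs.trans_le (min_le_right _ _))
  have hks : ‖k‖ ≤ Real.sqrt (C * δ) := Real.le_sqrt_of_sq_le hkn
  have hte : ‖t • e‖ ≤ C * E * δ := by
    rw [norm_smul]
    calc ‖t‖ * ‖e‖ ≤ (C * δ) * E := by gcongr
      _ = _ := by ring
  have hh : ‖k + t • e‖ ^ 2 ≤ C₃ * δ := by
    have h1 : ‖k + t • e‖ ^ 2 ≤ (‖k‖ + ‖t • e‖) ^ 2 := by gcongr; exact norm_add_le _ _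
    have h2 : ‖t • e‖ ^ 2 ≤ (C * E * δ) ^ 2 := by gcongr
    have h3 : (C * E * δ) ^ 2 ≤ (C * E) ^ 2 * δ := by
      rw [mul_pow]
      gcongr
      nlinarith
    nlinarith [sq_nonneg (‖k‖ - ‖t • e‖)]
  have hT' := hT q (by rw [mem_ball]; linarith) (q + (k + t • e)) (by
    have h1 : ‖k + t • e‖ ≤ Real.sqrt (C₃ * δ) := Real.le_sqrt_of_sq_le hh
    rw [mem_ball, dist_eq_norm, add_sub_right_comm]
    rw [dist_eq_norm] at hqs
    linarith [norm_add_le (q - p₀) (k + t • e)])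
  rw [add_sub_cancel_left, hq0, sub_zero, ← complexGradient_re, map_add, map_smul, hk, hle,
      zero_add,
    smul_eq_mul, mul_one] at hT'
  have hT'' : κ / (2 * C₃) * ‖k + t • e‖ ^ 2 ≤ κ * δ / 2 := by
    calc κ / (2 * C₃) * ‖k + t • e‖ ^ 2 ≤ κ / (2 * C₃) * (C₃ * δ) := by gcongr
      _ = _ := by field_simp
  have hexp : hess r q (k + t • e) (k + t • e) = hess r q k k
      + (hess r q k (t • e) + hess r q (t • e) k + hess r q (t • e) (t • e)) := by
    simp only [hess, map_add, add_apply]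
    ring
  have hrem : |hess r q k (t • e) + hess r q (t • e) k + hess r q (t • e) (t • e)| ≤ κ * δ := by
    have e1 := hB q hq1 k (t • e)
    have e2 := hB q hq1 (t • e) k
    have e3 := hB q hq1 (t • e) (t • e)
    have e4 : C₂ * ‖k‖ * ‖t • e‖ ≤ C₂ * Real.sqrt (C * δ) * (C * E * δ) := by gcongr
    have e5 : C₂ * ‖t • e‖ * ‖t • e‖ ≤ C₂ * (C * E * δ) * (C * E * δ) := by gcongr
    have e6 := mul_le_mul_of_nonneg_right hd₂.le hδ.le
    refine (abs_add_three _ _ _).trans ?_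
    linarith
  have hlev := leviForm_eq (hr.contDiffAt (x := q)) k
  rw [complexHessian_self_re, hlev]
  rw [hexp] at hT'
  rw [abs_le] at hT' hrem ⊢
  constructor <;> linarith [hT'.1, hT'.2, hrem.1, hrem.2]

end BoundaryModel

section ModelMap

variable {n : ℕ} (l : (Fin n → ℂ) →L[ℂ] ℂ) (P : (Fin n → ℂ) →ₗ[ℂ] (Fin n → ℂ) →ₗ[ℂ] ℂ)
  (e q : Fin n → ℂ) (σ : ℂ)

/-- The component in `ker l` of the Cayley-type map `modelMap`. -/
def modelTangent (v : Fin n → ℂ) : Fin n → ℂ := (σ / (1 - l v)) • (v - l v • e)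

/-- The component along `e` of the Cayley-type map `modelMap`. -/
def modelNormal (v : Fin n → ℂ) : ℂ :=
  -(σ ^ 2 * ((1 + l v) / (1 - l v))
    + P (modelTangent l e σ v) (modelTangent l e σ v) / 2)

/-- A Cayley-type map carrying the ellipsoid `‖l v‖² + L (v - l v • e) < 1` onto a domain which
osculates, near `q` and at scale `σ`, a strictly pseudoconvex domain with Levi form `L`. -/
def modelMap (v : Fin n → ℂ) : Fin n → ℂ :=
  q + (modelTangent l e σ v + modelNormal l P e σ v • e)

variable {l P e q σ}

theorem map_modelTangent (hle : l e = 1) (v : Fin n → ℂ) : l (modelTangent l e σ v) = 0 := by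
  rw [modelTangent, map_smul, map_sub, map_smul, hle, smul_eq_mul, smul_eq_mul, mul_one, sub_self,
    mul_zero]

theorem map_modelMap_sub (hle : l e = 1) (v : Fin n → ℂ) :
    l (modelMap l P e q σ v - q) = modelNormal l P e σ v := by
  rw [modelMap, add_sub_cancel_left, map_add, map_modelTangent hle, map_smul, hle, zero_add,
    smul_eq_mul, mul_one]

theorem differentiableAt_modelMap {v : Fin n → ℂ} (hv : l v ≠ 1) :
    DifferentiableAt ℂ (modelMap l P e q σ) v := by
  have hv' : 1 - l v ≠ 0 := sub_ne_zero.2 hv.symm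
  have hT : DifferentiableAt ℂ (modelTangent l e σ) v := by
    unfold modelTangent
    fun_prop (disch := assumption)
  have hP : DifferentiableAt ℂ (fun v => P (modelTangent l e σ v) (modelTangent l e σ v)) v :=
    ((P.toContinuousBilinearMap.differentiableAt).comp v hT).clm_apply hT
  have hw : DifferentiableAt ℂ (fun v => σ ^ 2 * ((1 + l v) / (1 - l v))) v := by
    fun_prop (disch := assumption)
  have hN : DifferentiableAt ℂ (modelNormal l P e σ) v :=
    (hw.add (by simpa only [div_eq_mul_inv] using hP.mul_const (2⁻¹ : ℂ))).neg
  exact (hT.add (hN.smul_const e)).const_add q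

theorem modelMap_injective (hle : l e = 1) (hσ : σ ≠ 0) {v v' : Fin n → ℂ} (hv : l v ≠ 1)
    (hv' : l v' ≠ 1) (h : modelMap l P e q σ v = modelMap l P e q σ v') : v = v' := by
  have h0 : 1 - l v ≠ 0 := sub_ne_zero.2 hv.symm
  have h0' : 1 - l v' ≠ 0 := sub_ne_zero.2 hv'.symm
  have hN : modelNormal l P e σ v = modelNormal l P e σ v' := by
    rw [← map_modelMap_sub (q := q) hle, h, map_modelMap_sub hle]
  have hT : modelTangent l e σ v = modelTangent l e σ v' := by
    simpa [modelMap, hN] using h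
  have hw : (1 + l v) / (1 - l v) = (1 + l v') / (1 - l v') := by
    simp only [modelNormal, hT] at hN
    exact mul_left_cancel₀ (pow_ne_zero 2 hσ) (by linear_combination -hN)
  have hl : l v = l v' := by
    rw [div_eq_div_iff h0 h0'] at hw
    linear_combination hw / 2
  rw [modelTangent, modelTangent, ← hl] at hT
  have := smul_right_injective _ (div_ne_zero hσ h0) hT
  simpa using this

theorem modelMap_eq (hle : l e = 1) (hσ : σ ≠ 0) {h : Fin n → ℂ} {w : ℂ} (hw : w + 1 ≠ 0)
    (hh : -(l h + P (h - l h • e) (h - l h • e) / 2) = σ ^ 2 * w) {v : Fin n → ℂ}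
    (hv : v = (2 / ((w + 1) * σ)) • (h - l h • e) + ((w - 1) / (w + 1)) • e) :
    l v = (w - 1) / (w + 1) ∧ v - l v • e = (2 / ((w + 1) * σ)) • (h - l h • e) ∧
      modelMap l P e q σ v = q + h := by
  have h1 : l v = (w - 1) / (w + 1) := by
    rw [hv, map_add, map_smul, map_smul, map_sub, map_smul, hle]
    simp
  have h2 : v - l v • e = (2 / ((w + 1) * σ)) • (h - l h • e) := by
    rw [h1, hv, add_sub_cancel_right]
  have h3 : 1 - l v = 2 / (w + 1) := by
    rw [h1]
    field_simp
    ring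
  have h4 : modelTangent l e σ v = h - l h • e := by
    rw [modelTangent, h2, smul_smul, h3]
    have : σ / (2 / (w + 1)) * (2 / ((w + 1) * σ)) = 1 := by
      field_simp
    rw [this, one_smul]
  have h5 : modelNormal l P e σ v = l h := by
    have : (1 + l v) / (1 - l v) = w := by
      rw [h3, h1]
      field_simp
      ring
    rw [modelNormal, h4, this]
    linear_combination hh
  refine ⟨h1, h2, ?_⟩
  rw [modelMap, h4, h5, sub_add_cancel]

end ModelMap

section Embedding

variable {n : ℕ} {r : (Fin n → ℂ) → ℝ} {p₀ : Fin n → ℂ}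

theorem re_cayley_mul_norm_sq {a : ℂ} (ha : a ≠ 1) :
    ((1 + a) / (1 - a)).re * ‖1 - a‖ ^ 2 = 1 - ‖a‖ ^ 2 := by
  have h : Complex.normSq (1 - a) ≠ 0 := Complex.normSq_eq_zero.not.2 (sub_ne_zero.2 ha.symm)
  rw [← Complex.normSq_eq_norm_sq, ← Complex.normSq_eq_norm_sq, Complex.div_re, add_mul,
    div_mul_cancel₀ _ h, div_mul_cancel₀ _ h, Complex.normSq_apply]
  simp
  ring

theorem norm_sub_one_sq_eq (w : ℂ) : ‖w - 1‖ ^ 2 = ‖w + 1‖ ^ 2 - 4 * w.re := by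
  rw [← Complex.normSq_eq_norm_sq, ← Complex.normSq_eq_norm_sq, Complex.normSq_apply,
    Complex.normSq_apply]
  simp
  ring

theorem exists_modelMap_image_subset (hr : ContDiff ℝ 2 r) {ε c : ℝ} (hε : 0 ≤ ε) (hc : 0 < c)
    (hlevi : ∀ z, |r z| ≤ ε → ∀ ξ, c * nsq ξ ≤ leviForm r z ξ) (p₀ : Fin n → ℂ) {E t : ℝ}
    (hE : 0 < E) (ht0 : 0 < t) (ht : t < 1) :
    ∃ s > 0, ∀ q ∈ ball p₀ s, r q = 0 → ∀ e, ‖e‖ ≤ E → complexGradient r q e = 1 →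
      ∀ σ : ℝ, 0 < σ → σ ^ 2 < s → ∀ v, ‖complexGradient r q v‖ ^ 2
          + leviForm r q (v - complexGradient r q v • e) < t ^ 2 →
        complexGradient r q v ≠ 1 ∧
        r (modelMap (complexGradient r q) (complexHessian r q) e q (σ : ℂ) v) < 0 := by
  obtain ⟨N, hN, hNb⟩ := exists_norm_leviPoly_add_complexGradient_le hr p₀
  have ht1 : 0 < 1 - t := by linarith
  have ht2 : 0 < 1 - t ^ 2 := by nlinarith
  set C₁ := 1 / (c * (1 - t) ^ 2) with hC₁
  set C := C₁ + 2 / (1 - t) + N * C₁ with hC_def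
  have hC₁0 : 0 < C₁ := by positivity
  obtain ⟨s, hs, hmodel⟩ := exists_boundary_model hr p₀ (C := C) (by positivity) hE
    (κ := (1 - t ^ 2) / 8) (by positivity)
  refine ⟨min 1 s, by positivity, fun q hq hq0 e he hle σ hσ hσs v hv => ?_⟩
  obtain ⟨-, hP⟩ := hNb q (ball_subset_ball (min_le_left _ _) hq)
  set l := complexGradient r q
  have hL := fun ξ => hlevi q (by rw [hq0, abs_zero]; exact hε) ξ
  set a := l v with ha_def
  set y := v - a • e with hy_def
  have hy0 : c * ‖y‖ ^ 2 ≤ leviForm r q y :=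
    (mul_le_mul_of_nonneg_left (norm_sq_le_nsq y) hc.le).trans (hL y)
  have hy1 : 0 ≤ c * ‖y‖ ^ 2 := by positivity
  have hat : ‖a‖ < t := lt_of_pow_lt_pow_left₀ 2 ht0.le (by linarith)
  have ha1 : a ≠ 1 := fun h => by
    rw [h, norm_one] at hat
    linarith
  have h1a : 1 - t ≤ ‖1 - a‖ := by
    have := norm_sub_norm_le (1 : ℂ) a
    rw [norm_one] at this
    linarith
  have h2a : ‖1 - a‖ ≤ 2 := by
    have := norm_sub_le (1 : ℂ) a
    rw [norm_one] at this
    linarith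
  have h1a0 : 0 < ‖1 - a‖ := ht1.trans_le h1a
  set k := modelTangent l e (σ : ℂ) v with hk_def
  set u := modelNormal l (complexHessian r q) e (σ : ℂ) v with hu_def
  have hk2 : ‖k‖ ^ 2 ≤ C₁ * σ ^ 2 := by
    rw [hk_def, modelTangent, norm_smul, norm_div, Complex.norm_real, Real.norm_of_nonneg hσ.le,
      mul_pow, div_pow]
    have h1 : ‖y‖ ^ 2 ≤ 1 / c := by
      rw [le_div_iff₀ hc]
      nlinarith [sq_nonneg ‖a‖]
    calc σ ^ 2 / ‖1 - a‖ ^ 2 * ‖y‖ ^ 2 ≤ σ ^ 2 / (1 - t) ^ 2 * (1 / c) := by gcongr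
      _ = _ := by rw [hC₁]; field_simp
  have hPk : ‖complexHessian r q k k‖ ≤ N * C₁ * σ ^ 2 :=
    (hP k).trans (by rw [mul_assoc]; gcongr)
  set w := (1 + a) / (1 - a) with hw_def
  have hwn : ‖w‖ ≤ 2 / (1 - t) := by
    rw [hw_def, norm_div]
    have := norm_add_le (1 : ℂ) a
    rw [norm_one] at this
    gcongr
    linarith
  have hu : u = -(((σ ^ 2 : ℝ) : ℂ) * w + complexHessian r q k k / 2) := by
    rw [hu_def, modelNormal, Complex.ofReal_pow]
  have hun : ‖u‖ ≤ C * σ ^ 2 := by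
    rw [hu, norm_neg]
    refine (norm_add_le _ _).trans ?_
    have h0 : ‖complexHessian r q k k / 2‖ = ‖complexHessian r q k k‖ / 2 := by
      rw [norm_div, Complex.norm_ofNat]
    rw [norm_mul, Complex.norm_real, Real.norm_of_nonneg (sq_nonneg σ), h0]
    have h1 : σ ^ 2 * ‖w‖ ≤ σ ^ 2 * (2 / (1 - t)) := by gcongr
    have h2 : 0 ≤ N * C₁ * σ ^ 2 := by positivity
    have h3 : 0 ≤ C₁ * σ ^ 2 := by positivity
    rw [hC_def]
    linarith
  have hure : u.re = -(σ ^ 2 * w.re) - (complexHessian r q k k).re / 2 := by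
    rw [hu, Complex.neg_re, Complex.add_re, Complex.re_ofReal_mul]
    have : (complexHessian r q k k / 2).re = (complexHessian r q k k).re / 2 := by simp
    rw [this]
    ring
  have hLk : leviForm r q k = σ ^ 2 / ‖1 - a‖ ^ 2 * leviForm r q y := by
    rw [hk_def, modelTangent, leviForm_complex_smul, norm_div, Complex.norm_real,
      Real.norm_of_nonneg hσ.le, div_pow]
  have hm := hmodel q (ball_subset_ball (min_le_right _ _) hq) hq0 e he hle (σ ^ 2) (by positivity)
    (hσs.trans_le (min_le_right _ _)) k u (map_modelTangent hle v)
    (hk2.trans (by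
      have h1 : 0 ≤ 2 / (1 - t) + N * C₁ := by positivity
      gcongr
      linarith)) hun
  refine ⟨ha1, ?_⟩
  have hm1 := (abs_le.1 hm).2
  rw [hure, hLk] at hm1
  have hwa := re_cayley_mul_norm_sq ha1
  rw [← hw_def] at hwa
  have hkey : (1 - t ^ 2) / 4 ≤ w.re - leviForm r q y / ‖1 - a‖ ^ 2 := by
    have e1 : w.re - leviForm r q y / ‖1 - a‖ ^ 2
        = (1 - ‖a‖ ^ 2 - leviForm r q y) / ‖1 - a‖ ^ 2 := by
      rw [← hwa]
      field_simp
    rw [e1, div_le_div_iff₀ (by norm_num) (by positivity)]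
    have e2 : ‖1 - a‖ ^ 2 ≤ 4 := by nlinarith
    nlinarith
  have hkey2 := mul_le_mul_of_nonneg_left hkey (sq_nonneg σ)
  have hpos : 0 < σ ^ 2 * (1 - t ^ 2) := by positivity
  have e3 : σ ^ 2 / ‖1 - a‖ ^ 2 * leviForm r q y
    = σ ^ 2 * (leviForm r q y / ‖1 - a‖ ^ 2) := by ring
  rw [e3] at hm1
  change r (q + (k + u • e)) < 0
  linarith

set_option maxHeartbeats 1000000 in
theorem exists_subset_modelMap_image (hr : ContDiff ℝ 2 r) {ε c : ℝ} (hε : 0 ≤ ε) (hc : 0 < c)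
    (hlevi : ∀ z, |r z| ≤ ε → ∀ ξ, c * nsq ξ ≤ leviForm r z ξ) (p₀ : Fin n → ℂ) {E M : ℝ}
    (hE : 0 < E) (hM : 0 < M) :
    ∃ t, 0 < t ∧ t < 1 ∧ ∃ s > 0, ∀ q ∈ ball p₀ s, r q = 0 → ∀ e, ‖e‖ ≤ E →
      complexGradient r q e = 1 → ∀ σ : ℝ, 0 < σ → σ ^ 2 < s → ∀ z, σ ^ 2 ≤ M * -r z →
      ‖leviPoly r q z‖ ≤ M * σ ^ 2 → ‖z - q‖ ^ 2 ≤ M * σ ^ 2 →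
        ∃ v, ‖complexGradient r q v‖ ^ 2
          + leviForm r q (v - complexGradient r q v • e) < t ^ 2 ∧
        modelMap (complexGradient r q) (complexHessian r q) e q (σ : ℂ) v = z := by
  obtain ⟨N, hN, hNb⟩ := exists_norm_leviPoly_add_complexGradient_le hr p₀
  set C₁ := M + N * M with hC₁
  have hC₁0 : 0 < C₁ := by positivity
  set C := C₁ + 2 * M + 2 * (C₁ * E) ^ 2 with hC_def
  have hC0 : 0 < C := by positivity
  set Λ := C₁ + N * C + 1 with hΛ_def
  have hΛ : 0 < Λ := by positivity
  set μ := 2 / (M * Λ ^ 2) with hμ_def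
  have hμ : 0 < μ := by positivity
  set t := 1 - min μ 1 / 4 with ht_def
  have hmin : 0 < min μ 1 := lt_min hμ one_pos
  have hmin1 : min μ 1 ≤ 1 := min_le_right _ _
  have htμ : 1 - μ < t ^ 2 := by
    have := min_le_left μ 1
    nlinarith
  obtain ⟨s, hs, hmodel⟩ := exists_boundary_model hr p₀ (C := C) hC0 hE
    (κ := 1 / (2 * M)) (by positivity)
  refine ⟨t, by linarith, by linarith, min 1 s, by positivity,
    fun q hq hq0 e he hle σ hσ hσs z hrz hΦ hzq => ?_⟩
  have hσ1 : σ ^ 2 < 1 := hσs.trans_le (min_le_left _ _)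
  have hσ2 : 0 < σ ^ 2 := by positivity
  obtain ⟨-, hP⟩ := hNb q (ball_subset_ball (min_le_left _ _) hq)
  have hL := fun ξ => hlevi q (by rw [hq0, abs_zero]; exact hε) ξ
  set l := complexGradient r q
  set h := z - q with hh_def
  set k := h - l h • e with hk_def
  have hlk : l k = 0 := by
    rw [hk_def, map_sub, map_smul, hle, smul_eq_mul, mul_one, sub_self]
  have hlh : ‖l h‖ ≤ C₁ * σ ^ 2 := by
    have e1 : l h = -leviPoly r q z - complexHessian r q h h / 2 := by
      rw [leviPoly]
      ring
    have e2 := hP h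
    have e3 : N * ‖h‖ ^ 2 ≤ N * (M * σ ^ 2) := by gcongr
    rw [e1]
    refine (norm_sub_le _ _).trans ?_
    rw [norm_neg, norm_div, Complex.norm_ofNat]
    have e4 : 0 ≤ N * (M * σ ^ 2) := by positivity
    rw [hC₁]
    linarith
  have hk2 : ‖k‖ ^ 2 ≤ C * σ ^ 2 := by
    have e1 : ‖l h • e‖ ≤ C₁ * σ ^ 2 * E := by
      rw [norm_smul]
      gcongr
    have e2 : ‖k‖ ^ 2 ≤ (‖h‖ + ‖l h • e‖) ^ 2 := by
      gcongr
      exact norm_sub_le _ _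
    have e3 : ‖l h • e‖ ^ 2 ≤ (C₁ * σ ^ 2 * E) ^ 2 := by gcongr
    have e4 : (C₁ * σ ^ 2 * E) ^ 2 ≤ (C₁ * E) ^ 2 * σ ^ 2 := by
      have : (C₁ * σ ^ 2 * E) ^ 2 = (C₁ * E) ^ 2 * (σ ^ 2 * σ ^ 2) := by ring
      rw [this]
      gcongr
      nlinarith
    have e5 : 0 ≤ C₁ * σ ^ 2 := by positivity
    rw [hC_def]
    nlinarith [sq_nonneg (‖h‖ - ‖l h • e‖)]
  have hPk : ‖complexHessian r q k k‖ ≤ N * C * σ ^ 2 :=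
    (hP k).trans (by rw [mul_assoc]; gcongr)
  have hσc : (σ : ℂ) ≠ 0 := Complex.ofReal_ne_zero.2 hσ.ne'
  set w : ℂ := -(l h + complexHessian r q k k / 2) / (σ : ℂ) ^ 2 with hw_def
  have hwσ : -(l h + complexHessian r q k k / 2) = (σ : ℂ) ^ 2 * w := by
    rw [hw_def]
    field_simp
  have hwn : ‖w + 1‖ ≤ Λ := by
    have e1 : ‖w‖ ≤ C₁ + N * C := by
      rw [hw_def, norm_div, norm_neg, norm_pow, Complex.norm_real, Real.norm_of_nonneg hσ.le,
        div_le_iff₀ hσ2]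
      refine (norm_add_le _ _).trans ?_
      rw [norm_div, Complex.norm_ofNat]
      have : 0 ≤ N * C * σ ^ 2 := by positivity
      linarith
    refine (norm_add_le _ _).trans ?_
    rw [norm_one]
    linarith
  have hwre : σ ^ 2 * w.re = -(l h).re - (complexHessian r q k k).re / 2 := by
    have e1 := congrArg Complex.re hwσ
    rw [← Complex.ofReal_pow, Complex.re_ofReal_mul, Complex.neg_re, Complex.add_re] at e1
    have e2 : (complexHessian r q k k / 2).re = (complexHessian r q k k).re / 2 := by simp
    rw [e2] at e1
    linarith
  have hm := hmodel q (ball_subset_ball (min_le_right _ _) hq) hq0 e he hle (σ ^ 2) hσ2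
    (hσs.trans_le (min_le_right _ _)) k (l h) hlk hk2 (hlh.trans (by
      have : 0 ≤ 2 * M + 2 * (C₁ * E) ^ 2 := by positivity
      gcongr
      linarith))
  rw [hk_def, sub_add_cancel, ← hk_def, hh_def, add_sub_cancel, ← hh_def] at hm
  have hkey : 1 / (2 * M) ≤ w.re - leviForm r q k / σ ^ 2 := by
    have e1 := (abs_le.1 hm).1
    have e2 : σ ^ 2 / M ≤ -r z := by
      rw [div_le_iff₀ hM]
      linarith
    have e3 : 1 / (2 * M) * σ ^ 2 = σ ^ 2 / M / 2 := by ring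
    have e4 : (w.re - leviForm r q k / σ ^ 2) = (σ ^ 2 * w.re - leviForm r q k) / σ ^ 2 := by
      field_simp
    rw [e4, le_div_iff₀ hσ2]
    linarith
  have hLk : 0 ≤ leviForm r q k / σ ^ 2 :=
    div_nonneg ((by have := nsq_nonneg k; positivity : 0 ≤ c * nsq k).trans (hL k)) hσ2.le
  have hw0 : 0 < w.re := by
    have : 0 < 1 / (2 * M) := by positivity
    linarith
  have hw1 : w + 1 ≠ 0 := fun h0 => by
    have := congrArg Complex.re h0
    simp at this
    linarith
  obtain ⟨v, hv⟩ : ∃ v, v = (2 / ((w + 1) * σ)) • (h - l h • e) + ((w - 1) / (w + 1)) • e :=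
    ⟨_, rfl⟩
  obtain ⟨h1, h2, h3⟩ := modelMap_eq (P := complexHessian r q) (q := q) hle hσc hw1 hwσ hv
  refine ⟨v, ?_, h3.trans (by rw [hh_def, add_sub_cancel])⟩
  clear_value w
  have hwn0 : 0 < ‖w + 1‖ := norm_pos_iff.2 hw1
  rw [h2, h1, leviForm_complex_smul, norm_div, norm_div, norm_mul, Complex.norm_real,
    Real.norm_of_nonneg hσ.le, Complex.norm_ofNat, div_pow, norm_sub_one_sq_eq]
  have e1 : (‖w + 1‖ ^ 2 - 4 * w.re) / ‖w + 1‖ ^ 2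
      + (2 / (‖w + 1‖ * σ)) ^ 2 * leviForm r q k
      = 1 - 4 * (w.re - leviForm r q k / σ ^ 2) / ‖w + 1‖ ^ 2 := by
    field_simp
    ring
  have e2 : μ ≤ 4 * (w.re - leviForm r q k / σ ^ 2) / ‖w + 1‖ ^ 2 := by
    calc μ = 4 * (1 / (2 * M)) / Λ ^ 2 := by
          rw [hμ_def]
          field_simp
          norm_num
      _ ≤ _ := by
          have h0 : 0 ≤ w.re - leviForm r q k / σ ^ 2 :=
            (by positivity : 0 ≤ 1 / (2 * M)).trans hkey
          gcongr
  refine lt_of_eq_of_lt e1 ?_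
  linarith

theorem exists_embedding (hr : ContDiff ℝ 2 r) {ε c : ℝ} (hε : 0 ≤ ε) (hc : 0 < c)
    (hlevi : ∀ z, |r z| ≤ ε → ∀ ξ, c * nsq ξ ≤ leviForm r z ξ) (hd : fderiv ℝ r p₀ ≠ 0) {M : ℝ}
    (hM : 0 < M) :
    ∃ s > 0, ∀ q ∈ ball p₀ s, r q = 0 → ∀ δ : ℝ, 0 < δ → δ < s → ∃ f : (Fin n → ℂ) → (Fin n → ℂ),
      DifferentiableOn ℂ f (euclUnitBall n) ∧ InjOn f (euclUnitBall n) ∧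
      f '' euclUnitBall n ⊆ {z | r z < 0} ∧
      {z | δ ≤ M * -r z ∧ ‖leviPoly r q z‖ ≤ M * δ ∧ ‖z - q‖ ^ 2 ≤ M * δ}
          ⊆ f '' euclUnitBall n := by
  obtain ⟨s₁, hs₁, E, hE, he⟩ := exists_complexGradient_eq_one hr hd
  obtain ⟨t, ht0, ht1, s₂, hs₂, hsurj⟩ := exists_subset_modelMap_image hr hε hc hlevi p₀ hE hM
  obtain ⟨s₃, hs₃, himg⟩ := exists_modelMap_image_subset hr hε hc hlevi p₀ hE ht0 ht1
  refine ⟨min s₁ (min s₂ s₃), by positivity, fun q hq hq0 δ hδ hδs => ?_⟩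
  obtain ⟨e, heE, hle⟩ := he q (ball_subset_ball (min_le_left _ _) hq)
  have hsurj' := hsurj q (ball_subset_ball ((min_le_right _ _).trans (min_le_left _ _)) hq)
      hq0 e heE
    hle (Real.sqrt δ) (Real.sqrt_pos.2 hδ) (by
      rw [Real.sq_sqrt hδ.le]
      exact hδs.trans_le ((min_le_right _ _).trans (min_le_left _ _)))
  have himg' := himg q (ball_subset_ball ((min_le_right _ _).trans (min_le_right _ _)) hq) hq0 e heE
    hle (Real.sqrt δ) (Real.sqrt_pos.2 hδ) (by
      rw [Real.sq_sqrt hδ.le]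
      exact hδs.trans_le ((min_le_right _ _).trans (min_le_right _ _)))
  obtain ⟨B, hB⟩ := exists_linearEquiv_nsq_eq_leviForm hc
    (hlevi q (by rw [hq0, abs_zero]; exact hε)) (complexGradient r q) e
  have hσ : ((Real.sqrt δ : ℝ) : ℂ) ≠ 0 := Complex.ofReal_ne_zero.2 (Real.sqrt_pos.2 hδ).ne'
  have htc : (t : ℂ) ≠ 0 := Complex.ofReal_ne_zero.2 ht0.ne'
  have hns : ∀ ζ : Fin n → ℂ, nsq ((t : ℂ) • ζ) = t ^ 2 * nsq ζ := fun ζ => by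
    simp [nsq, Finset.mul_sum, mul_pow]
  have hV : ∀ ζ ∈ euclUnitBall n, ‖complexGradient r q (B.symm ((t : ℂ) • ζ))‖ ^ 2
      + leviForm r q (B.symm ((t : ℂ) • ζ) - complexGradient r q (B.symm ((t : ℂ) • ζ)) • e)
        < t ^ 2 := fun ζ hζ => by
    have h1 : nsq ζ < 1 := hζ
    rw [hB, LinearEquiv.apply_symm_apply, hns]
    have : 0 < t ^ 2 := by positivity
    nlinarith
  have hVd : Differentiable ℂ fun ζ : Fin n → ℂ => B.symm ((t : ℂ) • ζ) :=
    (LinearMap.toContinuousLinearMap (B.symm : (Fin n → ℂ) →ₗ[ℂ] (Fin n → ℂ))).differentiable.comp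
      (differentiable_id.const_smul (t : ℂ))
  refine ⟨fun ζ => modelMap (complexGradient r q) (complexHessian r q) e q ((Real.sqrt δ : ℝ) : ℂ)
    (B.symm ((t : ℂ) • ζ)), fun ζ hζ => ?_, fun ζ hζ ζ' hζ' h => ?_, ?_, ?_⟩
  · exact ((differentiableAt_modelMap (himg' _ (hV ζ hζ)).1).comp ζ (hVd ζ)).differentiableWithinAt
  · have h1 := B.symm.injective (modelMap_injective hle hσ (himg' _ (hV ζ hζ)).1
      (himg' _ (hV ζ' hζ')).1 h)
    exact smul_right_injective _ htc h1
  · rintro _ ⟨ζ, hζ, rfl⟩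
    exact (himg' _ (hV ζ hζ)).2
  · rintro z ⟨h1, h2, h3⟩
    rw [Real.sq_sqrt hδ.le] at hsurj'
    obtain ⟨v, hv, hvz⟩ := hsurj' z h1 h2 h3
    have h4 : (t : ℂ) • ((t : ℂ)⁻¹ • B v) = B v := smul_inv_smul₀ htc _
    refine ⟨(t : ℂ)⁻¹ • B v, ?_, ?_⟩
    · rw [hB, ← h4, hns] at hv
      exact lt_of_mul_lt_mul_left (hv.trans_eq (mul_one _).symm) (sq_nonneg t)
    · beta_reduce
      rw [h4, LinearEquiv.symm_apply_apply, hvz]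

end Embedding

section Localization

variable {n : ℕ} {r : (Fin n → ℂ) → ℝ} {p₀ : Fin n → ℂ}

theorem norm_le_of_norm_sub_inv_le {u v a b : ℂ} {X M Λ : ℝ} (hX : 0 < X) (hΛ : 0 ≤ Λ)
    (ha : a ≠ 0) (hb : b ≠ 0) (hu : ‖u - a⁻¹‖ ≤ M) (hv : ‖v - b⁻¹‖ ≤ M) (huv : ‖u‖ ≤ Λ * ‖v‖)
    (haX : ‖a‖ ≤ X) (hXM : X * (2 * M * (1 + Λ)) ≤ 1) : ‖b‖ ≤ 2 * Λ * X := by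
  have ha0 := norm_pos_iff.2 ha
  have hb0 := norm_pos_iff.2 hb
  have h1 : X⁻¹ ≤ ‖a⁻¹‖ := by
    rw [norm_inv]
    gcongr
  have h2 : ‖a⁻¹‖ ≤ ‖u‖ + M := by
    have := norm_sub_norm_le a⁻¹ u
    rw [norm_sub_rev] at this
    linarith
  have h3 : ‖v‖ ≤ M + ‖b‖⁻¹ := by
    have := norm_sub_norm_le v b⁻¹
    rw [norm_inv] at this
    linarith
  have h4 : X⁻¹ ≤ Λ * (M + ‖b‖⁻¹) + M := by
    have := mul_le_mul_of_nonneg_left h3 hΛ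
    linarith
  have h5 : 1 ≤ X * (Λ * (M + ‖b‖⁻¹) + M) := by
    have := mul_le_mul_of_nonneg_left h4 hX.le
    rwa [mul_inv_cancel₀ hX.ne'] at this
  have h6 : 1 ≤ 2 * Λ * X * ‖b‖⁻¹ := by linarith
  have h7 := mul_le_mul_of_nonneg_right h6 hb0.le
  rwa [inv_mul_cancel_right₀ hb0.ne', one_mul] at h7

theorem norm_leviPoly_le {N : ℝ} {q z : Fin n → ℂ} (hN : 0 ≤ N)
    (hl : ∀ h, ‖complexGradient r q h‖ ≤ N * ‖h‖)
    (hP : ∀ h, ‖complexHessian r q h h‖ ≤ N * ‖h‖ ^ 2) (hz : ‖z - q‖ ≤ 1) :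
    ‖leviPoly r q z‖ ≤ 2 * N * ‖z - q‖ := by
  rw [leviPoly]
  refine (norm_sub_le _ _).trans ?_
  have h1 : ‖complexHessian r q (z - q) (z - q) / 2‖ =
      ‖complexHessian r q (z - q) (z - q)‖ / 2 := by
    rw [norm_div, Complex.norm_ofNat]
  rw [norm_neg, h1]
  have h2 : N * ‖z - q‖ ^ 2 ≤ N * ‖z - q‖ := by
    gcongr
    exact pow_le_of_le_one (norm_nonneg _) hz two_ne_zero
  have h3 : 0 ≤ N * ‖z - q‖ := by positivity
  linarith [hl (z - q), hP (z - q)]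

/-- Points which positive-real-part holomorphic functions cannot separate multiplicatively from
`p` lie in a region of anisotropic size comparable with the distance of `p` to the boundary. -/
theorem eventually_exists_localization (hr : ContDiff ℝ 2 r) (hcpt : IsCompact {z | r z ≤ 1 / 2})
    {ε c : ℝ} (hε : 0 < ε) (hc : 0 < c)
    (hlevi : ∀ z, |r z| ≤ ε → ∀ ξ, c * nsq ξ ≤ leviForm r z ξ) (hp₀ : r p₀ = 0)
    (hd : fderiv ℝ r p₀ ≠ 0) {Λ : ℝ} (hΛ : 0 < Λ) :
    ∃ C > 0, ∃ M > 0, ∀ᶠ p in 𝓝 p₀, r p < 0 → ∃ q, r q = 0 ∧ ‖p - q‖ ≤ C * -r p ∧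
      ∀ z, r z < 0 → (∀ H : (Fin n → ℂ) → ℂ, DifferentiableOn ℂ H {z | r z < 0} →
          (∀ w, r w < 0 → 0 < (H w).re) →
          ‖H p‖ ≤ Λ * ‖H z‖ ∧ ‖H z‖ ≤ Λ * ‖H p‖) →
        -r p ≤ M * -r z ∧ ‖leviPoly r q z‖ ≤ M * -r p ∧ ‖z - q‖ ^ 2 ≤ M * -r p := by
  obtain ⟨s, hs, M, hM, hsupp⟩ := exists_support_function hr hcpt hε hc hlevi p₀
  obtain ⟨s₁, hs₁, C, hC, hzero⟩ := exists_zero_norm_sub_le hr hp₀ hd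
  obtain ⟨N, hN, hNb⟩ := exists_norm_leviPoly_add_complexGradient_le hr p₀
  set B := 2 * N * C with hB_def
  have hB : 0 < B := by positivity
  set m := min 1 (min s s₁) with hm_def
  have hm : 0 < m := by positivity
  have hm1 : m ≤ 1 := min_le_left _ _
  have hms : m ≤ s := (min_le_right _ _).trans (min_le_left _ _)
  have hms₁ : m ≤ s₁ := (min_le_right _ _).trans (min_le_right _ _)
  have hev : ∀ A b : ℝ, 0 < b → ∀ᶠ p in 𝓝 p₀, A * -r p < b := fun A b hb => by
    have : Continuous fun p => A * -r p := continuous_const.mul hr.continuous.neg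
    exact this.continuousAt.eventually_lt_const (by simpa [hp₀] using hb)
  have hΦB : ∀ q ∈ ball p₀ m, ∀ z, ‖z - q‖ ≤ C * -r z → C * -r z ≤ 1 →
      ‖leviPoly r q z‖ ≤ B * -r z := fun q hq z hz hz1 => by
    obtain ⟨h1, h2⟩ := hNb q (ball_subset_ball hm1 hq)
    refine (norm_leviPoly_le hN.le h1 h2 (hz.trans hz1)).trans ?_
    rw [hB_def, mul_assoc (2 * N)]
    gcongr
  have hne : ∀ q z, r z < 0 → -r z + c / 2 * ‖z - q‖ ^ 2 ≤ (leviPoly r q z).re →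
      leviPoly r q z ≠ 0 := fun q z hz h h0 => by
    rw [h0, Complex.zero_re] at h
    have : 0 ≤ c / 2 * ‖z - q‖ ^ 2 := by positivity
    linarith
  refine ⟨C, hC, 2 * Λ * B + 4 * Λ * B / c, by positivity, ?_⟩
  filter_upwards [ball_mem_nhds p₀ (by positivity : 0 < m / 4), hev C (m / 4) (by positivity),
    hev (C * (2 * Λ * B)) (m / 4) (by positivity),
        hev (4 * Λ * B / c) ((m / 4) ^ 2) (by positivity),
    hev (B * (2 * M * (1 + Λ))) 1 one_pos, hev (B * (2 * Λ * B) * (2 * M * (1 + Λ))) 1 one_pos]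
    with p hp h1 h2 h3 h4 h5 hrp
  rw [mem_ball] at hp
  obtain ⟨q, hq0, hpq⟩ := hzero p (mem_ball.2 (by linarith)) hrp
  have hδ : 0 < -r p := by linarith
  have hqp : dist q p ≤ C * -r p := by rwa [dist_comm, dist_eq_norm]
  have hq : dist q p₀ < m := by linarith [dist_triangle q p p₀]
  obtain ⟨hlow, H, hHd, hHpos, hHnear, hHfar⟩ := hsupp q hq0 (hq.trans_le hms)
  refine ⟨q, hq0, hpq, fun z hrz hcomp => ?_⟩
  have hΦp : ‖leviPoly r q p‖ ≤ B * -r p := hΦB q hq p hpq (by linarith)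
  have hp0 := hne q p hrp (hlow p (by linarith))
  have hHp := hHnear p hrp (by linarith)
  have hzs : dist z p₀ < 5 * s := by
    by_contra! hzs
    have e1 := hHfar z hrz hzs
    have e2 := (hcomp H hHd hHpos).1
    have e3 : Λ * ‖H z‖ ≤ Λ * M := by gcongr
    have e4 := norm_sub_norm_le (leviPoly r q p)⁻¹ (H p)
    rw [norm_sub_rev, norm_inv] at e4
    have e5 : (B * -r p)⁻¹ ≤ ‖leviPoly r q p‖⁻¹ := by
      have := norm_pos_iff.2 hp0
      gcongr
    have e6 : (B * -r p)⁻¹ ≤ M * (1 + Λ) := by linarith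
    rw [inv_le_iff_one_le_mul₀ (by positivity)] at e6
    linarith
  have hlz := hlow z (by linarith)
  have hΦz : ‖leviPoly r q z‖ ≤ 2 * Λ * (B * -r p) :=
    norm_le_of_norm_sub_inv_le (by positivity) hΛ.le hp0 (hne q z hrz hlz) hHp (hHnear z hrz hzs)
      (hcomp H hHd hHpos).1 hΦp (by linarith)
  have hlz' := hlz.trans (Complex.re_le_norm _)
  have hzq : ‖z - q‖ ^ 2 ≤ 4 * Λ * B / c * -r p := by
    rw [div_mul_eq_mul_div, le_div_iff₀ hc]
    linarith
  have hrz' : -r z ≤ 2 * Λ * B * -r p := by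
    have : 0 ≤ c / 2 * ‖z - q‖ ^ 2 := by positivity
    linarith
  have hzq' : dist z q < m / 4 := by
    rw [dist_eq_norm]
    exact lt_of_pow_lt_pow_left₀ 2 (by positivity) (hzq.trans_lt h3)
  have hzp : dist z p₀ < 3 * m / 4 := by
    linarith [dist_triangle z q p₀, dist_triangle q p p₀]
  obtain ⟨q', hq'0, hzq''⟩ := hzero z (mem_ball.2 (by linarith)) hrz
  have hCz : C * -r z ≤ C * (2 * Λ * B * -r p) := by gcongr
  have hq'z : dist q' z ≤ C * -r z := by rwa [dist_comm, dist_eq_norm]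
  have hq' : dist q' p₀ < m := by linarith [dist_triangle q' z p₀]
  obtain ⟨hlow', H', hHd', hHpos', hHnear', -⟩ := hsupp q' hq'0 (hq'.trans_le hms)
  have hlp := hlow' p (by linarith)
  have hδz : 0 < -r z := by linarith
  have hΦp' : ‖leviPoly r q' p‖ ≤ 2 * Λ * (B * -r z) :=
    norm_le_of_norm_sub_inv_le (by positivity) hΛ.le (hne q' z hrz (hlow' z (by linarith)))
      (hne q' p hrp hlp) (hHnear' z hrz hzs) (hHnear' p hrp (by linarith))
      (hcomp H' hHd' hHpos').2 (hΦB q' hq' z hzq'' (by linarith)) (by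
        have : B * -r z * (2 * M * (1 + Λ)) ≤ B * (2 * Λ * B * -r p) * (2 * M * (1 + Λ)) :=
            by gcongr
        linarith)
  have hlp' := hlp.trans (Complex.re_le_norm _)
  have k1 : 0 ≤ c / 2 * ‖p - q'‖ ^ 2 := by positivity
  have k2 : 0 ≤ 4 * Λ * B / c * -r z := by positivity
  have k3 : 0 ≤ 4 * Λ * B / c * -r p := by positivity
  have k4 : 0 ≤ 2 * Λ * B * -r p := by positivity
  exact ⟨by linarith, by linarith, by linarith⟩

end Localization

section Fridman

variable {n : ℕ}

theorem fridmanInv_nonneg (Ω : Set (Fin n → ℂ)) (K : (Fin n → ℂ) → (Fin n → ℂ) → ℂ)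
    (p : Fin n → ℂ) : 0 ≤ fridmanInv Ω K p :=
  Real.sInf_nonneg (by
    rintro _ ⟨r, hr, rfl, -⟩
    positivity)

theorem fridmanInv_le {Ω : Set (Fin n → ℂ)} {K : (Fin n → ℂ) → (Fin n → ℂ) → ℂ}
    {p : Fin n → ℂ} {R : ℝ} (hR : 0 < R) {f : (Fin n → ℂ) → (Fin n → ℂ)}
    (hf : DifferentiableOn ℂ f (euclUnitBall n)) (hinj : InjOn f (euclUnitBall n))
    (himg : f '' euclUnitBall n ⊆ Ω) (hball : bergmanBall Ω K p R ⊆ f '' euclUnitBall n) :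
    fridmanInv Ω K p ≤ 1 / R :=
  csInf_le ⟨0, by
    rintro _ ⟨r, hr, rfl, -⟩
    positivity⟩ ⟨R, hR, rfl, f, hf, hinj, himg, hball⟩

theorem norm_le_exp_mul_norm {E : Type*} [NormedAddCommGroup E] {u v : E} (hu : u ≠ 0)
    (hv : v ≠ 0) {C : ℝ} (h : |Real.log ‖u‖ - Real.log ‖v‖| ≤ C) : ‖u‖ ≤ Real.exp C * ‖v‖ := by
  rw [← Real.exp_log (norm_pos_iff.2 hu), ← Real.exp_log (norm_pos_iff.2 hv), ← Real.exp_add,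
    Real.exp_le_exp]
  linarith [(abs_le.1 h).2]

theorem eventually_fridmanInv_le {D : Set (Fin n → ℂ)} (hopen : IsOpen D) (hconn : IsConnected D)
    (hbdd : Bornology.IsBounded D) {ρ : (Fin n → ℂ) → ℝ} (hρ : ContDiff ℝ 2 ρ)
    (hdef : IsDefiningFunction D ρ) (hspc : ∀ q ∈ frontier D, StronglyPseudoconvexAt ρ q)
    {K : (Fin n → ℂ) → (Fin n → ℂ) → ℂ} (hK : IsBergmanKernel D K) {p₀ : Fin n → ℂ}
    (hp₀ : p₀ ∈ frontier D) {R : ℝ} (hR : 0 < R) :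
    ∀ᶠ p in 𝓝 p₀, p ∈ D → fridmanInv D K p ≤ 1 / R := by
  obtain ⟨r, hr, hD, hfr, hcpt, hd, ε, hε, c, hc, hlevi⟩ :=
    exists_strictly_psh_defining_function hbdd hρ hdef hspc
  obtain rfl : D = {z | r z < 0} := Set.ext hD
  have hr0 : r p₀ = 0 := (hfr p₀).1 hp₀
  obtain ⟨C, hC, M, hM, hloc⟩ := eventually_exists_localization hr hcpt hε hc hlevi hr0
    (hd p₀ hp₀) (Real.exp_pos (2 * R))
  obtain ⟨s, hs, hemb⟩ := exists_embedding hr hε.le hc hlevi (hd p₀ hp₀) hM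
  have hδ : ∀ᶠ p in 𝓝 p₀, -r p < min s (s / (2 * C)) :=
    hr.continuous.neg.continuousAt.eventually_lt_const (by
      rw [Pi.neg_apply, hr0, neg_zero]
      positivity)
  filter_upwards [hloc, hδ, ball_mem_nhds p₀ (half_pos hs)] with p hp hpδ hps hpD
  have hrp : r p < 0 := hpD
  obtain ⟨q, hq0, hpq, hz⟩ := hp hrp
  have hCδ : C * -r p < s / 2 := by
    have := (lt_div_iff₀ (by positivity)).1 (hpδ.trans_le (min_le_right _ _))
    linarith
  have hq : q ∈ ball p₀ s := by
    rw [mem_ball] at hps ⊢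
    have := dist_triangle q p p₀
    rw [dist_comm q p, dist_eq_norm p q] at this
    linarith
  obtain ⟨f, hf, hinj, himg, hsub⟩ := hemb q hq hq0 (-r p) (by linarith)
    (hpδ.trans_le (min_le_left _ _))
  refine fridmanInv_le hR hf hinj himg (Subset.trans (fun z hzB => ?_) hsub)
  refine hz z hzB.1 fun H hH hpos => ?_
  have hne : ∀ w, r w < 0 → H w ≠ 0 := fun w hw h0 => by
    have := hpos w hw
    rw [h0, Complex.zero_re] at this
    exact lt_irrefl _ this
  have hlog := abs_log_norm_sub_le_of_mem_bergmanBall hopen hconn hbdd hK hH hpos hpD hzB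
  exact ⟨norm_le_exp_mul_norm (hne p hrp) (hne z hzB.1) (by rwa [abs_sub_comm]),
    norm_le_exp_mul_norm (hne z hzB.1) (hne p hrp) hlog⟩

end Fridman

/-- boundary behaviour of the Bergman–Fridman invariant on a bounded
`C²`-smooth strongly pseudoconvex domain: `h_D(p^j) → 0` for any sequence `p^j → p⁰ ∈ ∂D`. -/
theorem fridman_tendsto_zero_strongly_pseudoconvex {n : ℕ} (D : Set (Fin n → ℂ))
    (hopen : IsOpen D) (hconn : IsConnected D) (hbdd : Bornology.IsBounded D)
    (ρ : (Fin n → ℂ) → ℝ) (hρ : ContDiff ℝ 2 ρ) (hdef : IsDefiningFunction D ρ)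
    (hspc : ∀ q ∈ frontier D, StronglyPseudoconvexAt ρ q)
    (K : (Fin n → ℂ) → (Fin n → ℂ) → ℂ) (hK : IsBergmanKernel D K)
    (p : ℕ → (Fin n → ℂ)) (hp : ∀ j, p j ∈ D)
    (p0 : Fin n → ℂ) (hp0 : p0 ∈ frontier D)
    (hlim : Filter.Tendsto p Filter.atTop (nhds p0)) :
    Filter.Tendsto (fun j => fridmanInv D K (p j)) Filter.atTop (nhds 0) := by
  refine Metric.tendsto_nhds.2 fun ε hε => ?_
  filter_upwards [hlim.eventually (eventually_fridmanInv_le hopen hconn hbdd hρ hdef hspc hK hp0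
    (by positivity : 0 < 2 / ε))] with j hj
  rw [Real.dist_0_eq_abs, abs_of_nonneg (fridmanInv_nonneg _ _ _)]
  have := hj (hp j)
  rw [one_div_div] at this
  linarith

end
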